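/- As X → ∞, the sum over fundamental discriminants D with 0 < D < X of #Cl_3(D) equals (4/π²)·X + (8·ζ(1/3)/(5·Γ(2/3)³))·∏_p(1 − (p^{1/3}+1)/(p(p+1)))·X^{5/6} + o(X^{5/6}); that is, the difference between the sum and the two displayed terms, divided by X^{5/6}, tends to 0 as X → ∞. -/

import Mathlib

open Filter Topology
open scoped Classical

/-- The quadratic field `ℚ(√D)`, realized inside `ℂ`. -/
noncomputable def QuadField (D : ℤ) : IntermediateField ℚ ℂ :=
  IntermediateField.adjoin ℚ {(D : ℂ) ^ ((1 : ℂ)/2)}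

/-- `#Cl_3(D)`: the number of 3-torsion elements of the ideal class group of `ℚ(√D)`. -/
noncomputable def h3 (D : ℤ) : ℕ :=
  Nat.card {x : ClassGroup (NumberField.RingOfIntegers (QuadField D)) // x ^ 3 = 1}

/-- A fundamental discriminant: either squarefree and `≡ 1 (mod 4)`, or `4m` with `m`
squarefree and `≡ 2, 3 (mod 4)` (and `D ≠ 1`). -/
def IsFundamentalDiscriminant (D : ℤ) : Prop :=
  D ≠ 1 ∧ ((Squarefree D ∧ D % 4 = 1) ∨
    (∃ m : ℤ, D = 4 * m ∧ Squarefree m ∧ (m % 4 = 2 ∨ m % 4 = 3)))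

/-- The Euler product `∏_p (1 - (p^{1/3} + 1)/(p(p+1)))` over all primes. -/
noncomputable def primeProd : ℝ :=
  ∏' p : Nat.Primes, (1 - ((p : ℝ) ^ ((1 : ℝ)/3) + 1) / ((p : ℝ) * ((p : ℝ) + 1)))

/-- The sum of `#Cl_3(D)` over fundamental discriminants `D` satisfying `P`. -/
noncomputable def cl3sum (P : ℤ → Prop) : ℝ :=
  ∑' D : ℤ, if IsFundamentalDiscriminant D ∧ P D then (h3 D : ℝ) else 0

/-- The binary cubic form `a x³ + 3 b x² y + 3 c x y² + d y³`. -/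
@[ext] structure TForm where
  a : ℤ
  b : ℤ
  c : ℤ
  d : ℤ

/-- A twenty-seventh of minus the discriminant of `a x³ + 3 b x² y + 3 c x y² + d y³`. -/
def tdisc {R : Type*} [CommRing R] (a b c d : R) : R :=
  a ^ 2 * d ^ 2 - 6 * a * b * c * d - 3 * b ^ 2 * c ^ 2 + 4 * a * c ^ 3 + 4 * b ^ 3 * d

namespace TForm

/-- The value of a form at an integral vector. -/
def eval (f : TForm) (x y : ℤ) : ℤ :=
  f.a * x ^ 3 + 3 * f.b * x ^ 2 * y + 3 * f.c * x * y ^ 2 + f.d * y ^ 3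

/-- The form `f (p x + q y, r x + s y)`. -/
def act (f : TForm) (p q r s : ℤ) : TForm where
  a := f.a * p ^ 3 + 3 * f.b * p ^ 2 * r + 3 * f.c * p * r ^ 2 + f.d * r ^ 3
  b := f.a * p ^ 2 * q + f.b * (p ^ 2 * s + 2 * p * q * r) + f.c * (2 * p * r * s + q * r ^ 2)
    + f.d * r ^ 2 * s
  c := f.a * p * q ^ 2 + f.b * (2 * p * q * s + q ^ 2 * r) + f.c * (p * s ^ 2 + 2 * q * r * s)
    + f.d * r * s ^ 2
  d := f.a * q ^ 3 + 3 * f.b * q ^ 2 * s + 3 * f.c * q * s ^ 2 + f.d * s ^ 3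

/-- The discriminant of the Hessian of `f`. -/
def D (f : TForm) : ℤ := tdisc f.a f.b f.c f.d

/-- Leading coefficient of the Hessian. -/
def hA (f : TForm) : ℤ := f.b ^ 2 - f.a * f.c
/-- Middle coefficient of the Hessian. -/
def hB (f : TForm) : ℤ := f.b * f.c - f.a * f.d
/-- Last coefficient of the Hessian. -/
def hC (f : TForm) : ℤ := f.c ^ 2 - f.b * f.d

theorem D_eq (f : TForm) : f.D = f.hB ^ 2 - 4 * f.hA * f.hC := by
  simp only [D, tdisc, hA, hB, hC]; ring

theorem act_act (f : TForm) (p q r s p' q' r' s' : ℤ) :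
    (f.act p q r s).act p' q' r' s' =
      f.act (p * p' + q * r') (p * q' + q * s') (r * p' + s * r') (r * q' + s * s') := by
  ext <;> simp only [act] <;> ring

theorem act_one (f : TForm) : f.act 1 0 0 1 = f := by
  ext <;> simp [act]

theorem act_neg_one (f : TForm) : f.act (-1) 0 0 (-1) = ⟨-f.a, -f.b, -f.c, -f.d⟩ := by
  ext <;> simp only [act] <;> ring

theorem eval_act (f : TForm) (p q r s x y : ℤ) :
    (f.act p q r s).eval x y = f.eval (p * x + q * y) (r * x + s * y) := by
  simp only [act, eval]; ring

theorem D_act (f : TForm) (p q r s : ℤ) : (f.act p q r s).D = (p * s - q * r) ^ 6 * f.D := by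
  simp only [D, tdisc, act]; ring

theorem hA_act (f : TForm) (p q r s : ℤ) : (f.act p q r s).hA =
    (p * s - q * r) ^ 2 * (f.hA * p ^ 2 + f.hB * p * r + f.hC * r ^ 2) := by
  simp only [hA, hB, hC, act]; ring

theorem hB_act (f : TForm) (p q r s : ℤ) : (f.act p q r s).hB =
    (p * s - q * r) ^ 2 * (2 * f.hA * p * q + f.hB * (p * s + q * r) + 2 * f.hC * r * s) := by
  simp only [hA, hB, hC, act]; ring

theorem hC_act (f : TForm) (p q r s : ℤ) : (f.act p q r s).hC =
    (p * s - q * r) ^ 2 * (f.hA * q ^ 2 + f.hB * q * s + f.hC * s ^ 2) := by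
  simp only [hA, hB, hC, act]; ring

/-- Proper equivalence of forms. -/
def Eqv (f g : TForm) : Prop := ∃ p q r s : ℤ, p * s - q * r = 1 ∧ g = f.act p q r s

theorem Eqv.refl (f : TForm) : f.Eqv f := ⟨1, 0, 0, 1, by norm_num, (act_one f).symm⟩

theorem act_inv (f : TForm) {p q r s : ℤ} (h : p * s - q * r = 1) :
    (f.act p q r s).act s (-q) (-r) p = f := by
  rw [act_act]
  have h1 : p * s + q * -r = 1 := by linarith
  have h2 : p * -q + q * p = 0 := by ring
  have h3 : r * s + s * -r = 0 := by ring
  have h4 : r * -q + s * p = 1 := by linarith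
  rw [h1, h2, h3, h4, act_one]

theorem Eqv.symm {f g : TForm} : f.Eqv g → g.Eqv f := by
  rintro ⟨p, q, r, s, h, rfl⟩
  exact ⟨s, -q, -r, p, by linarith, (act_inv f h).symm⟩

theorem Eqv.trans {f g k : TForm} : f.Eqv g → g.Eqv k → f.Eqv k := by
  rintro ⟨p, q, r, s, h, rfl⟩ ⟨p', q', r', s', h', rfl⟩
  refine ⟨_, _, _, _, ?_, act_act f p q r s p' q' r' s'⟩
  linear_combination h * (p' * s' - q' * r') + h'

/-- Forms up to proper equivalence. -/
instance setoid : Setoid TForm := ⟨Eqv, Eqv.refl, Eqv.symm, Eqv.trans⟩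

/-- A form is irreducible if it does not represent zero nontrivially. -/
def Irred (f : TForm) : Prop := ∀ x y : ℤ, f.eval x y = 0 → x = 0 ∧ y = 0

/-- `h` divides the Hessian. -/
def HDvd (h : ℤ) (f : TForm) : Prop := h ∣ f.hA ∧ h ∣ f.hB ∧ h ∣ f.hC

theorem D_eqv {f g : TForm} (h : f.Eqv g) : g.D = f.D := by
  obtain ⟨p, q, r, s, h, rfl⟩ := h
  rw [D_act, h]; ring

theorem Irred.eqv {f g : TForm} (h : f.Eqv g) (hf : f.Irred) : g.Irred := by
  obtain ⟨p, q, r, s, h, rfl⟩ := h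
  intro x y hxy
  rw [eval_act] at hxy
  obtain ⟨h1, h2⟩ := hf _ _ hxy
  constructor
  · linear_combination s * h1 - q * h2 - x * h
  · linear_combination p * h2 - r * h1 - y * h

theorem HDvd.act {h : ℤ} {f : TForm} (hf : HDvd h f) (p q r s : ℤ) : HDvd h (f.act p q r s) := by
  obtain ⟨⟨A, hA⟩, ⟨B, hB⟩, ⟨C, hC⟩⟩ := hf
  refine ⟨?_, ?_, ?_⟩
  · rw [hA_act, hA, hB, hC]
    exact ⟨(p * s - q * r) ^ 2 * (A * p ^ 2 + B * p * r + C * r ^ 2), by ring⟩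
  · rw [hB_act, hA, hB, hC]
    exact ⟨(p * s - q * r) ^ 2 * (2 * A * p * q + B * (p * s + q * r) + 2 * C * r * s), by ring⟩
  · rw [hC_act, hA, hB, hC]
    exact ⟨(p * s - q * r) ^ 2 * (A * q ^ 2 + B * q * s + C * s ^ 2), by ring⟩

theorem HDvd.eqv {h : ℤ} {f g : TForm} (hfg : f.Eqv g) (hf : HDvd h f) : HDvd h g := by
  obtain ⟨p, q, r, s, -, rfl⟩ := hfg
  exact hf.act p q r s

theorem Irred.a_ne {f : TForm} (hf : f.Irred) : f.a ≠ 0 := by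
  intro h
  have := hf 1 0 (by simp [eval, h])
  simp at this

end TForm

section
open Matrix Complex ModularGroup UpperHalfPlane

/-- The strict or the weak order, according to a flag. -/
def flagLE (st : Bool) (x y : ℝ) : Prop := if st then x < y else x ≤ y

theorem flagLE.le {st : Bool} {x y : ℝ} (h : flagLE st x y) : x ≤ y := by
  cases st <;> simp [flagLE] at h
  · exact h
  · exact h.le

theorem flagLE_mul_iff {st : Bool} {x y k u v : ℝ} (hk : 0 < k) (h : v - u = k * (y - x)) :
    flagLE st u v ↔ flagLE st x y := by
  cases st
  · simp only [flagLE, Bool.false_eq_true, if_false]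
    rw [← sub_nonneg, h, ← sub_nonneg (a := y)]
    exact mul_nonneg_iff_of_pos_left hk
  · simp only [flagLE, if_true]
    rw [← sub_pos, h, ← sub_pos (a := y)]
    exact mul_pos_iff_of_pos_left hk

/-- The (open or closed) standard fundamental domain, without the condition `0 < y`. -/
def FDom (st : Bool) (x y : ℝ) : Prop :=
  flagLE st (-1 / 2) x ∧ flagLE st x (1 / 2) ∧ flagLE st 1 (x ^ 2 + y ^ 2)

/-- The conditions on the coefficients of a cubic form that express that its complex root is in the
fundamental domain. -/
def RedCond (st : Bool) (a b c d : ℝ) : Prop :=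
  flagLE st 0 ((a - 3 * b) ^ 3 + 3 * b * (a - 3 * b) ^ 2 + 3 * a * c * (a - 3 * b) + a ^ 2 * d) ∧
  flagLE st ((-a - 3 * b) ^ 3 + 3 * b * (-a - 3 * b) ^ 2 + 3 * a * c * (-a - 3 * b) + a ^ 2 * d) 0 ∧
  flagLE st 0 (d ^ 2 - a ^ 2 + 3 * a * c - 3 * b * d)

/-- The third coefficient of the form with leading coefficients `a`, `b` and complex root
`x + √w i`. -/
noncomputable def cOf (a b x w : ℝ) : ℝ := a * w / 3 - 2 * b * x - a * x ^ 2
/-- The last coefficient of the form with leading coefficients `a`, `b` and complex root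
`x + √w i`. -/
noncomputable def dOf (a b x w : ℝ) : ℝ := (x ^ 2 + w) * (3 * b + 2 * a * x)

theorem tdisc_of (a b x w : ℝ) : tdisc a b (cOf a b x w) (dOf a b x w) =
    4 * w / 27 * (9 * (b + a * x) ^ 2 + a ^ 2 * w) ^ 2 := by
  simp only [tdisc, cOf, dOf]; ring

theorem redCond_of {st : Bool} {a b x w : ℝ} (ha : 0 < a) (hw : 0 < w) :
    RedCond st a b (cOf a b x w) (dOf a b x w) ↔ (flagLE st (-1 / 2) x ∧ flagLE st x (1 / 2) ∧
      flagLE st 1 (x ^ 2 + w)) := by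
  unfold RedCond
  have h0 : 0 < a ^ 2 * w := by positivity
  refine and_congr ?_ (and_congr ?_ ?_)
  · refine flagLE_mul_iff (k := 2 * a * ((a - 3 * b - a * x) ^ 2 + a ^ 2 * w)) (by positivity) ?_
    simp only [cOf, dOf]; ring
  · refine flagLE_mul_iff (k := 2 * a * ((a + 3 * b + a * x) ^ 2 + a ^ 2 * w)) (by positivity) ?_
    simp only [cOf, dOf]; ring
  · refine flagLE_mul_iff (k := (a + x * (3 * b + 2 * a * x)) ^ 2 + (3 * b + 2 * a * x) ^ 2 * w)
      ?_ ?_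
    · by_cases hv : 3 * b + 2 * a * x = 0
      · rw [hv]; simp only [mul_zero, add_zero]; positivity
      · have : 0 < (3 * b + 2 * a * x) ^ 2 := by positivity
        positivity
    · simp only [cOf, dOf]; ring

theorem exists_cubic_root {a : ℝ} (ha : 0 < a) (b c d : ℝ) :
    ∃ t : ℝ, a * t ^ 3 + 3 * b * t ^ 2 + 3 * c * t + d = 0 := by
  set M : ℝ := 1 + (3 * |b| + 3 * |c| + |d|) / a with hM
  have hM1 : 1 ≤ M := by
    have : 0 ≤ (3 * |b| + 3 * |c| + |d|) / a := by positivity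
    linarith
  have haM : a * M = a + (3 * |b| + 3 * |c| + |d|) := by rw [hM]; field_simp
  have h1 : M ≤ M ^ 2 := by nlinarith
  have h2 : 1 ≤ M ^ 2 := by nlinarith
  have e2 : |c| * M ≤ |c| * M ^ 2 := mul_le_mul_of_nonneg_left h1 (abs_nonneg _)
  have e3 : |d| * 1 ≤ |d| * M ^ 2 := mul_le_mul_of_nonneg_left h2 (abs_nonneg _)
  have key : a * M ^ 3 = a * M ^ 2 + 3 * |b| * M ^ 2 + 3 * |c| * M ^ 2 + |d| * M ^ 2 := by
    linear_combination M ^ 2 * haM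
  have b1 : |b * M ^ 2| = |b| * M ^ 2 := by rw [abs_mul, abs_of_nonneg (by positivity : 0 ≤ M ^ 2)]
  have c1 : |c * M| = |c| * M := by rw [abs_mul, abs_of_nonneg (by positivity : 0 ≤ M)]
  have hb := abs_le.1 b1.le
  have hc := abs_le.1 c1.le
  have hd := abs_le.1 (le_refl |d|)
  have hpos : 0 ≤ a * M ^ 2 := by positivity
  obtain ⟨t, ht⟩ := intermediate_value_univ (-M) M
    (f := fun t : ℝ => a * t ^ 3 + 3 * b * t ^ 2 + 3 * c * t + d) (by fun_prop)
    (show (0 : ℝ) ∈ _ from ⟨by nlinarith, by nlinarith⟩)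
  exact ⟨t, ht⟩

/-- A real cubic form of positive `tdisc` has a complex root. -/
theorem exists_of {a b c d : ℝ} (ha : 0 < a) (hD : 0 < tdisc a b c d) :
    ∃ x y : ℝ, 0 < y ∧ c = cOf a b x (y ^ 2) ∧ d = dOf a b x (y ^ 2) := by
  obtain ⟨t, ht⟩ := exists_cubic_root ha b c d
  obtain ⟨x, hx⟩ : ∃ x : ℝ, x = -(t + 3 * b / a) / 2 := ⟨_, rfl⟩
  obtain ⟨w, hw⟩ : ∃ w : ℝ, w = 3 * c / a - 2 * t * x - x ^ 2 := ⟨_, rfl⟩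
  have hax : a * t = -(3 * b + 2 * a * x) := by rw [hx]; field_simp; ring
  have haw : a * w = 3 * c - 2 * (a * t) * x - a * x ^ 2 := by rw [hw]; field_simp
  have hc : c = cOf a b x w := by
    unfold cOf
    linear_combination - haw / 3 + 2 / 3 * x * hax
  have hd : d = dOf a b x w := by
    unfold dOf
    linear_combination ht - (t ^ 2 + x ^ 2 + w) * hax + t * haw
  rw [hc, hd, tdisc_of] at hD
  have hw0 : 0 < w := by
    by_contra! h
    exact hD.not_ge (mul_nonpos_of_nonpos_of_nonneg (by linarith) (by positivity))
  exact ⟨x, √w, Real.sqrt_pos.2 hw0, by rwa [Real.sq_sqrt hw0.le], by rwa [Real.sq_sqrt hw0.le]⟩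

/-- `z` is a root of the cubic form. -/
def CRoot (a b c d : ℝ) (z : ℂ) : Prop := a * z ^ 3 + 3 * b * z ^ 2 + 3 * c * z + d = 0

theorem cRoot_of (a b x y : ℝ) :
    CRoot a b (cOf a b x (y ^ 2)) (dOf a b x (y ^ 2)) (x + y * Complex.I) := by
  unfold CRoot cOf dOf
  push_cast
  ring_nf
  rw [I_pow_three, I_sq]
  ring

theorem of_cRoot {a b c d x y : ℝ} (hy : y ≠ 0) (h : CRoot a b c d (x + y * Complex.I)) :
    c = cOf a b x (y ^ 2) ∧ d = dOf a b x (y ^ 2) := by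
  unfold CRoot at h
  have hr := congrArg Complex.re h
  have hi := congrArg Complex.im h
  simp [pow_succ] at hr hi
  have hc : c = cOf a b x (y ^ 2) := by
    unfold cOf
    apply mul_left_cancel₀ hy
    linarith
  refine ⟨hc, ?_⟩
  rw [hc] at hr
  unfold cOf at hr
  unfold dOf
  linarith

theorem of_inj {a b x y x' y' : ℝ} (ha : a ≠ 0) (hy : 0 < y) (hy' : 0 < y')
    (hc : cOf a b x (y ^ 2) = cOf a b x' (y' ^ 2)) (hd : dOf a b x (y ^ 2) = dOf a b x' (y' ^ 2)) :
    x = x' ∧ y = y' := by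
  unfold cOf dOf at *
  have h : 2 * a * (x' - x) * ((3 * b + 2 * a * x + a * x') ^ 2 + a ^ 2 * y' ^ 2) = 0 := by
    linear_combination 3 * a * (3 * b + 2 * a * x) * hc - a ^ 2 * hd
  have hx : x = x' := by
    simpa [ha, sub_eq_zero, eq_comm] using (mul_eq_zero.1 h).resolve_right (by positivity)
  subst hx
  refine ⟨rfl, ?_⟩
  exact (pow_left_inj₀ hy.le hy'.le two_ne_zero).1 (mul_left_cancel₀ ha (by linarith))

namespace TForm

/-- Reduced forms with positive leading coefficient. -/
def Red (st : Bool) (f : TForm) : Prop := 0 < f.a ∧ 0 < f.D ∧ RedCond st f.a f.b f.c f.d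

theorem cast_D (f : TForm) : (f.D : ℝ) = tdisc (f.a : ℝ) f.b f.c f.d := by
  simp only [D, tdisc]; push_cast; ring

theorem exists_root {f : TForm} (ha : f.a ≠ 0) (hD : 0 < f.D) :
    ∃ z : UpperHalfPlane, CRoot f.a f.b f.c f.d z := by
  have hD' : 0 < tdisc (f.a : ℝ) f.b f.c f.d := by rw [← cast_D]; exact_mod_cast hD
  have key {a b c d : ℝ} (ha : 0 < a) (hD : 0 < tdisc a b c d) :
      ∃ z : UpperHalfPlane, CRoot a b c d z := by
    obtain ⟨x, y, hy, hc, hd⟩ := exists_of ha hD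
    refine ⟨⟨x + y * Complex.I, by simpa using hy⟩, ?_⟩
    rw [hc, hd]
    exact cRoot_of a b x y
  rcases lt_or_gt_of_ne ha with h | h
  · obtain ⟨z, hz⟩ := key (a := -f.a) (b := -f.b) (c := -f.c) (d := -f.d) (by simpa)
      (by convert hD' using 1; simp only [tdisc]; ring)
    unfold CRoot at *
    push_cast at hz
    exact ⟨z, by linear_combination -hz⟩
  · exact key (mod_cast h) hD'

theorem red_of_root {st : Bool} {f : TForm} (ha : 0 < f.a) (hD : 0 < f.D) {z : UpperHalfPlane}
    (hz : CRoot f.a f.b f.c f.d z) : f.Red st ↔ FDom st z.re z.im := by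
  have h1 : (0 : ℝ) < f.a := by exact_mod_cast ha
  obtain ⟨hc, hd⟩ := of_cRoot (x := z.re) z.im_pos.ne'
    (by convert hz; exact Complex.re_add_im _)
  unfold Red
  rw [hc, hd, redCond_of h1 (by have := z.im_pos; positivity)]
  simp [ha, hD, FDom]

theorem fd_iff (z : UpperHalfPlane) : z ∈ ModularGroup.fd ↔ FDom false z.re z.im := by
  simp only [fd, FDom, flagLE, Set.mem_ofPred_eq, normSq_apply, abs_le]
  simp only [Bool.false_eq_true, if_false]
  change (1 ≤ z.re * z.re + z.im * z.im ∧ _) ↔ _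
  constructor <;> rintro ⟨h1, h2, h3⟩ <;> refine ⟨?_, ?_, ?_⟩ <;> linarith

theorem fdo_iff (z : UpperHalfPlane) : z ∈ fdo ↔ FDom true z.re z.im := by
  simp only [fdo, FDom, flagLE, Set.mem_ofPred_eq, normSq_apply, abs_lt]
  simp only [if_true]
  change (1 < z.re * z.re + z.im * z.im ∧ _) ↔ _
  constructor <;> rintro ⟨h1, h2, h3⟩ <;> refine ⟨?_, ?_, ?_⟩ <;> linarith

theorem root_act {f : TForm} {g : SpecialLinearGroup (Fin 2) ℤ} {z : UpperHalfPlane}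
    {h : TForm} (hh : h = f.act (g 0 0) (g 0 1) (g 1 0) (g 1 1)) :
    CRoot h.a h.b h.c h.d z ↔ CRoot f.a f.b f.c f.d ((g • z : UpperHalfPlane) : ℂ) := by
  have hden : ((g 1 0 : ℤ) : ℂ) * (z : ℂ) + ((g 1 1 : ℤ) : ℂ) ≠ 0 := by
    simpa [denom] using denom_ne_zero (g : GL (Fin 2) ℝ) z
  rw [coe_specialLinearGroup_apply]
  have hc : ∀ n : ℤ, ((algebraMap ℤ ℝ n : ℝ) : ℂ) = (n : ℂ) := by intro n; simp
  simp only [hc]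
  subst hh
  unfold CRoot act
  push_cast
  generalize ((g 0 0 : ℤ) : ℂ) = p
  generalize ((g 0 1 : ℤ) : ℂ) = q
  generalize ((g 1 0 : ℤ) : ℂ) = r at *
  generalize ((g 1 1 : ℤ) : ℂ) = s at *
  obtain ⟨v, rfl⟩ : ∃ v, s = v - r * z := ⟨r * z + s, by ring⟩
  rw [add_sub_cancel] at *
  constructor <;> intro h <;> field_simp at h ⊢ <;> linear_combination h

theorem exists_red {f : TForm} (hf : f.Irred) (hD : 0 < f.D) : ∃ g, f.Eqv g ∧ g.Red false := by
  obtain ⟨z, hz⟩ := exists_root hf.a_ne hD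
  obtain ⟨γ, hγ⟩ := ModularGroup.exists_smul_mem_fd z
  set k := γ⁻¹ with hk
  set g := f.act (k 0 0) (k 0 1) (k 1 0) (k 1 1) with hg
  have hdet : k 0 0 * k 1 1 - k 0 1 * k 1 0 = 1 := by
    have := k.det_coe; rwa [det_fin_two] at this
  have hfg : f.Eqv g := ⟨_, _, _, _, hdet, hg⟩
  have hroot : CRoot g.a g.b g.c g.d (γ • z : UpperHalfPlane) := by
    rwa [root_act hg, hk, inv_smul_smul]
  have hgD : 0 < g.D := by rwa [D_eqv hfg]
  rcases lt_or_gt_of_ne (hf.eqv hfg).a_ne with h | h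
  · set g' := g.act (-1) 0 0 (-1) with hg'
    have hgg' : g.Eqv g' := ⟨_, _, _, _, by norm_num, hg'⟩
    refine ⟨g', hfg.trans hgg', ?_⟩
    rw [hg', act_neg_one]
    have hD' : 0 < (g').D := by rwa [D_eqv hgg']
    rw [hg', act_neg_one] at hD'
    rw [red_of_root (z := γ • z) (by simpa using h) hD', ← fd_iff]
    · exact hγ
    · unfold CRoot at hroot ⊢
      push_cast at hroot ⊢
      linear_combination - hroot
  · exact ⟨g, hfg, by rw [red_of_root h hgD hroot, ← fd_iff]; exact hγ⟩

theorem red_unique {f : TForm} {p q r s : ℤ} (h : p * s - q * r = 1) (hf : f.Red false)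
    (hg : (f.act p q r s).Red true) : p = 1 ∧ q = 0 ∧ r = 0 ∧ s = 1 := by
  set g := f.act p q r s with hgdef
  obtain ⟨z, hz⟩ := exists_root hg.1.ne' hg.2.1
  let γ : SpecialLinearGroup (Fin 2) ℤ := ⟨!![p, q; r, s], by rwa [det_fin_two_of]⟩
  have hg' : g = f.act (γ 0 0) (γ 0 1) (γ 1 0) (γ 1 1) := hgdef
  have hz' := (root_act hg').1 hz
  have hgpos := hg.1
  rw [red_of_root hg.1 hg.2.1 hz, ← fdo_iff] at hg
  have hf' := hf
  rw [red_of_root hf.1 hf.2.1 hz', ← fd_iff] at hf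
  rcases eq_one_or_neg_one_of_mem_fdo_mem_fd hg hf with h1 | h1 <;>
    have e := congrArg (fun M : SpecialLinearGroup (Fin 2) ℤ => (M 0 0, M 0 1, M 1 0, M 1 1)) h1 <;>
    simp [γ] at e
  · exact e
  · rw [hgdef, e.1, e.2.1, e.2.2.1, e.2.2.2, act_neg_one] at hgpos
    have := hf'.1
    simp at hgpos
    omega

theorem Red.toFalse {f : TForm} (h : f.Red true) : f.Red false := by
  refine ⟨h.1, h.2.1, ?_⟩
  obtain ⟨h1, h2, h3⟩ := h.2.2
  exact ⟨by simpa [flagLE] using h1.le, by simpa [flagLE] using h2.le, by simpa [flagLE] using h3.le⟩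

end TForm

end

namespace TForm

/-- Multiple of a form. -/
def mul (k : ℤ) (f : TForm) : TForm := ⟨k * f.a, k * f.b, k * f.c, k * f.d⟩

theorem mul_act (k : ℤ) (f : TForm) (p q r s : ℤ) : (mul k f).act p q r s = mul k (f.act p q r s) := by
  ext <;> simp only [act, mul] <;> ring

theorem mul_inj {k : ℤ} (hk : k ≠ 0) {f g : TForm} (h : mul k f = mul k g) : f = g := by
  have h' := TForm.mk.inj h
  ext
  · exact mul_left_cancel₀ hk h'.1
  · exact mul_left_cancel₀ hk h'.2.1
  · exact mul_left_cancel₀ hk h'.2.2.1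
  · exact mul_left_cancel₀ hk h'.2.2.2

theorem hA_mul (k : ℤ) (f : TForm) : (mul k f).hA = k ^ 2 * f.hA := by simp only [hA, mul]; ring
theorem hB_mul (k : ℤ) (f : TForm) : (mul k f).hB = k ^ 2 * f.hB := by simp only [hB, mul]; ring
theorem hC_mul (k : ℤ) (f : TForm) : (mul k f).hC = k ^ 2 * f.hC := by simp only [hC, mul]; ring
theorem D_mul (k : ℤ) (f : TForm) : (mul k f).D = k ^ 4 * f.D := by simp only [D, tdisc, mul]; ring
theorem eval_mul (k : ℤ) (f : TForm) (x y : ℤ) : (mul k f).eval x y = k * f.eval x y := by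
  simp only [eval, mul]; ring

/-- The translate `f (x + r y, y)`. -/
def shift (f : TForm) (r : ℤ) : TForm := f.act 1 r 0 1

theorem shift_b (f : TForm) (r : ℤ) : (f.shift r).b = f.b + f.a * r := by simp [shift, act]; ring
theorem shift_c (f : TForm) (r : ℤ) : (f.shift r).c = f.c + 2 * f.b * r + f.a * r ^ 2 := by
  simp [shift, act]; ring
theorem shift_d (f : TForm) (r : ℤ) :
    (f.shift r).d = f.d + 3 * f.c * r + 3 * f.b * r ^ 2 + f.a * r ^ 3 := by
  simp [shift, act]; ring

/-- The condition on a form for having an integral subform. -/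
def OvCond (N e : ℤ) (f : TForm) (r : ℤ) : Prop :=
  e ∣ f.a ∧ N ∣ (f.shift r).d ∧ IsCoprime (f.shift r).c N ∧ IsCoprime f.b e

/-- The subform of `f` attached to a sublattice. -/
def sub (N e : ℤ) (f : TForm) (r : ℤ) : TForm :=
  ⟨f.a / e * N ^ 2, (f.shift r).b * N, (f.shift r).c * e, (f.shift r).d / N * e ^ 2⟩

theorem mul_sub_eq {N e : ℤ} (hN : N ≠ 0) (he : e ≠ 0) {f : TForm} {r : ℤ} (h1 : e ∣ f.a)
    (h2 : N ∣ (f.shift r).d) : f.act N (r * e) 0 e = mul (N * e) (sub N e f r) := by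
  obtain ⟨u, hu⟩ := h1
  obtain ⟨v, hv⟩ := h2
  have hv' := hv
  rw [shift_d] at hv
  ext
  · simp only [act, mul, sub, hu]
    rw [Int.mul_ediv_cancel_left _ he]; ring
  · simp only [act, mul, sub, shift_b]; ring
  · simp only [act, mul, sub, shift_c]; ring
  · simp only [act, mul, sub, hv']
    rw [Int.mul_ediv_cancel_left _ hN]
    linear_combination e ^ 3 * hv

/-- `n²` divides `D` with quotient a discriminant. -/
def DDvd (n D : ℤ) : Prop := ∃ Δ : ℤ, D = n ^ 2 * Δ ∧ (Δ % 4 = 0 ∨ Δ % 4 = 1)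

theorem D_mod (f : TForm) : f.D % 4 = 0 ∨ f.D % 4 = 1 := by
  rw [D_eq]
  rcases Int.even_or_odd' f.hB with ⟨k, hk | hk⟩
  · left; rw [hk]; ring_nf; omega
  · right; rw [hk]; ring_nf; omega

section sub
variable {N e : ℤ} (hN : N ≠ 0) (he : e ≠ 0) {f : TForm} {r : ℤ} (h1 : e ∣ f.a)
    (h2 : N ∣ (f.shift r).d)
include hN he h1 h2

theorem hA_sub : (sub N e f r).hA = f.hA * N ^ 2 := by
  have h := congrArg hA (mul_sub_eq hN he h1 h2)
  rw [hA_mul, hA_act] at h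
  apply mul_left_cancel₀ (pow_ne_zero 2 (mul_ne_zero hN he)); rw [← h]; ring

theorem hB_sub : (sub N e f r).hB = N * e * (2 * f.hA * r + f.hB) := by
  have h := congrArg hB (mul_sub_eq hN he h1 h2)
  rw [hB_mul, hB_act] at h
  apply mul_left_cancel₀ (pow_ne_zero 2 (mul_ne_zero hN he)); rw [← h]; ring

theorem hC_sub : (sub N e f r).hC = e ^ 2 * (f.shift r).hC := by
  have h := congrArg hC (mul_sub_eq hN he h1 h2)
  rw [hC_mul, hC_act] at h
  apply mul_left_cancel₀ (pow_ne_zero 2 (mul_ne_zero hN he)); rw [← h, shift, hC_act]; ring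

theorem D_sub : (sub N e f r).D = (N * e) ^ 2 * f.D := by
  have h := congrArg D (mul_sub_eq hN he h1 h2)
  rw [D_mul, D_act] at h
  apply mul_left_cancel₀ (pow_ne_zero 4 (mul_ne_zero hN he)); rw [← h]; ring

theorem irred_sub (hf : f.Irred) : (sub N e f r).Irred := by
  intro x y hxy
  have h := congrArg (fun g => eval g x y) (mul_sub_eq hN he h1 h2)
  simp only [eval_mul, hxy, mul_zero, eval_act] at h
  obtain ⟨h3, h4⟩ := hf _ _ h
  have hy : y = 0 := by
    rcases mul_eq_zero.1 (show e * y = 0 by linarith) with h | h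
    · exact absurd h he
    · exact h
  subst hy
  refine ⟨?_, rfl⟩
  rcases mul_eq_zero.1 (show N * x = 0 by linarith) with h | h
  · exact absurd h hN
  · exact h

theorem hDvd_sub {h : ℤ} (hf : HDvd h f) : HDvd h (sub N e f r) := by
  refine ⟨?_, ?_, ?_⟩
  · rw [hA_sub hN he h1 h2]; exact hf.1.mul_right _
  · rw [hB_sub hN he h1 h2]
    exact (((hf.1.mul_left 2).mul_right r).add hf.2.1).mul_left _
  · rw [hC_sub hN he h1 h2]; exact (hf.act 1 r 0 1).2.2.mul_left _

theorem dDvd_sub : DDvd (N * e) (sub N e f r).D :=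
  ⟨f.D, D_sub hN he h1 h2, f.D_mod⟩

end sub

theorem not_hDvd_sub {N e : ℤ} (hNe : IsCoprime N e) (hN : N ≠ 0) (he : e ≠ 0) {f : TForm} {r : ℤ}
    (h : OvCond N e f r) {p : ℤ} (hp : Prime p) (hpn : p ∣ N * e) : ¬ HDvd p (sub N e f r) := by
  obtain ⟨h1, h2, h3, h4⟩ := h
  rintro ⟨k1, k2, k3⟩
  rw [hA_sub hN he h1 h2] at k1
  rw [hC_sub hN he h1 h2] at k3
  have hcop : ∀ {x y : ℤ}, IsCoprime x y → p ∣ x → p ∣ y → False := by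
    intro x y hxy hx hy
    exact hp.not_isUnit (hxy.isUnit_of_dvd' hx hy)
  rcases hp.dvd_or_dvd hpn with hpN | hpe
  · rcases hp.dvd_or_dvd k3 with k | k
    · exact hcop hNe hpN (hp.dvd_of_dvd_pow k)
    · refine hcop h3 ?_ hpN
      unfold hC at k
      have := (dvd_sub_left (hpN.trans (h2.mul_left (f.shift r).b))).1 k
      exact hp.dvd_of_dvd_pow this
  · rcases hp.dvd_or_dvd k1 with k | k
    · refine hcop h4 ?_ hpe
      unfold hA at k
      have := (dvd_sub_left (hpe.trans (h1.mul_right f.c))).1 k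
      exact hp.dvd_of_dvd_pow this
    · exact hcop hNe (hp.dvd_of_dvd_pow k) hpe

/-- The value of the Hessian. -/
def hEval (f : TForm) (x y : ℤ) : ℤ := f.hA * x ^ 2 + f.hB * x * y + f.hC * y ^ 2

theorem hEval_act (f : TForm) {p q r s : ℤ} (h : p * s - q * r = 1) (x y : ℤ) :
    (f.act p q r s).hEval x y = f.hEval (p * x + q * y) (r * x + s * y) := by
  unfold hEval
  rw [hA_act, hB_act, hC_act, h]; ring

theorem dvd_hEval_sub {N e : ℤ} (hNe : IsCoprime N e) (hsq : Squarefree (N * e)) {f : TForm} {r : ℤ}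
    (h : OvCond N e f r) {x y : ℤ} : N * e ∣ (sub N e f r).hEval x y ↔ e ∣ x ∧ N ∣ y := by
  have hNe0 : N * e ≠ 0 := hsq.ne_zero
  have hN : N ≠ 0 := left_ne_zero_of_mul hNe0
  have he : e ≠ 0 := right_ne_zero_of_mul hNe0
  obtain ⟨h1, h2, h3, h4⟩ := h
  unfold hEval
  rw [hA_sub hN he h1 h2, hB_sub hN he h1 h2, hC_sub hN he h1 h2]
  have cA : IsCoprime e f.hA := by
    unfold hA
    obtain ⟨k, hk⟩ := h1
    rw [hk, show f.b ^ 2 - e * k * f.c = f.b ^ 2 + e * (-k * f.c) by ring]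
    exact (IsCoprime.pow_left h4).symm.add_mul_left_right _
  have cC : IsCoprime N (f.shift r).hC := by
    unfold hC
    obtain ⟨k, hk⟩ := h2
    rw [hk, show (f.shift r).c ^ 2 - (f.shift r).b * (N * k) =
      (f.shift r).c ^ 2 + N * (-(f.shift r).b * k) by ring]
    exact (IsCoprime.pow_left h3).symm.add_mul_left_right _
  constructor
  · intro hd
    constructor
    · have : e ∣ f.hA * N ^ 2 * x ^ 2 := by
        have := (Dvd.intro_left N rfl).trans hd
        refine (Int.dvd_iff_dvd_of_dvd_sub ?_).1 this
        exact ⟨N * (2 * f.hA * r + f.hB) * x * y + e * (f.shift r).hC * y ^ 2, by ring⟩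
      have := (IsCoprime.mul_right cA (IsCoprime.pow_right hNe.symm (n := 2))).dvd_of_dvd_mul_left this
      exact (hsq.squarefree_of_dvd (Dvd.intro_left N rfl)).dvd_pow_iff_dvd two_ne_zero |>.1 this
    · have : N ∣ e ^ 2 * (f.shift r).hC * y ^ 2 := by
        have := (Dvd.intro e rfl).trans hd
        refine (Int.dvd_iff_dvd_of_dvd_sub ?_).1 this
        exact ⟨f.hA * N * x ^ 2 + e * (2 * f.hA * r + f.hB) * x * y, by ring⟩
      have := (IsCoprime.mul_right (IsCoprime.pow_right hNe (n := 2)) cC).dvd_of_dvd_mul_left this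
      exact (hsq.squarefree_of_dvd (Dvd.intro e rfl)).dvd_pow_iff_dvd two_ne_zero |>.1 this
  · rintro ⟨⟨u, rfl⟩, ⟨v, rfl⟩⟩
    exact ⟨N * e * u ^ 2 * f.hA + N * e * (2 * f.hA * r + f.hB) * u * v
      + (f.shift r).hC * N * e * v ^ 2, by ring⟩

/-- Inequivalent data give inequivalent subforms. -/
theorem sub_inj {n : ℤ} (hsq : Squarefree n) {N e N' e' : ℤ} (hN : 0 < N) (he : 0 < e) (hN' : 0 < N')
    (he' : 0 < e') (hn : N * e = n) (hn' : N' * e' = n) {f f' : TForm} {r r' : ℤ}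
    (hr : 0 ≤ r ∧ r < N) (hr' : 0 ≤ r' ∧ r' < N')
    (h : OvCond N e f r) (h' : OvCond N' e' f' r') (hf : f.Red true) (hf' : f'.Red true)
    (heq : (sub N e f r).Eqv (sub N' e' f' r')) : f = f' ∧ e = e' ∧ r = r' := by
  have cop : ∀ {N e : ℤ}, N * e = n → IsCoprime N e := fun h => by
    rw [← h] at hsq
    exact (squarefree_mul_iff.1 hsq).1.isCoprime
  obtain ⟨p, q, u, s, hdet, hG⟩ := heq
  -- the lattice is respected
  have lat : ∀ x y : ℤ, (e' ∣ x ∧ N' ∣ y) ↔ (e ∣ p * x + q * y ∧ N ∣ u * x + s * y) := by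
    intro x y
    rw [← dvd_hEval_sub (cop hn') (by rwa [hn']) h', hG, hEval_act _ hdet, hn', ← hn,
      dvd_hEval_sub (cop hn) (by rwa [hn]) h]
  obtain ⟨⟨x1, hx1⟩, ⟨y1, hy1⟩⟩ := (lat e' 0).1 ⟨dvd_rfl, dvd_zero _⟩
  obtain ⟨⟨x2, hx2⟩, ⟨y2, hy2⟩⟩ := (lat 0 N').1 ⟨dvd_zero _, dvd_rfl⟩
  simp only [mul_zero, add_zero, zero_add] at hx1 hy1 hx2 hy2
  have hn0 : n ≠ 0 := hsq.ne_zero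
  -- f = f'.act δ where δ = M γ M'⁻¹
  have key := mul_sub_eq hN.ne' he.ne' h.1 h.2.1
  have key' := mul_sub_eq hN'.ne' he'.ne' h'.1 h'.2.1
  -- M = [[N, r e],[0,e]],  γ adj(M') = [[p,q],[u,s]] [[e', -r' e'],[0,N']]
  -- = [[p e', -p r' e' + q N'],[u e', -u r' e' + s N']] = [[e x1, e (x2 - r' x1)],[N y1, N (y2 - r' y1)]]
  have hδ : f' = f.act (x1 + r * y1) (x2 - r' * x1 + r * (y2 - r' * y1)) y1 (y2 - r' * y1) := by
    have e1 : (f'.act N' (r' * e') 0 e').act e' (-(r' * e')) 0 N' = mul (n ^ 3) f' := by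
      rw [act_act, ← hn']
      ext <;> simp only [act, mul] <;> ring
    have e2 : (f.act N (r * e) 0 e).act (e * x1) (e * (x2 - r' * x1)) (N * y1) (N * (y2 - r' * y1))
        = mul (n ^ 3) (f.act (x1 + r * y1) (x2 - r' * x1 + r * (y2 - r' * y1)) y1 (y2 - r' * y1)) := by
      rw [act_act, ← hn]
      ext <;> simp only [act, mul] <;> ring
    apply mul_inj (pow_ne_zero 3 hn0)
    rw [← e1, ← e2, key, key', hn, hn', mul_act, mul_act, hG, act_act]
    congr 2
    · rw [← hx1]; ring
    · linear_combination hx2 - r' * hx1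
    · rw [← hy1]; ring
    · linear_combination hy2 - r' * hy1
  have hdet' : x1 * y2 - x2 * y1 = 1 := by
    have : (N * e) * (x1 * y2 - x2 * y1) = (N' * e') * 1 := by
      calc (N * e) * (x1 * y2 - x2 * y1) = (e * x1) * (N * y2) - (e * x2) * (N * y1) := by ring
        _ = (p * e') * (s * N') - (q * N') * (u * e') := by rw [hx1, hy1, hx2, hy2]
        _ = (N' * e') * (p * s - q * u) := by ring
        _ = _ := by rw [hdet]
    rw [hn, hn'] at this
    exact mul_left_cancel₀ hn0 this
  have huniq := red_unique (f := f) (p := x1 + r * y1) (q := x2 - r' * x1 + r * (y2 - r' * y1))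
    (r := y1) (s := y2 - r' * y1) (by linear_combination hdet') hf.toFalse (by rw [← hδ]; exact hf')
  obtain ⟨i1, i2, i3, i4⟩ := huniq
  rw [i1, i2, i4, i3, act_one] at hδ
  rw [i3] at i1 i4
  simp only [mul_zero, add_zero, sub_zero] at i1 i4
  rw [i1] at hx1
  rw [i4] at hy2
  rw [i1, i3, i4] at i2
  -- now p e' = e, u = 0, s N' = N
  have hu : u = 0 := by
    rw [i3, mul_zero] at hy1
    exact (mul_eq_zero.1 hy1).resolve_right he'.ne'
  have hps : p * s = 1 := by rw [hu] at hdet; linarith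
  have hp0 : 0 < p := by
    by_contra hneg
    push Not at hneg
    nlinarith
  have hp : p = 1 := by
    rcases Int.eq_one_or_neg_one_of_mul_eq_one hps with h | h
    · exact h
    · omega
  have hee : e = e' := by rw [hp] at hx1; linarith
  have hs : s = 1 := by rw [hp] at hps; linarith
  have hNN : N = N' := by rw [hs] at hy2; linarith
  refine ⟨hδ.symm, hee, ?_⟩
  -- x2 = r' - r, e x2 = q N'
  have hx2' : x2 = r' - r := by linarith
  have hdvd : N ∣ r' - r := by
    rw [← hx2']
    refine (cop hn).dvd_of_dvd_mul_left ?_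
    exact ⟨q, by rw [← hx2, hNN]; ring⟩
  have := Int.eq_zero_of_abs_lt_dvd hdvd (by rw [abs_lt]; constructor <;> omega)
  omega

end TForm

namespace TForm

theorem dvd_prod_filter_iff {s : Finset ℕ} (hs : ∀ p ∈ s, p.Prime) (P : ℕ → Prop)
    [DecidablePred P] {p : ℕ} (hp : p ∈ s) : (p : ℤ) ∣ ∏ q ∈ s with P q, (q : ℤ) ↔ P p := by
  rw [(Nat.prime_iff_prime_int.1 (hs p hp)).dvd_finsetProd_iff]
  constructor
  · rintro ⟨q, hq, hpq⟩
    rw [Finset.mem_filter] at hq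
    exact (Nat.prime_dvd_prime_iff_eq (hs p hp) (hs q hq.1)).1 (mod_cast hpq) ▸ hq.2
  · intro h; exact ⟨p, by simp [hp, h], dvd_rfl⟩

theorem isCoprime_of_forall_prime {x y : ℤ}
    (h : ∀ p : ℕ, p.Prime → (p : ℤ) ∣ x → (p : ℤ) ∣ y → False) : IsCoprime x y := by
  rw [Int.isCoprime_iff_gcd_eq_one]
  by_contra hne
  obtain ⟨p, hp, hpd⟩ := Nat.exists_prime_and_dvd hne
  rw [← Int.natCast_dvd_natCast] at hpd
  exact h p hp (hpd.trans (Int.gcd_dvd_left ..)) (hpd.trans (Int.gcd_dvd_right ..))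

theorem exists_hC_coprime {n : ℤ} (hn : n ≠ 0) {g : TForm}
    (hc : ∀ p : ℤ, Prime p → p ∣ n → ¬ HDvd p g) : ∃ g', g.Eqv g' ∧ IsCoprime g'.hC n := by
  set s := n.natAbs.primeFactors with hs
  have hsp : ∀ p ∈ s, p.Prime := fun p hp => Nat.prime_of_mem_primeFactors hp
  have iy {p} (hp : p ∈ s) := dvd_prod_filter_iff hsp (fun p => ¬ (p : ℤ) ∣ g.hA) hp
  have ix {p} (hp : p ∈ s) :=
    dvd_prod_filter_iff hsp (fun p => (p : ℤ) ∣ g.hA ∧ ¬ (p : ℤ) ∣ g.hC) hp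
  set y : ℤ := ∏ q ∈ s with ¬ ((q : ℕ) : ℤ) ∣ g.hA, (q : ℤ)
  set x : ℤ := ∏ q ∈ s with ((q : ℕ) : ℤ) ∣ g.hA ∧ ¬ (q : ℤ) ∣ g.hC, (q : ℤ)
  obtain ⟨u, v, huv⟩ : IsCoprime x y := by
    refine isCoprime_of_forall_prime fun p hp h1 h2 => ?_
    have hps : p ∈ s := by
      obtain ⟨q, hq, hpq⟩ := (Nat.prime_iff_prime_int.1 hp).dvd_finsetProd_iff _ |>.1 h2
      have hq' := (Finset.mem_filter.1 hq).1
      rwa [(Nat.prime_dvd_prime_iff_eq hp (hsp q hq')).1 (mod_cast hpq)]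
    exact (iy hps).1 h2 ((ix hps).1 h1).1
  refine ⟨g.act v x (-u) y, ⟨v, x, -u, y, by linarith, rfl⟩,
    isCoprime_of_forall_prime fun p hp h1 h2 => ?_⟩
  have hps : p ∈ s := by
    rw [hs, Nat.mem_primeFactors]
    exact ⟨hp, Int.natCast_dvd.1 h2, by simpa using hn⟩
  have h := hc p (Nat.prime_iff_prime_int.1 hp) h2
  have ix := ix hps
  have iy := iy hps
  have := Fact.mk hp
  clear_value x y
  rw [hC_act, show v * y - x * -u = 1 by linarith] at h1
  simp only [HDvd, ← ZMod.intCast_zmod_eq_zero_iff_dvd] at *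
  push_cast at h1
  grind

theorem exists_normal {n : ℤ} (hn : 0 < n) {g : TForm} (hd : DDvd n g.D)
    (hc : ∀ p : ℤ, Prime p → p ∣ n → ¬ HDvd p g) :
    ∃ g', g.Eqv g' ∧ n ^ 2 ∣ g'.a ∧ n ∣ g'.b := by
  obtain ⟨g1, hg1, hC⟩ := exists_hC_coprime hn.ne' hc
  obtain ⟨Δ, hΔ, hm⟩ := hd
  rw [← D_eqv hg1, D_eq] at hΔ
  obtain ⟨k, hk⟩ : Even (n * Δ - g1.hB) := by
    have := congrArg Even hΔ
    simp [parity_simps] at this ⊢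
    tauto
  obtain ⟨u, v, huv⟩ := hC
  set t := u * k with ht
  have hCt : g1.hC * t = k - n * (v * k) := by rw [ht]; linear_combination k * huv
  obtain ⟨q, hq⟩ : 4 ∣ Δ ^ 2 - Δ := by
    rcases hm with h | h <;> simp [Int.dvd_iff_emod_eq_zero, pow_two, Int.sub_emod, Int.mul_emod, h]
  set g2 := g1.act 1 0 t 1 with hg2
  have e12 : g1.Eqv g2 := ⟨1, 0, t, 1, by ring, hg2⟩
  have hB3 : g2.hB = n * (Δ - 2 * (v * k)) := by
    rw [hg2, hB_act]; linear_combination 2 * hCt - hk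
  have hcop : IsCoprime n g2.hC := ⟨v, u, by rw [hg2, hC_act]; linarith⟩
  have hA3 : n ^ 2 ∣ g2.hA := by
    have h4 : 4 * (g2.hC * g2.hA) = 4 * (n ^ 2 * (q - Δ * (v * k) + (v * k) ^ 2)) := by
      have hD2 : g2.hB ^ 2 - 4 * g2.hA * g2.hC = n ^ 2 * Δ := by
        rw [← hΔ, ← D_eq, ← D_eq, D_eqv e12]
      rw [hB3] at hD2
      linear_combination - hD2 + n ^ 2 * hq
    exact (hcop.pow_left (m := 2)).dvd_of_dvd_mul_left ⟨_, mul_left_cancel₀ four_ne_zero h4⟩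
  have hb : n ∣ g2.b := by
    refine hcop.dvd_of_dvd_mul_right ?_
    rw [show g2.b * g2.hC = g2.hB * g2.c - g2.hA * g2.d by simp only [hA, hB, hC]; ring]
    exact dvd_sub (.mul_right ⟨_, hB3⟩ _) (.mul_right ((Dvd.intro_left n (by ring)).trans hA3) _)
  refine ⟨g2, hg1.trans e12, ?_, hb⟩
  refine (hcop.pow_left (m := 2)).dvd_of_dvd_mul_right ?_
  rw [show g2.a * g2.hC = g2.b * g2.hB - g2.c * g2.hA by simp only [hA, hB, hC]; ring]
  exact dvd_sub (pow_two n ▸ mul_dvd_mul hb ⟨_, hB3⟩) (hA3.mul_left _)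

/-- Hermite normal form. -/
theorem exists_hnf {n : ℤ} (hn : 0 < n) (hsq : Squarefree n) {p q r s : ℤ} (hdet : p * s - q * r = n) :
    ∃ N e t x y z w : ℤ, 0 < N ∧ 0 < e ∧ N * e = n ∧ 0 ≤ t ∧ t < N ∧ x * w - y * z = 1 ∧
      p * x + q * z = N ∧ p * y + q * w = t * e ∧ r * x + s * z = 0 ∧ r * y + s * w = e := by
  have hrs : 0 < Int.gcd r s := by
    rw [Int.gcd_pos_iff]
    by_contra! h
    rw [h.1, h.2] at hdet
    simp at hdet
    omega
  obtain ⟨e, r', s', he, hg, rfl, rfl⟩ := Int.exists_gcd_one' hrs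
  obtain ⟨u, v, h1⟩ := Int.isCoprime_iff_gcd_eq_one.2 hg
  set N := p * s' - q * r' with hN
  have hNe : N * e = n := by linarith
  have he0 : (0 : ℤ) < e := mod_cast he
  have hN0 : 0 < N := (pos_iff_pos_of_mul_pos (hNe ▸ hn)).2 he0
  have hcop : IsCoprime N e := by
    rw [← hNe] at hsq; exact (squarefree_mul_iff.1 hsq).1.isCoprime
  obtain ⟨α, β, hαβ⟩ := hcop
  set S := p * u + q * v with hS
  set t := (S * β) % N with ht
  have htd : t = S * β - N * ((S * β) / N) := by rw [ht, Int.emod_def]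
  set j := -(S * α) - e * ((S * β) / N) with hj
  refine ⟨N, e, t, s', u + s' * j, -r', v - r' * j, hN0, he0, hNe, Int.emod_nonneg _ hN0.ne',
    Int.emod_lt_of_pos _ hN0, by linear_combination h1, by rw [hN]; ring, ?_, ?_, ?_⟩
  · rw [htd, hj]; linear_combination - S * hαβ
  · ring
  · linear_combination e * h1

theorem Eqv.hDvd_iff {h : ℤ} {f g : TForm} (hfg : f.Eqv g) : HDvd h f ↔ HDvd h g :=
  ⟨HDvd.eqv hfg, HDvd.eqv hfg.symm⟩

/-- Every form whose discriminant is divisible by `n²` is a subform. -/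
theorem exists_sub {n : ℤ} (hn : 0 < n) (hsq : Squarefree n) {h : ℤ} (hnh : IsCoprime n h)
    {g : TForm} (hg : g.Irred) (hD : 0 < g.D) (hd : DDvd n g.D)
    (hc : ∀ p : ℤ, Prime p → p ∣ n → ¬ HDvd p g) (hh : HDvd h g) :
    ∃ N e f r, 0 < N ∧ 0 < e ∧ N * e = n ∧ 0 ≤ r ∧ r < N ∧ f.Red false ∧ f.Irred ∧ HDvd h f ∧
      OvCond N e f r ∧ g.Eqv (sub N e f r) := by
  obtain ⟨g1, hg1, ⟨a, ha⟩, ⟨b, hb⟩⟩ := exists_normal hn hd hc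
  set f0 : TForm := ⟨a, b, g1.c, n * g1.d⟩ with hf0
  have e0 : f0.act n 0 0 1 = mul n g1 := by
    ext <;> simp only [act, mul, hf0, ha, hb] <;> ring
  have hg1i := hg.eqv hg1
  have hf0D : 0 < f0.D := by
    have := congrArg D e0
    rw [D_act, D_mul, D_eqv hg1] at this
    have h2 : n ^ 2 * f0.D = g.D := mul_left_cancel₀ (pow_ne_zero 4 hn.ne') (by rw [← this]; ring)
    exact (mul_pos_iff_of_pos_left (by positivity)).1 (h2 ▸ hD)
  have hf0i : f0.Irred := by
    intro x y hxy
    have h1 : (f0.act n 0 0 1).eval x (n * y) = n ^ 3 * f0.eval x y := by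
      rw [eval_act]; simp only [eval]; ring
    rw [e0, eval_mul, hxy, mul_zero] at h1
    obtain ⟨h2, h3⟩ := hg1i _ _ ((mul_eq_zero.1 h1).resolve_left hn.ne')
    exact ⟨h2, (mul_eq_zero.1 h3).resolve_left hn.ne'⟩
  obtain ⟨f, hff, hfr⟩ := exists_red hf0i hf0D
  have hff' := hff
  obtain ⟨p, q, r, s, hdet, hf⟩ := hff.symm
  have e1 : f.act (p * n) q (r * n) s = mul n g1 := by
    rw [← e0, hf, act_act]; congr 1 <;> ring
  obtain ⟨N, e, t, x, y, z, w, hN, he, hNe, ht, htN, hxy, k1, k2, k3, k4⟩ :=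
    exists_hnf hn hsq (p := p * n) (q := q) (r := r * n) (s := s) (by linear_combination n * hdet)
  set G := g1.act x y z w with hG
  have hgG : g.Eqv G := hg1.trans ⟨x, y, z, w, hxy, hG⟩
  have e2 : f.act N (t * e) 0 e = mul n G := by
    rw [hG, ← mul_act, ← e1, act_act, k1, k2, k3, k4]
  have hcop : IsCoprime N e := by
    rw [← hNe] at hsq; exact (squarefree_mul_iff.1 hsq).1.isCoprime
  have i1 : e ∣ f.a := by
    have := congrArg TForm.a e2
    simp only [act, mul, ← hNe] at this
    exact (hcop.symm.pow_right (n := 2)).dvd_of_dvd_mul_right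
      ⟨G.a, mul_left_cancel₀ hN.ne' (by linear_combination this)⟩
  have i2 : N ∣ (f.shift t).d := by
    have := congrArg TForm.d e2
    simp only [act, mul, ← hNe] at this
    exact (hcop.pow_right (n := 2)).dvd_of_dvd_mul_right
      ⟨G.d, mul_left_cancel₀ he.ne' (by rw [shift_d]; linear_combination this)⟩
  have hGs : G = sub N e f t :=
    mul_inj hn.ne' (by rw [← e2, mul_sub_eq hN.ne' he.ne' i1 i2, hNe])
  have hcG : ∀ p : ℤ, Prime p → p ∣ n → ¬ HDvd p (sub N e f t) := fun p hp hpn hH =>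
    hc p hp hpn (by rw [hgG.hDvd_iff, hGs]; exact hH)
  have s1 := hA_sub hN.ne' he.ne' i1 i2
  have s2 := hB_sub hN.ne' he.ne' i1 i2
  have s3 := hC_sub hN.ne' he.ne' i1 i2
  refine ⟨N, e, f, t, hN, he, hNe, ht, htN, hfr, hf0i.eqv hff', ?_, ⟨i1, i2, ?_, ?_⟩, hGs ▸ hgG⟩
  · have e3 : (mul n g1).act s (-(q)) (-(r * n)) (p * n) = mul (n ^ 3) f := by
      rw [← e1, act_act, show p * n * s + q * -(r * n) = n by linear_combination n * hdet,
        show p * n * -q + q * (p * n) = 0 by ring, show r * n * s + s * -(r * n) = 0 by ring,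
        show r * n * -q + s * (p * n) = n by linear_combination n * hdet]
      ext <;> simp only [act, mul] <;> ring
    have hdv : HDvd h (mul (n ^ 3) f) := by
      rw [← e3]
      apply HDvd.act
      have := hh.eqv hg1
      simp only [HDvd, hA_mul, hB_mul, hC_mul]
      exact ⟨this.1.mul_left _, this.2.1.mul_left _, this.2.2.mul_left _⟩
    have hc6 : IsCoprime h ((n ^ 3) ^ 2) := hnh.pow_left.pow_left.symm
    simp only [HDvd, hA_mul, hB_mul, hC_mul] at hdv
    exact ⟨hc6.dvd_of_dvd_mul_left hdv.1, hc6.dvd_of_dvd_mul_left hdv.2.1,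
      hc6.dvd_of_dvd_mul_left hdv.2.2⟩
  · refine isCoprime_of_forall_prime fun p hp h1 h2 => ?_
    refine hcG p (Nat.prime_iff_prime_int.1 hp) (h2.trans ⟨e, hNe.symm⟩) ⟨?_, ?_, ?_⟩
    · rw [s1]; exact (h2.trans (Dvd.intro_left N (by ring))).mul_left _
    · rw [s2, mul_assoc]; exact h2.mul_right _
    · rw [s3]
      refine Dvd.dvd.mul_left ?_ _
      exact (h1.trans (Dvd.intro_left _ (pow_two _).symm)).sub ((h2.trans i2).mul_left _)
  · refine isCoprime_of_forall_prime fun p hp h1 h2 => ?_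
    refine hcG p (Nat.prime_iff_prime_int.1 hp) (h2.trans ⟨N, by linarith⟩) ⟨?_, ?_, ?_⟩
    · rw [s1]
      refine Dvd.dvd.mul_right ?_ _
      exact (h1.trans (Dvd.intro_left _ (pow_two _).symm)).sub ((h2.trans i1).mul_right _)
    · rw [s2, mul_comm N e, mul_assoc]; exact h2.mul_right _
    · rw [s3]; exact (h2.trans (Dvd.intro_left _ (pow_two _).symm)).mul_right _

end TForm

section
open MeasureTheory Set

/-- The frontier of `S` has at most `k` points. -/
def FewFrontier (k : ℕ) (S : Set ℝ) : Prop := ∃ F : Finset ℝ, F.card ≤ k ∧ frontier S ⊆ F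

namespace FewFrontier

theorem inter {k l : ℕ} {S T : Set ℝ} (hS : FewFrontier k S) (hT : FewFrontier l T) :
    FewFrontier (k + l) (S ∩ T) := by
  obtain ⟨F, h1, h2⟩ := hS
  obtain ⟨G, h3, h4⟩ := hT
  refine ⟨F ∪ G, (Finset.card_union_le _ _).trans (by omega), fun x hx => ?_⟩
  rcases frontier_inter_subset S T hx with h | h
  · exact Finset.mem_coe.2 (Finset.mem_union_left _ (h2 h.1))
  · exact Finset.mem_coe.2 (Finset.mem_union_right _ (h4 h.2))

theorem compl {k : ℕ} {S : Set ℝ} (hS : FewFrontier k S) : FewFrontier k Sᶜ := by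
  unfold FewFrontier; rwa [frontier_compl]

theorem measurableSet {k : ℕ} {S : Set ℝ} (hS : FewFrontier k S) : MeasurableSet S := by
  obtain ⟨F, -, h2⟩ := hS
  have : S = interior S ∪ (S ∩ frontier S) := by
    ext x
    simp only [mem_union, mem_inter_iff, frontier, Set.mem_sdiff]
    constructor
    · intro hx
      by_cases h : x ∈ interior S
      · exact Or.inl h
      · exact Or.inr ⟨hx, subset_closure hx, h⟩
    · rintro (h | h)
      · exact interior_subset h
      · exact h.1
  rw [this]
  exact isOpen_interior.measurableSet.union
    ((F.finite_toSet.subset (inter_subset_right.trans h2)).measurableSet)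

theorem of_polynomial {m : ℕ} {p : Polynomial ℝ} (hp : p.natDegree ≤ m) :
    FewFrontier m {t | 0 < p.eval t} := by
  rcases eq_or_ne p 0 with rfl | h0
  · exact ⟨∅, by simp, by simp⟩
  refine ⟨p.roots.toFinset, (Multiset.toFinset_card_le _).trans
    ((Polynomial.card_roots' p).trans hp), fun x hx => ?_⟩
  have h1 := frontier_lt_subset_eq continuous_const p.continuous hx
  simp only [mem_ofPred_eq] at h1
  simpa [h0] using h1.symm

theorem card_sub_volume {S : Set ℝ} {k : ℕ} (hS : FewFrontier k S) {T : Finset ℤ}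
    (hT : ∀ x ∈ S, ⌊x⌋ ∈ T) :
    |((T.filter fun z : ℤ => (z : ℝ) ∈ S).card : ℝ) - volume.real S| ≤ k := by
  have hm := hS.measurableSet
  obtain ⟨F, h1, h2⟩ := hS
  have hU : S = ⋃ z ∈ T, S ∩ Ico (z : ℝ) (z + 1) := by
    ext x
    simp only [mem_iUnion, mem_inter_iff, mem_Ico, exists_prop]
    constructor
    · intro hx; exact ⟨⌊x⌋, hT x hx, hx, Int.floor_le x, Int.lt_floor_add_one x⟩
    · rintro ⟨z, -, h, -⟩; exact h
  have hvol : volume.real S = ∑ z ∈ T, volume.real (S ∩ Ico (z : ℝ) (z + 1)) := by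
    conv_lhs => rw [hU]
    refine measureReal_biUnion_finset ?_ (fun z _ => hm.inter measurableSet_Ico) fun z _ => ?_
    · intro z _ w _ hzw
      refine Set.disjoint_left.2 fun x hx hy => hzw ?_
      rw [← Int.floor_eq_iff.2 ⟨hx.2.1, hx.2.2⟩, ← Int.floor_eq_iff.2 ⟨hy.2.1, hy.2.2⟩]
    · exact (lt_of_le_of_lt (measure_mono inter_subset_right) (by simp)).ne
  have hcard : ((T.filter fun z : ℤ => (z : ℝ) ∈ S).card : ℝ) =
      ∑ z ∈ T, if (z : ℝ) ∈ S then (1 : ℝ) else 0 := by simp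
  rw [hvol, hcard, ← Finset.sum_sub_distrib]
  refine (Finset.abs_sum_le_sum_abs _ _).trans ?_
  have key : ∀ z ∈ T, |(if (z : ℝ) ∈ S then (1 : ℝ) else 0) - volume.real (S ∩ Ico (z : ℝ) (z + 1))|
      ≤ if z ∈ F.image (fun x => ⌊x⌋) then (1 : ℝ) else 0 := by
    intro z _
    have hle : volume.real (S ∩ Ico (z : ℝ) (z + 1)) ≤ 1 := by
      refine (measureReal_mono inter_subset_right (by simp)).trans ?_
      simp [measureReal_def]
    have h0 : 0 ≤ volume.real (S ∩ Ico (z : ℝ) (z + 1)) := measureReal_nonneg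
    split_ifs with hz hF hF
    · rw [abs_le]; constructor <;> linarith
    all_goals try (rw [abs_le]; constructor <;> linarith)
    all_goals
      have hpre : IsPreconnected (Ico (z : ℝ) (z + 1)) := isPreconnected_Ico
      have hzI : (z : ℝ) ∈ Ico (z : ℝ) (z + 1) := ⟨le_rfl, by linarith⟩
      have hsub := hpre.subset_or_subset isOpen_interior (v := interior Sᶜ) isOpen_interior
        (disjoint_compl_right.mono interior_subset interior_subset) (by
          intro x hx
          by_contra hcon
          apply hF
          rw [Finset.mem_image]
          refine ⟨x, h2 ?_, Int.floor_eq_iff.2 ⟨hx.1, hx.2⟩⟩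
          rw [mem_union, not_or, interior_compl, mem_compl_iff, not_not] at hcon
          exact ⟨hcon.2, hcon.1⟩)
    · rcases hsub with h | h
      · rw [inter_eq_self_of_subset_right (h.trans interior_subset)]
        simp [measureReal_def]
      · exact absurd hz (interior_subset (h hzI))
    · rcases hsub with h | h
      · exact absurd (interior_subset (h hzI)) hz
      · have : S ∩ Ico (z : ℝ) (z + 1) = ∅ :=
          (Set.disjoint_left.2 fun x hx hy => interior_subset (h hy) hx).inter_eq
        rw [this]; simp
  refine (Finset.sum_le_sum key).trans ?_
  rw [← Finset.sum_filter, Finset.sum_const, nsmul_eq_mul, mul_one]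
  norm_cast
  refine le_trans (Finset.card_le_card fun z hz => (Finset.mem_filter.1 hz).2) ?_
  exact Finset.card_image_le.trans h1

/-- The number of integers in a random section compared with the volume. -/
theorem sum_measure_sub {P : Type*} [MeasurableSpace P] {μ : Measure P} [SFinite μ]
    {E : Set (P × ℝ)} (hE : MeasurableSet E) {k : ℕ} {T : Finset ℤ} {P0 : Set P}
    (hP0 : MeasurableSet P0) (hfin : μ P0 ≠ ⊤)
    (hk : ∀ p, FewFrontier k {t | (p, t) ∈ E}) (hT : ∀ p t, (p, t) ∈ E → p ∈ P0 ∧ ⌊t⌋ ∈ T) :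
    |∑ z ∈ T, μ.real {p | (p, (z : ℝ)) ∈ E} - (μ.prod volume).real E| ≤ k * μ.real P0 := by
  have hEfin : (μ.prod volume) E ≠ ⊤ := by
    have : E ⊆ P0 ×ˢ (⋃ z ∈ T, Ico (z : ℝ) (z + 1)) := fun x hx => by
      refine ⟨(hT x.1 x.2 hx).1, ?_⟩
      simp only [mem_iUnion, exists_prop]
      exact ⟨_, (hT x.1 x.2 hx).2, Int.floor_le _, Int.lt_floor_add_one _⟩
    refine ((measure_mono this).trans_lt ?_).ne
    rw [Measure.prod_prod]
    refine ENNReal.mul_lt_top hfin.lt_top ?_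
    refine (measure_biUnion_finset_le _ _).trans_lt ?_
    simp
  have h1 := Measure.integrable_measure_prodMk_left hE hEfin
  have h2 : (μ.prod volume).real E = ∫ p, volume.real (Prod.mk p ⁻¹' E) ∂μ := by
    simp_rw [measureReal_def]
    rw [integral_toReal (measurable_measure_prodMk_left hE).aemeasurable
      (Measure.ae_measure_lt_top hE hEfin), Measure.prod_apply hE]
  have hms : ∀ z : ℤ, MeasurableSet {p | (p, (z : ℝ)) ∈ E} := fun z =>
    measurable_prodMk_right hE
  have hsub : ∀ z : ℤ, {p | (p, (z : ℝ)) ∈ E} ⊆ P0 := fun z p hp => (hT _ _ hp).1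
  have h3 : ∀ z : ℤ, μ.real {p | (p, (z : ℝ)) ∈ E} =
      ∫ p, ({p | (p, (z : ℝ)) ∈ E}.indicator (fun _ => (1 : ℝ)) p) ∂μ := fun z => by
    rw [integral_indicator (hms z)]; simp
  have h4 : ∀ z : ℤ, Integrable ({p | (p, (z : ℝ)) ∈ E}.indicator (fun _ => (1 : ℝ))) μ := fun z =>
    (integrable_indicator_iff (hms z)).2 (integrableOn_const
      (hs := ((measure_mono (hsub z)).trans_lt hfin.lt_top).ne))
  simp_rw [h3]
  rw [h2, ← integral_finsetSum _ (fun z _ => h4 z),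
    ← integral_sub (integrable_finsetSum _ (fun z _ => h4 z)) h1]
  have h5 : ∀ p, ‖(∑ z ∈ T, {p | (p, (z : ℝ)) ∈ E}.indicator (fun _ => (1 : ℝ)) p) -
      volume.real (Prod.mk p ⁻¹' E)‖ ≤ P0.indicator (fun _ => (k : ℝ)) p := by
    intro p
    by_cases hp : p ∈ P0
    · rw [indicator_of_mem hp, Real.norm_eq_abs]
      convert (hk p).card_sub_volume (T := T) (fun x hx => (hT p x hx).2) using 3
      · rw [Finset.card_filter]
        push_cast
        exact Finset.sum_congr rfl fun z _ => by simp [indicator_apply]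
      · rfl
    · have e1 : Prod.mk p ⁻¹' E = ∅ := by
        ext t; simp only [mem_preimage, mem_empty_iff_false, iff_false]
        exact fun h => hp (hT p t h).1
      have e2 : ∀ z : ℤ, {p | (p, (z : ℝ)) ∈ E}.indicator (fun _ => (1 : ℝ)) p = 0 := fun z =>
        indicator_of_notMem (fun h => hp (hsub z h)) _
      rw [e1]
      simp [e2, indicator_of_notMem hp]
  rw [← Real.norm_eq_abs]
  refine (norm_integral_le_of_norm_le ((integrable_indicator_iff hP0).2
    (integrableOn_const (hs := hfin))) (ae_of_all _ h5)).trans ?_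
  rw [integral_indicator hP0]
  simp [mul_comm]

/-- Lattice points in a planar region on a family of shifted horizontal lines. -/
theorem sum_card_sub {E : Set (ℝ × ℝ)} (hE : MeasurableSet E) {k : ℕ} {j0 s0 J I : ℝ}
    (hJ : 0 ≤ J) (hI : 0 ≤ I)
    (h1 : ∀ j, FewFrontier k {s | (j, s) ∈ E}) (h2 : ∀ s, FewFrontier k {j | (j, s) ∈ E})
    (hb : ∀ j s, (j, s) ∈ E → j0 ≤ j ∧ j ≤ j0 + J ∧ s0 ≤ s ∧ s ≤ s0 + I) (θ : ℤ → ℝ)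
    {T U : Finset ℤ} (hT : T = Finset.Icc ⌊s0⌋ ⌊s0 + I⌋)
    (hU : ∀ i ∈ T, ∀ j : ℝ, (j + θ i, (i : ℝ)) ∈ E → ⌊j⌋ ∈ U) :
    |∑ i ∈ T, ((U.filter fun u : ℤ => ((u : ℝ) + θ i, (i : ℝ)) ∈ E).card : ℝ) - volume.real E| ≤
      k * (I + 2) + k * J := by
  have hfl : ∀ s : ℝ, s0 ≤ s → s ≤ s0 + I → ⌊s⌋ ∈ T := fun s h h' => by
    rw [hT, Finset.mem_Icc]; exact ⟨Int.floor_mono h, Int.floor_mono h'⟩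
  have k1 := sum_measure_sub (μ := (volume : Measure ℝ)) hE (P0 := Icc j0 (j0 + J)) (T := T)
    measurableSet_Icc (by simp) h1 (fun j s h => by
      obtain ⟨q1, q2, q3, q4⟩ := hb j s h
      exact ⟨⟨q1, q2⟩, hfl _ q3 q4⟩)
  have k2 : ∀ i ∈ T, |((U.filter fun u : ℤ => ((u : ℝ) + θ i, (i : ℝ)) ∈ E).card : ℝ) -
      volume.real {j | (j, (i : ℝ)) ∈ E}| ≤ k := by
    intro i hi
    have hpre : {j : ℝ | (j + θ i, (i : ℝ)) ∈ E} = (fun j => j + θ i) ⁻¹' {j | (j, (i : ℝ)) ∈ E} := rfl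
    have hf : FewFrontier k {j : ℝ | (j + θ i, (i : ℝ)) ∈ E} := by
      obtain ⟨F, hF1, hF2⟩ := h2 i
      refine ⟨F.image (fun x => x - θ i), Finset.card_image_le.trans hF1, ?_⟩
      rw [hpre]
      have : frontier ((fun j => j + θ i) ⁻¹' {j | (j, (i : ℝ)) ∈ E}) =
          (fun j => j + θ i) ⁻¹' frontier {j | (j, (i : ℝ)) ∈ E} :=
        ((Homeomorph.addRight (θ i)).preimage_frontier _).symm
      rw [this]
      intro x hx
      rw [Finset.mem_coe, Finset.mem_image]
      exact ⟨_, hF2 hx, by ring⟩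
    have := hf.card_sub_volume (T := U) (fun x hx => hU i hi x hx)
    have e : volume.real {j : ℝ | (j + θ i, (i : ℝ)) ∈ E} = volume.real {j | (j, (i : ℝ)) ∈ E} := by
      rw [hpre, measureReal_def, measure_preimage_add_right, measureReal_def]
    rw [e] at this
    exact this
  have k3 : |∑ i ∈ T, ((U.filter fun u : ℤ => ((u : ℝ) + θ i, (i : ℝ)) ∈ E).card : ℝ) -
      ∑ i ∈ T, volume.real {j | (j, (i : ℝ)) ∈ E}| ≤ k * (I + 2) := by
    rw [← Finset.sum_sub_distrib]
    refine (Finset.abs_sum_le_sum_abs _ _).trans ((Finset.sum_le_sum k2).trans ?_)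
    rw [Finset.sum_const, nsmul_eq_mul, mul_comm]
    refine mul_le_mul_of_nonneg_left ?_ (Nat.cast_nonneg _)
    have hle : ⌊s0⌋ ≤ ⌊s0 + I⌋ := Int.floor_mono (by linarith)
    have : (T.card : ℝ) = (⌊s0 + I⌋ : ℝ) + 1 - ⌊s0⌋ := by
      rw [hT, Int.card_Icc]
      have : ((⌊s0 + I⌋ + 1 - ⌊s0⌋).toNat : ℤ) = ⌊s0 + I⌋ + 1 - ⌊s0⌋ := Int.toNat_of_nonneg (by omega)
      exact_mod_cast this
    rw [this]
    have := Int.floor_le (s0 + I)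
    have := Int.lt_floor_add_one s0
    linarith
  have k4 : volume.real (Icc j0 (j0 + J)) = J := by simp [measureReal_def, hJ]
  rw [k4] at k1
  calc _ ≤ _ := abs_sub_le _ (∑ i ∈ T, volume.real {j | (j, (i : ℝ)) ∈ E}) _
    _ ≤ _ := add_le_add k3 k1

end FewFrontier

end

section
open MeasureTheory Set

/-- Every section of `Ω` by a line has few frontier points. -/
def LineNice (k : ℕ) (Ω : Set (ℝ × ℝ)) : Prop :=
  ∀ x y α β : ℝ, FewFrontier k {t | (x + t * α, y + t * β) ∈ Ω}

theorem volume_real_preimage_affine (Ω : Set (ℝ × ℝ)) (x0 y0 : ℝ) {p q r s : ℝ}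
    (h : p * s - q * r ≠ 0) :
    volume.real {z : ℝ × ℝ | (x0 + (p * z.1 + q * z.2), y0 + (r * z.1 + s * z.2)) ∈ Ω} =
      |p * s - q * r|⁻¹ * volume.real Ω := by
  set L := Matrix.toLin (Module.Basis.finTwoProd ℝ) (Module.Basis.finTwoProd ℝ) !![p, q; r, s] with hL
  have hdet : LinearMap.det L = p * s - q * r := by
    rw [hL, LinearMap.det_toLin, Matrix.det_fin_two_of]
  have hset : {z : ℝ × ℝ | (x0 + (p * z.1 + q * z.2), y0 + (r * z.1 + s * z.2)) ∈ Ω} =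
      L ⁻¹' ((fun w => (x0, y0) + w) ⁻¹' Ω) := by
    ext z
    simp [hL, Matrix.toLin_finTwoProd_apply]
  rw [hset, measureReal_def, Measure.addHaar_preimage_linearMap _ (by rwa [hdet]),
    measure_preimage_add, hdet, ENNReal.toReal_mul, measureReal_def, abs_inv,
    ENNReal.toReal_ofReal (by positivity)]

/-- Counting points of a lattice coset in a region, by lines parallel to a primitive vector. -/
theorem lattice_count {Ω : Set (ℝ × ℝ)} (hΩ : MeasurableSet Ω) {k : ℕ} (hk : LineNice k Ω)
    {x0 y0 R : ℝ} (hR : 0 ≤ R) (hbox : ∀ c d, (c, d) ∈ Ω → |c - x0| ≤ R ∧ |d - y0| ≤ R)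
    {N : ℤ} (hN : 0 < N) (ρ σ : ℤ) {v1 v2 m : ℤ} (hv1 : 0 < v1) (hcop : IsCoprime v1 m)
    (hv2 : v2 = ρ * v1 + N * m) :
    {p : ℤ × ℤ | ((p.1 : ℝ), (p.2 : ℝ)) ∈ Ω ∧ N ∣ p.2 - ρ * p.1 - σ}.Finite ∧
    |({p : ℤ × ℤ | ((p.1 : ℝ), (p.2 : ℝ)) ∈ Ω ∧ N ∣ p.2 - ρ * p.1 - σ}.ncard : ℝ) -
      volume.real Ω / N| ≤ k * (2 * R / v1 + 2 * R * (v1 + |(v2 : ℝ)|) / N + 2) := by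
  obtain ⟨wβ, wα', hw'⟩ := hcop
  obtain ⟨wα, hwα⟩ : ∃ wα, wα = -wα' := ⟨_, rfl⟩
  have hw : v1 * wβ - m * wα = 1 := by rw [hwα]; linarith
  have hv1R : (0 : ℝ) < v1 := by exact_mod_cast hv1
  have hNR : (0 : ℝ) < N := by exact_mod_cast hN
  set E : Set (ℝ × ℝ) :=
    {z | (0 + (v1 * z.1 + 0 * z.2), (σ : ℝ) + (v2 * z.1 + N / v1 * z.2)) ∈ Ω} with hE
  have hEm : MeasurableSet E := by
    have : Measurable fun z : ℝ × ℝ =>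
      ((0 + (v1 * z.1 + 0 * z.2), (σ : ℝ) + (v2 * z.1 + N / v1 * z.2)) : ℝ × ℝ) := by fun_prop
    exact this hΩ
  have hEvol : volume.real E = volume.real Ω / N := by
    have hd : (v1 : ℝ) * (N / v1) - 0 * v2 = N := by field_simp; ring
    rw [hE, volume_real_preimage_affine Ω 0 σ (by rw [hd]; exact hNR.ne'), hd, abs_of_pos hNR]
    field_simp
  set j0 : ℝ := (x0 - R) / v1
  set J : ℝ := 2 * R / v1
  set s0 : ℝ := (v1 * y0 - v1 * σ - v2 * x0 - R * (v1 + |(v2 : ℝ)|)) / N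
  set I : ℝ := 2 * R * (v1 + |(v2 : ℝ)|) / N
  have hb : ∀ j s, (j, s) ∈ E → j0 ≤ j ∧ j ≤ j0 + J ∧ s0 ≤ s ∧ s ≤ s0 + I := by
    intro j s h
    obtain ⟨hc, hd⟩ := hbox _ _ h
    have hs : s = (v1 * ((σ : ℝ) + (v2 * j + N / v1 * s)) - v1 * σ - v2 * (v1 * j)) / N := by
      field_simp; ring
    simp only [zero_mul, zero_add, add_zero] at hc hd
    set d := (σ : ℝ) + (v2 * j + N / v1 * s)
    set c := (v1 : ℝ) * j
    have e1 : |(v1 : ℝ) * (d - y0) - v2 * (c - x0)| ≤ R * (v1 + |(v2 : ℝ)|) := by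
      refine (abs_sub _ _).trans ?_
      rw [abs_mul, abs_mul, abs_of_pos hv1R]
      nlinarith [abs_nonneg (v2 : ℝ)]
    rw [abs_le] at hc e1
    refine ⟨?_, ?_, ?_, ?_⟩
    · rw [div_le_iff₀ hv1R, mul_comm]; linarith
    · rw [← add_div, le_div_iff₀ hv1R, mul_comm]; linarith
    · rw [hs]; exact div_le_div_of_nonneg_right (by linarith) hNR.le
    · rw [hs, ← add_div]; exact div_le_div_of_nonneg_right (by linarith) hNR.le
  set θ : ℤ → ℝ := fun i => i * wα / v1 with hθ
  set T := Finset.Icc ⌊s0⌋ ⌊s0 + I⌋ with hT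
  set U : Finset ℤ := T.biUnion fun i => Finset.Icc ⌊j0 - θ i⌋ ⌊j0 + J - θ i⌋ with hU
  have hUmem : ∀ i ∈ T, ∀ j : ℝ, (j + θ i, (i : ℝ)) ∈ E → ⌊j⌋ ∈ U := by
    intro i hi j h
    obtain ⟨q1, q2, -⟩ := hb _ _ h
    rw [hU, Finset.mem_biUnion]
    exact ⟨i, hi, Finset.mem_Icc.2 ⟨Int.floor_mono (by linarith), Int.floor_mono (by linarith)⟩⟩
  have main := FewFrontier.sum_card_sub hEm (k := k) (j0 := j0) (s0 := s0) (J := J) (I := I)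
    (by positivity) (by positivity)
    (fun j => by
      have := hk (v1 * j) (σ + v2 * j) 0 (N / v1)
      convert this using 3 with t
      simp only [hE, mem_ofPred_eq]
      refine iff_of_eq (congrArg (· ∈ Ω) ?_)
      ext <;> ring)
    (fun s => by
      have := hk 0 (σ + N / v1 * s) v1 v2
      convert this using 3 with t
      simp only [hE, mem_ofPred_eq]
      refine iff_of_eq (congrArg (· ∈ Ω) ?_)
      ext <;> ring) hb θ hT hUmem
  set φ : ℤ × ℤ → ℤ × ℤ := fun p =>
    (p.2 * v1 + p.1 * wα, σ + p.2 * v2 + p.1 * (ρ * wα + N * wβ)) with hφ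
  set Z := (T ×ˢ U).filter fun p : ℤ × ℤ => ((p.2 : ℝ) + θ p.1, (p.1 : ℝ)) ∈ E with hZ
  have hEiff : ∀ i u : ℤ, ((u : ℝ) + θ i, (i : ℝ)) ∈ E ↔
      (((φ (i, u)).1 : ℝ), ((φ (i, u)).2 : ℝ)) ∈ Ω := by
    intro i u
    have hwR : (v1 : ℝ) * wβ - m * wα = 1 := by exact_mod_cast hw
    have hvR : (v2 : ℝ) = ρ * v1 + N * m := by exact_mod_cast hv2
    simp only [hE, mem_ofPred_eq, hφ, hθ]
    refine iff_of_eq (congrArg (· ∈ Ω) ?_)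
    push_cast
    ext
    · field_simp; ring
    · simp only
      field_simp
      rw [hvR]
      linear_combination (-(N : ℝ) * i) * hwR
  have hinj : Function.Injective φ := by
    rintro ⟨i, u⟩ ⟨i', u'⟩ h
    simp only [hφ, Prod.mk.injEq] at h
    obtain ⟨h1, h2⟩ := h
    have h3 : u * m + i * wβ = u' * m + i' * wβ := by
      apply mul_left_cancel₀ hN.ne'
      rw [hv2] at h2
      linear_combination h2 - ρ * h1
    have e1 : i = i' := by linear_combination v1 * h3 - m * h1 - (i - i') * hw
    have e2 : u = u' := by linear_combination wβ * h1 - wα * h3 - (u - u') * hw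
    rw [e1, e2]
  have himg : {p : ℤ × ℤ | ((p.1 : ℝ), (p.2 : ℝ)) ∈ Ω ∧ N ∣ p.2 - ρ * p.1 - σ} = ↑(Z.image φ) := by
    ext ⟨c, d⟩
    simp only [mem_ofPred_eq, Finset.coe_image, mem_image, Finset.mem_coe]
    constructor
    · rintro ⟨hcd, β, hβ⟩
      have e : φ (v1 * β - m * c, wβ * c - wα * β) = (c, d) := by
        simp only [hφ]
        ext
        · simp only; linear_combination c * hw
        · simp only
          rw [hv2]
          linear_combination (ρ * c + N * β) * hw - hβ
      have hcd' := (hEiff (v1 * β - m * c) (wβ * c - wα * β)).2 (by rw [e]; exact hcd)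
      refine ⟨_, ?_, e⟩
      obtain ⟨-, -, q3, q4⟩ := hb _ _ hcd'
      have hiT : (v1 * β - m * c) ∈ T := by
        have e3 := Int.floor_mono q3
        have e4 := Int.floor_mono q4
        rw [Int.floor_intCast] at e3 e4
        exact Finset.mem_Icc.2 ⟨e3, e4⟩
      have huU := hUmem _ hiT _ hcd'
      rw [Int.floor_intCast] at huU
      exact Finset.mem_filter.2 ⟨Finset.mem_product.2 ⟨hiT, huU⟩, hcd'⟩
    · rintro ⟨⟨i, u⟩, hp, hφp⟩
      have h1 := (hEiff i u).1 (Finset.mem_filter.1 hp).2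
      rw [hφp] at h1
      refine ⟨h1, u * m + i * wβ, ?_⟩
      simp only [hφ, Prod.mk.injEq] at hφp
      rw [← hφp.1, ← hφp.2, hv2]; ring
  rw [himg]
  refine ⟨Finset.finite_toSet _, ?_⟩
  rw [ncard_coe_finset, Finset.card_image_of_injective _ hinj, ← hEvol]
  have hcard : (Z.card : ℝ) =
      ∑ i ∈ T, ((U.filter fun u : ℤ => ((u : ℝ) + θ i, (i : ℝ)) ∈ E).card : ℝ) := by
    rw [hZ, Finset.card_filter, Finset.sum_product]
    push_cast
    exact Finset.sum_congr rfl fun i _ => by rw [Finset.card_filter]; push_cast; rfl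
  rw [hcard]
  refine main.trans (le_of_eq ?_)
  ring

/-- Short primitive vectors in the lattice `N ∣ d - ρ c`. -/
theorem exists_short_vector {N : ℤ} (hN : 0 < N) (ρ : ℤ) {M : ℕ} (hM : 0 < M) :
    ∃ v1 m : ℤ, 0 < v1 ∧ v1 ≤ M ∧ IsCoprime v1 m ∧ |((ρ * v1 + N * m : ℤ) : ℝ)| ≤ N / (M + 1) := by
  obtain ⟨q, h1, h2⟩ := Real.exists_rat_abs_sub_le_and_den_le ((ρ : ℝ) / N) hM
  have hNR : (0 : ℝ) < N := by exact_mod_cast hN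
  have hdR : (0 : ℝ) < q.den := by exact_mod_cast q.den_pos
  refine ⟨q.den, -q.num, by exact_mod_cast q.den_pos, by exact_mod_cast h2, ?_, ?_⟩
  · have := q.isCoprime_num_den
    exact this.symm.neg_right
  · have e : ((ρ * q.den + N * -q.num : ℤ) : ℝ) = (N * q.den) * ((ρ : ℝ) / N - q) := by
      have : (q : ℝ) = q.num / q.den := by exact_mod_cast (Rat.num_div_den q).symm
      rw [this]; push_cast; field_simp; ring
    rw [e, abs_mul, abs_of_pos (by positivity)]
    calc (N * q.den : ℝ) * |(ρ : ℝ) / N - q| ≤ (N * q.den) * (1 / ((M + 1) * q.den)) :=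
          mul_le_mul_of_nonneg_left h1 (by positivity)
      _ = N / (M + 1) := by field_simp

end

section
open MeasureTheory Set
open Polynomial

/-- The last two coefficients of the reduced forms with leading coefficients `a`, `b` and
discriminant less than `Y`. -/
def Om (st : Bool) (a b Y : ℝ) : Set (ℝ × ℝ) :=
  {p | RedCond st a b p.1 p.2 ∧ 0 < tdisc a b p.1 p.2 ∧ tdisc a b p.1 p.2 < Y}

theorem FewFrontier.flagLE_polynomial {m : ℕ} (st : Bool) {p : Polynomial ℝ} (hp : p.natDegree ≤ m) :
    FewFrontier m {t | flagLE st 0 (p.eval t)} := by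
  cases st
  · have : {t | flagLE false 0 (p.eval t)} = {t | 0 < (-p).eval t}ᶜ := by
      ext t; simp [flagLE]
    rw [this]
    exact (FewFrontier.of_polynomial (by rwa [natDegree_neg])).compl
  · exact FewFrontier.of_polynomial hp

theorem flagLE_zero_neg {st : Bool} {x : ℝ} : flagLE st x 0 ↔ flagLE st 0 (-x) := by
  cases st <;> simp [flagLE]

theorem measurableSet_flagLE (st : Bool) {α : Type*} [MeasurableSpace α] {f g : α → ℝ}
    (hf : Measurable f) (hg : Measurable g) : MeasurableSet {x | flagLE st (f x) (g x)} := by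
  cases st
  · simpa [flagLE] using measurableSet_le hf hg
  · simpa [flagLE] using measurableSet_lt hf hg

theorem measurableSet_om (st : Bool) (a b Y : ℝ) : MeasurableSet (Om st a b Y) := by
  have e1 : Measurable fun p : ℝ × ℝ => tdisc a b p.1 p.2 := by unfold tdisc; fun_prop
  unfold Om RedCond
  refine ((measurableSet_flagLE st (by fun_prop) (by fun_prop)).inter
    ((measurableSet_flagLE st (by fun_prop) (by fun_prop)).inter
    (measurableSet_flagLE st (by fun_prop) (by fun_prop)))).inter
    ((measurableSet_lt measurable_const e1).inter (measurableSet_lt e1 measurable_const))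

theorem lineNice_om (st : Bool) (a b Y : ℝ) : LineNice 10 (Om st a b Y) := by
  intro x y α β
  obtain ⟨u, hu⟩ : ∃ u : Polynomial ℝ, u = C x + X * C α := ⟨_, rfl⟩
  obtain ⟨v, hv⟩ : ∃ v : Polynomial ℝ, v = C y + X * C β := ⟨_, rfl⟩
  have hu1 : u.natDegree ≤ 1 := by rw [hu]; compute_degree
  have hv1 : v.natDegree ≤ 1 := by rw [hv]; compute_degree
  have huv : ∀ t, u.eval t = x + t * α ∧ v.eval t = y + t * β := fun t => by
    simp [hu, hv, mul_comm t]
  let A := C a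
  let B := C b
  have h1 := FewFrontier.flagLE_polynomial (m := 1) st (p := C ((a - 3 * b) ^ 3 + 3 * b * (a - 3 * b) ^ 2) +
    C (3 * a * (a - 3 * b)) * u + C (a ^ 2) * v) (by compute_degree; simp [hu1, hv1])
  have h2 := FewFrontier.flagLE_polynomial (m := 1) st (p := - (C ((-a - 3 * b) ^ 3 + 3 * b * (-a - 3 * b) ^ 2) +
    C (3 * a * (-a - 3 * b)) * u + C (a ^ 2) * v)) (by compute_degree; simp [hu1, hv1])
  have h3 := FewFrontier.flagLE_polynomial (m := 2) st (p := v ^ 2 - C (a ^ 2) +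
    C (3 * a) * u - C (3 * b) * v) (by compute_degree; omega)
  have h4 := FewFrontier.of_polynomial (m := 3) (p := tdisc A B u v) (by
    simp only [tdisc, A, B]; compute_degree; omega)
  have h5 := FewFrontier.of_polynomial (m := 3) (p := C Y - tdisc A B u v) (by
    simp only [tdisc, A, B]; compute_degree; omega)
  have h := (h1.inter (h2.inter h3)).inter (h4.inter h5)
  convert h using 1
  ext t
  have e1 := (huv t).1
  have e2 := (huv t).2
  simp only [Om, RedCond, mem_ofPred_eq, mem_inter_iff, eval_add, eval_sub, eval_neg,
    eval_mul, eval_pow, eval_C, tdisc, e1, e2, A, B, eval_ofNat, sub_pos]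
  rw [flagLE_zero_neg]
  refine and_congr (and_congr ?_ (and_congr ?_ ?_)) Iff.rfl <;> ring_nf

/-- Parametrization of `Om` by the complex root. -/
theorem mem_om_iff {st : Bool} {a b S : ℝ} (ha : 0 < a) (hS : 0 < S) {c d : ℝ} :
    (c, d) ∈ Om st a b (4 / 27 * S ^ 2) ↔ ∃ x y : ℝ, 0 < y ∧ FDom st x y ∧
      y * (9 * (b + a * x) ^ 2 + a ^ 2 * y ^ 2) < S ∧ c = cOf a b x (y ^ 2) ∧ d = dOf a b x (y ^ 2) := by
  have key : ∀ x y : ℝ, 0 < y → (tdisc a b (cOf a b x (y ^ 2)) (dOf a b x (y ^ 2)) < 4 / 27 * S ^ 2 ↔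
      y * (9 * (b + a * x) ^ 2 + a ^ 2 * y ^ 2) < S) := fun x y hy => by
    rw [tdisc_of, show 4 * y ^ 2 / 27 * (9 * (b + a * x) ^ 2 + a ^ 2 * y ^ 2) ^ 2 =
      4 / 27 * (y * (9 * (b + a * x) ^ 2 + a ^ 2 * y ^ 2)) ^ 2 by ring,
      mul_lt_mul_iff_right₀ (by norm_num), sq_lt_sq₀ (by positivity) hS.le]
  constructor
  · rintro ⟨h1, h2, h3⟩
    obtain ⟨x, y, hy, hc, hd⟩ := exists_of ha h2
    simp only at h1 h3 hc hd
    rw [hc, hd] at h1 h3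
    exact ⟨x, y, hy, (redCond_of ha (by positivity)).1 h1, (key x y hy).1 h3, hc, hd⟩
  · rintro ⟨x, y, hy, hF, hs, rfl, rfl⟩
    refine ⟨(redCond_of ha (by positivity)).2 hF, ?_, (key x y hy).2 hs⟩
    simp only [tdisc_of]
    positivity

theorem FDom.bounds {st : Bool} {x y : ℝ} (h : FDom st x y) (hy : 0 < y) :
    |x| ≤ 1 / 2 ∧ 1 ≤ x ^ 2 + y ^ 2 ∧ 3 / 4 ≤ y ^ 2 ∧ 4 / 5 ≤ y := by
  have h1 := h.1.le
  have h2 := h.2.1.le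
  have h3 := h.2.2.le
  have h4 : 3 / 4 ≤ y ^ 2 := by nlinarith
  exact ⟨abs_le.2 ⟨by linarith, h2⟩, h3, h4, by nlinarith⟩

set_option maxHeartbeats 2000000 in
/-- Size of the elements of `Om`. -/
theorem om_bounds {st : Bool} {a b B : ℝ} (ha : 0 < a) (hB : 0 < B) {c d : ℝ}
    (h : (c, d) ∈ Om st a b (4 / 27 * (a ^ 2 * B ^ 3) ^ 2)) :
    4 / 5 ≤ B ∧ b ^ 2 ≤ 2 * a ^ 2 * B ^ 3 ∧
      |c| ≤ 100 * (a ^ 3 * B ^ 5 / (a ^ 2 * B ^ 2 + b ^ 2)) ∧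
      |d| ≤ 100 * (a ^ 3 * B ^ 5 / (a ^ 2 * B ^ 2 + b ^ 2)) ∧ |c| ≤ 5 * a * B ^ 2 := by
  obtain ⟨x, y, hy, hF, hs, rfl, rfl⟩ := (mem_om_iff ha (by positivity)).1 h
  obtain ⟨hx, hxy, hy2, hy1⟩ := hF.bounds hy
  obtain ⟨u, hu⟩ : ∃ u, u = b + a * x := ⟨_, rfl⟩
  rw [← hu] at hs
  obtain ⟨z, hz, hz0⟩ : ∃ z, z ^ 2 = y ∧ 0 < z := ⟨√y, Real.sq_sqrt hy.le, Real.sqrt_pos.2 hy⟩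
  obtain ⟨w, hw, hw0⟩ : ∃ w, w ^ 2 = B ∧ 0 < w := ⟨√B, Real.sq_sqrt hB.le, Real.sqrt_pos.2 hB⟩
  have hyB : y < B := by
    have : a ^ 2 * y ^ 3 < a ^ 2 * B ^ 3 := by nlinarith [mul_nonneg hy.le (sq_nonneg u)]
    exact lt_of_pow_lt_pow_left₀ 3 hB.le (lt_of_mul_lt_mul_left this (by positivity))
  have hzw : z < w := lt_of_pow_lt_pow_left₀ 2 hw0.le (by rw [hz, hw]; exact hyB)
  have hz1 : 4 / 5 ≤ z := by nlinarith
  have hw1 : 4 / 5 ≤ w := hz1.trans hzw.le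
  have hzu : z * |u| ≤ a * w ^ 3 / 3 := by
    refine (pow_le_pow_iff_left₀ (by positivity) (by positivity) two_ne_zero).1 ?_
    have : (z * |u|) ^ 2 = y * u ^ 2 := by rw [mul_pow, sq_abs, hz]
    rw [this]
    have : (a * w ^ 3 / 3) ^ 2 = a ^ 2 * B ^ 3 / 9 := by rw [← hw]; ring
    rw [this]
    have : 0 ≤ y * (a ^ 2 * y ^ 2) := by positivity
    nlinarith
  obtain ⟨U, hU⟩ : ∃ U, U = |u| := ⟨_, rfl⟩
  rw [← hU] at hzu
  have hU0 : 0 ≤ U := hU ▸ abs_nonneg u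
  have hUu : U ^ 2 = u ^ 2 := by rw [hU, sq_abs]
  have hU1 : U ≤ 5 / 12 * (a * w ^ 3) := by nlinarith
  have hw3 : (64 / 125 : ℝ) ≤ w ^ 3 := by
    have := pow_le_pow_left₀ (by norm_num) hw1 3
    norm_num at this ⊢; linarith
  have haw : a ≤ 125 / 64 * (a * w ^ 3) := by nlinarith
  have hax : |a * x| ≤ a / 2 := by
    rw [abs_mul, abs_of_pos ha]; nlinarith
  have hb1 : |b| ≤ U + a / 2 := by
    rw [hU, show b = u - a * x by rw [hu]; ring]
    exact (abs_sub _ _).trans (by linarith)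
  have hb2 : |b| ≤ 7 / 5 * (a * w ^ 3) := by
    have : 0 ≤ a * w ^ 3 := by positivity
    linarith
  have hbsq : b ^ 2 ≤ 2 * a ^ 2 * B ^ 3 := by
    rw [← sq_abs, ← hw]
    have := pow_le_pow_left₀ (abs_nonneg b) hb2 2
    have h0 : 0 ≤ (a * w ^ 3) ^ 2 := by positivity
    linarith
  have hc1 : |cOf a b x (y ^ 2)| ≤ 5 * a * B ^ 2 := by
    have e : cOf a b x (y ^ 2) = a * y ^ 2 / 3 + (-(2 * b * x) - a * x ^ 2) := by
      unfold cOf; ring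
    have e1 : |2 * b * x| ≤ |b| := by
      rw [abs_mul, abs_mul, abs_two]
      linarith [mul_le_mul_of_nonneg_left hx (abs_nonneg b)]
    have e2 : |a * x ^ 2| ≤ a / 4 := by
      rw [abs_mul, abs_of_pos ha, abs_pow]
      have := pow_le_pow_left₀ (abs_nonneg x) hx 2
      linarith [mul_le_mul_of_nonneg_left this ha.le]
    have e3 : |a * y ^ 2 / 3| ≤ a * B ^ 2 / 3 := by
      rw [abs_of_pos (by positivity)]
      have := pow_le_pow_left₀ hy.le hyB.le 2
      linarith [mul_le_mul_of_nonneg_left this ha.le]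
    have e4 : a * w ^ 3 ≤ 5 / 4 * (a * B ^ 2) := by
      rw [← hw]
      have : 0 < a * w ^ 3 := by positivity
      linarith [mul_le_mul_of_nonneg_left hw1 this.le]
    rw [e]
    refine (abs_add_le _ _).trans ?_
    have := abs_sub (-(2 * b * x)) (a * x ^ 2)
    rw [abs_neg] at this
    have e5 : 0 ≤ a * B ^ 2 := by positivity
    linarith
  have hden : 0 < a ^ 2 * B ^ 2 + b ^ 2 := by positivity
  have hyB' : 4 / 5 ≤ B := by linarith
  refine ⟨hyB', hbsq, ?_, ?_, hc1⟩
  · rw [mul_div_assoc', le_div_iff₀ hden]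
    have : |cOf a b x (y ^ 2)| * (a ^ 2 * B ^ 2 + b ^ 2) ≤
        5 * a * B ^ 2 * (a ^ 2 * B ^ 2 + 2 * a ^ 2 * B ^ 3) :=
      mul_le_mul hc1 (by linarith) hden.le (by positivity)
    have h0 : 0 < a ^ 3 * B ^ 4 := by positivity
    linarith [mul_le_mul_of_nonneg_left hyB' h0.le, (by positivity : 0 < a ^ 3 * B ^ 5)]
  · rw [mul_div_assoc', le_div_iff₀ hden]
    have hd1 : |dOf a b x (y ^ 2)| ≤ 4 / 3 * y ^ 2 * (3 * U + a / 2) := by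
      have e : dOf a b x (y ^ 2) = (x ^ 2 + y ^ 2) * (3 * u - a * x) := by unfold dOf; rw [hu]; ring
      rw [e, abs_mul, abs_of_pos (by positivity)]
      refine mul_le_mul ?_ ?_ (abs_nonneg _) (by positivity)
      · have : x ^ 2 ≤ 1 / 4 := by
          rw [← sq_abs]; linarith [pow_le_pow_left₀ (abs_nonneg x) hx 2]
        linarith
      · refine (abs_sub _ _).trans ?_
        rw [abs_mul, abs_of_pos (by norm_num : (0 : ℝ) < 3), ← hU]
        linarith
    have hb3 : b ^ 2 ≤ 2 * U ^ 2 + a ^ 2 / 2 := by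
      rw [← sq_abs]
      have := pow_le_pow_left₀ (abs_nonneg b) hb1 2
      linarith [sq_nonneg (U - a / 2)]
    have hden2 : a ^ 2 * B ^ 2 + b ^ 2 ≤ 2 * U ^ 2 + 2 * (a ^ 2 * B ^ 2) := by
      have : a ^ 2 * (16 / 25) ≤ a ^ 2 * B ^ 2 := by
        refine mul_le_mul_of_nonneg_left ?_ (by positivity)
        linarith [pow_le_pow_left₀ (by norm_num) hyB' 2]
      linarith [sq_nonneg a]
    refine (mul_le_mul hd1 hden2 hden.le (by positivity)).trans ?_
    have hz2 : z ^ 2 = y := hz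
    have f1 : y ^ 2 * U ≤ a * B ^ 3 / 3 := by
      have : z ^ 3 * (z * U) ≤ w ^ 3 * (a * w ^ 3 / 3) :=
        mul_le_mul (pow_le_pow_left₀ hz0.le hzw.le 3) hzu (by positivity) (by positivity)
      rw [← hz, ← hw]; linarith
    have f2 : y ^ 2 * U ^ 3 ≤ a ^ 3 * B ^ 5 / 27 := by
      have : z * (z * U) ^ 3 ≤ w * (a * w ^ 3 / 3) ^ 3 :=
        mul_le_mul hzw.le (pow_le_pow_left₀ (by positivity) hzu 3) (by positivity) (by positivity)
      rw [← hz, ← hw]; linarith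
    have f3 : y ^ 2 * U ^ 2 ≤ a ^ 2 * B ^ 4 / 9 := by
      have : z ^ 2 * (z * U) ^ 2 ≤ w ^ 2 * (a * w ^ 3 / 3) ^ 2 :=
        mul_le_mul (pow_le_pow_left₀ hz0.le hzw.le 2) (pow_le_pow_left₀ (by positivity) hzu 2)
          (by positivity) (by positivity)
      rw [← hz, ← hw]; linarith
    have f4 : y ^ 2 ≤ B ^ 2 := pow_le_pow_left₀ hy.le hyB.le 2
    have g1 := mul_le_mul_of_nonneg_right f1 (by positivity : 0 ≤ a ^ 2 * B ^ 2)
    have g3 := mul_le_mul_of_nonneg_right f3 ha.le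
    have g4 := mul_le_mul_of_nonneg_right f4 (by positivity : 0 ≤ a ^ 3 * B ^ 2)
    have g5 : a ^ 3 * B ^ 4 * (4 / 5) ≤ a ^ 3 * B ^ 4 * B :=
      mul_le_mul_of_nonneg_left hyB' (by positivity)
    have g6 : 0 < a ^ 3 * B ^ 5 := by positivity
    linarith

end

section
open MeasureTheory Set
open Real ENNReal

/-- The region under the graph of the Jacobian of the parametrization of `Om` by complex roots. -/
def Cap (st : Bool) (a b S : ℝ) : Set ((ℝ × ℝ) × ℝ) :=
  {p | (0 < p.1.2 ∧ FDom st p.1.1 p.1.2) ∧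
    p.1.2 * (9 * (b + a * p.1.1) ^ 2 + a ^ 2 * p.1.2 ^ 2) < S ∧ 0 < p.2 ∧
    p.2 < 4 / 3 * (p.1.2 * (9 * (b + a * p.1.1) ^ 2 + a ^ 2 * p.1.2 ^ 2))}

theorem measurableSet_fDom (st : Bool) : MeasurableSet {p : ℝ × ℝ | 0 < p.2 ∧ FDom st p.1 p.2} := by
  have h1 : MeasurableSet {p : ℝ × ℝ | 0 < p.2} := measurableSet_lt (by fun_prop) (by fun_prop)
  have h2 : MeasurableSet {p : ℝ × ℝ | flagLE st (-1 / 2) p.1} :=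
    measurableSet_flagLE st (by fun_prop) (by fun_prop)
  have h3 : MeasurableSet {p : ℝ × ℝ | flagLE st p.1 (1 / 2)} :=
    measurableSet_flagLE st (by fun_prop) (by fun_prop)
  have h4 : MeasurableSet {p : ℝ × ℝ | flagLE st 1 (p.1 ^ 2 + p.2 ^ 2)} :=
    measurableSet_flagLE st (by fun_prop) (by fun_prop)
  exact h1.inter (h2.inter (h3.inter h4))

theorem volume_om {st : Bool} {a b S : ℝ} (ha : 0 < a) (hS : 0 < S) :
    volume (Om st a b (4 / 27 * S ^ 2)) = volume (Cap st a b S) := by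
  set G : Set (ℝ × ℝ) := {p | 0 < p.2 ∧ FDom st p.1 p.2} ∩
    {p | p.2 * (9 * (b + a * p.1) ^ 2 + a ^ 2 * p.2 ^ 2) < S} with hG
  have hGm : MeasurableSet G := (measurableSet_fDom st).inter
    (measurableSet_lt (by fun_prop) (by fun_prop))
  set φ : ℝ × ℝ → ℝ × ℝ := fun p => (cOf a b p.1 (p.2 ^ 2), dOf a b p.1 (p.2 ^ 2)) with hφ
  have himg : φ '' G = Om st a b (4 / 27 * S ^ 2) := by
    ext ⟨c, d⟩
    rw [mem_om_iff ha hS]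
    constructor
    · rintro ⟨⟨x, y⟩, ⟨⟨h1, h2⟩, h3⟩, h4⟩
      obtain ⟨h5, h6⟩ := Prod.mk.inj h4
      exact ⟨x, y, h1, h2, h3, h5.symm, h6.symm⟩
    · rintro ⟨x, y, h1, h2, h3, rfl, rfl⟩
      exact ⟨(x, y), ⟨⟨h1, h2⟩, h3⟩, rfl⟩
  have hinj : InjOn φ G := by
    rintro ⟨x, y⟩ ⟨⟨hy, -⟩, -⟩ ⟨x', y'⟩ ⟨⟨hy', -⟩, -⟩ h
    obtain ⟨h5, h6⟩ := Prod.mk.inj h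
    obtain ⟨h1, h2⟩ := of_inj ha.ne' hy hy' h5 h6
    exact Prod.ext h1 h2
  set M : ℝ × ℝ → ℝ × ℝ →L[ℝ] ℝ × ℝ := fun p =>
    LinearMap.toContinuousLinearMap (Matrix.toLin (Module.Basis.finTwoProd ℝ) (Module.Basis.finTwoProd ℝ)
      !![-2 * b - 2 * a * p.1, 2 * a * p.2 / 3;
        2 * p.1 * (3 * b + 2 * a * p.1) + 2 * a * (p.1 ^ 2 + p.2 ^ 2),
        2 * p.2 * (3 * b + 2 * a * p.1)]) with hM
  have hder : ∀ p ∈ G, HasFDerivWithinAt φ (M p) G p := by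
    intro p _
    refine HasFDerivAt.hasFDerivWithinAt ?_
    rw [hM]
    simp only [Matrix.toLin_finTwoProd_toContinuousLinearMap]
    have e1 : HasFDerivAt (fun p : ℝ × ℝ => p.1) (ContinuousLinearMap.fst ℝ ℝ ℝ) p := hasFDerivAt_fst
    have e2 : HasFDerivAt (fun p : ℝ × ℝ => p.2) (ContinuousLinearMap.snd ℝ ℝ ℝ) p := hasFDerivAt_snd
    refine HasFDerivAt.prodMk ?_ ?_
    · have := ((((e2.pow 2).const_mul a).mul_const (3⁻¹ : ℝ)).sub (e1.const_mul (2 * b))).sub ((e1.pow 2).const_mul a)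
      refine this.congr_fderiv ?_
      ext <;> simp <;> ring
    · have := ((e1.pow 2).add (e2.pow 2)).mul ((e1.const_mul (2 * a)).const_add (3 * b))
      refine this.congr_fderiv ?_
      ext <;> simp <;> ring
  have hdet : ∀ p ∈ G, |(M p).det| = 4 / 3 * (p.2 * (9 * (b + a * p.1) ^ 2 + a ^ 2 * p.2 ^ 2)) := by
    rintro p ⟨⟨hp, -⟩, -⟩
    have : (M p).det = - (4 / 3 * (p.2 * (9 * (b + a * p.1) ^ 2 + a ^ 2 * p.2 ^ 2))) := by
      rw [hM]
      simp only [ContinuousLinearMap.det, LinearMap.coe_toContinuousLinearMap, LinearMap.det_toLin,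
        Matrix.det_fin_two_of]
      ring
    rw [this, abs_neg, abs_of_nonneg (by positivity)]
  rw [← himg, ← lintegral_abs_det_fderiv_eq_addHaar_image volume hGm hder hinj]
  have h1 := volume_regionBetween_eq_lintegral (μ := (volume : Measure (ℝ × ℝ))) (s := G) (f := fun _ => 0)
    (g := fun p => 4 / 3 * (p.2 * (9 * (b + a * p.1) ^ 2 + a ^ 2 * p.2 ^ 2)))
    (by fun_prop) (by fun_prop) hGm
  have h2 : regionBetween (fun _ => 0)
    (fun p : ℝ × ℝ => 4 / 3 * (p.2 * (9 * (b + a * p.1) ^ 2 + a ^ 2 * p.2 ^ 2))) G = Cap st a b S := by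
    ext p
    simp only [regionBetween, mem_ofPred_eq, hG, mem_inter_iff, Cap, mem_Ioo]
    tauto
  rw [← h2]
  refine Eq.trans ?_ h1.symm
  refine setLIntegral_congr_fun hGm fun p hp => ?_
  simp only [hdet p hp, Pi.sub_apply, sub_zero]

/-- The area of a section of the region in `(b, s)`-space, suitably normalized. -/
noncomputable def eta (w : ℝ) : ℝ :=
  volume.real {q : ℝ × ℝ | 0 < q.1 ∧ q.1 < q.2 ^ 2 + w ^ 2 ∧ q.2 ^ 2 + w ^ 2 < 1}

/-- The normalized volume of the set of reduced forms of fixed leading coefficient. -/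
noncomputable def Phi (st : Bool) (lam : ℝ) : ℝ :=
  ∫ p in {p : ℝ × ℝ | 0 < p.2 ∧ FDom st p.1 p.2}, eta (lam * (p.2 * √p.2)) / √p.2

theorem section_cap (a : ℝ) {S l : ℝ} (hS : 0 < S) (hl : 0 < l) (x : ℝ) {y : ℝ} (hy : 0 < y) :
    volume.real {q : ℝ × ℝ | y * (9 * (l * q.2 + a * x) ^ 2 + a ^ 2 * y ^ 2) < S ∧ 0 < q.1 ∧
      q.1 < 4 / 3 * (y * (9 * (l * q.2 + a * x) ^ 2 + a ^ 2 * y ^ 2))} =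
    4 / 9 * (S * √S) / l * (eta (a / √S * (y * √y)) / √y) := by
  obtain ⟨z, hz, hz0⟩ : ∃ z, z ^ 2 = y ∧ 0 < z := ⟨√y, sq_sqrt hy.le, sqrt_pos.2 hy⟩
  obtain ⟨w, hw, hw0⟩ : ∃ w, w ^ 2 = S ∧ 0 < w := ⟨√S, sq_sqrt hS.le, sqrt_pos.2 hS⟩
  have hsy : √y = z := by rw [← hz, sqrt_sq hz0.le]
  have hsS : √S = w := by rw [← hw, sqrt_sq hw0.le]
  rw [hsy, hsS]
  have key := volume_real_preimage_affine {q : ℝ × ℝ | 0 < q.1 ∧ q.1 < q.2 ^ 2 + (a / w * (y * z)) ^ 2 ∧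
    q.2 ^ 2 + (a / w * (y * z)) ^ 2 < 1} 0 (3 * z / w * (a * x)) (p := 3 / (4 * w ^ 2)) (q := 0) (r := 0)
    (s := 3 * z / w * l) (by simp only [mul_zero, sub_zero]; positivity)
  unfold eta
  have e : {q : ℝ × ℝ | y * (9 * (l * q.2 + a * x) ^ 2 + a ^ 2 * y ^ 2) < S ∧ 0 < q.1 ∧
      q.1 < 4 / 3 * (y * (9 * (l * q.2 + a * x) ^ 2 + a ^ 2 * y ^ 2))} =
    {q : ℝ × ℝ | (0 + (3 / (4 * w ^ 2) * q.1 + 0 * q.2), 3 * z / w * (a * x) + (0 * q.1 + 3 * z / w * l * q.2)) ∈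
    {q : ℝ × ℝ | 0 < q.1 ∧ q.1 < q.2 ^ 2 + (a / w * (y * z)) ^ 2 ∧ q.2 ^ 2 + (a / w * (y * z)) ^ 2 < 1}} := by
    ext ⟨s, t⟩
    simp only [mem_ofPred_eq]
    have h1 : (3 * z / w * (a * x) + (0 * s + 3 * z / w * l * t)) ^ 2 + (a / w * (y * z)) ^ 2 =
      (y * (9 * (l * t + a * x) ^ 2 + a ^ 2 * y ^ 2)) / S := by
      rw [← hz, ← hw]; field_simp; ring
    rw [h1, hw, div_lt_one hS, lt_div_iff₀ hS]
    have h2 : (0 + (3 / (4 * S) * s + 0 * t)) = 3 / (4 * S) * s := by ring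
    rw [h2, mul_pos_iff_of_pos_left (by positivity)]
    have h3 : 3 / (4 * S) * s * S = 3 / 4 * s := by field_simp
    rw [h3]
    constructor
    · rintro ⟨h4, h5, h6⟩; exact ⟨h5, by linarith, h4⟩
    · rintro ⟨h4, h5, h6⟩; exact ⟨h6, h4, by linarith⟩
  rw [e, key, mul_zero, sub_zero, abs_of_pos (by positivity), ← hw]
  field_simp
  ring

theorem measureReal_prod_eq {P Q : Type*} [MeasurableSpace P] [MeasurableSpace Q] {μ : Measure P}
    {ν : Measure Q} [SFinite μ] [SFinite ν] {E : Set (P × Q)} (hE : MeasurableSet E)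
    (hfin : (μ.prod ν) E ≠ ⊤) : (μ.prod ν).real E = ∫ p, ν.real (Prod.mk p ⁻¹' E) ∂μ := by
  simp_rw [measureReal_def]
  rw [integral_toReal (measurable_measure_prodMk_left hE).aemeasurable
    (Measure.ae_measure_lt_top hE hfin), Measure.prod_apply hE]

theorem cap_bounds {st : Bool} {a b B : ℝ} (ha : 0 < a) (hB : 0 < B) {p : (ℝ × ℝ) × ℝ}
    (h : p ∈ Cap st a b (a ^ 2 * B ^ 3)) :
    (p.1.1 ∈ Icc (-1 / 2 : ℝ) (1 / 2) ∧ p.1.2 ∈ Icc 0 B) ∧ p.2 ∈ Icc 0 (4 / 3 * (a ^ 2 * B ^ 3)) ∧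
      b ^ 2 ≤ 2 * a ^ 2 * B ^ 3 := by
  obtain ⟨⟨h1, h2⟩, h3, h4, h5⟩ := h
  have hyB : p.1.2 < B := by
    have : a ^ 2 * p.1.2 ^ 3 < a ^ 2 * B ^ 3 := by
      nlinarith [mul_nonneg h1.le (sq_nonneg (b + a * p.1.1))]
    exact lt_of_pow_lt_pow_left₀ 3 hB.le (lt_of_mul_lt_mul_left this (by positivity))
  refine ⟨⟨⟨h2.1.le, h2.2.1.le⟩, h1.le, hyB.le⟩, ⟨h4.le, by linarith⟩, ?_⟩
  exact (om_bounds (st := st) ha hB ((mem_om_iff ha (by positivity)).2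
    ⟨p.1.1, p.1.2, h1, h2, h3, rfl, rfl⟩)).2.1

/-- The sum over the second coefficient of the areas of the sets `Om`. -/
theorem sum_volume_om (st : Bool) {a B l : ℝ} (ha : 0 < a) (hB : 0 < B) (hl : 0 < l) {T : Finset ℤ}
    (hT : ∀ t : ℝ, (l * t) ^ 2 ≤ 2 * a ^ 2 * B ^ 3 → ⌊t⌋ ∈ T) :
    |∑ z ∈ T, volume.real (Om st a (l * z) (4 / 27 * (a ^ 2 * B ^ 3) ^ 2)) -
      4 / 9 * (a ^ 2 * B ^ 3 * √(a ^ 2 * B ^ 3)) / l * Phi st (a / √(a ^ 2 * B ^ 3))| ≤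
      6 * (a ^ 2 * B ^ 3 * B) := by
  set S := a ^ 2 * B ^ 3 with hS
  have hS0 : 0 < S := by positivity
  set E : Set (((ℝ × ℝ) × ℝ) × ℝ) := {p | p.1 ∈ Cap st a (l * p.2) S} with hE
  have hEm : MeasurableSet E := by
    have h1 : MeasurableSet {p : ((ℝ × ℝ) × ℝ) × ℝ | 0 < p.1.1.2 ∧ FDom st p.1.1.1 p.1.1.2} :=
      (measurable_fst.fst : Measurable fun p : ((ℝ × ℝ) × ℝ) × ℝ => p.1.1) (measurableSet_fDom st)
    have h2 : MeasurableSet {p : ((ℝ × ℝ) × ℝ) × ℝ |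
      p.1.1.2 * (9 * (l * p.2 + a * p.1.1.1) ^ 2 + a ^ 2 * p.1.1.2 ^ 2) < S} :=
      measurableSet_lt (by fun_prop) (by fun_prop)
    have h3 : MeasurableSet {p : ((ℝ × ℝ) × ℝ) × ℝ | 0 < p.1.2} :=
      measurableSet_lt (by fun_prop) (by fun_prop)
    have h4 : MeasurableSet {p : ((ℝ × ℝ) × ℝ) × ℝ |
      p.1.2 < 4 / 3 * (p.1.1.2 * (9 * (l * p.2 + a * p.1.1.1) ^ 2 + a ^ 2 * p.1.1.2 ^ 2))} :=
      measurableSet_lt (by fun_prop) (by fun_prop)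
    exact h1.inter (h2.inter (h3.inter h4))
  set P0 : Set ((ℝ × ℝ) × ℝ) := (Icc (-1 / 2 : ℝ) (1 / 2) ×ˢ Icc 0 B) ×ˢ Icc 0 (4 / 3 * S) with hP0
  have hP0m : MeasurableSet P0 := (measurableSet_Icc.prod measurableSet_Icc).prod measurableSet_Icc
  have hvP0 : volume P0 = ENNReal.ofReal (4 / 3 * S * B) := by
    rw [hP0, Measure.volume_eq_prod, Measure.prod_prod, Measure.volume_eq_prod, Measure.prod_prod,
      volume_Icc, volume_Icc, volume_Icc, ← ofReal_mul (by norm_num),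
      ← ofReal_mul (by norm_num; exact hB.le)]
    congr 1; ring
  have hbd : ∀ p t, (p, t) ∈ E → p ∈ P0 ∧ ⌊t⌋ ∈ T := by
    intro p t h
    obtain ⟨h1, h2, h3⟩ := cap_bounds ha hB h
    exact ⟨⟨h1, h2⟩, hT t h3⟩
  have hfew : ∀ p, FewFrontier 4 {t | (p, t) ∈ E} := by
    rintro ⟨⟨x, y⟩, s⟩
    by_cases h : (0 < y ∧ FDom st x y) ∧ 0 < s
    · have q1 := FewFrontier.of_polynomial (m := 2) (p := Polynomial.C S - Polynomial.C y * (9 * (Polynomial.C l * Polynomial.X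
        + Polynomial.C (a * x)) ^ 2 + Polynomial.C (a ^ 2 * y ^ 2))) (by compute_degree)
      have q2 := FewFrontier.of_polynomial (m := 2) (p := Polynomial.C (4 / 3) * (Polynomial.C y * (9 * (Polynomial.C l * Polynomial.X
        + Polynomial.C (a * x)) ^ 2 + Polynomial.C (a ^ 2 * y ^ 2))) - Polynomial.C s) (by compute_degree)
      convert q1.inter q2 using 1
      ext t
      simp only [hE, Cap, mem_ofPred_eq, mem_inter_iff, h, true_and, Polynomial.eval_sub, Polynomial.eval_mul,
        Polynomial.eval_add, Polynomial.eval_pow, Polynomial.eval_C, Polynomial.eval_X, Polynomial.eval_ofNat, sub_pos, and_self]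
    · have : {t | (((x, y), s), t) ∈ E} = ∅ := by
        ext t
        simp only [hE, Cap, mem_ofPred_eq, mem_empty_iff_false, iff_false]
        tauto
      rw [this]
      exact ⟨∅, by simp, by simp⟩
  have main := FewFrontier.sum_measure_sub (μ := (volume : Measure ((ℝ × ℝ) × ℝ))) hEm (P0 := P0) (T := T) hP0m
    (by rw [hvP0]; exact ofReal_ne_top) hfew hbd
  have hsec : ∀ z : ℤ, volume.real {p : (ℝ × ℝ) × ℝ | (p, (z : ℝ)) ∈ E} =
      volume.real (Om st a (l * z) (4 / 27 * S ^ 2)) := fun z => by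
    rw [measureReal_def, measureReal_def, volume_om ha hS0]; rfl
  simp_rw [hsec] at main
  have hEfin : (volume : Measure (((ℝ × ℝ) × ℝ) × ℝ)) E ≠ ⊤ := by
    have : E ⊆ P0 ×ˢ (⋃ z ∈ T, Ico (z : ℝ) (z + 1)) := fun x hx => by
      refine ⟨(hbd x.1 x.2 hx).1, ?_⟩
      simp only [mem_iUnion, exists_prop]
      exact ⟨_, (hbd x.1 x.2 hx).2, Int.floor_le _, Int.lt_floor_add_one _⟩
    refine ((measure_mono this).trans_lt ?_).ne
    rw [Measure.volume_eq_prod, Measure.prod_prod, hvP0]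
    refine mul_lt_top ofReal_lt_top ?_
    refine (measure_biUnion_finset_le _ _).trans_lt ?_
    simp
  have hEv : (volume : Measure (((ℝ × ℝ) × ℝ) × ℝ)).real E =
      4 / 9 * (S * √S) / l * Phi st (a / √S) := by
    set E' : Set ((ℝ × ℝ) × (ℝ × ℝ)) := MeasurableEquiv.prodAssoc.symm ⁻¹' E with hE'
    have hE'm : MeasurableSet E' := MeasurableEquiv.prodAssoc.symm.measurable hEm
    have e1 : volume E' = volume E :=
      (volume_preserving_prodAssoc (α₁ := ℝ × ℝ) (β₁ := ℝ) (γ₁ := ℝ)).symm.measure_preimage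
        hEm.nullMeasurableSet
    rw [measureReal_def, ← e1, ← measureReal_def, Measure.volume_eq_prod,
      measureReal_prod_eq hE'm (by rw [← Measure.volume_eq_prod, e1]; exact hEfin), Phi,
      ← integral_const_mul, ← integral_indicator (measurableSet_fDom st)]
    refine integral_congr_ae (ae_of_all _ fun p => ?_)
    by_cases hp : 0 < p.2 ∧ FDom st p.1 p.2
    · simp only
      rw [indicator_of_mem (by exact hp), ← section_cap a hS0 hl p.1 hp.1]
      congr 1
      ext q
      simp only [hE', hE, Cap, mem_preimage, mem_ofPred_eq, MeasurableEquiv.prodAssoc, MeasurableEquiv.symm_mk, MeasurableEquiv.coe_mk]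
      simp [hp]
    · simp only
      rw [indicator_of_notMem (by exact hp)]
      have : Prod.mk p ⁻¹' E' = ∅ := by
        ext q
        simp only [hE', hE, Cap, mem_preimage, mem_ofPred_eq, mem_empty_iff_false, iff_false]
        exact fun h => hp h.1
      rw [this]; simp
  rw [← hEv]
  refine main.trans ?_
  rw [measureReal_def, hvP0, toReal_ofReal (by positivity)]
  have : 0 < S * B := by positivity
  push_cast
  linarith

end

section
open MeasureTheory Set
open Real

theorem integrableOn_beta {α β : ℝ} (hα : 0 < α) (hβ : 0 < β) :
    IntegrableOn (fun x : ℝ => x ^ (α - 1) * (1 - x) ^ (β - 1)) (Ioo 0 1) ∧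
      ∫ x in Ioo (0 : ℝ) 1, x ^ (α - 1) * (1 - x) ^ (β - 1) = ProbabilityTheory.beta α β := by
  have h0 := ProbabilityTheory.beta_pos hα hβ
  have h1 := ProbabilityTheory.lintegral_betaPDF_eq_one hα hβ
  rw [ProbabilityTheory.lintegral_betaPDF] at h1
  have hI : ∫ x in Ioo (0 : ℝ) 1, x ^ (α - 1) * (1 - x) ^ (β - 1) = ProbabilityTheory.beta α β := by
    have e (x : ℝ) : x ^ (α - 1) * (1 - x) ^ (β - 1) = ProbabilityTheory.beta α β *
        (1 / ProbabilityTheory.beta α β * x ^ (α - 1) * (1 - x) ^ (β - 1)) := by field_simp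
    simp_rw [e]
    rw [integral_const_mul, integral_eq_lintegral_of_nonneg_ae _ (by fun_prop), h1]
    · simp
    · filter_upwards [ae_restrict_mem measurableSet_Ioo] with x hx
      have := hx.1; have := sub_pos.2 hx.2
      simp only [Pi.zero_apply]
      positivity
  exact ⟨.of_integral_ne_zero (hI ▸ h0.ne'), hI⟩

theorem eta_nonneg (w : ℝ) : 0 ≤ eta w := measureReal_nonneg

theorem eta_formula (w : ℝ) : eta w = 2 / 3 * √(1 - w ^ 2) ^ 3 + 2 * w ^ 2 * √(1 - w ^ 2) := by
  set s := √(1 - w ^ 2) with hs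
  have hs0 : 0 ≤ s := sqrt_nonneg _
  have h1 := volume_regionBetween_eq_integral (μ := (volume : Measure ℝ)) (s := Ioo (-s) s) (f := fun _ => 0)
    (g := fun v => v ^ 2 + w ^ 2) (by simp) ((Continuous.integrableOn_Icc (a := -s) (b := s)
      (by fun_prop)).mono_set Ioo_subset_Icc_self) measurableSet_Ioo (fun v _ => by positivity)
  have h2 : {q : ℝ × ℝ | 0 < q.1 ∧ q.1 < q.2 ^ 2 + w ^ 2 ∧ q.2 ^ 2 + w ^ 2 < 1} =
      MeasurableEquiv.prodComm ⁻¹' regionBetween (fun _ => 0) (fun v => v ^ 2 + w ^ 2) (Ioo (-s) s) := by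
    ext q
    simp only [regionBetween, mem_preimage, mem_ofPred_eq, mem_Ioo, MeasurableEquiv.prodComm, MeasurableEquiv.coe_mk,
      Equiv.prodComm_apply, Prod.fst_swap, Prod.snd_swap]
    rw [← abs_lt, lt_sqrt (abs_nonneg _), sq_abs, lt_sub_iff_add_lt]
    tauto
  have h3 : volume {q : ℝ × ℝ | 0 < q.1 ∧ q.1 < q.2 ^ 2 + w ^ 2 ∧ q.2 ^ 2 + w ^ 2 < 1} =
      volume (regionBetween (fun _ => 0) (fun v => v ^ 2 + w ^ 2) (Ioo (-s) s)) := by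
    rw [h2]
    exact Measure.measurePreserving_swap.measure_preimage (measurableSet_regionBetween measurable_const (by fun_prop) measurableSet_Ioo).nullMeasurableSet
  rw [eta, measureReal_def, h3, Measure.volume_eq_prod, h1, ENNReal.toReal_ofReal, ← integral_Ioc_eq_integral_Ioo,
    ← intervalIntegral.integral_of_le (by linarith)]
  · simp only [Pi.sub_apply, sub_zero]
    simp
    ring
  · refine integral_nonneg fun v => ?_
    simp only [Pi.sub_apply, sub_zero, Pi.zero_apply]; positivity

theorem eta_eq_zero {w : ℝ} (hw : 1 ≤ w) : eta w = 0 := by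
  rw [eta_formula, sqrt_eq_zero_of_nonpos (by nlinarith)]; simp

theorem measurable_eta : Measurable eta := by
  rw [funext eta_formula]; fun_prop

theorem mellin_eta {p : ℝ} (hp : 0 < p) :
    IntegrableOn (fun w => w ^ (p - 1) * eta w) (Ioi 0) ∧
    ∫ w in Ioi (0 : ℝ), w ^ (p - 1) * eta w =
      (1 + p) * √π * Gamma (p / 2) / (4 * Gamma (p / 2 + 5 / 2)) := by
  obtain ⟨i1, e1⟩ := integrableOn_beta (α := p / 2) (β := 5 / 2) (by positivity) (by norm_num)
  obtain ⟨i2, e2⟩ := integrableOn_beta (α := p / 2 + 1) (β := 3 / 2) (by positivity) (by norm_num)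
  set φ : ℝ → ℝ := fun x => 1 / 3 * (x ^ (p / 2 - 1) * (1 - x) ^ ((5 / 2 : ℝ) - 1)) +
    x ^ (p / 2 + 1 - 1) * (1 - x) ^ ((3 / 2 : ℝ) - 1) with hφ
  have key : ∀ x ∈ Ioi (0 : ℝ), ((1 / 2 : ℝ) * x ^ ((1 / 2 : ℝ) - 1)) • ((x ^ (1 / 2 : ℝ)) ^ (p - 1) * eta (x ^ (1 / 2 : ℝ))) =
      (Ioo (0 : ℝ) 1).indicator φ x := by
    intro x (hx0 : 0 < x)
    have h1 : x ^ ((1 / 2 : ℝ) - 1) * (x ^ (1 / 2 : ℝ)) ^ (p - 1) = x ^ (p / 2 - 1) := by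
      rw [← rpow_mul hx0.le, ← rpow_add hx0]; congr 1; ring
    have h2 : (x ^ (1 / 2 : ℝ)) ^ 2 = x := by
      rw [← sqrt_eq_rpow, sq_sqrt hx0.le]
    rcases lt_or_ge x 1 with h | h
    · rw [indicator_of_mem (show x ∈ Ioo (0 : ℝ) 1 from ⟨hx0, h⟩), eta_formula, h2, smul_eq_mul]
      have h4 : (1 - x) ^ ((5 / 2 : ℝ) - 1) = √(1 - x) ^ 3 := by
        rw [sqrt_eq_rpow, ← rpow_natCast, ← rpow_mul (by linarith)]; norm_num
      have h5 : (1 - x) ^ ((3 / 2 : ℝ) - 1) = √(1 - x) := by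
        rw [sqrt_eq_rpow]; norm_num
      have h6 : x ^ (p / 2 + 1 - 1) = x ^ (p / 2 - 1) * x := by
        rw [← rpow_add_one hx0.ne']; ring_nf
      simp only [hφ, h4, h5, h6, ← h1]; ring
    · rw [indicator_of_notMem (fun hm => absurd hm.2 (not_lt.2 h)), eta_eq_zero (one_le_rpow h (by norm_num))]; simp
  constructor
  · rw [← integrableOn_Ioi_comp_rpow_iff _ (p := 1 / 2) (by norm_num)]
    refine ((integrable_indicator_iff measurableSet_Ioo).2 ((i1.const_mul (1 / 3)).add i2)).integrableOn.congr_fun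
      (fun x hx => ?_) measurableSet_Ioi
    exact (key x hx).symm.trans (by norm_num)
  · rw [← integral_comp_rpow_Ioi_of_pos (p := 1 / 2) (by norm_num), setIntegral_congr_fun measurableSet_Ioi key,
      setIntegral_indicator measurableSet_Ioo, inter_eq_self_of_subset_right Ioo_subset_Ioi_self,
      integral_add (i1.const_mul _) i2, integral_const_mul, e1, e2, ProbabilityTheory.beta, ProbabilityTheory.beta]
    have g1 : Gamma (p / 2 + 1) = p / 2 * Gamma (p / 2) := Gamma_add_one (by positivity)
    have g2 : Gamma (3 / 2) = 1 / 2 * √π := by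
      rw [← Gamma_one_half_eq, ← Gamma_add_one (by norm_num)]; norm_num
    have g3 : Gamma (5 / 2) = 3 / 4 * √π := by
      rw [show (5 / 2 : ℝ) = 3 / 2 + 1 by norm_num, Gamma_add_one (by norm_num), g2]; ring
    have g5 : 0 < Gamma (p / 2 + 5 / 2) := Gamma_pos_of_pos (by positivity)
    rw [show p / 2 + 1 + 3 / 2 = p / 2 + 5 / 2 by ring, g1, g2, g3]
    field_simp
    ring

theorem integral_eta : ∫ w in Ioi (0 : ℝ), eta w = π / 4 := by
  have h := (mellin_eta (p := 1) one_pos).2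
  simp only [sub_self, rpow_zero, one_mul] at h
  rw [h, Gamma_one_half_eq, show (1 / 2 + 5 / 2 : ℝ) = (2 : ℕ) + 1 by norm_num, Gamma_nat_eq_factorial]
  simp
  linear_combination (1 / 4) * mul_self_sqrt pi_pos.le

/-- The constant of the secondary term for a single leading coefficient. -/
noncomputable def kappa : ℝ := √π * Gamma (1 / 6) / (5 * Gamma (2 / 3))

theorem integral_eta_comp {l : ℝ} (hl : 0 < l) :
    IntegrableOn (fun y => eta (l * (y * √y)) / √y) (Ioi 0) ∧
    ∫ y in Ioi (0 : ℝ), eta (l * (y * √y)) / √y = kappa * l ^ (-(1 / 3) : ℝ) := by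
  obtain ⟨h1, h2⟩ := mellin_eta (p := 1 / 3) (by norm_num)
  have key : ∀ x ∈ Ioi (0 : ℝ), ((2 / 3 : ℝ) * x ^ ((2 / 3 : ℝ) - 1)) • (eta (l * (x ^ (2 / 3 : ℝ) * √(x ^ (2 / 3 : ℝ)))) / √(x ^ (2 / 3 : ℝ))) =
      (2 / 3 * l ^ (2 / 3 : ℝ)) * ((l * x) ^ ((1 / 3 : ℝ) - 1) * eta (l * x)) := by
    intro x (hx0 : 0 < x)
    have e1 : √(x ^ (2 / 3 : ℝ)) = x ^ (1 / 3 : ℝ) := by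
      rw [sqrt_eq_rpow, ← rpow_mul hx0.le]; norm_num
    have e2 : x ^ (2 / 3 : ℝ) * x ^ (1 / 3 : ℝ) = x := by
      rw [← rpow_add hx0]; norm_num
    have e3 : x ^ ((2 / 3 : ℝ) - 1) = x ^ ((1 / 3 : ℝ) - 1) * x ^ (1 / 3 : ℝ) := by
      rw [← rpow_add hx0]; norm_num
    have e4 : l ^ (2 / 3 : ℝ) * l ^ ((1 / 3 : ℝ) - 1) = 1 := by
      rw [← rpow_add hl]; norm_num
    have e5 : 0 < x ^ (1 / 3 : ℝ) := rpow_pos_of_pos hx0 _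
    rw [e1, e2, e3, smul_eq_mul, mul_rpow hl.le hx0.le]
    have e6 : x ^ (1 / 3 : ℝ) * (eta (l * x) / x ^ (1 / 3 : ℝ)) = eta (l * x) := by field_simp
    linear_combination (2 / 3 * x ^ ((1 / 3 : ℝ) - 1)) * e6 - (2 / 3 * x ^ ((1 / 3 : ℝ) - 1) * eta (l * x)) * e4
  have e6 : l ^ (-(1 / 3) : ℝ) = l ^ (2 / 3 : ℝ) * l⁻¹ := by
    rw [← rpow_neg_one l, ← rpow_add hl]; norm_num
  constructor
  · rw [← integrableOn_Ioi_comp_rpow_iff _ (p := 2 / 3) (by norm_num)]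
    have h3 := ((integrableOn_Ioi_comp_mul_left_iff (fun x : ℝ => x ^ ((1 / 3 : ℝ) - 1) * eta x) 0 hl).2
      (by simpa using h1)).const_mul (2 / 3 * l ^ (2 / 3 : ℝ))
    exact IntegrableOn.congr_fun h3 (fun x hx => (key x hx).symm.trans (by norm_num)) measurableSet_Ioi
  · rw [← integral_comp_rpow_Ioi_of_pos (p := 2 / 3) (by norm_num), setIntegral_congr_fun measurableSet_Ioi key,
      integral_const_mul, integral_comp_mul_left_Ioi (fun x : ℝ => x ^ ((1 / 3 : ℝ) - 1) * eta x) 0 hl, mul_zero, h2, e6, kappa]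
    have g1 : Gamma (1 / 3 / 2 + 5 / 2) = 10 / 9 * Gamma (2 / 3) := by
      rw [show (1 / 3 / 2 + 5 / 2 : ℝ) = 2 / 3 + 1 + 1 by norm_num, Gamma_add_one (by norm_num),
        Gamma_add_one (by norm_num)]
      ring
    have g2 : 0 < Gamma (2 / 3) := Gamma_pos_of_pos (by norm_num)
    rw [g1, smul_eq_mul, show (1 / 3 / 2 : ℝ) = 1 / 6 by norm_num]
    field_simp
    ring

end

section
open MeasureTheory Set
open Real ENNReal Function

theorem strip {g : ℝ → ℝ} {I J : Set ℝ} (hI : volume I ≠ ⊤) (hg : IntegrableOn g J) :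
    IntegrableOn (fun p : ℝ × ℝ => g p.2) (I ×ˢ J) ∧
      ∫ p in I ×ˢ J, g p.2 = volume.real I * ∫ y in J, g y := by
  constructor
  · have := (integrableOn_const (C := (1 : ℝ)) hI).mul_prod hg
    rw [Measure.prod_restrict] at this
    simpa [IntegrableOn, Measure.volume_eq_prod] using this
  · simpa [Measure.volume_eq_prod] using setIntegral_prod_mul (fun _ : ℝ => (1 : ℝ)) g I J (μ := volume) (ν := volume)

theorem sum_eta (μ : ℝ) (K : ℕ) :
    |∑ k ∈ Finset.Icc 1 K, eta (k * μ) - ∫ t in Ioc (0 : ℝ) K, eta (t * μ)| ≤ 12 := by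
  set E : Set ((ℝ × ℝ) × ℝ) := {p | 0 < p.1.1 ∧ p.1.1 < p.1.2 ^ 2 + (p.2 * μ) ^ 2 ∧
    p.1.2 ^ 2 + (p.2 * μ) ^ 2 < 1 ∧ 0 < p.2 ∧ p.2 ≤ K} with hE
  have hEm : MeasurableSet E := by
    simp only [hE, Set.ofPred_and]
    refine .inter ?_ (.inter ?_ (.inter ?_ (.inter ?_ ?_)))
    all_goals first | apply measurableSet_lt | apply measurableSet_le
    all_goals fun_prop
  set P0 : Set (ℝ × ℝ) := Icc 0 1 ×ˢ Icc (-1 : ℝ) 1 with hP0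
  have hvP0 : volume P0 = ENNReal.ofReal 2 := by
    rw [hP0, Measure.volume_eq_prod, Measure.prod_prod, volume_Icc, volume_Icc,
      ← ofReal_mul (by norm_num)]
    congr 1; norm_num
  have hbd : ∀ p t, (p, t) ∈ E → p ∈ P0 ∧ ⌊t⌋ ∈ Finset.Icc (0 : ℤ) K := by
    rintro ⟨x, y⟩ t ⟨h1, h2, h3, h4, h5⟩
    simp only at h1 h2 h3 h4 h5
    exact ⟨⟨⟨h1.le, by linarith⟩, by constructor <;> nlinarith [sq_nonneg (t * μ)]⟩,
      Finset.mem_Icc.2 ⟨Int.floor_nonneg.2 h4.le, by simpa using Int.floor_le_floor h5⟩⟩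
  have hfew : ∀ p, FewFrontier 6 {t | (p, t) ∈ E} := by
    rintro ⟨x, y⟩
    by_cases h : 0 < x
    · open Polynomial in
      convert ((FewFrontier.of_polynomial (m := 2) (p := C (y ^ 2 - x) + (X * C μ) ^ 2)
        (by compute_degree)).inter (.of_polynomial (m := 2) (p := C (1 - y ^ 2) - (X * C μ) ^ 2)
        (by compute_degree))).inter ((FewFrontier.of_polynomial (m := 1) (p := X)
        (by compute_degree)).inter (FewFrontier.of_polynomial (m := 1) (p := X - C (K : ℝ))
        (by compute_degree)).compl) using 1
      ext t
      simp [hE, h, sub_add_eq_add_sub, and_assoc, lt_sub_iff_add_lt', mul_comm t]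
    · rw [show {t | ((x, y), t) ∈ E} = ∅ by ext; simp [hE, h]]
      exact ⟨∅, by simp, by simp⟩
  have main := FewFrontier.sum_measure_sub (μ := (volume : Measure (ℝ × ℝ))) hEm (P0 := P0) (T := Finset.Icc (0 : ℤ) K)
    (measurableSet_Icc.prod measurableSet_Icc) (by rw [hvP0]; exact ofReal_ne_top) hfew hbd
  have hsec : ∀ t : ℝ, volume.real {p : ℝ × ℝ | (p, t) ∈ E} = (Ioc (0 : ℝ) K).indicator (fun t => eta (t * μ)) t := by
    intro t
    by_cases ht : t ∈ Ioc (0 : ℝ) K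
    · simp [eta, hE, ht.1, ht.2]
    · rw [indicator_of_notMem ht, show {p : ℝ × ℝ | (p, t) ∈ E} = ∅ from
        eq_empty_of_forall_notMem fun q h => ht ⟨h.2.2.2.1, h.2.2.2.2⟩]
      simp
  have hsum : ∑ z ∈ Finset.Icc (0 : ℤ) K, volume.real {p : ℝ × ℝ | (p, (z : ℝ)) ∈ E} = ∑ k ∈ Finset.Icc 1 K, eta (k * μ) := by
    simp_rw [hsec]
    symm
    refine Finset.sum_of_injOn (fun k : ℕ => (k : ℤ)) (fun _ _ _ _ h => by simpa using h) ?_ ?_ ?_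
    · simp +contextual [MapsTo]
    · intro z hz hz'
      refine indicator_of_notMem (fun h => hz' ?_) _
      have : 0 < z := mod_cast h.1
      exact ⟨z.toNat, by simp at *; omega, by grind⟩
    · intro k hk
      rw [Finset.mem_Icc] at hk
      rw [indicator_of_mem]
      · simp
      · simpa [Nat.pos_iff_ne_zero, Nat.one_le_iff_ne_zero] using hk
  have hEfin : (volume.prod volume : Measure ((ℝ × ℝ) × ℝ)) E ≠ ⊤ := by
    have : E ⊆ P0 ×ˢ Ioc (0 : ℝ) K := fun x hx => ⟨(hbd x.1 x.2 hx).1, hx.2.2.2.1, hx.2.2.2.2⟩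
    refine ((measure_mono this).trans_lt ?_).ne
    rw [Measure.prod_prod, hvP0]
    exact mul_lt_top ofReal_lt_top (by simp)
  have hint : (volume.prod volume : Measure ((ℝ × ℝ) × ℝ)).real E = ∫ t in Ioc (0 : ℝ) K, eta (t * μ) := by
    rw [measureReal_def, ← (Measure.measurePreserving_swap (μ := volume)
      (ν := volume)).measure_preimage hEm.nullMeasurableSet] at *
    rw [← measureReal_def, measureReal_prod_eq (measurable_swap hEm) hEfin,
      ← integral_indicator measurableSet_Ioc]
    exact integral_congr_ae (.of_forall hsec)
  rw [hsum, hint, measureReal_def, hvP0, toReal_ofReal (by norm_num)] at main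
  push_cast at main
  linarith

theorem flagSet_false : {x : ℝ | flagLE false (-1 / 2) x ∧ flagLE false x (1 / 2)} =
    Icc (-1 / 2) (1 / 2) := by ext x; simp [flagLE]

theorem flagSet_true : {x : ℝ | flagLE true (-1 / 2) x ∧ flagLE true x (1 / 2)} =
    Ioo (-1 / 2) (1 / 2) := by ext x; simp [flagLE]

theorem integral_fDom (st : Bool) :
    ∫ p in {p : ℝ × ℝ | 0 < p.2 ∧ FDom st p.1 p.2}, (p.2 ^ 2)⁻¹ = π / 3 := by
  set F := {p : ℝ × ℝ | 0 < p.2 ∧ FDom st p.1 p.2} with hF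
  have hFm : MeasurableSet F := measurableSet_fDom st
  have hsub : F ⊆ Icc (-1 / 2 : ℝ) (1 / 2) ×ˢ Ioi (3 / 4 : ℝ) := by
    rintro ⟨x, y⟩ ⟨h1, h2⟩
    simp only at h1 h2
    have e1 := h2.1.le; have e2 := h2.2.1.le; have e3 := h2.2.2.le
    refine ⟨⟨e1, e2⟩, ?_⟩
    simp only [mem_Ioi]
    nlinarith
  have hp {u : ℝ} (hu : 0 < u) : EqOn (fun y : ℝ => y ^ (-2 : ℝ)) (fun y => (y ^ 2)⁻¹) (Ioi u) :=
    fun y hy => by simp only; rw [rpow_neg (hu.trans hy).le]; norm_cast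
  have hI := (integrableOn_Ioi_rpow_of_lt (a := -2) (by norm_num) (by norm_num :
    (0 : ℝ) < 3 / 4)).congr_fun (hp (by norm_num)) measurableSet_Ioi
  have hint : IntegrableOn (fun p : ℝ × ℝ => (p.2 ^ 2)⁻¹) F := by
    exact (strip (by simp) hI).1.mono_set hsub
  rw [← integral_indicator hFm, Measure.volume_eq_prod, integral_prod]
  swap
  · rw [← Measure.volume_eq_prod]; exact (integrable_indicator_iff hFm).2 hint
  have hin : ∀ x : ℝ, ∫ y, F.indicator (fun p : ℝ × ℝ => (p.2 ^ 2)⁻¹) (x, y) =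
      {x : ℝ | flagLE st (-1 / 2) x ∧ flagLE st x (1 / 2)}.indicator (fun x => 1 / √(1 - x ^ 2)) x := by
    intro x
    by_cases hx : flagLE st (-1 / 2) x ∧ flagLE st x (1 / 2)
    · have e1 := hx.1.le; have e2 := hx.2.le
      have h0 : 0 < 1 - x ^ 2 := by nlinarith
      rw [indicator_of_mem (by exact hx)]
      have e3 : ∫ y in Ioi √(1 - x ^ 2), (y ^ 2)⁻¹ = 1 / √(1 - x ^ 2) := by
        have h := integral_Ioi_rpow_of_lt (a := -2) (by norm_num) (sqrt_pos.2 h0)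
        rw [setIntegral_congr_fun measurableSet_Ioi (hp (sqrt_pos.2 h0))] at h
        norm_num [h, Real.rpow_neg_one]
      cases st
      on_goal 1 => rw [← e3, ← integral_Ici_eq_integral_Ioi, ← integral_indicator measurableSet_Ici]
      on_goal 2 => rw [← e3, ← integral_indicator measurableSet_Ioi]
      all_goals
        refine integral_congr_ae (.of_forall fun y => ?_)
        simp only [indicator_apply, hF, mem_ofPred_eq, mem_Ici, mem_Ioi, FDom, hx, true_and]
        refine if_congr ?_ rfl rfl
        simp only [flagLE, if_true, Bool.false_eq_true, if_false]
        constructor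
        · rintro ⟨h1, h2⟩
          first | rw [sqrt_le_left h1.le] | rw [sqrt_lt' h1]
          linarith
        · intro h1
          have h2 := (sqrt_pos.2 h0).trans_le (by first | exact h1 | exact h1.le)
          first | rw [sqrt_le_left h2.le] at h1 | rw [sqrt_lt' h2] at h1
          exact ⟨h2, by linarith⟩
    · rw [indicator_of_notMem (by exact hx)]
      exact integral_eq_zero_of_ae (.of_forall fun y =>
        indicator_of_notMem (fun h => hx ⟨h.2.1, h.2.2.1⟩) _)
  simp_rw [hin]
  have hasin : ∫ x in Ioc (-1 / 2 : ℝ) (1 / 2), 1 / √(1 - x ^ 2) = π / 3 := by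
    rw [← intervalIntegral.integral_of_le (by norm_num), intervalIntegral.integral_eq_sub_of_hasDerivAt (f := arcsin)]
    · rw [neg_div, arcsin_neg, arcsin_eq_of_sin_eq (x := π / 6) (by simp)
        (by constructor <;> linarith [pi_pos])]
      ring
    · intro x hx
      rw [uIcc_of_le (by norm_num)] at hx
      exact hasDerivAt_arcsin (by linarith [hx.1]) (by linarith [hx.2])
    · refine ContinuousOn.intervalIntegrable fun x hx => ?_
      rw [uIcc_of_le (by norm_num)] at hx
      have : √(1 - x ^ 2) ≠ 0 := (sqrt_pos.2 (by nlinarith [hx.1, hx.2])).ne'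
      exact ContinuousAt.continuousWithinAt (by fun_prop (disch := exact this))
  rw [← hasin]
  cases st
  · rw [flagSet_false, integral_indicator measurableSet_Icc, integral_Icc_eq_integral_Ioc]
  · rw [flagSet_true, integral_indicator measurableSet_Ioo, integral_Ioc_eq_integral_Ioo]

theorem sum_phi (st : Bool) {l : ℝ} (hl : 0 < l) {K : ℕ} (hK : 4 ≤ K * l) :
    |∑ k ∈ Finset.Icc 1 K, Phi st (k * l) - kappa * l ^ (-(1 / 3) : ℝ) *
      (∑ k ∈ Finset.Icc 1 K, (k : ℝ) ^ (-(1 / 3) : ℝ) - 3 / 2 * (K : ℝ) ^ (2 / 3 : ℝ)) -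
      π ^ 2 / 12 / l| ≤ 24 := by
  have hK0 : (0 : ℝ) < K := by by_contra! h; nlinarith
  set I : Set ℝ := {x | flagLE st (-1 / 2) x ∧ flagLE st x (1 / 2)} with hI
  have hIm : MeasurableSet I := (measurableSet_flagLE st (by fun_prop) (by fun_prop)).inter
    (measurableSet_flagLE st (by fun_prop) (by fun_prop))
  have hIv : volume.real I = 1 := by
    cases st <;> simp only [hI, flagSet_false, flagSet_true] <;> norm_num
  have hIf : volume I ≠ ⊤ := fun h => by simp [measureReal_def, h] at hIv
  set F := {p : ℝ × ℝ | 0 < p.2 ∧ FDom st p.1 p.2} with hF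
  have hFm : MeasurableSet F := measurableSet_fDom st
  set T : Set (ℝ × ℝ) := I ×ˢ Ioi 0 with hT
  have hTm : MeasurableSet T := hIm.prod measurableSet_Ioi
  have hFT : F ⊆ T := fun p hp => ⟨⟨hp.2.1, hp.2.2.1⟩, hp.1⟩
  set U : ℝ → ℝ × ℝ → ℝ := fun t p => eta (t * l * (p.2 * √p.2)) / √p.2 with hU
  have hUi : ∀ t : ℝ, 0 < t → IntegrableOn (U t) T ∧ ∫ p in T, U t p = kappa * l ^ (-(1 / 3) : ℝ) * t ^ (-(1 / 3) : ℝ) := by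
    intro t ht
    obtain ⟨h1, h2⟩ := integral_eta_comp (mul_pos ht hl)
    obtain ⟨h3, h4⟩ := strip hIf h1
    refine ⟨h3, h4.trans ?_⟩
    rw [hIv, h2, mul_rpow ht.le hl.le]; ring
  have hUm : Measurable (uncurry U) := by
    simp only [hU, uncurry_def]
    refine Measurable.div (measurable_eta.comp ?_) ?_ <;> fun_prop
  have hU0 : ∀ t p, 0 ≤ U t p := fun t p => div_nonneg (eta_nonneg _) (sqrt_nonneg _)
  have hrp : IntegrableOn (fun t : ℝ => t ^ (-(1 / 3) : ℝ)) (Ioc 0 K) := by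
    have := intervalIntegral.intervalIntegrable_rpow' (a := 0) (b := K) (r := -(1 / 3)) (by norm_num)
    rwa [intervalIntegrable_iff_integrableOn_Ioc_of_le hK0.le] at this
  have hprod : Integrable (uncurry U) ((volume.restrict (Ioc (0 : ℝ) K)).prod (volume.restrict T)) := by
    rw [integrable_prod_iff hUm.aestronglyMeasurable]
    constructor
    · filter_upwards [ae_restrict_mem measurableSet_Ioc] with t ht
      exact (hUi t ht.1).1
    · refine IntegrableOn.congr_fun (hrp.const_mul (kappa * l ^ (-(1 / 3) : ℝ))) (fun t ht => ?_)
        measurableSet_Ioc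
      simp only [uncurry_apply_pair, norm_of_nonneg (hU0 _ _)]
      exact (hUi t ht.1).2.symm
  set A : ℝ × ℝ → ℝ := fun p => ∫ t in Ioc (0 : ℝ) K, U t p with hA
  set B : ℝ × ℝ → ℝ := fun p => ∑ k ∈ Finset.Icc 1 K, U k p with hB
  have hAi : IntegrableOn A T := hprod.integral_prod_right
  have hk (k : ℕ) (hk : k ∈ Finset.Icc 1 K) := hUi k (mod_cast (Finset.mem_Icc.1 hk).1)
  have hBi : IntegrableOn B T := integrable_finsetSum _ fun k h => (hk k h).1
  have hAT : ∫ p in T, A p = kappa * l ^ (-(1 / 3) : ℝ) * (3 / 2 * (K : ℝ) ^ (2 / 3 : ℝ)) := by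
    simp only [hA]
    rw [← integral_integral_swap hprod, setIntegral_congr_fun measurableSet_Ioc (fun t ht => (hUi t ht.1).2), integral_const_mul,
      ← intervalIntegral.integral_of_le hK0.le, integral_rpow (Or.inl (by norm_num)), zero_rpow (by norm_num)]
    ring_nf
  have hBT : ∫ p in T, B p = kappa * l ^ (-(1 / 3) : ℝ) * ∑ k ∈ Finset.Icc 1 K, (k : ℝ) ^ (-(1 / 3) : ℝ) := by
    simp only [hB]
    rw [integral_finsetSum _ fun k h => (hk k h).1, Finset.mul_sum]
    exact Finset.sum_congr rfl fun k h => (hk k h).2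
  have hBF : ∫ p in F, B p = ∑ k ∈ Finset.Icc 1 K, Phi st (k * l) := by
    simp only [hB]
    rw [integral_finsetSum _ fun k h => (hk k h).1.mono_set hFT]
    rfl
  have hAF : ∫ p in F, A p = π ^ 2 / 12 / l := by
    have h1 : ∀ p ∈ F, A p = π / 4 / l * (p.2 ^ 2)⁻¹ := by
      rintro ⟨x, y⟩ ⟨h1, h2⟩
      simp only at h1 h2
      obtain ⟨-, -, h3, h4⟩ := h2.bounds h1
      have hs : 1 / 2 ≤ √y := le_sqrt_of_sq_le (by linarith)
      have hs0 : 0 < √y := by linarith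
      have hc : 0 < l * (y * √y) := by positivity
      have h5 : 1 ≤ K * (l * (y * √y)) := by
        nlinarith [mul_le_mul hK (show 2 / 5 ≤ y * √y by nlinarith) (by norm_num) (by positivity)]
      simp only [hA, hU]
      rw [integral_div, ← intervalIntegral.integral_of_le hK0.le]
      have h6 := intervalIntegral.integral_comp_mul_right (a := 0) (b := K) (fun w => eta w) hc.ne'
      simp only [← mul_assoc] at h6 ⊢
      have h7 : ∫ w in (0 : ℝ)..(K * l * y * √y), eta w = π / 4 := by
        rw [← integral_eta, intervalIntegral.integral_of_le (by positivity)]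
        refine setIntegral_eq_of_subset_of_forall_sdiff_eq_zero measurableSet_Ioi Ioc_subset_Ioi_self ?_ |>.symm
        exact fun w hw => eta_eq_zero (by nlinarith [not_le.1 fun h => hw.2 ⟨hw.1, h⟩])
      rw [h6, zero_mul, zero_mul, zero_mul, h7, smul_eq_mul]
      have := mul_self_sqrt h1.le
      field_simp
      rw [sq_sqrt h1.le]
    rw [setIntegral_congr_fun hFm h1, integral_const_mul, integral_fDom]
    ring
  have hdiff : ∀ {f : ℝ × ℝ → ℝ}, IntegrableOn f T → ∫ p in F, f p = (∫ p in T, f p) - ∫ p in T \ F, f p :=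
    fun hf => by linarith [setIntegral_sdiff hFm hf hFT]
  have hrest : |∫ p in T \ F, (B p - A p)| ≤ 24 := by
    have hsub : T \ F ⊆ I ×ˢ Ioc (0 : ℝ) 1 := by
      rintro ⟨x, y⟩ ⟨⟨h1, h2⟩, h3⟩
      refine ⟨h1, h2, ?_⟩
      by_contra! h4
      refine h3 ⟨h2, h1.1, h1.2, ?_⟩
      cases st <;> simp [flagLE] at * <;> nlinarith [sq_nonneg x]
    have hsq : IntegrableOn (fun y : ℝ => 12 * y ^ (-(1 / 2) : ℝ)) (Ioc 0 1) := by
      have := intervalIntegral.intervalIntegrable_rpow' (a := 0) (b := 1) (r := -(1 / 2)) (by norm_num)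
      rw [intervalIntegrable_iff_integrableOn_Ioc_of_le zero_le_one] at this
      exact this.const_mul _
    obtain ⟨hdom, hval⟩ := strip hIf hsq
    rw [integral_const_mul (μ := volume.restrict (Ioc _ _)), ← intervalIntegral.integral_of_le zero_le_one,
      integral_rpow (Or.inl (by norm_num)), zero_rpow (by norm_num), hIv] at hval
    norm_num only at hval
    rw [← hval, ← norm_eq_abs]
    refine (norm_integral_le_of_norm_le (hdom.mono_set hsub) ?_).trans ?_
    · filter_upwards [ae_restrict_mem (hTm.diff hFm)] with p hp
      have hy : 0 < p.2 := hp.1.2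
      have hs := sqrt_pos.2 hy
      have h1 := sum_eta (l * (p.2 * √p.2)) K
      have h2 : B p - A p = (∑ k ∈ Finset.Icc 1 K, eta (k * (l * (p.2 * √p.2))) -
          ∫ t in Ioc (0 : ℝ) K, eta (t * (l * (p.2 * √p.2)))) / √p.2 := by
        simp only [hA, hB, hU, integral_div, sub_div, Finset.sum_div, mul_assoc]
      rw [h2, norm_eq_abs, abs_div, abs_of_pos hs, rpow_neg hy.le, ← sqrt_eq_rpow, ← div_eq_mul_inv]
      gcongr
    · refine setIntegral_mono_set hdom ?_ (LE.le.eventuallyLE hsub)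
      filter_upwards [ae_restrict_mem (hIm.prod measurableSet_Ioc)] with p hp
      have := hp.2.1
      simp only [Pi.zero_apply]
      positivity
  have e1 := hdiff hBi
  have e2 := hdiff hAi
  rw [integral_sub (hBi.mono_set sdiff_subset) (hAi.mono_set sdiff_subset)] at hrest
  rw [← hBF]
  have : (∫ p in F, B p) - kappa * l ^ (-(1 / 3) : ℝ) *
      (∑ k ∈ Finset.Icc 1 K, (k : ℝ) ^ (-(1 / 3) : ℝ) - 3 / 2 * (K : ℝ) ^ (2 / 3 : ℝ)) -
      π ^ 2 / 12 / l = - ((∫ p in T \ F, B p) - ∫ p in T \ F, A p) := by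
    rw [mul_sub, ← hBT, ← hAT, ← hAF, e1, e2]; ring
  rwa [this, abs_neg]

end

section
open Finset Complex Set

/-- The summand of the Euler–Maclaurin expansion of `(s - 1) ζ(s)`. -/
noncomputable def zterm (k : ℕ) (s : ℂ) : ℂ :=
  (s - 1) * ((k + 2 : ℕ) : ℂ) ^ (-s) + ((k + 2 : ℕ) : ℂ) ^ (1 - s) - ((k + 1 : ℕ) : ℂ) ^ (1 - s)

theorem sum_zterm (K : ℕ) (s : ℂ) :
    ∑ k ∈ range K, zterm k s =
      (s - 1) * ∑ k ∈ Icc 1 (K + 1), (k : ℂ) ^ (-s) + ((K + 1 : ℕ) : ℂ) ^ (1 - s) - s := by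
  induction K with
  | zero => simp
  | succ K ih =>
    rw [sum_range_succ, ih, sum_Icc_succ_top (by omega) (b := K + 1), zterm]
    push_cast
    ring_nf

theorem norm_zterm_le {s : ℂ} (hs : 1 / 4 < s.re) (hs2 : ‖s‖ < 10) (k : ℕ) :
    ‖zterm k s‖ ≤ 110 * ((k + 1 : ℕ) : ℝ) ^ (-(5 / 4) : ℝ) := by
  have hs1 : ‖s - 1‖ ≤ 11 := (norm_sub_le _ _).trans (by norm_num; linarith)
  set a : ℝ := ((k + 1 : ℕ) : ℝ) with ha
  have ha1 : 1 ≤ a := by rw [ha]; exact_mod_cast Nat.le_add_left 1 k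
  have hpos : ∀ t ∈ Icc a (a + 1), 0 < t := fun t ht => by linarith [ht.1]
  have hnorm : ∀ t ∈ Icc a (a + 1), ‖(t : ℂ) ^ (-s - 1)‖ ≤ a ^ (-(5 / 4) : ℝ) := by
    intro t ht
    rw [norm_cpow_eq_rpow_re_of_pos (hpos t ht)]
    have h1 : (-s - 1).re ≤ -(5 / 4) := by
      simp only [sub_re, neg_re, one_re]; linarith
    calc t ^ (-s - 1).re ≤ t ^ (-(5 / 4) : ℝ) :=
          Real.rpow_le_rpow_of_exponent_le (ha1.trans ht.1) h1
      _ ≤ a ^ (-(5 / 4) : ℝ) :=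
          Real.rpow_le_rpow_of_nonpos (by linarith) ht.1 (by norm_num)
  have hder : ∀ (r : ℂ), r ≠ 0 → ∀ t ∈ Icc a (a + 1),
      HasDerivWithinAt (fun t : ℝ => (t : ℂ) ^ r) (r * (t : ℂ) ^ (r - 1)) (Icc a (a + 1)) t := by
    intro r hr t ht
    have h1 : HasDerivAt (fun x : ℂ => x ^ r) (r * (t : ℂ) ^ (r - 1)) (t : ℂ) := by
      simpa using (hasDerivAt_id (t : ℂ)).cpow_const (c := r) (Or.inl (by simpa using hpos t ht))
    exact h1.comp_ofReal.hasDerivWithinAt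
  have hs0 : s ≠ 0 := by rintro rfl; norm_num at hs
  have hmem : a + 1 ∈ Icc a (a + 1) := ⟨by linarith, le_rfl⟩
  have hmem' : a ∈ Icc a (a + 1) := ⟨le_rfl, by linarith⟩
  have h1 : ∀ t ∈ Icc a (a + 1), ‖((a + 1 : ℝ) : ℂ) ^ (-s) - (t : ℂ) ^ (-s)‖ ≤
      10 * a ^ (-(5 / 4) : ℝ) := by
    intro t ht
    have := (convex_Icc a (a + 1)).norm_image_sub_le_of_norm_hasDerivWithin_le
      (C := 10 * a ^ (-(5 / 4) : ℝ)) (hder (-s) (neg_ne_zero.2 hs0)) ?_ ht hmem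
    · refine this.trans ?_
      have h2 : ‖a + 1 - t‖ ≤ 1 := by
        rw [Real.norm_eq_abs, abs_le]; constructor <;> linarith [ht.1, ht.2]
      exact mul_le_of_le_one_right (by positivity) h2
    · intro x hx
      rw [norm_mul, norm_neg]
      exact mul_le_mul hs2.le (hnorm x hx) (norm_nonneg _) (by norm_num)
  have h2 : ∀ t ∈ Icc a (a + 1),
      HasDerivWithinAt (fun t : ℝ => (s - 1) * ((t : ℂ) * ((a + 1 : ℝ) : ℂ) ^ (-s)) + (t : ℂ) ^ (1 - s))
        ((s - 1) * (((a + 1 : ℝ) : ℂ) ^ (-s) - (t : ℂ) ^ (-s))) (Icc a (a + 1)) t := by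
    intro t ht
    have h3 : HasDerivWithinAt (fun t : ℝ => (t : ℂ) ^ (1 - s)) ((1 - s) * (t : ℂ) ^ (-s))
        (Icc a (a + 1)) t := by
      rcases eq_or_ne (1 - s) 0 with h0 | h0
      · simp only [h0, cpow_zero, zero_mul]
        exact hasDerivWithinAt_const _ _ _
      · simpa using hder (1 - s) h0 t ht
    have h4 : HasDerivWithinAt (fun t : ℝ => (s - 1) * ((t : ℂ) * ((a + 1 : ℝ) : ℂ) ^ (-s)))
        ((s - 1) * (1 * ((a + 1 : ℝ) : ℂ) ^ (-s))) (Icc a (a + 1)) t :=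
      ((hasDerivAt_id t).ofReal_comp.hasDerivWithinAt.mul_const _).const_mul _
    exact (h4.fun_add h3).congr_deriv (by ring)
  have h5 := (convex_Icc a (a + 1)).norm_image_sub_le_of_norm_hasDerivWithin_le
      (C := 110 * a ^ (-(5 / 4) : ℝ)) h2 ?_ hmem' hmem
  · have h6 : zterm k s = (s - 1) * (((a + 1 : ℝ) : ℂ) * ((a + 1 : ℝ) : ℂ) ^ (-s)) +
        ((a + 1 : ℝ) : ℂ) ^ (1 - s) - ((s - 1) * ((a : ℂ) * ((a + 1 : ℝ) : ℂ) ^ (-s)) + (a : ℂ) ^ (1 - s)) := by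
      rw [zterm, ha]
      push_cast
      rw [show (k : ℂ) + 1 + 1 = k + 2 by ring]
      ring
    rw [h6]
    simpa using h5
  · intro t ht
    rw [norm_mul]
    calc _ ≤ 11 * (10 * a ^ (-(5 / 4) : ℝ)) := mul_le_mul hs1 (h1 t ht) (norm_nonneg _) (by norm_num)
      _ = _ := by ring

theorem summable_zbound : Summable fun k : ℕ => 110 * ((k + 1 : ℕ) : ℝ) ^ (-(5 / 4) : ℝ) :=
  ((summable_nat_add_iff 1).2 (Real.summable_nat_rpow.2 (by norm_num))).mul_left _

theorem tsum_zterm {s : ℂ} (hs : 1 / 4 < s.re) (hs2 : ‖s‖ < 10) :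
    (s - 1) * riemannZeta s = s + ∑' k, zterm k s ∨ s = 1 := by
  set U : Set ℂ := {s | 1 / 4 < s.re} ∩ Metric.ball 0 10 with hU
  have hUo : IsOpen U := (isOpen_lt continuous_const continuous_re).inter Metric.isOpen_ball
  have hUc : IsPreconnected U :=
    ((convex_halfSpace_re_gt _).inter (convex_ball _ _)).isPreconnected
  have hd : DifferentiableOn ℂ (fun s => s + ∑' k, zterm k s) U := by
    refine differentiableOn_id.add (differentiableOn_tsum_of_summable_norm summable_zbound ?_ hUo ?_)
    · intro k
      have h1 : ((k + 2 : ℕ) : ℂ) ≠ 0 := Nat.cast_ne_zero.2 (by omega)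
      have h2 : ((k + 1 : ℕ) : ℂ) ≠ 0 := Nat.cast_ne_zero.2 (by omega)
      unfold zterm
      refine Differentiable.differentiableOn ?_
      refine ((differentiable_id.sub_const 1).mul (differentiable_neg.const_cpow (Or.inl h1))).add
        (((differentiable_const _).sub differentiable_id).const_cpow (Or.inl h1)) |>.sub
        (((differentiable_const _).sub differentiable_id).const_cpow (Or.inl h2))
    · intro k w hw
      exact norm_zterm_le hw.1 (by simpa using hw.2) k
  have hz : AnalyticOnNhd ℂ riemannZeta₁ U := differentiable_riemannZeta₁.differentiableOn.analyticOnNhd hUo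
  have key : EqOn riemannZeta₁ (fun s => s + ∑' k, zterm k s) U := by
    refine hz.eqOn_of_preconnected_of_eventuallyEq (hd.analyticOnNhd hUo) hUc (z₀ := 2) ⟨?_, ?_⟩ ?_
    · simp only [mem_ofPred_eq]; norm_num
    · simp; norm_num
    · have h1 : ∀ᶠ w : ℂ in 𝓝 2, 1 < w.re :=
        (isOpen_lt continuous_const continuous_re).mem_nhds (by simp)
      have h2 : ∀ᶠ w : ℂ in 𝓝 2, w ∈ U := hUo.mem_nhds ⟨by simp only [mem_ofPred_eq]; norm_num, by simp; norm_num⟩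
      filter_upwards [h1, h2] with w hw hwU
      have hw1 : w ≠ 1 := by rintro rfl; simp at hw
      have hsum : Summable fun k => zterm k w :=
        Summable.of_norm_bounded summable_zbound (norm_zterm_le hwU.1 (by simpa using hwU.2))
      have ht := hsum.hasSum.tendsto_sum_nat
      have h3 : Tendsto (fun K : ℕ => ∑ k ∈ Icc 1 (K + 1), (k : ℂ) ^ (-w)) atTop
          (𝓝 (riemannZeta w)) := by
        have h4 : Summable fun n : ℕ => 1 / ((n : ℂ) + 1) ^ w := by
          have := (summable_nat_add_iff 1).2 (summable_one_div_nat_cpow.2 hw)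
          simpa using this
        have h5 := h4.hasSum.tendsto_sum_nat
        rw [← zeta_eq_tsum_one_div_nat_add_one_cpow hw] at h5
        refine ((tendsto_add_atTop_iff_nat 1).2 h5).congr fun K => ?_
        have h10 : ∑ k ∈ Icc 1 (K + 1), (k : ℂ) ^ (-w) =
            ∑ n ∈ range (K + 1), ((n + 1 : ℕ) : ℂ) ^ (-w) := by
          rw [range_eq_Ico, sum_Ico_add' (fun n : ℕ => (n : ℂ) ^ (-w)) 0 (K + 1) 1]
          rfl
        rw [h10]
        · refine sum_congr rfl fun n _ => ?_
          rw [cpow_neg, one_div]; push_cast; rfl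
      have h6 : Tendsto (fun K : ℕ => ((K + 1 : ℕ) : ℂ) ^ (1 - w)) atTop (𝓝 0) := by
        rw [tendsto_zero_iff_norm_tendsto_zero]
        have h7 : Tendsto (fun K : ℕ => ((K + 1 : ℕ) : ℝ) ^ (-(w.re - 1))) atTop (𝓝 0) :=
          (tendsto_rpow_neg_atTop (by linarith)).comp
            (tendsto_natCast_atTop_atTop.comp (tendsto_add_atTop_nat 1))
        refine h7.congr fun K => ?_
        rw [norm_natCast_cpow_of_pos (by omega)]
        simp
      have h8 := ((h3.const_mul (w - 1)).add h6).sub_const w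
      simp_rw [← sum_zterm] at h8
      have h9 := tendsto_nhds_unique ht h8
      rw [h9]
      have := riemannZeta_eq_inv_sub_mul hw1
      rw [this]
      have : w - 1 ≠ 0 := sub_ne_zero.2 hw1
      field_simp
      ring
  rcases eq_or_ne s 1 with h | h
  · exact Or.inr h
  · left
    have := key (show s ∈ U from ⟨hs, by simpa using hs2⟩)
    simp only at this
    rw [← this, riemannZeta_eq_inv_sub_mul h]
    have : s - 1 ≠ 0 := sub_ne_zero.2 h
    field_simp

theorem tendsto_zeta_third : Tendsto (fun K : ℕ => ∑ k ∈ Icc 1 K, (k : ℝ) ^ (-(1 / 3) : ℝ) -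
    3 / 2 * (K : ℝ) ^ (2 / 3 : ℝ)) atTop (𝓝 (riemannZeta (1 / 3)).re) := by
  have hre : ((1 / 3 : ℂ)).re = 1 / 3 := by norm_num
  have hn : ‖(1 / 3 : ℂ)‖ < 10 := by norm_num
  have hs : (1 : ℝ) / 4 < ((1 / 3 : ℂ)).re := by rw [hre]; norm_num
  have hsum : Summable fun k => zterm k (1 / 3) :=
    Summable.of_norm_bounded summable_zbound (norm_zterm_le hs hn)
  have ht := (hsum.hasSum.tendsto_sum_nat.add_const (1 / 3 : ℂ)).const_mul (-(3 / 2) : ℂ)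
  have h0 : -(3 / 2) * (∑' k, zterm k (1 / 3) + 1 / 3) = riemannZeta (1 / 3) := by
    rcases tsum_zterm hs hn with h | h
    · linear_combination (3 / 2 : ℂ) * h
    · norm_num at h
  rw [h0] at ht
  rw [← tendsto_add_atTop_iff_nat 1]
  refine ((continuous_re.tendsto _).comp ht).congr fun K => ?_
  rw [Function.comp_apply, sum_zterm]
  have h1 : ∀ k : ℕ, (k : ℂ) ^ (-(1 / 3 : ℂ)) = (((k : ℝ) ^ (-(1 / 3) : ℝ) : ℝ) : ℂ) := by
    intro k
    rw [ofReal_cpow (Nat.cast_nonneg k)]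
    norm_num
  have h2 : ((K + 1 : ℕ) : ℂ) ^ (1 - 1 / 3 : ℂ) = ((((K + 1 : ℕ) : ℝ) ^ (2 / 3 : ℝ) : ℝ) : ℂ) := by
    rw [ofReal_cpow (Nat.cast_nonneg _)]
    norm_num
  simp_rw [h1]
  rw [h2, ← ofReal_sum]
  have h3 : (-(3 / 2) : ℂ) * ((1 / 3 - 1) * ((∑ k ∈ Icc 1 (K + 1), (k : ℝ) ^ (-(1 / 3) : ℝ) : ℝ) : ℂ) +
      ((((K + 1 : ℕ) : ℝ) ^ (2 / 3 : ℝ) : ℝ) : ℂ) - 1 / 3 + 1 / 3) =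
      ((∑ k ∈ Icc 1 (K + 1), (k : ℝ) ^ (-(1 / 3) : ℝ) -
    3 / 2 * ((K + 1 : ℕ) : ℝ) ^ (2 / 3 : ℝ) : ℝ) : ℂ) := by
    push_cast; ring
  rw [h3, ofReal_re]

end

section
open Finset Real

theorem Phi_eq_zero (st : Bool) {lam : ℝ} (h : 4 ≤ lam) : Phi st lam = 0 := by
  unfold Phi
  refine MeasureTheory.setIntegral_eq_zero_of_forall_eq_zero ?_
  rintro ⟨x, y⟩ ⟨h1, h2⟩
  simp only at h1 h2 ⊢
  obtain ⟨-, -, h3, h4⟩ := h2.bounds h1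
  have hs : 1 / 2 ≤ √y := le_sqrt_of_sq_le (by linarith)
  have : 2 / 5 ≤ y * √y := by nlinarith
  rw [eta_eq_zero (by nlinarith), zero_div]

theorem sum_phi_eq (st : Bool) {l : ℝ} (hl : 0 < l) {K : ℕ} (hK : 4 ≤ K * l) :
    |∑ k ∈ Icc 1 K, Phi st (k * l) - kappa * (riemannZeta (1 / 3)).re * l ^ (-(1 / 3) : ℝ) -
      π ^ 2 / 12 / l| ≤ 24 := by
  have h1 : ∀ K' ≥ K, ∑ k ∈ Icc 1 K', Phi st (k * l) = ∑ k ∈ Icc 1 K, Phi st (k * l) := by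
    intro K' hK'
    symm
    refine sum_subset (Icc_subset_Icc_right hK') fun k hk hk' => Phi_eq_zero st ?_
    simp only [mem_Icc, not_and, not_le] at hk hk'
    have : (K : ℝ) ≤ k := by exact_mod_cast (hk' hk.1).le
    nlinarith
  have h2 := (((tendsto_zeta_third.const_mul (kappa * l ^ (-(1 / 3) : ℝ))).const_sub
    (∑ k ∈ Icc 1 K, Phi st (k * l))).sub_const (π ^ 2 / 12 / l)).abs
  have h3 := le_of_tendsto h2 (b := 24) (by
    filter_upwards [eventually_ge_atTop K] with K' hK'
    rw [← h1 K' hK']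
    refine sum_phi st hl (hK.trans ?_)
    have : (K : ℝ) ≤ K' := by exact_mod_cast hK'
    gcongr)
  rwa [show kappa * (riemannZeta (1 / 3)).re * l ^ (-(1 / 3) : ℝ) =
    kappa * l ^ (-(1 / 3) : ℝ) * (riemannZeta (1 / 3)).re by ring]

/-- The main term for the count of reduced forms with given leading coefficient. -/
noncomputable def Wmain (st : Bool) (S a : ℝ) : ℝ := 4 / 9 * (S * √S) * Phi st (a / √S)

theorem sum_Wmain (st : Bool) {S : ℝ} (hS : 0 < S) {e : ℕ} (he : 0 < e) {K : ℕ} (hK : 4 * √S ≤ K * e) :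
    |∑ k ∈ Icc 1 K, Wmain st S (k * e) - π ^ 2 / 27 * S ^ 2 / e -
      4 / 9 * kappa * (riemannZeta (1 / 3)).re * S ^ (5 / 3 : ℝ) * (e : ℝ) ^ (-(1 / 3) : ℝ)| ≤
      11 * (S * √S) := by
  have hs := sqrt_pos.2 hS
  have heR : (0 : ℝ) < e := by exact_mod_cast he
  have hl : 0 < e / √S := by positivity
  have h := sum_phi_eq st hl (K := K) (by rw [← mul_div_assoc, le_div_iff₀ hs]; linarith)
  have e1 : ∑ k ∈ Icc 1 K, Wmain st S (k * e) =
      4 / 9 * (S * √S) * ∑ k ∈ Icc 1 K, Phi st (k * (e / √S)) := by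
    rw [mul_sum]
    refine sum_congr rfl fun k _ => ?_
    rw [Wmain, mul_div_assoc]
  have e2 : π ^ 2 / 27 * S ^ 2 / e = 4 / 9 * (S * √S) * (π ^ 2 / 12 / (e / √S)) := by
    have := mul_self_sqrt hS.le
    field_simp
    rw [sq_sqrt hS.le]
    ring
  have e3 : 4 / 9 * kappa * (riemannZeta (1 / 3)).re * S ^ (5 / 3 : ℝ) * (e : ℝ) ^ (-(1 / 3) : ℝ) =
      4 / 9 * (S * √S) * (kappa * (riemannZeta (1 / 3)).re * (e / √S) ^ (-(1 / 3) : ℝ)) := by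
    rw [div_rpow heR.le hs.le, sqrt_eq_rpow, ← rpow_mul hS.le,
      show (5 / 3 : ℝ) = 1 + 1 / 2 - 1 / 2 * -(1 / 3) by norm_num, rpow_sub hS, rpow_add hS,
      rpow_one]
    ring
  rw [e1, e2, e3, ← mul_sub, ← mul_sub, sub_right_comm, abs_mul, abs_of_nonneg (by positivity)]
  calc _ ≤ 4 / 9 * (S * √S) * 24 := by
        refine mul_le_mul_of_nonneg_left ?_ (by positivity)
        exact h
    _ ≤ _ := by nlinarith [mul_pos hS hs]

end

section
open Finset Real

theorem card_linear_congr_le {N : ℕ} (hN : 0 < N) (u j : ℤ) :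
    ((range N).filter fun r : ℕ => (N : ℤ) ∣ u * (r : ℤ) - j).card ≤ Int.gcd u N := by
  set g := Int.gcd u N with hg
  have hgpos : 0 < g := Int.gcd_pos_of_ne_zero_right _ (by omega)
  obtain ⟨q, hq⟩ : g ∣ N := by
    have := Int.gcd_dvd_right (a := u) (b := (N : ℤ)); exact_mod_cast this
  obtain ⟨w, hw⟩ : (g : ℤ) ∣ u := Int.gcd_dvd_left _ _
  have hqpos : 0 < q := Nat.pos_of_ne_zero (by rintro rfl; omega)
  have hcop : IsCoprime (q : ℤ) w := by
    have h1 := Int.isCoprime_iff_gcd_eq_one.2 (Int.gcd_div_gcd_div_gcd (i := u) (j := N) hgpos)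
    rw [← hg, hw, Int.mul_ediv_cancel_left _ (by omega), hq, Nat.cast_mul,
      Int.mul_ediv_cancel_left _ (by omega)] at h1
    exact h1.symm
  rw [← card_range g]
  refine card_le_card_of_injOn (fun r => r / q) ?_ ?_
  · intro r hr
    simp only [coe_filter, mem_range, Set.mem_ofPred_eq] at hr
    simp only [coe_range, Set.mem_Iio]
    rw [Nat.div_lt_iff_lt_mul hqpos, ← hq]; exact hr.1
  · intro r hr r' hr' hrr
    simp only [coe_filter, mem_range, Set.mem_ofPred_eq] at hr hr' hrr
    have h1 : (N : ℤ) ∣ u * ((r : ℤ) - r') := by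
      have := dvd_sub hr.2 hr'.2
      rwa [show u * r - j - (u * r' - j) = u * ((r : ℤ) - r') by ring] at this
    rw [hw, hq, Nat.cast_mul, mul_assoc, mul_dvd_mul_iff_left (by omega)] at h1
    have h2 : (q : ℤ) ∣ (r : ℤ) - r' := hcop.dvd_of_dvd_mul_left h1
    have h3 : r' ≡ r [MOD q] := (Nat.modEq_iff_dvd).2 h2
    rw [← Nat.div_add_mod r q, ← Nat.div_add_mod r' q, hrr, h3]

theorem exists_short_vectors {N : ℕ} (hN : 0 < N) {g : ℤ} (hg : IsCoprime g N) :
    ∃ v m : ℕ → ℤ, (∀ r, 0 < v r ∧ IsCoprime (v r) (m r)) ∧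
      ∑ r ∈ range N, (1 / (v r : ℝ) + (v r + |((-3 * r * g * v r + N * m r : ℤ) : ℝ)|) / N) ≤
        13 * (N : ℝ) ^ (5 / 6 : ℝ) := by
  have hNZ : (0 : ℤ) < N := by exact_mod_cast hN
  have hNR : (1 : ℝ) ≤ N := by exact_mod_cast hN
  have hM : 0 < Nat.sqrt N := Nat.sqrt_pos.2 hN
  choose v m hv hvM hcop hm using fun r : ℕ => exists_short_vector hNZ (-3 * r * g) hM
  refine ⟨v, m, fun r => ⟨hv r, hcop r⟩, ?_⟩
  set q := √(N : ℝ) with hq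
  have hqq : q * q = N := mul_self_sqrt (by linarith)
  have hq1 : 1 ≤ q := one_le_sqrt.2 hNR
  have hMq : (Nat.sqrt N : ℝ) ≤ q := nat_sqrt_le_real_sqrt
  have hqM : q ≤ Nat.sqrt N + 1 := real_sqrt_le_nat_sqrt_succ
  have hv' : ∀ r, (v r : ℝ) ≤ q := fun r => le_trans (by exact_mod_cast hvM r) hMq
  have hm' : ∀ r, |((-3 * r * g * v r + N * m r : ℤ) : ℝ)| ≤ q := fun r => by
    have h1 := hm r
    push_cast at h1 ⊢
    refine h1.trans ?_
    rw [div_le_iff₀ (by positivity)]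
    nlinarith
  set T : ℝ := (N : ℝ) ^ (1 / 6 : ℝ) with hT
  have hT1 : 1 ≤ T := one_le_rpow hNR (by norm_num)
  have e1 : (N : ℝ) = T * N ^ (5 / 6 : ℝ) := by
    rw [hT, ← rpow_add (by linarith)]; norm_num
  have e2 : q * T ^ 2 = N ^ (5 / 6 : ℝ) := by
    rw [hT, hq, sqrt_eq_rpow, ← rpow_natCast, ← rpow_mul (by linarith),
      ← rpow_add (by linarith)]; norm_num
  have e3 : q ≤ N ^ (5 / 6 : ℝ) := by rw [← e2]; nlinarith
  set bad := (range N).filter fun r => (v r : ℝ) ≤ T with hbad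
  have hbadcard : (bad.card : ℝ) ≤ 9 * (q * T ^ 2) := by
    have hsub : bad ⊆ (Icc 1 ⌊T⌋₊).biUnion fun t => (Icc (-(⌊q⌋₊ : ℤ)) ⌊q⌋₊).biUnion fun j =>
        (range N).filter fun r : ℕ => (N : ℤ) ∣ (-3 * (t : ℤ) * g) * (r : ℤ) - j := by
      intro r hr
      simp only [hbad, mem_filter] at hr
      simp only [mem_biUnion, mem_filter]
      refine ⟨(v r).toNat, ?_, -3 * r * g * v r + N * m r, ?_, hr.1, ?_⟩
      · have h1 : (((v r).toNat : ℕ) : ℤ) = v r := Int.toNat_of_nonneg (hv r).le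
        rw [mem_Icc]
        refine ⟨by have := hv r; omega, Nat.le_floor ?_⟩
        have h2 : (((v r).toNat : ℕ) : ℝ) = v r := by exact_mod_cast h1
        rw [h2]; exact hr.2
      · rw [mem_Icc, ← abs_le]
        have h3 := hm' r
        have h4 : ((-3 * r * g * v r + N * m r).natAbs : ℝ) = |((-3 * r * g * v r + N * m r : ℤ) : ℝ)| := by
          rw [Nat.cast_natAbs, Int.cast_abs]
        rw [← h4] at h3
        have h5 := Nat.le_floor h3
        rw [Int.abs_eq_natAbs]
        exact_mod_cast h5
      · rw [Int.toNat_of_nonneg (hv r).le]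
        exact ⟨-m r, by ring⟩
    have h1 : ∀ t ∈ Icc 1 ⌊T⌋₊, ∀ j : ℤ,
        (((range N).filter fun r : ℕ => (N : ℤ) ∣ (-3 * (t : ℤ) * g) * (r : ℤ) - j).card : ℝ) ≤ 3 * T := by
      intro t ht j
      rw [mem_Icc] at ht
      have h2 := card_linear_congr_le hN (-3 * t * g) j
      have h3 : Int.gcd (-3 * t * g) N ≤ 3 * t := by
        have h4 : Int.gcd (-3 * t * g) N ∣ 3 * t := by
          have h5 : ((Int.gcd (-3 * t * g) N : ℕ) : ℤ) ∣ -3 * t * g := Int.gcd_dvd_left _ _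
          have h6 : ((Int.gcd (-3 * t * g) N : ℕ) : ℤ) ∣ N := Int.gcd_dvd_right _ _
          have h7 : IsCoprime ((Int.gcd (-3 * t * g) N : ℕ) : ℤ) g := (hg.of_isCoprime_of_dvd_right h6).symm
          have h8 := h7.dvd_of_dvd_mul_right h5
          rw [neg_mul, dvd_neg] at h8
          exact_mod_cast h8
        exact Nat.le_of_dvd (by omega) h4
      have h9 : (t : ℝ) ≤ T := (Nat.cast_le.2 ht.2).trans (Nat.floor_le (by linarith))
      calc _ ≤ ((3 * t : ℕ) : ℝ) := by exact_mod_cast h2.trans h3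
        _ ≤ 3 * T := by push_cast; linarith
    have h2 : (bad.card : ℝ) ≤ ∑ t ∈ Icc 1 ⌊T⌋₊, ∑ j ∈ Icc (-(⌊q⌋₊ : ℤ)) ⌊q⌋₊,
        (((range N).filter fun r : ℕ => (N : ℤ) ∣ (-3 * (t : ℤ) * g) * (r : ℤ) - j).card : ℝ) := by
      have := (card_le_card hsub).trans (card_biUnion_le.trans
        (sum_le_sum fun t _ => card_biUnion_le))
      exact_mod_cast this
    refine h2.trans ?_
    calc _ ≤ ∑ t ∈ Icc 1 ⌊T⌋₊, ∑ j ∈ Icc (-(⌊q⌋₊ : ℤ)) ⌊q⌋₊, 3 * T :=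
          sum_le_sum fun t ht => sum_le_sum fun j _ => h1 t ht j
      _ = ⌊T⌋₊ * ((2 * ⌊q⌋₊ + 1) * (3 * T)) := by
          simp only [sum_const, Nat.card_Icc, Int.card_Icc, nsmul_eq_mul]
          rw [show ((⌊q⌋₊ : ℤ) + 1 - -(⌊q⌋₊ : ℤ)).toNat = 2 * ⌊q⌋₊ + 1 by omega]
          push_cast; simp
      _ ≤ T * ((2 * q + q) * (3 * T)) := by
          have i1 := Nat.floor_le (show 0 ≤ T by linarith)
          have i2 := Nat.floor_le (show 0 ≤ q by linarith)
          gcongr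
      _ = _ := by ring
  have hsum1 : ∑ r ∈ range N, 1 / (v r : ℝ) ≤ 10 * (N : ℝ) ^ (5 / 6 : ℝ) := by
    have h1 : ∀ r ∈ range N, 1 / (v r : ℝ) ≤ 1 / T + if (v r : ℝ) ≤ T then 1 else 0 := by
      intro r _
      have h2 : (1 : ℝ) ≤ v r := by exact_mod_cast hv r
      split_ifs with h
      · have : 0 ≤ 1 / T := by positivity
        have : 1 / (v r : ℝ) ≤ 1 := by rw [div_le_one (by linarith)]; exact h2
        linarith
      · rw [add_zero]
        exact one_div_le_one_div_of_le (by linarith) (not_le.1 h).le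
    refine (sum_le_sum h1).trans ?_
    rw [sum_add_distrib, sum_const, card_range, nsmul_eq_mul, sum_boole]
    have h2 : (N : ℝ) * (1 / T) = N ^ (5 / 6 : ℝ) := by
      rw [mul_one_div, div_eq_iff (by linarith), mul_comm]; exact e1
    rw [h2]
    have := hbadcard
    rw [e2] at this
    linarith
  have hsum2 : ∑ r ∈ range N, ((v r : ℝ) + |((-3 * r * g * v r + N * m r : ℤ) : ℝ)|) / N ≤
      2 * (N : ℝ) ^ (5 / 6 : ℝ) := by
    calc _ ≤ ∑ r ∈ range N, (q + q) / N := by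
          refine sum_le_sum fun r _ => ?_
          gcongr
          exacts [hv' r, hm' r]
      _ = 2 * q := by
          rw [sum_const, card_range, nsmul_eq_mul]; field_simp; ring
      _ ≤ _ := by linarith
  rw [sum_add_distrib]
  have : 0 ≤ (N : ℝ) ^ (5 / 6 : ℝ) := by positivity
  linarith

end

section
open MeasureTheory
open Finset ArithmeticFunction

theorem sum_moebius_coprime {N : ℕ} (hN : 0 < N) (x : ℤ) :
    ∑ k ∈ N.divisors, (if (k : ℤ) ∣ x then (moebius k : ℝ) else 0) =
      if IsCoprime x N then 1 else 0 := by
  have h1 : N.divisors.filter (fun k : ℕ => (k : ℤ) ∣ x) = (Int.gcd x N).divisors := by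
    ext k
    simp only [mem_filter, Nat.mem_divisors, ne_eq, Int.gcd_eq_zero_iff, not_and]
    constructor
    · rintro ⟨⟨h1, h2⟩, h3⟩
      refine ⟨?_, fun _ => by omega⟩
      have := Int.dvd_coe_gcd h3 (show (k : ℤ) ∣ (N : ℤ) by exact_mod_cast h1)
      exact_mod_cast this
    · rintro ⟨h1, -⟩
      have h2 : (k : ℤ) ∣ (Int.gcd x N : ℤ) := by exact_mod_cast h1
      refine ⟨⟨?_, by omega⟩, h2.trans (Int.gcd_dvd_left _ _)⟩
      exact_mod_cast h2.trans (Int.gcd_dvd_right _ _)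
  rw [← sum_filter, h1]
  simp only [Int.isCoprime_iff_gcd_eq_one]
  have h2 : ∑ i ∈ (Int.gcd x N).divisors, moebius i = if Int.gcd x N = 1 then 1 else 0 := by
    rw [← coe_mul_zeta_apply, moebius_mul_coe_zeta,
      one_apply]
  have h3 := congrArg (Int.cast : ℤ → ℝ) h2
  push_cast at h3
  exact h3

theorem ncard_coprime {α : Type*} {A : Set α} (hA : A.Finite) (φ : α → ℤ) {N : ℕ} (hN : 0 < N) :
    ({x | x ∈ A ∧ IsCoprime (φ x) N}.ncard : ℝ) =
      ∑ k ∈ N.divisors, (moebius k : ℝ) * {x | x ∈ A ∧ (k : ℤ) ∣ φ x}.ncard := by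
  have key : ∀ (P : α → Prop) [DecidablePred P], ({x | x ∈ A ∧ P x}.ncard : ℝ) = ∑ x ∈ hA.toFinset, if P x then 1 else 0 := by
    intro P _
    rw [sum_boole, ← Set.ncard_coe_finset]
    congr 2
    ext x; simp
  simp_rw [key, mul_sum]
  rw [sum_comm]
  refine sum_congr rfl fun x _ => ?_
  rw [← sum_moebius_coprime hN]
  refine sum_congr rfl fun k _ => ?_
  split_ifs <;> simp

theorem exists_crt {m n : ℤ} (h : IsCoprime m n) (x y : ℤ) : ∃ z, m ∣ z - x ∧ n ∣ z - y := by
  obtain ⟨u, v, huv⟩ := h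
  refine ⟨x * (v * n) + y * (u * m), ⟨u * (y - x), ?_⟩, ⟨v * (x - y), ?_⟩⟩
  · linear_combination x * huv
  · linear_combination y * huv

theorem LineNice.affine {K : ℕ} {Ω : Set (ℝ × ℝ)} (h : LineNice K Ω) (x0 y0 s t : ℝ) :
    LineNice K {z : ℝ × ℝ | (x0 + s * z.1, y0 + t * z.2) ∈ Ω} := by
  intro x y α β
  have := h (x0 + s * x) (y0 + t * y) (s * α) (t * β)
  convert this using 3
  simp only [Set.mem_ofPred_eq]
  constructor <;> intro h <;> convert h using 2 <;> ring

theorem count_coset {Ω : Set (ℝ × ℝ)} (hΩ : MeasurableSet Ω) (hL : LineNice 10 Ω) {R : ℝ} (hR : 0 ≤ R)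
    (hbox : ∀ c d, (c, d) ∈ Ω → |c| ≤ R ∧ |d| ≤ R) {g h k N : ℤ} (hg : 0 < g) (hh : 0 < h) (hk : 0 < k)
    (hN : 0 < N) (h1 : IsCoprime (g * h) k) (h2 : IsCoprime (h * k) N) (a b γ δ r : ℤ)
    {r' v m : ℤ} (hr : N ∣ r - r') (hv : 0 < v) (hm : IsCoprime v m) :
    {p : ℤ × ℤ | ((p.1 : ℝ), (p.2 : ℝ)) ∈ Ω ∧ g * h ∣ p.1 - γ ∧ h ∣ p.2 - δ ∧
      k ∣ p.1 + 2 * b * r + a * r ^ 2 ∧ k * N ∣ p.2 + 3 * p.1 * r + 3 * b * r ^ 2 + a * r ^ 3}.Finite ∧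
    |({p : ℤ × ℤ | ((p.1 : ℝ), (p.2 : ℝ)) ∈ Ω ∧ g * h ∣ p.1 - γ ∧ h ∣ p.2 - δ ∧
      k ∣ p.1 + 2 * b * r + a * r ^ 2 ∧
      k * N ∣ p.2 + 3 * p.1 * r + 3 * b * r ^ 2 + a * r ^ 3}.ncard : ℝ) -
      volume.real Ω / (g * h ^ 2 * k ^ 2 * N)| ≤
      20 * (R / (h * k) * (1 / v + (v + |((-3 * r' * g * v + N * m : ℤ) : ℝ)|) / N) + 1) := by
  have hgR : (1 : ℝ) ≤ g := by exact_mod_cast hg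
  have hhR : (0 : ℝ) < h := by exact_mod_cast hh
  have hkR : (0 : ℝ) < k := by exact_mod_cast hk
  have hNR : (0 : ℝ) < N := by exact_mod_cast hN
  have hvR : (0 : ℝ) < v := by exact_mod_cast hv
  obtain ⟨c0, hc1, hc2⟩ := exists_crt h1 γ (-(2 * b * r + a * r ^ 2))
  obtain ⟨d0, hd1, hd2⟩ := exists_crt (h1.of_mul_left_right) δ (-(3 * c0 * r + 3 * b * r ^ 2 + a * r ^ 3))
  obtain ⟨w, w', hw⟩ := h2
  set Ω' : Set (ℝ × ℝ) := {z | ((c0 : ℝ) + (g * h * k) * z.1, (d0 : ℝ) + (h * k) * z.2) ∈ Ω} with hΩ'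
  have hm' : MeasurableSet Ω' := by
    refine measurableSet_preimage (f := fun z : ℝ × ℝ => ((c0 : ℝ) + (g * h * k) * z.1, (d0 : ℝ) + (h * k) * z.2)) (by fun_prop) hΩ
  have hL' : LineNice 10 Ω' := hL.affine _ _ _ _
  have hbox' : ∀ c d, (c, d) ∈ Ω' → |c - (-c0 / (g * h * k))| ≤ R / (h * k) ∧ |d - (-d0 / (h * k))| ≤ R / (h * k) := by
    intro c d hcd
    obtain ⟨i1, i2⟩ := hbox _ _ hcd
    constructor
    · have e : c - (-c0 / (g * h * k)) = (c0 + (g * h * k) * c) / (g * h * k) := by field_simp; ring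
      rw [e, abs_div, abs_of_pos (show (0 : ℝ) < g * h * k by positivity)]
      refine div_le_div₀ hR i1 (by positivity) ?_
      rw [mul_assoc]
      exact le_mul_of_one_le_left (by positivity) hgR
    · have e : d - (-d0 / (h * k)) = (d0 + (h * k) * d) / (h * k) := by field_simp; ring
      rw [e, abs_div, abs_of_pos (show (0 : ℝ) < h * k by positivity)]
      gcongr
  obtain ⟨σ, hσ⟩ : ∃ σ : ℤ, σ = -w * (d0 + 3 * c0 * r + 3 * b * r ^ 2 + a * r ^ 3) := ⟨_, rfl⟩
  have hcount := lattice_count hm' hL' (R := R / (h * k)) (by positivity) hbox' hN (-3 * r' * g) σ hv hm rfl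
  have hvol : volume.real Ω' = volume.real Ω / (g * h ^ 2 * k ^ 2) := by
    have := volume_real_preimage_affine Ω c0 d0 (p := g * h * k) (q := 0) (r := 0) (s := h * k)
      (by have : (0 : ℝ) < g * h * k * (h * k) := by positivity
          simpa using this.ne')
    simp only [zero_mul, add_zero, zero_add, mul_zero, sub_zero] at this
    rw [hΩ', this, abs_of_pos (by positivity), div_eq_inv_mul]
    congr 2
    ring
  set B := {p : ℤ × ℤ | ((p.1 : ℝ), (p.2 : ℝ)) ∈ Ω' ∧ N ∣ p.2 - -3 * r' * g * p.1 - σ} with hB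
  have himg : {p : ℤ × ℤ | ((p.1 : ℝ), (p.2 : ℝ)) ∈ Ω ∧ g * h ∣ p.1 - γ ∧ h ∣ p.2 - δ ∧
      k ∣ p.1 + 2 * b * r + a * r ^ 2 ∧ k * N ∣ p.2 + 3 * p.1 * r + 3 * b * r ^ 2 + a * r ^ 3} =
      (fun z : ℤ × ℤ => (c0 + (g * h * k) * z.1, d0 + (h * k) * z.2)) '' B := by
    ext ⟨c, d⟩
    simp only [Set.mem_ofPred_eq, Set.mem_image, hB, hΩ', Prod.exists, Prod.mk.injEq]
    have hcongr : ∀ c2 d2 : ℤ, (N ∣ d2 - -3 * r' * g * c2 - σ ↔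
        N ∣ (d0 + (h * k) * d2) + 3 * (c0 + (g * h * k) * c2) * r + 3 * b * r ^ 2 + a * r ^ 3) := by
      intro c2 d2
      obtain ⟨t, ht⟩ := hr
      have hr' : r = r' + N * t := by linarith
      have e1 : (d0 + (h * k) * d2) + 3 * (c0 + (g * h * k) * c2) * r + 3 * b * r ^ 2 + a * r ^ 3 =
          (h * k) * (d2 - -3 * r' * g * c2 - σ) + N * (3 * (g * h * k) * c2 * t +
            w' * (d0 + 3 * c0 * r + 3 * b * r ^ 2 + a * r ^ 3)) := by
        rw [hσ]
        have : (3 * (g * h * k) * c2) * r = (3 * (g * h * k) * c2) * (r' + N * t) := by rw [← hr']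
        linear_combination this - (d0 + 3 * c0 * r + 3 * b * r ^ 2 + a * r ^ 3) * hw
      rw [e1, dvd_add_left (dvd_mul_right _ _)]
      exact ⟨fun h => h.mul_left _, fun h => (show IsCoprime N _ from ⟨w', w, by linarith⟩).dvd_of_dvd_mul_left h⟩
    have hkN : IsCoprime k N := ⟨w * h, w', by linarith⟩
    constructor
    · rintro ⟨i1, i2, i3, i4, i5⟩
      have j1 : g * h ∣ c - c0 := by have := dvd_sub i2 hc1; rwa [sub_sub_sub_cancel_right] at this
      have j2 : k ∣ c - c0 := by
        have := dvd_sub i4 hc2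
        rwa [show c + 2 * b * r + a * r ^ 2 - (c0 - -(2 * b * r + a * r ^ 2)) = c - c0 by ring] at this
      obtain ⟨c2, hc⟩ := h1.mul_dvd j1 j2
      have j3 : h ∣ d - d0 := by have := dvd_sub i3 hd1; rwa [sub_sub_sub_cancel_right] at this
      have j4 : k ∣ d - d0 := by
        have := dvd_sub ((dvd_mul_right k N).trans i5) (hd2.add (j2.mul_left (3 * r)))
        rwa [show d + 3 * c * r + 3 * b * r ^ 2 + a * r ^ 3 -
          (d0 - -(3 * c0 * r + 3 * b * r ^ 2 + a * r ^ 3) + 3 * r * (c - c0)) = d - d0 by ring] at this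
      obtain ⟨d2, hd⟩ := h1.of_mul_left_right.mul_dvd j3 j4
      have k1 : c0 + g * h * k * c2 = c := by linarith
      have k2 : d0 + h * k * d2 = d := by linarith
      refine ⟨c2, d2, ⟨?_, ?_⟩, k1, k2⟩
      · rw [← k1, ← k2] at i1
        push_cast at i1
        exact i1
      · rw [hcongr, k1, k2]
        exact (dvd_mul_left N k).trans i5
    · rintro ⟨c2, d2, ⟨i1, i2⟩, rfl, rfl⟩
      rw [hcongr] at i2
      have j1 : k ∣ c0 + g * h * k * c2 + 2 * b * r + a * r ^ 2 := by
        have := hc2.add (show k ∣ g * h * k * c2 from ⟨g * h * c2, by ring⟩)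
        rwa [show c0 - -(2 * b * r + a * r ^ 2) + g * h * k * c2 = c0 + g * h * k * c2 + 2 * b * r + a * r ^ 2 by ring] at this
      refine ⟨?_, ?_, ?_, j1, hkN.mul_dvd ?_ i2⟩
      · push_cast; exact i1
      · have := hc1.add (show g * h ∣ g * h * k * c2 from ⟨k * c2, by ring⟩)
        rwa [show c0 - γ + g * h * k * c2 = c0 + g * h * k * c2 - γ by ring] at this
      · have := hd1.add (show h ∣ h * k * d2 from ⟨k * d2, by ring⟩)
        rwa [show d0 - δ + h * k * d2 = d0 + h * k * d2 - δ by ring] at this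
      · have := hd2.add (show k ∣ h * k * d2 + 3 * (g * h * k * c2) * r from ⟨h * d2 + 3 * (g * h * c2) * r, by ring⟩)
        rwa [show d0 - -(3 * c0 * r + 3 * b * r ^ 2 + a * r ^ 3) + (h * k * d2 + 3 * (g * h * k * c2) * r) =
          d0 + h * k * d2 + 3 * (c0 + g * h * k * c2) * r + 3 * b * r ^ 2 + a * r ^ 3 by ring] at this
  have hinj : Function.Injective (fun z : ℤ × ℤ => (c0 + (g * h * k) * z.1, d0 + (h * k) * z.2)) := by
    rintro ⟨x, y⟩ ⟨x', y'⟩ hxy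
    simp only [Prod.mk.injEq, add_right_inj] at hxy
    have n1 : g * h * k ≠ 0 := by positivity
    have n2 : h * k ≠ 0 := by positivity
    rw [Prod.mk.injEq]
    exact ⟨mul_left_cancel₀ n1 hxy.1, mul_left_cancel₀ n2 hxy.2⟩
  rw [himg, Set.ncard_image_of_injective _ hinj]
  refine ⟨hcount.1.image _, ?_⟩
  have := hcount.2
  rw [hvol, div_div] at this
  refine this.trans (le_of_eq ?_)
  push_cast
  field_simp
  ring

end

section
open MeasureTheory
open Finset ArithmeticFunction

theorem sum_range_mul_mod {f : ℕ → ℝ} (k N : ℕ) :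
    ∑ r ∈ range (k * N), f (r % N) = k * ∑ r ∈ range N, f r := by
  induction k with
  | zero => simp
  | succ k ih =>
    rw [add_mul, one_mul, sum_range_add, ih]
    have : ∑ x ∈ range N, f ((k * N + x) % N) = ∑ x ∈ range N, f x := by
      refine sum_congr rfl fun x hx => ?_
      rw [add_comm, Nat.add_mul_mod_self_right, Nat.mod_eq_of_lt (mem_range.1 hx)]
    rw [this]; push_cast; ring

/-- The density `φ(n)/n`, written as a divisor sum. -/
noncomputable def phiD (n : ℕ) : ℝ := ∑ k ∈ n.divisors, (moebius k : ℝ) / k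

/-- The points `(c, d)` of `Ω` in given congruence classes, meeting the overform conditions at `r`. -/
def CSet (Ω : Set (ℝ × ℝ)) (g h N a b γ δ r : ℤ) : Set (ℤ × ℤ) :=
  {p | ((p.1 : ℝ), (p.2 : ℝ)) ∈ Ω ∧ g * h ∣ p.1 - γ ∧ h ∣ p.2 - δ ∧
    N ∣ p.2 + 3 * p.1 * r + 3 * b * r ^ 2 + a * r ^ 3 ∧ IsCoprime (p.1 + 2 * b * r + a * r ^ 2) N}

theorem count_r {Ω : Set (ℝ × ℝ)} (hΩ : MeasurableSet Ω) (hL : LineNice 10 Ω) {R : ℝ} (hR : 0 ≤ R)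
    (hbox : ∀ c d, (c, d) ∈ Ω → |c| ≤ R ∧ |d| ≤ R) {g h : ℤ} {N : ℕ} (hg : 0 < g) (hh : 0 < h)
    (hN : Squarefree N) (hgh : IsCoprime (g * h) N) (a b γ δ : ℤ) :
    (∀ r : ℕ, (CSet Ω g h N a b γ δ r).Finite) ∧
    |(∑ r ∈ range N, ((CSet Ω g h N a b γ δ r).ncard : ℝ)) - phiD N * (volume.real Ω / (g * h ^ 2))| ≤
      N.divisors.card * (260 * (R / h * (N : ℝ) ^ (5 / 6 : ℝ)) + 20 * N) := by
  have hN0 : 0 < N := Nat.pos_of_ne_zero hN.ne_zero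
  have hhR : (0 : ℝ) < h := by exact_mod_cast hh
  have hgR : (0 : ℝ) < g := by exact_mod_cast hg
  set A : ℕ → Set (ℤ × ℤ) := fun r => {p : ℤ × ℤ | ((p.1 : ℝ), (p.2 : ℝ)) ∈ Ω ∧ g * h ∣ p.1 - γ ∧ h ∣ p.2 - δ ∧
    (N : ℤ) ∣ p.2 + 3 * p.1 * r + 3 * b * r ^ 2 + a * r ^ 3} with hA
  have hfact : ∀ k ∈ N.divisors, ∃ N' : ℕ, N = k * N' ∧ 0 < k ∧ 0 < N' ∧ IsCoprime (g * h) (k : ℤ) ∧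
      IsCoprime (h * k) (N' : ℤ) ∧ IsCoprime g (N' : ℤ) := by
    intro k hk
    obtain ⟨N', hN'⟩ := Nat.dvd_of_mem_divisors hk
    have hk0 : 0 < k := Nat.pos_of_ne_zero (by rintro rfl; simp at hN'; omega)
    have hN'0 : 0 < N' := Nat.pos_of_ne_zero (by rintro rfl; simp at hN'; omega)
    have h1 : IsCoprime (g * h) (k : ℤ) := hgh.of_isCoprime_of_dvd_right ⟨N', by exact_mod_cast hN'⟩
    have h2 : IsCoprime (g * h) (N' : ℤ) := hgh.of_isCoprime_of_dvd_right ⟨k, by rw [mul_comm]; exact_mod_cast hN'⟩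
    have h3 : IsCoprime (k : ℤ) (N' : ℤ) := by
      rw [Nat.isCoprime_iff_coprime]
      rw [hN'] at hN
      exact Nat.coprime_of_squarefree_mul hN
    exact ⟨N', hN', hk0, hN'0, h1, h2.of_mul_left_right.mul_left h3, h2.of_mul_left_left⟩
  have key : ∀ k ∈ N.divisors, (∀ r : ℕ, {x | x ∈ A r ∧ (k : ℤ) ∣ x.1 + 2 * b * r + a * r ^ 2}.Finite) ∧
      |∑ r ∈ range N, ({x | x ∈ A r ∧ (k : ℤ) ∣ x.1 + 2 * b * r + a * r ^ 2}.ncard : ℝ) -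
        1 / k * (volume.real Ω / (g * h ^ 2))| ≤ 260 * (R / h * (N : ℝ) ^ (5 / 6 : ℝ)) + 20 * N := by
    intro k hk
    obtain ⟨N', hN', hk0, hN'0, h1, h2, h3⟩ := hfact k hk
    have hkR : (0 : ℝ) < k := by exact_mod_cast hk0
    have hN'R : (0 : ℝ) < N' := by exact_mod_cast hN'0
    obtain ⟨v, m, hvm, hsum⟩ := exists_short_vectors hN'0 h3
    have hset : ∀ r : ℕ, {x | x ∈ A r ∧ (k : ℤ) ∣ x.1 + 2 * b * r + a * r ^ 2} =
        {p : ℤ × ℤ | ((p.1 : ℝ), (p.2 : ℝ)) ∈ Ω ∧ g * h ∣ p.1 - γ ∧ h ∣ p.2 - δ ∧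
      (k : ℤ) ∣ p.1 + 2 * b * r + a * r ^ 2 ∧ (k : ℤ) * N' ∣ p.2 + 3 * p.1 * r + 3 * b * r ^ 2 + a * r ^ 3} := by
      intro r; ext p
      simp only [hA, Set.mem_ofPred_eq]
      rw [show (N : ℤ) = k * N' by exact_mod_cast hN']
      tauto
    have hc : ∀ r : ℕ, _ := fun r => count_coset hΩ hL hR hbox hg hh (k := k) (N := N') (by exact_mod_cast hk0)
      (by exact_mod_cast hN'0) h1 h2 a b γ δ r (r' := ((r % N' : ℕ) : ℤ)) (v := v (r % N')) (m := m (r % N'))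
      (by push_cast; exact Int.dvd_self_sub_emod) (hvm _).1 (hvm _).2
    simp_rw [← hset] at hc
    refine ⟨fun r => (hc r).1, ?_⟩
    have e1 : 1 / k * (volume.real Ω / (g * h ^ 2)) =
        ∑ r ∈ range N, volume.real Ω / (g * h ^ 2 * (k : ℤ) ^ 2 * (N' : ℤ)) := by
      rw [sum_const, card_range, nsmul_eq_mul, hN']
      push_cast
      field_simp
    rw [e1, ← sum_sub_distrib]
    refine (abs_sum_le_sum_abs _ _).trans ((sum_le_sum fun r _ => (hc r).2).trans ?_)
    have e2 := sum_range_mul_mod (f := fun r => 20 * (R / (h * (k : ℤ)) * (1 / (v r : ℝ) +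
      (v r + |((-3 * r * g * v r + N' * m r : ℤ) : ℝ)|) / (N' : ℤ)) + 1)) k N'
    rw [← hN'] at e2
    refine (le_of_eq e2).trans ?_
    rw [← mul_sum, sum_add_distrib, ← mul_sum, sum_const, card_range,
      nsmul_eq_mul, mul_one]
    simp only [Int.cast_natCast] at hsum ⊢
    have e3 : R / (h * k) * ∑ r ∈ range N', (1 / (v r : ℝ) +
      (v r + |((-3 * r * g * v r + N' * m r : ℤ) : ℝ)|) / N') ≤ R / (h * k) * (13 * (N : ℝ) ^ (5 / 6 : ℝ)) := by
      refine mul_le_mul_of_nonneg_left (hsum.trans ?_) (by positivity)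
      have : (N' : ℝ) ≤ N := by
        rw [hN']; push_cast; exact le_mul_of_one_le_left hN'R.le (by exact_mod_cast hk0)
      gcongr
    calc _ ≤ (k : ℝ) * (20 * (R / (h * k) * (13 * (N : ℝ) ^ (5 / 6 : ℝ)) + N')) := by gcongr
      _ = 260 * (R / h * (N : ℝ) ^ (5 / 6 : ℝ)) + 20 * (k * N') := by field_simp; ring
      _ = _ := by rw [show (N : ℝ) = k * N' by exact_mod_cast hN']
  have hAfin : ∀ r, (A r).Finite := by
    intro r
    have := (key 1 (by simp [hN0.ne'])).1 r
    simpa using this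
  have hC : ∀ r : ℕ, CSet Ω g h N a b γ δ r = {x | x ∈ A r ∧ IsCoprime (x.1 + 2 * b * r + a * r ^ 2) (N : ℤ)} := by
    intro r; ext p; simp only [CSet, hA, Set.mem_ofPred_eq]; tauto
  refine ⟨fun r => by rw [hC]; exact (hAfin r).subset fun x hx => hx.1, ?_⟩
  have e1 : ∑ r ∈ range N, ((CSet Ω g h N a b γ δ r).ncard : ℝ) = ∑ k ∈ N.divisors,
      (moebius k : ℝ) * ∑ r ∈ range N,
        ({x | x ∈ A r ∧ (k : ℤ) ∣ x.1 + 2 * b * r + a * r ^ 2}.ncard : ℝ) := by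
    simp_rw [mul_sum]
    rw [sum_comm]
    refine sum_congr rfl fun r _ => ?_
    rw [hC, ncard_coprime (hAfin r) (fun x => x.1 + 2 * b * r + a * r ^ 2) hN0]
  rw [e1, phiD, sum_mul, ← sum_sub_distrib, ← nsmul_eq_mul, ← sum_const]
  refine (abs_sum_le_sum_abs _ _).trans (sum_le_sum fun k hk => ?_)
  rw [div_mul_eq_mul_div, mul_div_assoc, ← mul_sub, abs_mul]
  have h1 : |(moebius k : ℝ)| ≤ 1 := by
    rw [← Int.cast_abs]; exact_mod_cast abs_moebius_le_one
  have h2 := (key k hk).2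
  rw [one_div_mul_eq_div] at h2
  calc _ ≤ 1 * _ := mul_le_mul_of_nonneg_right h1 (abs_nonneg _)
    _ ≤ _ := by rw [one_mul]; exact h2

end

section
open MeasureTheory
open Finset TForm

theorem ncard_fiber {α β : Type*} {s : Set α} (φ : α → β) {T : Finset β} (hT : ∀ x ∈ s, φ x ∈ T)
    (hfin : ∀ t ∈ T, {x | x ∈ s ∧ φ x = t}.Finite) :
    s.Finite ∧ (s.ncard : ℝ) = ∑ t ∈ T, ({x | x ∈ s ∧ φ x = t}.ncard : ℝ) := by
  have hs : s.Finite := by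
    refine (T.finite_toSet.biUnion hfin).subset fun x hx => ?_
    simp only [Set.mem_iUnion]
    exact ⟨φ x, hT x hx, hx, rfl⟩
  refine ⟨hs, ?_⟩
  have h1 := card_eq_sum_card_fiberwise (s := hs.toFinset) (t := T) (f := φ)
    (fun x hx => hT x (by simpa using hx))
  rw [Set.ncard_eq_toFinset_card s hs, h1]
  push_cast
  refine sum_congr rfl fun t ht => ?_
  rw [← Set.ncard_coe_finset]
  congr 2
  ext x
  simp

theorem hDvd_class (a : ℤ) {h : ℕ} (hh : Squarefree h) :
    ∃ g h' : ℤ, 0 < g ∧ 0 < h' ∧ (h : ℤ) = g * h' ∧ g ∣ a ∧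
      (∀ b c d, HDvd h ⟨a, b, c, d⟩ → g ∣ b) ∧
      ∀ b, g ∣ b → ∃ γ δ : ℤ, ∀ c d, HDvd h ⟨a, b, c, d⟩ ↔ g * h' ∣ c - γ ∧ h' ∣ d - δ := by
  have hh0 : 0 < h := Nat.pos_of_ne_zero hh.ne_zero
  obtain ⟨h₁, hh₁⟩ : Int.gcd a h ∣ h := by exact_mod_cast Int.gcd_dvd_right a h
  set g : ℕ := Int.gcd a h with hg
  have hg0 : 0 < g := Nat.pos_of_ne_zero (by rintro h; rw [h] at hh₁; omega)
  have h₁0 : 0 < h₁ := Nat.pos_of_ne_zero (by rintro rfl; omega)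
  have hsq := hh
  rw [hh₁] at hsq
  have hcop : IsCoprime (g : ℤ) h₁ := by
    rw [Nat.isCoprime_iff_coprime]; exact Nat.coprime_of_squarefree_mul hsq
  have hgsq : Squarefree (g : ℤ) := by
    rw [Int.squarefree_natCast]; exact hsq.of_mul_left
  have hga : (g : ℤ) ∣ a := Int.gcd_dvd_left _ _
  have hah : IsCoprime a h₁ := by
    rw [Int.isCoprime_iff_gcd_eq_one]
    set q := Int.gcd a h₁ with hq
    have q1 : (q : ℤ) ∣ a := Int.gcd_dvd_left _ _
    have q2 : (q : ℤ) ∣ h₁ := Int.gcd_dvd_right _ _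
    have q3 : q ∣ g := Int.dvd_gcd q1 (by rw [hh₁]; push_cast; exact q2.mul_left _)
    have q4 : IsCoprime (q : ℤ) q := IsCoprime.of_isCoprime_of_dvd_left
      (hcop.of_isCoprime_of_dvd_right q2) (by exact_mod_cast q3)
    rw [isCoprime_self, Int.isUnit_iff] at q4
    omega
  have hdv : ∀ x : ℤ, (h : ℤ) ∣ x ↔ (g : ℤ) ∣ x ∧ (h₁ : ℤ) ∣ x := by
    intro x
    rw [hh₁]; push_cast
    exact ⟨fun h => ⟨(Dvd.intro _ rfl).trans h, (Dvd.intro_left _ rfl).trans h⟩, fun h => hcop.mul_dvd h.1 h.2⟩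
  have hbA : ∀ b c : ℤ, (h : ℤ) ∣ b ^ 2 - a * c → (g : ℤ) ∣ b := by
    intro b c h1
    have := dvd_add ((hdv _).1 h1).1 (hga.mul_right c)
    rw [sub_add_cancel] at this
    exact (hgsq.dvd_pow_iff_dvd two_ne_zero).1 this
  refine ⟨g, h₁, by exact_mod_cast hg0, by exact_mod_cast h₁0, by rw [hh₁]; push_cast; rfl, hga, ?_, ?_⟩
  · intro b c d hH
    exact hbA b c hH.1
  · intro b hgb
    obtain ⟨u, v, huv⟩ := hah
    obtain ⟨γ, hγ1, hγ2⟩ := exists_crt hcop 0 (u * b ^ 2)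
    rw [sub_zero] at hγ1
    refine ⟨γ, u ^ 2 * b ^ 3, fun c d => ?_⟩
    have hau : (h₁ : ℤ) ∣ u * a - 1 := ⟨-v, by linear_combination huv⟩
    have cancel : ∀ x, (h₁ : ℤ) ∣ a * x → (h₁ : ℤ) ∣ x := fun x hx =>
      (IsCoprime.symm ⟨u, v, huv⟩).dvd_of_dvd_mul_left hx
    constructor
    · rintro ⟨h1, h2, h3⟩
      simp only [hA, hB, hC, hdv] at h1 h2 h3
      have hgc : (g : ℤ) ∣ c := by
        have := dvd_add h3.1 (hgb.mul_right d)
        rw [sub_add_cancel] at this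
        exact (hgsq.dvd_pow_iff_dvd two_ne_zero).1 this
      have hc' : (h₁ : ℤ) ∣ c - u * b ^ 2 := by
        obtain ⟨t, ht⟩ := h1.2
        obtain ⟨s, hs⟩ := hau
        exact ⟨-(u * t) - s * c, by linear_combination (-u) * ht - c * hs⟩
      refine ⟨hcop.mul_dvd (dvd_sub hgc hγ1) ?_, ?_⟩
      · have := dvd_sub hc' hγ2
        rwa [sub_sub_sub_cancel_right] at this
      · obtain ⟨t, ht⟩ := h2.2
        obtain ⟨s, hs⟩ := hau
        obtain ⟨w, hw⟩ := hc'
        exact ⟨-(u * t) - s * d + u * b * w, by linear_combination (-u) * ht - d * hs + u * b * hw⟩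
    · rintro ⟨h1, h2⟩
      have hgc : (g : ℤ) ∣ c := by
        have := dvd_add ((Dvd.intro _ rfl).trans h1) hγ1
        rwa [sub_add_cancel] at this
      have hc' : (h₁ : ℤ) ∣ c - u * b ^ 2 := by
        have := dvd_add ((Dvd.intro_left _ rfl).trans h1) hγ2
        rwa [sub_add_sub_cancel] at this
      obtain ⟨s, hs⟩ := hau
      obtain ⟨w, hw⟩ := hc'
      obtain ⟨t, ht⟩ := h2
      have k1 : (h₁ : ℤ) ∣ b ^ 2 - a * c := ⟨-(a * w) - b ^ 2 * s, by
        linear_combination (-a) * hw - b ^ 2 * hs⟩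
      have k2 : (h₁ : ℤ) ∣ b * c - a * d := ⟨b * w - a * t - u * b ^ 3 * s, by
        linear_combination b * hw - a * ht - u * b ^ 3 * hs⟩
      have k3 : (h₁ : ℤ) ∣ c ^ 2 - b * d := by
        refine cancel _ ?_
        obtain ⟨p, hp⟩ := k1
        obtain ⟨q, hq⟩ := k2
        exact ⟨b * q - c * p, by linear_combination b * hq - c * hp⟩
      simp only [HDvd, hA, hB, hC, hdv]
      refine ⟨⟨?_, k1⟩, ⟨?_, k2⟩, ⟨?_, k3⟩⟩
      · exact dvd_sub (dvd_pow hgb two_ne_zero) (hga.mul_right _)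
      · exact dvd_sub (hgb.mul_right _) (hga.mul_right _)
      · exact dvd_sub (dvd_pow hgc two_ne_zero) (hgb.mul_right _)

theorem sum_inv_sq_le {P g : ℝ} (hP : 0 < P) (hg : 0 < g) (K : ℕ) :
    ∑ z ∈ Icc (-K : ℤ) K, 1 / (P ^ 2 + (g * z) ^ 2) ≤ 1 / P ^ 2 + 4 / (g * P) := by
  suffices h : ∑ z ∈ Icc (-K : ℤ) K, 1 / (P ^ 2 + (g * z) ^ 2) ≤
      1 / P ^ 2 + 4 / (g * P) - 4 / (g * (P + g * K)) from
    h.trans (sub_le_self _ (by positivity))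
  induction K with
  | zero => simp
  | succ K ih =>
    have e : Icc (-(K + 1 : ℕ) : ℤ) (K + 1 : ℕ) =
        insert (-(K + 1) : ℤ) (insert ((K : ℤ) + 1) (Icc (-K : ℤ) K)) := by
      ext z; simp only [mem_Icc, mem_insert]; push_cast; omega
    rw [e, sum_insert, sum_insert]
    · have h1 : 1 / (P ^ 2 + (g * (K + 1)) ^ 2) ≤ 2 / (g * (P + g * K)) - 2 / (g * (P + g * (K + 1))) := by
        rw [div_sub_div _ _ (by positivity) (by positivity), div_le_div_iff₀ (by positivity) (by positivity)]
        have h2 : 0 ≤ g * g * ((P - g * (K + 1)) ^ 2) + 2 * g * g * g * (P + g * (K + 1)) := by positivity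
        nlinarith [h2]
      push_cast at ih ⊢
      have e3 : (g * (-1 + -(K : ℝ))) ^ 2 = (g * (K + 1)) ^ 2 := by ring
      simp only [neg_add_rev, e3] at *
      have e4 : 4 / (g * (P + g * K)) = 2 * (2 / (g * (P + g * K))) := by ring
      have e5 : 4 / (g * (P + g * (K + 1))) = 2 * (2 / (g * (P + g * (K + 1)))) := by ring
      linarith
    · simp
    · simp only [mem_insert, mem_Icc]; omega

end

section
open MeasureTheory
open Finset ArithmeticFunction TForm

/-- Reduced forms of bounded discriminant meeting the overform conditions at `r`. -/
def XSet (st : Bool) (Y : ℝ) (h N e r : ℤ) : Set TForm :=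
  {f | f.Red st ∧ (f.D : ℝ) < Y ∧ f.HDvd h ∧ f.OvCond N e r}

theorem abs_phiD_le (n : ℕ) : |phiD n| ≤ n.divisors.card := by
  refine (abs_sum_le_sum_abs _ _).trans ?_
  rw [card_eq_sum_ones]; push_cast
  refine sum_le_sum fun k hk => ?_
  have hk0 : (1 : ℝ) ≤ k := by exact_mod_cast Nat.pos_of_mem_divisors hk
  rw [abs_div, div_le_one (by positivity), abs_of_pos (zero_lt_one.trans_le hk0), ← Int.cast_abs]
  have : |moebius k| ≤ 1 := abs_moebius_le_one
  exact le_trans (by exact_mod_cast this) hk0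

/-- Summing the areas over the second coefficient. -/
theorem sum_volume_coprime (st : Bool) {a B : ℝ} (ha : 0 < a) (hB : 0 < B) {g : ℤ} (hg : 0 < g) {e M : ℕ}
    (he : 0 < e) (hge : IsCoprime g (e : ℤ)) (hM : √(2 * (a ^ 2 * B ^ 3)) ≤ M) :
    |∑ b ∈ (Icc (-M : ℤ) M).filter (fun b : ℤ => g ∣ b ∧ IsCoprime b (e : ℤ)),
      volume.real (Om st a b (4 / 27 * (a ^ 2 * B ^ 3) ^ 2)) -
      phiD e * (Wmain st (a ^ 2 * B ^ 3) a / g)| ≤ e.divisors.card * (6 * (a ^ 2 * B ^ 3 * B)) := by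
  set S := a ^ 2 * B ^ 3 with hS
  set V : ℤ → ℝ := fun b => volume.real (Om st a b (4 / 27 * S ^ 2)) with hV
  have hgR : (0 : ℝ) < g := by exact_mod_cast hg
  have hzero : ∀ b : ℤ, V b ≠ 0 → b ^ 2 ≤ (M : ℤ) ^ 2 := by
    intro b hb
    by_contra hlt
    apply hb
    have : Om st a b (4 / 27 * S ^ 2) = ∅ := by
      refine Set.eq_empty_of_forall_notMem fun p hp => hlt ?_
      have h1 := (om_bounds (c := p.1) (d := p.2) ha hB hp).2.1
      have h2 := Real.sq_sqrt (show 0 ≤ 2 * S by positivity)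
      have h3 : √(2 * S) ^ 2 ≤ (M : ℝ) ^ 2 := by gcongr
      have : (b : ℝ) ^ 2 ≤ (M : ℝ) ^ 2 := by rw [hS] at h2 h3; linarith
      exact_mod_cast this
    simp only [hV, this, measureReal_empty]
  have e1 : ∑ b ∈ (Icc (-M : ℤ) M).filter (fun b : ℤ => g ∣ b ∧ IsCoprime b (e : ℤ)), V b =
      ∑ l ∈ e.divisors, (moebius l : ℝ) *
        ∑ b ∈ (Icc (-M : ℤ) M).filter (fun b : ℤ => g * l ∣ b), V b := by
    simp_rw [mul_sum, sum_filter]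
    rw [sum_comm]
    refine sum_congr rfl fun b _ => ?_
    by_cases hgb : g ∣ b
    · have h1 := sum_moebius_coprime he b
      have h2 : ∀ l ∈ e.divisors, (g * (l : ℤ) ∣ b ↔ (l : ℤ) ∣ b) := by
        intro l hl
        have hl' : (l : ℤ) ∣ e := by exact_mod_cast Nat.dvd_of_mem_divisors hl
        exact ⟨fun h => (Dvd.intro_left _ rfl).trans h,
          fun h => (hge.of_isCoprime_of_dvd_right hl').mul_dvd hgb h⟩
      rw [show (if g ∣ b ∧ IsCoprime b (e : ℤ) then V b else 0) = (if IsCoprime b (e : ℤ) then 1 else 0) * V b by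
        simp only [hgb, true_and, ite_mul, one_mul, zero_mul], ← h1, sum_mul]
      refine sum_congr rfl fun l hl => ?_
      simp only [h2 l hl, ite_mul, zero_mul]
    · rw [if_neg (fun h => hgb h.1)]
      symm
      refine sum_eq_zero fun l _ => ?_
      rw [if_neg (fun h => hgb ((Dvd.intro _ rfl).trans h))]
  have e2 : ∀ l ∈ e.divisors, ∑ b ∈ (Icc (-M : ℤ) M).filter (fun b : ℤ => g * l ∣ b), V b =
      ∑ z ∈ Icc (-(M + 1) : ℤ) (M + 1), volume.real (Om st a ((g * l : ℝ) * z) (4 / 27 * S ^ 2)) := by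
    intro l hl
    have hl0 : (0 : ℤ) < l := by exact_mod_cast Nat.pos_of_mem_divisors hl
    have hgl : 0 < g * l := mul_pos hg hl0
    refine sum_of_injOn (fun b => b / (g * l)) ?_ ?_ ?_ ?_
    · intro b hb b' hb' hbb
      have h1 := (mem_filter.1 hb).2
      have h2 := (mem_filter.1 hb').2
      exact (Int.ediv_left_inj h1 h2).1 hbb
    · intro b hb
      obtain ⟨h1, t, rfl⟩ := mem_filter.1 hb
      rw [mem_Icc] at h1
      simp only [Int.mul_ediv_cancel_left _ hgl.ne', coe_Icc, Set.mem_Icc]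
      constructor <;> nlinarith
    · intro z hz hzn
      have : V (g * l * z) = 0 := by
        by_contra hne
        have h1 := hzero _ hne
        apply hzn
        refine ⟨g * l * z, mem_coe.2 (mem_filter.2 ⟨mem_Icc.2 ?_, Dvd.intro _ rfl⟩),
          Int.mul_ediv_cancel_left _ hgl.ne'⟩
        exact abs_le.1 (abs_le_of_sq_le_sq h1 (by positivity))
      simpa only [hV, Int.cast_mul, Int.cast_natCast] using this
    · intro b hb
      obtain ⟨h1, t, rfl⟩ := mem_filter.1 hb
      simp only [Int.mul_ediv_cancel_left _ hgl.ne', hV, Int.cast_mul, Int.cast_natCast]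
  rw [e1, phiD, sum_mul, ← sum_sub_distrib, ← nsmul_eq_mul, ← sum_const]
  refine (abs_sum_le_sum_abs _ _).trans (sum_le_sum fun l hl => ?_)
  have hl0 : (1 : ℝ) ≤ l := by exact_mod_cast Nat.pos_of_mem_divisors hl
  have hg1 : (1 : ℝ) ≤ g := by exact_mod_cast hg
  rw [div_mul_eq_mul_div, mul_div_assoc, ← mul_sub, abs_mul, e2 l hl]
  have h1 : |(moebius l : ℝ)| ≤ 1 := by
    rw [← Int.cast_abs]; exact_mod_cast abs_moebius_le_one
  have h2 := sum_volume_om st ha hB (l := (g : ℝ) * l) (by positivity) (T := Icc (-(M + 1) : ℤ) (M + 1)) (by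
    intro t ht
    have h3 : |g * l * t| ≤ √(2 * S) := Real.abs_le_sqrt (by rw [hS]; linarith)
    have h4 : |t| ≤ |g * l * t| := by
      rw [abs_mul ((g : ℝ) * l) t]
      exact le_mul_of_one_le_left (abs_nonneg _)
        ((one_le_mul_of_one_le_of_one_le hg1 hl0).trans (le_abs_self _))
    have h5 := abs_le.1 (h4.trans (h3.trans hM))
    rw [mem_Icc]
    constructor
    · rw [Int.le_floor]; push_cast; linarith
    · have := Int.floor_le t
      have : ((⌊t⌋ : ℤ) : ℝ) ≤ ((M + 1 : ℤ) : ℝ) := by push_cast; linarith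
      exact_mod_cast this)
  rw [← hS] at h2
  have e3 : 4 / 9 * (S * √S) / (g * l) * Phi st (a / √S) = Wmain st S a / g / l := by
    rw [Wmain]; field_simp
  rw [e3] at h2
  calc _ ≤ 1 * _ := mul_le_mul_of_nonneg_right h1 (abs_nonneg _)
    _ ≤ _ := by rw [one_mul]; exact h2

set_option maxHeartbeats 1000000 in
/-- The count for a fixed leading coefficient. -/
theorem count_a (st : Bool) {a : ℕ} (ha : 0 < a) {B : ℝ} (hB : 1 / 3 ≤ B) {N e h : ℕ} (hea : e ∣ a)
    (hsq : Squarefree (e * N)) (hh : Squarefree h) (hhn : h.Coprime (e * N)) :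
    (∀ r ∈ range N, {f | f ∈ XSet st (4 / 27 * ((a : ℝ) ^ 2 * B ^ 3) ^ 2) h N e r ∧ f.a = a}.Finite) ∧
    |∑ r ∈ range N, ({f | f ∈ XSet st (4 / 27 * ((a : ℝ) ^ 2 * B ^ 3) ^ 2) h N e r ∧ f.a = a}.ncard : ℝ) -
      phiD N * phiD e * Wmain st ((a : ℝ) ^ 2 * B ^ 3) a / h ^ 2| ≤
    N.divisors.card * e.divisors.card * (182006 * ((a : ℝ) ^ 2 * B ^ 3 * B) * (N : ℝ) ^ (5 / 6 : ℝ) / h +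
      N * (60 * √((a : ℝ) ^ 2 * B ^ 3) + 60)) := by
  have hB0 : 0 < B := by linarith
  have haR : (0 : ℝ) < a := by exact_mod_cast ha
  have ha1 : (1 : ℝ) ≤ a := by exact_mod_cast ha
  set S := (a : ℝ) ^ 2 * B ^ 3 with hS
  have hS0 : 0 < S := by positivity
  set Y := 4 / 27 * S ^ 2 with hY
  have he0 : 0 < e := Nat.pos_of_dvd_of_pos hea ha
  have hNsq : Squarefree N := hsq.of_mul_right
  have hN0 : 0 < N := Nat.pos_of_ne_zero hNsq.ne_zero
  have hh0 : 0 < h := Nat.pos_of_ne_zero hh.ne_zero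
  obtain ⟨g, h', hg, hh', hgh, hga, hgb, hcl⟩ := hDvd_class (a : ℤ) hh
  have hhe : IsCoprime (h : ℤ) e := by
    rw [Nat.isCoprime_iff_coprime]; exact Nat.Coprime.coprime_mul_right_right hhn
  have hhN : IsCoprime (h : ℤ) N := by
    rw [Nat.isCoprime_iff_coprime]; exact Nat.Coprime.coprime_mul_left_right hhn
  have hge : IsCoprime g (e : ℤ) := hhe.of_isCoprime_of_dvd_left ⟨h', hgh⟩
  set M : ℕ := ⌈√(2 * S)⌉₊ with hM
  have hM1 : √(2 * S) ≤ M := Nat.le_ceil _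
  have hM2 : (M : ℝ) < √(2 * S) + 1 := Nat.ceil_lt_add_one (Real.sqrt_nonneg _)
  set T := (Icc (-M : ℤ) M).filter (fun b : ℤ => g ∣ b ∧ IsCoprime b (e : ℤ)) with hT
  choose! γ δ hγδ using hcl
  set Ω : ℤ → Set (ℝ × ℝ) := fun b => Om st a b Y with hΩ
  set R : ℤ → ℝ := fun b => 100 * ((a : ℝ) ^ 3 * B ^ 5 / ((a : ℝ) ^ 2 * B ^ 2 + (b : ℝ) ^ 2)) with hR
  have hRnn : ∀ b, 0 ≤ R b := fun b => by positivity
  have hcount : ∀ b : ℤ, _ := fun b => count_r (measurableSet_om st a b Y) (lineNice_om st a b Y) (hRnn b)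
    (fun c d hcd => ⟨(om_bounds haR hB0 hcd).2.2.1, (om_bounds haR hB0 hcd).2.2.2.1⟩) hg hh' hNsq
    (by rw [← hgh]; exact hhN) a b (γ b) (δ b)
  have hfib : ∀ b ∈ T, ∀ r : ℕ, {f | f ∈ {f | f ∈ XSet st Y h N e r ∧ f.a = a} ∧ f.b = b} =
      (fun p : ℤ × ℤ => (⟨a, b, p.1, p.2⟩ : TForm)) '' CSet (Ω b) g h' N a b (γ b) (δ b) r := by
    intro b hb r
    have hb' := (mem_filter.1 hb).2
    ext f
    obtain ⟨fa, fb, fc, fd⟩ := f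
    simp only [Set.mem_ofPred_eq, Set.mem_image, XSet, CSet, Prod.exists, TForm.mk.injEq, TForm.Red,
      cast_D, OvCond, shift_c, shift_d, hΩ, Om]
    constructor
    · rintro ⟨⟨⟨⟨h1, h2, h3⟩, h4, h5, h6, h7, h8, h9⟩, rfl⟩, rfl⟩
      have h2' : 0 < tdisc ((a : ℤ) : ℝ) fb fc fd := by
        have := cast_D ⟨(a : ℤ), fb, fc, fd⟩
        rw [← this]; exact_mod_cast h2
      have h10 := (hγδ _ hb'.1 fc fd).1 h5
      exact ⟨fc, fd, ⟨⟨h3, h2', h4⟩, h10.1, h10.2, h7, h8⟩, rfl, rfl, rfl, rfl⟩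
    · rintro ⟨c, d, ⟨⟨h1, h2, h3⟩, h4, h5, h6, h7⟩, rfl, rfl, rfl, rfl⟩
      have h2' : 0 < (⟨(a : ℤ), b, c, d⟩ : TForm).D := by
        have := TForm.cast_D ⟨(a : ℤ), b, c, d⟩
        have h3 : (0 : ℝ) < (⟨(a : ℤ), b, c, d⟩ : TForm).D := by rw [this]; exact h2
        exact_mod_cast h3
      exact ⟨⟨⟨⟨by exact_mod_cast ha, h2', h1⟩, h3, (hγδ _ hb'.1 c d).2 ⟨h4, h5⟩, by exact_mod_cast hea,
        h6, h7, hb'.2⟩, rfl⟩, rfl⟩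
  have hinj : ∀ b : ℤ, Function.Injective (fun p : ℤ × ℤ => (⟨a, b, p.1, p.2⟩ : TForm)) := by
    rintro b ⟨c, d⟩ ⟨c', d'⟩ hcd
    simp only [TForm.mk.injEq] at hcd
    exact Prod.ext hcd.2.2.1 hcd.2.2.2
  have hmem : ∀ r : ℕ, ∀ f ∈ {f | f ∈ XSet st Y h N e r ∧ f.a = a}, f.b ∈ T := by
    rintro r ⟨fa, fb, fc, fd⟩ ⟨⟨⟨h1, h2, h3⟩, h4, h5, h6⟩, rfl⟩
    have h2' : 0 < tdisc ((a : ℤ) : ℝ) fb fc fd := by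
      have := cast_D ⟨(a : ℤ), fb, fc, fd⟩
      rw [← this]; exact_mod_cast h2
    have h4' : tdisc ((a : ℤ) : ℝ) fb fc fd < Y := by
      have := cast_D ⟨(a : ℤ), fb, fc, fd⟩
      rw [← this]; exact_mod_cast h4
    have h7 : ((fc : ℝ), (fd : ℝ)) ∈ Om st a fb Y := ⟨h3, h2', h4'⟩
    have h8 := (om_bounds haR hB0 h7).2.1
    refine mem_filter.2 ⟨mem_Icc.2 (abs_le.1 ?_), hgb _ _ _ h5, h6.2.2.2⟩
    have h9 : |(fb : ℝ)| ≤ M := (Real.abs_le_sqrt (by rw [hS]; linarith)).trans hM1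
    exact_mod_cast h9
  have hcard : ∀ r : ℕ, _ := fun r => ncard_fiber (fun f : TForm => f.b) (hmem r) (by
    intro b hb
    show {f | f ∈ {f | f ∈ XSet st Y h N e r ∧ f.a = a} ∧ f.b = b}.Finite
    rw [hfib b hb r]
    exact ((hcount b).1 r).image _)
  refine ⟨fun r _ => (hcard r).1, ?_⟩
  have hsum : ∑ r ∈ range N, ({f | f ∈ XSet st Y h N e r ∧ f.a = a}.ncard : ℝ) =
      ∑ b ∈ T, ∑ r ∈ range N, ((CSet (Ω b) g h' N a b (γ b) (δ b) r).ncard : ℝ) := by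
    rw [sum_comm]
    refine sum_congr rfl fun r _ => ?_
    rw [(hcard r).2]
    refine sum_congr rfl fun b hb => ?_
    rw [hfib b hb r, Set.ncard_image_of_injective _ (hinj b)]
  have hgR : (0 : ℝ) < g := by exact_mod_cast hg
  have hh'R : (0 : ℝ) < h' := by exact_mod_cast hh'
  have hg1 : (1 : ℝ) ≤ g := by exact_mod_cast hg
  have hh'1 : (1 : ℝ) ≤ h' := by exact_mod_cast hh'
  have hN1 : (1 : ℝ) ≤ N := by exact_mod_cast hN0
  have hhR : (h : ℝ) = g * h' := by exact_mod_cast hgh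
  have hga' : (g : ℝ) ≤ a := by exact_mod_cast Int.le_of_dvd (by exact_mod_cast ha) hga
  have hN56 : (1 : ℝ) ≤ (N : ℝ) ^ (5 / 6 : ℝ) := Real.one_le_rpow hN1 (by norm_num)
  have hTcard : (T.card : ℝ) ≤ 3 * √S + 3 := by
    have h1 : (T.card : ℝ) ≤ 2 * M + 1 := by
      have : T.card ≤ (Icc (-M : ℤ) M).card := card_le_card (filter_subset _ _)
      rw [Int.card_Icc] at this
      have h2 : T.card ≤ 2 * M + 1 := by omega
      exact_mod_cast h2
    have h2 : √(2 * S) ≤ 3 / 2 * √S := by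
      rw [Real.sqrt_le_left (by positivity), mul_pow, Real.sq_sqrt hS0.le]; linarith
    linarith
  have hRsum : ∑ b ∈ T, R b ≤ 700 * (S * B) / g := by
    have h1 : ∑ b ∈ T, R b ≤ ∑ z ∈ Icc (-M : ℤ) M, R (g * z) := by
      have h2 : T ⊆ (Icc (-M : ℤ) M).image (fun z => g * z) := by
        intro b hb
        obtain ⟨h3, ⟨t, rfl⟩, _⟩ := mem_filter.1 hb
        rw [mem_Icc] at h3
        refine mem_image.2 ⟨t, mem_Icc.2 ⟨?_, ?_⟩, rfl⟩ <;> nlinarith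
      refine (sum_le_sum_of_subset_of_nonneg h2 fun _ _ _ => hRnn _).trans ?_
      rw [sum_image fun x _ y _ hxy => mul_left_cancel₀ hg.ne' hxy]
    have h2 := sum_inv_sq_le (P := a * B) (by positivity) hgR M
    have h3 : ∑ z ∈ Icc (-M : ℤ) M, R (g * z) =
        100 * ((a : ℝ) ^ 3 * B ^ 5) * ∑ z ∈ Icc (-M : ℤ) M, 1 / ((a * B) ^ 2 + ((g : ℝ) * z) ^ 2) := by
      rw [mul_sum]
      refine sum_congr rfl fun z _ => ?_
      simp only [hR]; push_cast; rw [mul_pow (a : ℝ) B 2]; ring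
    have h4 : 1 / (a * B) ^ 2 ≤ 3 / (g * (a * B)) := by
      rw [div_le_div_iff₀ (by positivity) (by positivity)]
      have : (g : ℝ) ≤ 3 * (a * B) := by nlinarith
      nlinarith [mul_le_mul_of_nonneg_right this (show 0 ≤ a * B by positivity)]
    rw [h3] at h1
    refine h1.trans ((mul_le_mul_of_nonneg_left (h2.trans (add_le_add_left h4 _)) (by positivity)).trans
      (le_of_eq ?_))
    rw [hS]; field_simp; ring
  have hV := sum_volume_coprime st haR hB0 hg he0 hge (M := M) hM1
  rw [hsum]
  have hmain : |∑ b ∈ T, phiD N * (volume.real (Ω b) / (g * h' ^ 2)) -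
      phiD N * phiD e * Wmain st S a / h ^ 2| ≤
      N.divisors.card * e.divisors.card * (6 * (S * B)) / h := by
    have e1 : ∑ b ∈ T, phiD N * (volume.real (Ω b) / (g * h' ^ 2)) - phiD N * phiD e * Wmain st S a / h ^ 2 =
        phiD N * ((∑ b ∈ T, volume.real (Ω b) - phiD e * (Wmain st S a / g)) / (g * h' ^ 2)) := by
      rw [← mul_sum, ← sum_div, hhR]; field_simp
    rw [e1, abs_mul, abs_div, abs_of_pos (show (0 : ℝ) < g * h' ^ 2 by positivity)]
    have h1 : (h : ℝ) ≤ g * h' ^ 2 := by rw [hhR]; nlinarith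
    have h2 : (0 : ℝ) < h := by exact_mod_cast hh0
    calc _ ≤ (N.divisors.card : ℝ) * (e.divisors.card * (6 * (S * B)) / h) := by
          gcongr
          exact abs_phiD_le N
      _ = _ := by ring
  have herr : |∑ b ∈ T, ∑ r ∈ range N, ((CSet (Ω b) g h' N a b (γ b) (δ b) r).ncard : ℝ) -
      ∑ b ∈ T, phiD N * (volume.real (Ω b) / (g * h' ^ 2))| ≤
      N.divisors.card * (182000 * (S * B) * (N : ℝ) ^ (5 / 6 : ℝ) / h + N * (60 * √S + 60)) := by
    rw [← sum_sub_distrib]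
    refine (abs_sum_le_sum_abs _ _).trans ((sum_le_sum fun b _ => (hcount b).2).trans ?_)
    rw [← mul_sum, sum_add_distrib, sum_const, nsmul_eq_mul, ← mul_sum,
      ← sum_mul, ← sum_div]
    refine mul_le_mul_of_nonneg_left (add_le_add ?_ ?_) (by positivity)
    · calc _ ≤ 260 * ((700 * (S * B) / g) / h' * (N : ℝ) ^ (5 / 6 : ℝ)) := by gcongr
        _ = _ := by rw [hhR]; field_simp; norm_num
    · calc _ ≤ (3 * √S + 3) * (20 * N) := by gcongr
        _ = _ := by ring
  have he1 : (1 : ℝ) ≤ e.divisors.card := by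
    exact_mod_cast card_pos.2 ⟨1, by simp [he0.ne']⟩
  have h2 : (0 : ℝ) < h := by exact_mod_cast hh0
  refine (abs_sub_le _ _ _).trans ((add_le_add herr hmain).trans ?_)
  have hX : (0 : ℝ) ≤ 182000 * (S * B) * (N : ℝ) ^ (5 / 6 : ℝ) / h + N * (60 * √S + 60) := by positivity
  have hX2 : (6 * (S * B)) / h ≤ 6 * (S * B) * (N : ℝ) ^ (5 / 6 : ℝ) / h := by
    exact div_le_div_of_nonneg_right (le_mul_of_one_le_right (by positivity) hN56) h2.le
  have hx : (0 : ℝ) ≤ N.divisors.card := Nat.cast_nonneg _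
  clear_value S Y T
  generalize (N.divisors.card : ℝ) = x at *
  generalize (e.divisors.card : ℝ) = y at *
  generalize (N : ℝ) ^ (5 / 6 : ℝ) = w at *
  have h3 := mul_le_mul_of_nonneg_left hX2 (mul_nonneg hx (zero_le_one.trans he1))
  have h4 := mul_le_mul_of_nonneg_right (le_mul_of_one_le_right hx he1) hX
  have h5 : x * y * (6 * (S * B)) / h = x * y * ((6 * (S * B)) / h) := by ring
  rw [h5]
  refine (add_le_add h4 h3).trans (le_of_eq ?_)
  ring

end

section
open MeasureTheory
open Finset Real

theorem sum_rpow_neg_two_thirds (K : ℕ) :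
    ∑ k ∈ Icc 1 K, (k : ℝ) ^ (-(2 / 3) : ℝ) ≤ 3 * (K : ℝ) ^ (1 / 3 : ℝ) := by
  induction K with
  | zero => simp
  | succ K ih =>
    rw [sum_Icc_succ_top (by omega)]
    obtain ⟨u, hu⟩ : ∃ u, u = ((K + 1 : ℕ) : ℝ) ^ (1 / 3 : ℝ) := ⟨_, rfl⟩
    obtain ⟨v, hv⟩ : ∃ v, v = (K : ℝ) ^ (1 / 3 : ℝ) := ⟨_, rfl⟩
    have hu0 : 0 < u := by rw [hu]; positivity
    have hv0 : 0 ≤ v := by rw [hv]; positivity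
    have hvu : v ≤ u := by rw [hu, hv]; gcongr; simp
    have hu3 : u ^ 3 = K + 1 := by
      rw [hu, ← rpow_natCast, ← rpow_mul (by positivity)]; norm_num
    have hv3 : v ^ 3 = K := by
      rw [hv, ← rpow_natCast, ← rpow_mul (by positivity)]; norm_num
    have h1 : ((K + 1 : ℕ) : ℝ) ^ (-(2 / 3) : ℝ) = (u ^ 2)⁻¹ := by
      rw [hu, ← rpow_natCast, ← rpow_mul (by positivity), ← rpow_neg (by positivity)]; norm_num
    have h2 : (u ^ 2)⁻¹ ≤ 3 * (u - v) := by
      rw [inv_le_iff_one_le_mul₀ (by positivity)]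
      nlinarith [mul_nonneg (sub_nonneg.2 hvu) (sub_nonneg.2 (mul_le_mul_of_nonneg_left hvu hu0.le)),
        mul_nonneg (sub_nonneg.2 hvu) (sub_nonneg.2 (mul_le_mul hvu hvu hv0 hu0.le))]
    rw [h1, ← hu]; rw [← hv] at ih; linarith

set_option maxHeartbeats 1000000 in
/-- The number of reduced forms of bounded discriminant with marked overform data. -/
theorem count_reduced (st : Bool) {S : ℝ} (hS : 1 ≤ S) {N e h : ℕ}
    (hsq : Squarefree (e * N)) (hh : Squarefree h) (hhn : h.Coprime (e * N)) :
    (∀ r ∈ range N, (XSet st (4 / 27 * S ^ 2) h N e r).Finite) ∧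
    |∑ r ∈ range N, ((XSet st (4 / 27 * S ^ 2) h N e r).ncard : ℝ) -
      phiD N * phiD e / h ^ 2 * (π ^ 2 / 27 * S ^ 2 / e +
        4 / 9 * kappa * (riemannZeta (1 / 3)).re * S ^ (5 / 3 : ℝ) * (e : ℝ) ^ (-(1 / 3) : ℝ))| ≤
    N.divisors.card * e.divisors.card * (1000000 * (S * √S) * ((e * N : ℕ) : ℝ) ^ (5 / 6 : ℝ) / h +
      480 * (e * N : ℕ) * S) := by
  have hS0 : 0 < S := by linarith
  have hs1 : 1 ≤ √S := one_le_sqrt.2 hS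
  have hss : √S * √S = S := mul_self_sqrt hS0.le
  have he0 : 0 < e := Nat.pos_of_ne_zero hsq.of_mul_left.ne_zero
  have hN0 : 0 < N := Nat.pos_of_ne_zero hsq.of_mul_right.ne_zero
  have hh0 : 0 < h := Nat.pos_of_ne_zero hh.ne_zero
  have heR : (1 : ℝ) ≤ e := by exact_mod_cast he0
  have hNR : (1 : ℝ) ≤ N := by exact_mod_cast hN0
  have hhR : (1 : ℝ) ≤ h := by exact_mod_cast hh0
  set Y := 4 / 27 * S ^ 2 with hY
  set B : ℝ → ℝ := fun a => (S / a ^ 2) ^ (1 / 3 : ℝ) with hB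
  have hBS : ∀ a : ℝ, 0 < a → a ^ 2 * B a ^ 3 = S := by
    intro a ha
    simp only [hB]
    rw [← rpow_natCast ((S / a ^ 2) ^ (1 / 3 : ℝ)), ← rpow_mul (by positivity)]
    norm_num
    field_simp
  have hBpos : ∀ a : ℝ, 0 < a → 0 < B a := fun a ha => by simp only [hB]; positivity
  set K := ⌊4 * √S / e⌋₊ with hK
  have hK1 : (K : ℝ) * e ≤ 4 * √S := by
    rw [← le_div_iff₀ (by positivity)]; exact Nat.floor_le (by positivity)
  have hK2 : 4 * √S < (K + 1 : ℕ) * e := by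
    rw [← div_lt_iff₀ (by positivity)]; push_cast; exact Nat.lt_floor_add_one _
  have hmem : ∀ r : ℕ, ∀ f ∈ XSet st Y h N e r, f.a ∈ (Icc 1 K).image (fun k : ℕ => ((k * e : ℕ) : ℤ)) := by
    rintro r ⟨fa, fb, fc, fd⟩ ⟨⟨h1, h2, h3⟩, h4, h5, h6⟩
    have h2' : 0 < tdisc (fa : ℝ) fb fc fd := by
      have := TForm.cast_D ⟨fa, fb, fc, fd⟩
      rw [← this]; exact_mod_cast h2
    have h4' : tdisc (fa : ℝ) fb fc fd < Y := by
      have := TForm.cast_D ⟨fa, fb, fc, fd⟩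
      rw [← this]; exact_mod_cast h4
    obtain ⟨k, hk⟩ : (e : ℤ) ∣ fa := h6.1
    have hfa : (0 : ℝ) < fa := by exact_mod_cast h1
    have h7 : ((fc : ℝ), (fd : ℝ)) ∈ Om st fa fb (4 / 27 * ((fa : ℝ) ^ 2 * B fa ^ 3) ^ 2) := by
      rw [hBS _ hfa]; exact ⟨h3, h2', h4'⟩
    have h8 := (om_bounds hfa (hBpos _ hfa) h7).1
    have h9 : (4 / 5 : ℝ) ^ 3 ≤ B fa ^ 3 := by gcongr
    have h10 : (fa : ℝ) ≤ 4 * √S := by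
      refine le_of_sq_le_sq ?_ (by positivity)
      rw [mul_pow, sq_sqrt hS0.le]
      have := hBS _ hfa
      nlinarith [mul_le_mul_of_nonneg_left h9 (sq_nonneg (fa : ℝ))]
    have hk0 : 0 < k := by
      have : 0 < (e : ℤ) * k := by rw [← hk]; exact h1
      exact (pos_iff_pos_of_mul_pos this).1 (by exact_mod_cast he0)
    refine mem_image.2 ⟨k.toNat, mem_Icc.2 ⟨by omega, ?_⟩, ?_⟩
    · refine Nat.le_floor ?_
      rw [le_div_iff₀ (by positivity)]
      have h11 : ((k.toNat : ℕ) : ℝ) = (k : ℝ) := by exact_mod_cast Int.toNat_of_nonneg hk0.le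
      rw [h11, mul_comm]
      calc _ = (fa : ℝ) := by rw [hk]; push_cast; rfl
        _ ≤ _ := h10
    · push_cast
      rw [Int.toNat_of_nonneg hk0.le, mul_comm]; exact hk.symm
  have hinj : Set.InjOn (fun k : ℕ => ((k * e : ℕ) : ℤ)) (Icc 1 K) := by
    intro x _ y _ hxy
    have hxy' : ((x * e : ℕ) : ℤ) = ((y * e : ℕ) : ℤ) := hxy
    have : x * e = y * e := by exact_mod_cast hxy'
    exact Nat.eq_of_mul_eq_mul_right he0 this
  have hc : ∀ k ∈ Icc 1 K, _ := fun k hk => count_a st (a := k * e)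
    (Nat.mul_pos (mem_Icc.1 hk).1 he0) (B := B (k * e : ℕ)) (by
      have hk0 : (0 : ℝ) < ((k * e : ℕ) : ℝ) := by exact_mod_cast Nat.mul_pos (mem_Icc.1 hk).1 he0
      by_contra hlt
      have h1 := hBS _ hk0
      have h2 : B (k * e : ℕ) ^ 3 ≤ (1 / 3) ^ 3 := by
        have := (hBpos _ hk0).le
        gcongr; linarith
      have h3 : ((k * e : ℕ) : ℝ) ≤ 4 * √S := by
        refine le_trans ?_ hK1; push_cast
        have : (k : ℝ) ≤ K := by exact_mod_cast (mem_Icc.1 hk).2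
        gcongr
      have h4 : ((k * e : ℕ) : ℝ) ^ 2 ≤ (4 * √S) ^ 2 := by gcongr
      rw [mul_pow, sq_sqrt hS0.le] at h4
      nlinarith [mul_le_mul_of_nonneg_left h2 (sq_nonneg ((k * e : ℕ) : ℝ))])
    (Dvd.intro_left _ rfl) hsq hh hhn
  have hBS' : ∀ k ∈ Icc 1 K, (((k * e : ℕ) : ℝ)) ^ 2 * B (k * e : ℕ) ^ 3 = S := fun k hk =>
    hBS _ (by exact_mod_cast Nat.mul_pos (mem_Icc.1 hk).1 he0)
  have hfinite : ∀ r ∈ range N, ∀ t ∈ (Icc 1 K).image (fun k : ℕ => ((k * e : ℕ) : ℤ)),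
      {f | f ∈ XSet st Y h N e r ∧ f.a = t}.Finite := by
    intro r hr t ht
    obtain ⟨k, hk, rfl⟩ := mem_image.1 ht
    have := (hc k hk).1 r hr
    rwa [hBS' k hk] at this
  have hcard : ∀ r ∈ range N, _ := fun r hr =>
    ncard_fiber (fun f : TForm => f.a) (hmem r) (hfinite r hr)
  refine ⟨fun r hr => (hcard r hr).1, ?_⟩
  have hsum : ∑ r ∈ range N, ((XSet st Y h N e r).ncard : ℝ) = ∑ k ∈ Icc 1 K,
      ∑ r ∈ range N, ({f | f ∈ XSet st Y h N e r ∧ f.a = (k * e : ℕ)}.ncard : ℝ) := by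
    rw [sum_comm]
    refine sum_congr rfl fun r hr => ?_
    rw [(hcard r hr).2, sum_image hinj]
  have hSB : ∑ k ∈ Icc 1 K, S * B (k * e : ℕ) ≤ 5 * (S * √S) := by
    have h1 : ∀ k ∈ Icc 1 K, S * B (k * e : ℕ) ≤
        S ^ (4 / 3 : ℝ) * (e : ℝ) ^ (-(2 / 3) : ℝ) * (k : ℝ) ^ (-(2 / 3) : ℝ) := by
      intro k hk
      have hk0 : (0 : ℝ) < k := by exact_mod_cast (mem_Icc.1 hk).1
      refine le_of_eq ?_
      simp only [hB]
      push_cast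
      rw [div_rpow hS0.le (by positivity), ← rpow_natCast, ← rpow_mul (by positivity),
        mul_rpow hk0.le (by positivity), show (4 / 3 : ℝ) = 1 + 1 / 3 by norm_num, rpow_add hS0,
        rpow_one, rpow_neg (by positivity), rpow_neg (by positivity)]
      norm_num
      field_simp
    refine (sum_le_sum h1).trans ?_
    rw [← mul_sum]
    have h2 : (K : ℝ) ^ (1 / 3 : ℝ) ≤ (4 * √S) ^ (1 / 3 : ℝ) * (e : ℝ) ^ (-(1 / 3) : ℝ) := by
      rw [rpow_neg (by positivity), ← inv_rpow (by positivity), ← mul_rpow (by positivity) (by positivity)]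
      gcongr
      rw [← div_eq_mul_inv, le_div_iff₀ (by positivity)]; exact hK1
    have h4 : (4 : ℝ) ^ (1 / 3 : ℝ) ≤ 5 / 3 := by
      rw [show (5 / 3 : ℝ) = ((5 / 3) ^ (3 : ℝ)) ^ (1 / 3 : ℝ) by
        rw [← rpow_mul (by norm_num)]; norm_num]
      gcongr; norm_num
    have h5 : S ^ (4 / 3 : ℝ) * √S ^ (1 / 3 : ℝ) = S * √S := by
      rw [sqrt_eq_rpow, ← rpow_mul hS0.le, ← rpow_add hS0]
      nth_rewrite 2 [← rpow_one S]
      rw [← rpow_add hS0]; norm_num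
    have h6 : (e : ℝ) ^ (-(2 / 3) : ℝ) * (e : ℝ) ^ (-(1 / 3) : ℝ) ≤ 1 := by
      rw [← rpow_add (by positivity)]
      exact rpow_le_one_of_one_le_of_nonpos heR (by norm_num)
    calc _ ≤ S ^ (4 / 3 : ℝ) * (e : ℝ) ^ (-(2 / 3) : ℝ) * (3 * ((4 * √S) ^ (1 / 3 : ℝ) * (e : ℝ) ^ (-(1 / 3) : ℝ))) := by
          refine mul_le_mul_of_nonneg_left ((sum_rpow_neg_two_thirds K).trans ?_) (by positivity)
          linarith
      _ = 3 * 4 ^ (1 / 3 : ℝ) * (S ^ (4 / 3 : ℝ) * √S ^ (1 / 3 : ℝ)) *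
          ((e : ℝ) ^ (-(2 / 3) : ℝ) * (e : ℝ) ^ (-(1 / 3) : ℝ)) := by
          rw [mul_rpow (by norm_num) (by positivity)]; ring
      _ ≤ 3 * (5 / 3) * (S * √S) * 1 := by
          rw [h5]; gcongr
      _ = _ := by ring
  have hW := sum_Wmain st hS0 he0 (K := K + 1) hK2.le
  have hWlast : Wmain st S ((K + 1 : ℕ) * e) = 0 := by
    rw [Wmain, Phi_eq_zero, mul_zero]
    rw [le_div_iff₀ (by positivity)]; exact hK2.le
  rw [sum_Icc_succ_top (by omega), hWlast, add_zero] at hW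
  have h1 : |∑ r ∈ range N, ((XSet st Y h N e r).ncard : ℝ) -
      phiD N * phiD e / h ^ 2 * ∑ k ∈ Icc 1 K, Wmain st S (k * e)| ≤
      N.divisors.card * e.divisors.card * (182006 * (5 * (S * √S)) * (N : ℝ) ^ (5 / 6 : ℝ) / h +
        K * (N * (60 * √S + 60))) := by
    rw [hsum, mul_sum, ← sum_sub_distrib]
    refine (abs_sum_le_sum_abs _ _).trans ?_
    have h2 : ∀ k ∈ Icc 1 K, |∑ r ∈ range N, ({f | f ∈ XSet st Y h N e r ∧ f.a = (k * e : ℕ)}.ncard : ℝ) -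
        phiD N * phiD e / h ^ 2 * Wmain st S (k * e)| ≤ N.divisors.card * e.divisors.card *
        (182006 * (S * B (k * e : ℕ)) * (N : ℝ) ^ (5 / 6 : ℝ) / h + N * (60 * √S + 60)) := by
      intro k hk
      have h3 := (hc k hk).2
      rw [hBS' k hk, ← hY] at h3
      rw [div_mul_eq_mul_div, ← Nat.cast_mul k e]
      exact h3
    refine (sum_le_sum h2).trans ?_
    rw [← mul_sum, sum_add_distrib, sum_const, Nat.card_Icc, add_tsub_cancel_right,
      nsmul_eq_mul, ← sum_div, ← sum_mul, ← mul_sum]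
    gcongr
  have h2 : |phiD N * phiD e / h ^ 2 * ∑ k ∈ Icc 1 K, Wmain st S (k * e) -
      phiD N * phiD e / h ^ 2 * (π ^ 2 / 27 * S ^ 2 / e +
        4 / 9 * kappa * (riemannZeta (1 / 3)).re * S ^ (5 / 3 : ℝ) * (e : ℝ) ^ (-(1 / 3) : ℝ))| ≤
      N.divisors.card * e.divisors.card * (11 * (S * √S) / h) := by
    rw [← mul_sub, abs_mul, abs_div, abs_mul, abs_of_pos (show (0 : ℝ) < h ^ 2 by positivity), ← sub_sub]
    have h3 : (h : ℝ) ≤ (h : ℝ) ^ 2 := by nlinarith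
    calc _ ≤ (N.divisors.card : ℝ) * e.divisors.card / h * (11 * (S * √S)) := by
          gcongr
          · exact abs_phiD_le N
          · exact abs_phiD_le e
      _ = _ := by ring
  refine (abs_sub_le _ _ _).trans ((add_le_add h1 h2).trans ?_)
  rw [← mul_add]
  refine mul_le_mul_of_nonneg_left ?_ (by positivity)
  have hNn : (N : ℝ) ≤ (e * N : ℕ) := by exact_mod_cast Nat.le_mul_of_pos_left N he0
  have h3 : (N : ℝ) ^ (5 / 6 : ℝ) ≤ ((e * N : ℕ) : ℝ) ^ (5 / 6 : ℝ) := by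
    exact rpow_le_rpow (by positivity) hNn (by norm_num)
  have h4 : (1 : ℝ) ≤ ((e * N : ℕ) : ℝ) ^ (5 / 6 : ℝ) :=
    one_le_rpow (by push_cast; exact one_le_mul_of_one_le_of_one_le heR hNR) (by norm_num)
  have h5 : (K : ℝ) * (N * (60 * √S + 60)) ≤ 480 * (e * N : ℕ) * S := by
    calc (K : ℝ) * (N * (60 * √S + 60)) ≤ (4 * √S) * (N * (120 * √S)) := by
          gcongr
          · exact le_trans (le_mul_of_one_le_right (by positivity) heR) hK1
          · linarith
      _ = 480 * N * (√S * √S) := by ring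
      _ ≤ 480 * (e * N : ℕ) * S := by
          rw [hss]
          exact mul_le_mul_of_nonneg_right (mul_le_mul_of_nonneg_left hNn (by norm_num)) hS0.le
  have h6 : 182006 * (5 * (S * √S)) * (N : ℝ) ^ (5 / 6 : ℝ) / h + 11 * (S * √S) / h ≤
      1000000 * (S * √S) * ((e * N : ℕ) : ℝ) ^ (5 / 6 : ℝ) / h := by
    rw [← add_div]
    refine div_le_div_of_nonneg_right ?_ (by positivity)
    have : 0 < S * √S := by positivity
    nlinarith [mul_le_mul_of_nonneg_left h3 this.le, mul_le_mul_of_nonneg_left h4 this.le]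
  linarith

end

section
open Finset TForm Set

theorem xSet_finite (st : Bool) (Y : ℝ) {h N e : ℕ} (hsq : Squarefree (e * N)) (hh : Squarefree h)
    (hhn : h.Coprime (e * N)) {r : ℕ} (hr : r < N) : (XSet st Y h N e r).Finite := by
  refine ((count_reduced st (S := max 1 (4 * |Y| + 4)) (le_max_left _ _) hsq hh hhn).1 r
    (mem_range.2 hr)).subset fun f hf => ⟨hf.1, hf.2.1.trans_le ?_, hf.2.2⟩
  have h1 := le_max_right 1 (4 * |Y| + 4)
  have h2 := le_abs_self Y
  have h3 := abs_nonneg Y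
  nlinarith

/-- The irreducible elements of `XSet`. -/
def XIrr (st : Bool) (Y : ℝ) (h N e r : ℤ) : Set TForm := {f | f ∈ XSet st Y h N e r ∧ f.Irred}

/-- Classes of irreducible forms of discriminant divisible by `n²`, with Hessian divisible by `h`
and prime to `n`. -/
def OSet (X : ℝ) (n h : ℤ) : Set (Quotient setoid) :=
  {o | ∃ g : TForm, ⟦g⟧ = o ∧ g.Irred ∧ 0 < g.D ∧ (g.D : ℝ) < X ∧ DDvd n g.D ∧
    (∀ p : ℤ, Prime p → p ∣ n → ¬ g.HDvd p) ∧ g.HDvd h}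

theorem oSet_subset {X : ℝ} {n h : ℕ} (hsq : Squarefree n) (hnh : h.Coprime n) :
    OSet X n h ⊆ ⋃ e ∈ n.divisors, ⋃ r ∈ range (n / e),
      (fun f => (⟦f.sub (n / e : ℕ) e r⟧ : Quotient setoid)) '' XIrr false (X / n ^ 2) h (n / e : ℕ) e r := by
  have hn0 : 0 < n := Nat.pos_of_ne_zero hsq.ne_zero
  rintro o ⟨g, rfl, hg, hD, hDX, hd, hc, hh⟩
  obtain ⟨N, e, f, r, hN, he, hNe, hr0, hrN, hf, hfi, hfh, hov, hgs⟩ := exists_sub (by exact_mod_cast hn0)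
    (by rw [Int.squarefree_natCast]; exact hsq) (h := h) (by rw [Nat.isCoprime_iff_coprime]; exact hnh.symm) hg hD hd hc hh
  lift N to ℕ using hN.le
  lift e to ℕ using he.le
  lift r to ℕ using hr0
  have hNe' : N * e = n := by exact_mod_cast hNe
  have he' : 0 < e := by exact_mod_cast he
  have hN' : n / e = N := by rw [← hNe', Nat.mul_div_cancel _ he']
  simp only [mem_iUnion]
  refine ⟨e, Nat.mem_divisors.2 ⟨Dvd.intro_left _ hNe', hn0.ne'⟩, r,
    mem_range.2 (by rw [hN']; exact_mod_cast hrN), f, ⟨⟨hf, ?_, hfh, by rw [hN']; exact hov⟩, hfi⟩, ?_⟩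
  · have h1 := D_eqv hgs
    rw [D_sub hN.ne' he.ne' hov.1 hov.2.1, hNe] at h1
    rw [lt_div_iff₀ (by positivity)]
    have h2 : ((f.D : ℤ) : ℝ) * (n : ℝ) ^ 2 = g.D := by
      rw [← h1]; push_cast; ring
    rw [h2]; exact hDX
  · rw [hN']; exact Quotient.sound hgs.symm

theorem xIrr_finite (st : Bool) (Y : ℝ) {h n e : ℕ} (hsq : Squarefree n) (hh : Squarefree h)
    (hhn : h.Coprime n) (he : e ∈ n.divisors) {r : ℕ} (hr : r ∈ range (n / e)) :
    (XIrr st Y h (n / e : ℕ) e r).Finite := by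
  have h1 : e * (n / e) = n := Nat.mul_div_cancel' (Nat.dvd_of_mem_divisors he)
  exact (xSet_finite st Y (by rw [h1]; exact hsq) hh (by rw [h1]; exact hhn) (mem_range.1 hr)).subset
    fun f hf => hf.1

theorem oSet_finite (X : ℝ) {n h : ℕ} (hsq : Squarefree n) (hh : Squarefree h) (hnh : h.Coprime n) :
    (OSet X n h).Finite := by
  refine Finite.subset ?_ (oSet_subset hsq hnh)
  exact Finite.biUnion (finite_toSet _) fun e he => Finite.biUnion (finite_toSet _) fun r hr =>
    (xIrr_finite false _ hsq hh hnh he hr).image _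

theorem ncard_oSet_le (X : ℝ) {n h : ℕ} (hsq : Squarefree n) (hh : Squarefree h) (hnh : h.Coprime n) :
    (OSet X n h).ncard ≤ ∑ e ∈ n.divisors, ∑ r ∈ range (n / e),
      (XIrr false (X / n ^ 2) h (n / e : ℕ) e r).ncard := by
  refine (ncard_le_ncard (oSet_subset hsq hnh) ?_).trans ?_
  · exact Finite.biUnion (finite_toSet _) fun e he => Finite.biUnion (finite_toSet _) fun r hr =>
      (xIrr_finite false _ hsq hh hnh he hr).image _
  refine (set_ncard_biUnion_le _ _).trans (sum_le_sum fun e he => ?_)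
  refine (set_ncard_biUnion_le _ _).trans (sum_le_sum fun r hr => ?_)
  exact ncard_image_le (xIrr_finite false _ hsq hh hnh he hr)

theorem le_ncard_oSet (X : ℝ) {n h : ℕ} (hsq : Squarefree n) (hh : Squarefree h) (hnh : h.Coprime n) :
    ∑ e ∈ n.divisors, ∑ r ∈ range (n / e), (XIrr true (X / n ^ 2) h (n / e : ℕ) e r).ncard ≤
      (OSet X n h).ncard := by
  have hn0 : 0 < n := Nat.pos_of_ne_zero hsq.ne_zero
  set F : ℕ → ℕ → Finset TForm := fun e r =>
    if hF : (XIrr true (X / n ^ 2) h (n / e : ℕ) e r).Finite then hF.toFinset else ∅ with hF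
  have hFm : ∀ e ∈ n.divisors, ∀ r ∈ range (n / e), ∀ f, f ∈ F e r ↔ f ∈ XIrr true (X / n ^ 2) h (n / e : ℕ) e r := by
    intro e he r hr f
    simp only [hF, dif_pos (xIrr_finite true _ hsq hh hnh he hr), Finite.mem_toFinset]
  have e1 : ∑ e ∈ n.divisors, ∑ r ∈ range (n / e), (XIrr true (X / n ^ 2) h (n / e : ℕ) e r).ncard =
      (n.divisors.sigma fun e => (range (n / e)).sigma fun r => F e r).card := by
    rw [card_sigma]
    refine sum_congr rfl fun e he => ?_
    rw [card_sigma]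
    refine sum_congr rfl fun r hr => ?_
    rw [← ncard_coe_finset]
    congr 1
    ext f
    rw [mem_coe, hFm e he r hr]
  rw [e1, ncard_eq_toFinset_card _ (oSet_finite X hsq hh hnh)]
  refine card_le_card_of_injOn (fun x => (⟦x.2.2.sub (n / x.1 : ℕ) x.1 x.2.1⟧ : Quotient setoid)) ?_ ?_
  · rintro ⟨e, r, f⟩ hx
    simp only [coe_sigma, mem_sigma_iff, mem_coe] at hx
    obtain ⟨he, hr, hf⟩ := hx
    rw [hFm e he r hr] at hf
    obtain ⟨⟨hf1, hf2, hf3, hf4⟩, hfi⟩ := hf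
    have he0 : 0 < e := Nat.pos_of_mem_divisors he
    have hNe : n / e * e = n := Nat.div_mul_cancel (Nat.dvd_of_mem_divisors he)
    have hN0 : 0 < n / e := Nat.pos_of_ne_zero (by intro h0; rw [h0] at hNe; omega)
    have hNeZ : ((n / e : ℕ) : ℤ) * e = n := by exact_mod_cast hNe
    have hN0' : ((n / e : ℕ) : ℤ) ≠ 0 := by exact_mod_cast hN0.ne'
    have he0' : (e : ℤ) ≠ 0 := by exact_mod_cast he0.ne'
    rw [mem_coe, Finite.mem_toFinset]
    have hDs := D_sub hN0' he0' hf4.1 hf4.2.1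
    rw [hNeZ] at hDs
    have hcop : IsCoprime ((n / e : ℕ) : ℤ) e := by
      rw [Nat.isCoprime_iff_coprime]; rw [← hNe] at hsq; exact Nat.coprime_of_squarefree_mul hsq
    refine ⟨_, rfl, irred_sub hN0' he0' hf4.1 hf4.2.1 hfi, ?_, ?_, ?_, ?_, hDvd_sub hN0' he0' hf4.1 hf4.2.1 hf3⟩
    · rw [hDs]; have := hf1.2.1; positivity
    · rw [hDs]; rw [lt_div_iff₀ (by positivity)] at hf2; push_cast; linarith
    · have := dDvd_sub hN0' he0' hf4.1 hf4.2.1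
      rwa [hNeZ] at this
    · intro p hp hpn
      exact not_hDvd_sub hcop hN0' he0' hf4 hp (by rw [hNeZ]; exact hpn)
  · rintro ⟨e, r, f⟩ hx ⟨e', r', f'⟩ hx' heq
    simp only [coe_sigma, mem_sigma_iff, mem_coe] at hx hx'
    obtain ⟨he, hr, hf⟩ := hx
    obtain ⟨he', hr', hf'⟩ := hx'
    rw [hFm e he r hr] at hf
    rw [hFm e' he' r' hr'] at hf'
    have aux : ∀ {e : ℕ}, e ∈ n.divisors → (0 : ℤ) < (n / e : ℕ) ∧ (0 : ℤ) < e ∧ ((n / e : ℕ) : ℤ) * e = n := by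
      intro e he
      have he0 : 0 < e := Nat.pos_of_mem_divisors he
      have hNe : n / e * e = n := Nat.div_mul_cancel (Nat.dvd_of_mem_divisors he)
      have hN0 : 0 < n / e := Nat.pos_of_ne_zero (by intro h0; rw [h0] at hNe; omega)
      exact ⟨by exact_mod_cast hN0, by exact_mod_cast he0, by exact_mod_cast hNe⟩
    obtain ⟨a1, a2, a3⟩ := aux he
    obtain ⟨b1, b2, b3⟩ := aux he'
    have := sub_inj (n := n) (by rw [Int.squarefree_natCast]; exact hsq) a1 a2 b1 b2 a3 b3
      (r := r) (r' := r') ⟨by positivity, by exact_mod_cast mem_range.1 hr⟩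
      ⟨by positivity, by exact_mod_cast mem_range.1 hr'⟩ hf.1.2.2.2 hf'.1.2.2.2 hf.1.1 hf'.1.1 (Quotient.exact heq)
    obtain ⟨rfl, h2, h3⟩ := this
    obtain rfl : e = e' := by exact_mod_cast h2
    obtain rfl : r = r' := by exact_mod_cast h3
    rfl

end

section SelmerCount

variable {A B : Type*} [CommGroup A] [CommGroup B] (p : B →* A)

/-- Pairs `(I, δ)` with `I ^ 3 = (δ)`. -/
def cubePairs : Subgroup (A × B) where
  carrier := {x | x.1 ^ 3 = p x.2}
  one_mem' := by simp
  mul_mem' := by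
    intro x y hx hy
    simp only [Set.mem_ofPred_eq, Prod.fst_mul, Prod.snd_mul, map_mul, mul_pow] at *
    rw [hx, hy]
  inv_mem' := by
    intro x hx
    simp only [Set.mem_ofPred_eq, Prod.fst_inv, Prod.snd_inv, map_inv, inv_pow] at *
    rw [hx]

lemma mem_cubePairs {x : A × B} : x ∈ cubePairs p ↔ x.1 ^ 3 = p x.2 := Iff.rfl

/-- The trivial pairs `((κ), κ ^ 3)`. -/
def trivPairs : Subgroup (cubePairs p) :=
  MonoidHom.range (G := B)
    { toFun := fun k => ⟨(p k, k ^ 3), by simp [mem_cubePairs]⟩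
      map_one' := by ext <;> simp
      map_mul' := by intro x y; ext <;> simp [mul_pow] }

lemma mem_trivPairs {x : cubePairs p} :
    x ∈ trivPairs p ↔ ∃ k : B, (p k, k ^ 3) = (x : A × B) := by
  simp only [trivPairs, MonoidHom.mem_range, MonoidHom.coe_mk, OneHom.coe_mk, Subtype.ext_iff]

lemma card_cubePairs_quotient (hU : Nat.card (p.ker ⧸ (powMonoidHom 3 : p.ker →* p.ker).range) = 3) :
    Nat.card (cubePairs p ⧸ trivPairs p) = 3 * Nat.card {x : A ⧸ p.range // x ^ 3 = 1} := by
  let φ : cubePairs p ⧸ trivPairs p →* A ⧸ p.range :=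
    QuotientGroup.lift _ ((QuotientGroup.mk' p.range).comp
      ((MonoidHom.fst A B).comp (cubePairs p).subtype)) (by
        intro x hx
        obtain ⟨k, hk⟩ := (mem_trivPairs p).1 hx
        change (QuotientGroup.mk (x : A × B).1 : A ⧸ p.range) = 1
        rw [QuotientGroup.eq_one_iff, ← hk]
        exact ⟨k, rfl⟩)
  let ψ : p.ker →* cubePairs p ⧸ trivPairs p :=
    (QuotientGroup.mk' _).comp
      { toFun := fun u => ⟨(1, u), by simp [mem_cubePairs, (MonoidHom.mem_ker).1 u.2]⟩
        map_one' := by ext <;> simp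
        map_mul' := by intro x y; ext <;> simp }
  have hφmk : ∀ x : cubePairs p, φ (QuotientGroup.mk x) = QuotientGroup.mk (x : A × B).1 :=
    fun x => rfl
  have hψmk : ∀ u : p.ker, ψ u = QuotientGroup.mk
      (⟨(1, u), by simp [mem_cubePairs, (MonoidHom.mem_ker).1 u.2]⟩ : cubePairs p) := fun u => rfl
  have hrange : (φ.range : Set (A ⧸ p.range)) = {x | x ^ 3 = 1} := by
    ext x
    simp only [SetLike.mem_coe, MonoidHom.mem_range, Set.mem_ofPred_eq]
    constructor
    · rintro ⟨y, rfl⟩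
      induction y using QuotientGroup.induction_on with
      | H y =>
        rw [hφmk, ← QuotientGroup.mk_pow, QuotientGroup.eq_one_iff, (mem_cubePairs p).1 y.2]
        exact ⟨_, rfl⟩
    · intro hx
      induction x using QuotientGroup.induction_on with
      | H x =>
        rw [← QuotientGroup.mk_pow, QuotientGroup.eq_one_iff] at hx
        obtain ⟨d, hd⟩ := hx
        exact ⟨QuotientGroup.mk ⟨(x, d), hd.symm⟩, rfl⟩
  have hker : φ.ker = ψ.range := by
    ext y
    rw [MonoidHom.mem_ker, MonoidHom.mem_range]
    constructor
    · induction y using QuotientGroup.induction_on with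
      | H y =>
        intro hy
        rw [hφmk, QuotientGroup.eq_one_iff] at hy
        obtain ⟨k, hk⟩ := hy
        have hy3 := (mem_cubePairs p).1 y.2
        refine ⟨⟨(k ^ 3)⁻¹ * (y : A × B).2, ?_⟩, ?_⟩
        · rw [MonoidHom.mem_ker, map_mul, map_inv, map_pow, hk, ← hy3, inv_mul_cancel]
        · rw [hψmk, QuotientGroup.eq, mem_trivPairs]
          refine ⟨k, ?_⟩
          ext <;> simp [hk]
    · rintro ⟨u, rfl⟩
      rw [hψmk, hφmk, QuotientGroup.eq_one_iff]
      exact one_mem _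
  have hkψ : ψ.ker = (powMonoidHom 3 : p.ker →* p.ker).range := by
    ext u
    rw [MonoidHom.mem_ker, hψmk, QuotientGroup.eq_one_iff, mem_trivPairs, MonoidHom.mem_range]
    constructor
    · rintro ⟨k, hk⟩
      simp only [Prod.mk.injEq] at hk
      exact ⟨⟨k, hk.1⟩, Subtype.ext hk.2⟩
    · rintro ⟨k, rfl⟩
      exact ⟨k, by simp [(MonoidHom.mem_ker).1 k.2]⟩
  rw [Subgroup.card_eq_card_quotient_mul_card_subgroup φ.ker,
    Nat.card_congr (QuotientGroup.quotientKerEquivRange φ).toEquiv, hker,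
    ← Nat.card_congr (QuotientGroup.quotientKerEquivRange ψ).toEquiv, hkψ, hU, mul_comm]
  congr 1
  change Nat.card (φ.range : Set (A ⧸ p.range)) = _
  rw [hrange]
  rfl

lemma card_unit_cubes {U : Type*} [CommGroup U] (φ : U →* Multiplicative ℤ)
    (hs : Function.Surjective φ) (hk : ∀ u, φ u = 1 → ∃ v, v ^ 3 = u) :
    Nat.card (U ⧸ (powMonoidHom 3 : U →* U).range) = 3 := by
  let χ : U →* Multiplicative (ZMod 3) :=
    (AddMonoidHom.toMultiplicative (Int.castAddHom (ZMod 3))).comp φ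
  have hχ : ∀ u, χ u = Multiplicative.ofAdd ((Multiplicative.toAdd (φ u) : ℤ) : ZMod 3) :=
    fun u => rfl
  have hsχ : Function.Surjective χ := by
    intro x
    obtain ⟨z, hz⟩ := ZMod.intCast_surjective (Multiplicative.toAdd x)
    obtain ⟨u, hu⟩ := hs (Multiplicative.ofAdd z)
    exact ⟨u, by rw [hχ, hu]; simp [hz]⟩
  have hkχ : χ.ker = (powMonoidHom 3 : U →* U).range := by
    ext u
    rw [MonoidHom.mem_ker, MonoidHom.mem_range, hχ]
    constructor
    · intro h
      have h0 : ((Multiplicative.toAdd (φ u) : ℤ) : ZMod 3) = 0 := h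
      rw [ZMod.intCast_zmod_eq_zero_iff_dvd] at h0
      obtain ⟨z, hz⟩ := h0
      obtain ⟨w, hw⟩ := hs (Multiplicative.ofAdd z)
      have : φ (u * (w ^ 3)⁻¹) = 1 := by
        rw [map_mul, map_inv, map_pow, hw, mul_inv_eq_one, ← ofAdd_toAdd (φ u), hz, ← ofAdd_nsmul]
        simp
      obtain ⟨v, hv⟩ := hk _ this
      refine ⟨v * w, ?_⟩
      rw [powMonoidHom_apply, mul_pow, hv, inv_mul_cancel_right]
    · rintro ⟨v, rfl⟩
      rw [powMonoidHom_apply, map_pow, toAdd_pow]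
      have : ((3 • Multiplicative.toAdd (φ v) : ℤ) : ZMod 3) = 0 := by
        rw [ZMod.intCast_zmod_eq_zero_iff_dvd, nsmul_eq_mul]
        exact dvd_mul_right _ _
      rw [this]
      rfl
  rw [← hkχ, Nat.card_congr (QuotientGroup.quotientKerEquivOfSurjective χ hsχ).toEquiv]
  simp

end SelmerCount

section
open Polynomial

open NumberField in
/-- `K = ℚ(θ)` with `θ ^ 2 = D`, `D` not a square. -/
structure IsQuad (K : Type*) [Field K] [NumberField K] (D : ℤ) (θ : K) : Prop where
  sq : θ * θ = D
  span : ∀ z : K, ∃ x y : ℚ, z = x + y * θ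
  nonsq : ¬ IsSquare D

namespace IsQuad

open NumberField

variable {K : Type*} [Field K] [NumberField K] {D : ℤ} {θ : K} (h : IsQuad K D θ)

include h

lemma eq_zero {x y : ℚ} (hxy : (x : K) + y * θ = 0) : x = 0 ∧ y = 0 := by
  by_cases hy : y = 0
  · subst hy
    simp only [Rat.cast_zero, zero_mul, add_zero, Rat.cast_eq_zero] at hxy
    exact ⟨hxy, rfl⟩
  · exfalso
    apply h.nonsq
    have hy' : (y : K) ≠ 0 := by exact_mod_cast hy
    have h1 : θ = ((-x / y : ℚ) : K) := by
      push_cast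
      field_simp
      linear_combination hxy
    have h2 := h.sq
    rw [h1] at h2
    have h3 : (-x / y) * (-x / y) = (D : ℚ) := by exact_mod_cast h2
    rw [← Rat.isSquare_intCast_iff]
    exact ⟨_, h3.symm⟩

lemma inj {x y x' y' : ℚ} (hxy : (x : K) + y * θ = x' + y' * θ) : x = x' ∧ y = y' := by
  have := h.eq_zero (x := x - x') (y := y - y') (by push_cast; linear_combination hxy)
  exact ⟨sub_eq_zero.1 this.1, sub_eq_zero.1 this.2⟩

/-- Coordinates give an isomorphism with the quadratic algebra. -/
lemma exists_equiv : ∃ e : QuadraticAlgebra ℚ (D : ℚ) 0 ≃ₐ[ℚ] K,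
    ∀ z, e z = (z.re : K) + z.im * θ := by
  let f : QuadraticAlgebra ℚ (D : ℚ) 0 →ₐ[ℚ] K := QuadraticAlgebra.lift ⟨θ, by
    rw [h.sq, Rat.smul_def]; simp⟩
  have hf : ∀ z, f z = (z.re : K) + z.im * θ := by
    intro z
    change z.re • (1 : K) + z.im • θ = _
    simp [Rat.smul_def]
  refine ⟨AlgEquiv.ofBijective f ⟨?_, ?_⟩, hf⟩
  · intro z w hzw
    rw [hf, hf] at hzw
    exact QuadraticAlgebra.ext (h.inj hzw).1 (h.inj hzw).2
  · intro z
    obtain ⟨x, y, hz⟩ := h.span z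
    exact ⟨⟨x, y⟩, by rw [hf, hz]⟩

lemma norm_eq (x y : ℚ) : Algebra.norm ℚ ((x : K) + y * θ) = x ^ 2 - D * y ^ 2 := by
  obtain ⟨e, he⟩ := h.exists_equiv
  have := he ⟨x, y⟩
  simp only at this
  rw [← this, Algebra.norm_eq_of_algEquiv, Algebra.norm_apply]
  have h2 := QuadraticAlgebra.det_toLinearMap_eq_norm (R := ℚ) (a := D) (b := 0) ⟨x, y⟩
  refine Eq.trans (congrArg LinearMap.det ?_) (h2.trans ?_)
  · ext w <;> simp
  · simp [QuadraticAlgebra.norm]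
    ring

lemma finrank_eq : Module.finrank ℚ K = 2 := by
  obtain ⟨e, he⟩ := h.exists_equiv
  rw [← e.toLinearEquiv.finrank_eq, Module.finrank_eq_card_basis (QuadraticAlgebra.basis (D : ℚ) 0)]
  simp

lemma exists_conj : ∃ σ : K →+* K, σ θ = -θ := by
  obtain ⟨e, he⟩ := h.exists_equiv
  let f : QuadraticAlgebra ℚ (D : ℚ) 0 →ₐ[ℚ] K := QuadraticAlgebra.lift ⟨-θ, by
    rw [neg_mul_neg, h.sq, Rat.smul_def]; simp⟩
  refine ⟨(f.comp e.symm.toAlgHom).toRingHom, ?_⟩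
  have : e.symm θ = ⟨0, 1⟩ := by
    rw [AlgEquiv.symm_apply_eq, he]; simp
  change f (e.symm θ) = -θ
  rw [this]
  change (0 : ℚ) • (1 : K) + (1 : ℚ) • (-θ) = -θ
  simp

lemma isIntegral_iff (hD : IsFundamentalDiscriminant D) (z : K) :
    IsIntegral ℤ z ↔ ∃ m n : ℤ, z = m + n * ((D + θ) / 2) := by
  have hD4 : (4 : ℤ) ∣ D * D - D := by
    rcases hD.2 with ⟨-, h1⟩ | ⟨m, rfl, -⟩
    · have : D * D - D = D * (D - 1) := by ring
      rw [this]
      exact Dvd.dvd.mul_left (by omega) _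
    · exact ⟨4 * m * m - m, by ring⟩
  constructor
  · intro hz
    obtain ⟨σ, hσ⟩ := h.exists_conj
    obtain ⟨x, y, rfl⟩ := h.span z
    have hσz : σ (x + y * θ) = x - y * θ := by simp [hσ, sub_eq_add_neg]
    have hz' : IsIntegral ℤ ((x : K) - y * θ) := by
      rw [← hσz]; exact hz.map (σ.toIntAlgHom)
    have ht : IsIntegral ℤ (2 * x : ℚ) := by
      rw [← isIntegral_algebraMap_iff (B := K) (algebraMap ℚ K).injective]
      have := hz.add hz'
      have e : algebraMap ℚ K (2 * x) = (x : K) + y * θ + (x - y * θ) := by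
        rw [eq_ratCast]; push_cast; ring
      rwa [e]
    have hn : IsIntegral ℤ (x * x - D * (y * y) : ℚ) := by
      rw [← isIntegral_algebraMap_iff (B := K) (algebraMap ℚ K).injective]
      have := hz.mul hz'
      have e : algebraMap ℚ K (x * x - D * (y * y)) = ((x : K) + y * θ) * (x - y * θ) := by
        rw [eq_ratCast]; push_cast
        linear_combination (y : K) ^ 2 * h.sq
      rwa [e]
    obtain ⟨u, hu⟩ := IsIntegrallyClosed.isIntegral_iff.1 ht
    obtain ⟨n, hn⟩ := IsIntegrallyClosed.isIntegral_iff.1 hn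
    simp only [algebraMap_int_eq, eq_intCast] at hu hn
    set v : ℚ := 2 * y with hv
    have hvD : (D : ℚ) * (v * v) = ((u * u - 4 * n : ℤ) : ℚ) := by
      push_cast; rw [hu, hn, hv]; ring
    obtain ⟨p, q, hq0, hcop, hpq⟩ : ∃ p q : ℤ, q ≠ 0 ∧ IsCoprime p q ∧ v * q = p :=
      ⟨v.num, v.den, by exact_mod_cast v.den_nz, Int.isCoprime_iff_gcd_eq_one.2 v.reduced,
        by exact_mod_cast Rat.mul_den_eq_num v⟩
    have h1 : D * (p * p) = (u * u - 4 * n) * (q * q) := by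
      have : (D : ℚ) * (p * p) = ((u * u - 4 * n : ℤ) : ℚ) * (q * q) := by
        rw [← hvD, ← hpq]; ring
      exact_mod_cast this
    have hqD : q * q ∣ D := by
      have : q * q ∣ D * (p * p) := ⟨u * u - 4 * n, by rw [h1]; ring⟩
      refine IsCoprime.dvd_of_dvd_mul_right ?_ this
      exact (IsCoprime.mul_left (hcop.symm.mul_right hcop.symm) (hcop.symm.mul_right hcop.symm))
    have hvint : ∃ w : ℤ, v = w := by
      have hq1 : IsUnit q := by
        rcases hD.2 with ⟨hs, -⟩ | ⟨m, hm, hs, hm4⟩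
        · exact hs q hqD
        · -- `q` divides `2`
          have hodd : ¬ (2 : ℤ) ∣ q := by
            rintro ⟨k, rfl⟩
            have hp : ¬ (2 : ℤ) ∣ p := by
              intro h2
              have := hcop.isUnit_of_dvd' h2 (dvd_mul_right _ _)
              exact absurd (Int.isUnit_iff.1 this) (by norm_num)
            have hmk : m * (p * p) = (u * u - 4 * n) * (k * k) := by
              rw [hm] at h1; linarith
            have hk : k * k ∣ m := by
              obtain ⟨w, hw⟩ := hqD
              exact ⟨w, by rw [hm] at hw; linarith⟩
            have hk1 : k * k = 1 := by
              rcases Int.isUnit_iff.1 (hs k hk) with rfl | rfl <;> rfl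
            rw [hk1, mul_one] at hmk
            obtain ⟨p', rfl⟩ : ∃ p', p = 2 * p' + 1 := ⟨p / 2, by omega⟩
            have : m = u * u - 4 * (n + m * (p' * p' + p')) := by linarith
            rcases Int.even_or_odd' u with ⟨u', rfl | rfl⟩
            · have : m = 4 * (u' * u' - (n + m * (p' * p' + p'))) := by linarith
              omega
            · have : m = 4 * (u' * u' + u' - (n + m * (p' * p' + p'))) + 1 := by linarith
              omega
          have : q * q ∣ m := by
            have h2 : IsCoprime (q * q) (4 : ℤ) := by
              have : IsCoprime q 2 := (Int.prime_two.coprime_iff_not_dvd.2 hodd).symm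
              have h4 : (4 : ℤ) = 2 * 2 := rfl
              rw [h4]
              exact IsCoprime.mul_left (this.mul_right this) (this.mul_right this)
            rw [hm] at hqD
            exact h2.dvd_of_dvd_mul_left hqD
          exact hs q this
      rcases Int.isUnit_iff.1 hq1 with rfl | rfl
      · exact ⟨p, by simpa using hpq⟩
      · exact ⟨-p, by push_cast at hpq ⊢; linarith⟩
    obtain ⟨w, hw⟩ := hvint
    have h2 : D * (w * w) = u * u - 4 * n := by
      rw [hw] at hvD; exact_mod_cast hvD
    have h3 : (2 : ℤ) ∣ u - w * D := by
      have : (2 : ℤ) ∣ (u - w * D) * (u - w * D) := by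
        obtain ⟨k, hk⟩ := hD4
        refine ⟨2 * n + D * (w * w) - u * w * D + 2 * k * (w * w), ?_⟩
        linear_combination (-1) * h2 + w * w * hk
      exact (Int.prime_two.dvd_or_dvd this).elim id id
    obtain ⟨m, hm⟩ := h3
    refine ⟨m, w, ?_⟩
    have hx : x = (2 * m + w * D) / 2 := by
      have : (u : ℚ) = 2 * m + w * D := by
        have : u = 2 * m + w * D := by linarith
        exact_mod_cast this
      rw [← this, hu]; ring
    have hy : y = w / 2 := by rw [← hw, hv]; ring
    rw [hx, hy]
    push_cast
    ring
  · rintro ⟨m, n, rfl⟩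
    have hω : IsIntegral ℤ (((D : K) + θ) / 2) := by
      obtain ⟨k, hk⟩ := hD4
      refine ⟨X ^ 2 - C D * X + C k, ?_, ?_⟩
      · monicity!
      · have hk' : (D : K) * D - D = 4 * k := by exact_mod_cast congrArg (Int.cast (R := K)) hk
        simp only [eval₂_add, eval₂_sub, eval₂_mul,
          eval₂_pow, eval₂_X, eval₂_C]
        simp only [algebraMap_int_eq, eq_intCast]
        linear_combination (1 / 4 : K) * h.sq - (1 / 4 : K) * hk'
    exact (isIntegral_algebraMap (R := ℤ) (x := m)).add
      ((isIntegral_algebraMap (R := ℤ) (x := n)).mul hω)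

end IsQuad

end

section
open Submodule Module Fintype Units

namespace IsQuad

open NumberField nonZeroDivisors

variable {K : Type*} [Field K] [NumberField K] {D : ℤ} {θ : K} (h : IsQuad K D θ)

include h

lemma exists_basis (hD : IsFundamentalDiscriminant D) : ∃ b : Module.Basis (Fin 2) ℤ (𝓞 K),
    (b 0 : K) = 1 ∧ (b 1 : K) = (D + θ) / 2 := by
  have hω : IsIntegral ℤ (((D : K) + θ) / 2) :=
    (h.isIntegral_iff hD _).2 ⟨0, 1, by simp⟩
  let ω : 𝓞 K := ⟨_, hω⟩
  have hωK : (ω : K) = (D + θ) / 2 := rfl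
  have hli : LinearIndependent ℤ ![(1 : 𝓞 K), ω] := by
    rw [LinearIndependent.pair_iff]
    intro s t hst
    have h1 := congrArg (fun z : 𝓞 K => (z : K)) hst
    simp only [zsmul_eq_mul, mul_one, map_add, map_intCast, map_mul, map_zero, hωK] at h1
    have h2 := h.eq_zero (x := s + t * D / 2) (y := t / 2) (by push_cast; linear_combination h1)
    have ht : t = 0 := by
      have := h2.2
      rw [div_eq_zero_iff] at this
      simpa using this
    subst ht
    have := h2.1
    simp only [Int.cast_zero, zero_mul, zero_div, add_zero, Int.cast_eq_zero] at this
    exact ⟨this, rfl⟩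
  have hsp : ⊤ ≤ Submodule.span ℤ (Set.range ![(1 : 𝓞 K), ω]) := by
    intro z _
    obtain ⟨m, n, hz⟩ := (h.isIntegral_iff hD (z : K)).1 z.2
    have : z = m • (1 : 𝓞 K) + n • ω := by
      apply RingOfIntegers.ext
      simp only [zsmul_eq_mul, mul_one, map_add, map_intCast, map_mul, hωK]
      exact hz
    rw [this]
    refine add_mem (smul_mem _ _ (subset_span ⟨0, rfl⟩))
      (smul_mem _ _ (subset_span ⟨1, rfl⟩))
  refine ⟨Basis.mk hli hsp, ?_, ?_⟩
  · rw [Basis.mk_apply]; simp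
  · rw [Basis.mk_apply]; exact hωK

lemma exists_ideal_basis (hD : IsFundamentalDiscriminant D) {σ : K →+* K} (hσ : σ θ = -θ)
    {I : (FractionalIdeal (𝓞 K)⁰ K)ˣ} {δ : Kˣ} (hI : I ^ 3 = toPrincipalIdeal (𝓞 K) K δ) :
    ∃ α β w : K, (∀ z, z ∈ (I : FractionalIdeal (𝓞 K)⁰ K) ↔ ∃ m n : ℤ, z = m * α + n * β) ∧
      (∀ m n : ℤ, (m : K) * α + n * β = 0 → m = 0 ∧ n = 0) ∧
      σ α * β - α * σ β = w * θ ∧ w ^ 3 = δ * σ δ := by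
  obtain ⟨b, hb0, hb1⟩ := h.exists_basis hD
  let ι := Free.ChooseBasisIndex ℤ (I : FractionalIdeal (𝓞 K)⁰ K)
  have hcard : card ι = card (Fin 2) := by
    rw [← finrank_eq_card_chooseBasisIndex, fractionalIdeal_rank, RingOfIntegers.rank,
      h.finrank_eq, card_fin]
  let bI := (fractionalIdealBasis K (I : FractionalIdeal (𝓞 K)⁰ K)).reindex
    (equivOfCardEq hcard)
  obtain ⟨x₁, y₁, h1⟩ := h.span (bI 0 : K)
  obtain ⟨x₂, y₂, h2⟩ := h.span (bI 1 : K)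
  have hmem : ∀ z : K, z ∈ (I : FractionalIdeal (𝓞 K)⁰ K) ↔
      ∃ m n : ℤ, z = m * (bI 0 : K) + n * (bI 1 : K) := by
    intro z
    constructor
    · intro hz
      have := bI.sum_repr ⟨z, hz⟩
      rw [Fin.sum_univ_two] at this
      refine ⟨bI.repr ⟨z, hz⟩ 0, bI.repr ⟨z, hz⟩ 1, ?_⟩
      have h3 := congrArg Subtype.val this
      simpa [zsmul_eq_mul] using h3.symm
    · rintro ⟨m, n, rfl⟩
      have h3 : (m • bI 0 + n • bI 1 : (I : FractionalIdeal (𝓞 K)⁰ K)).1 =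
        m * (bI 0 : K) + n * (bI 1 : K) := by simp [zsmul_eq_mul]
      rw [← h3]
      exact (m • bI 0 + n • bI 1).2
  have hli : ∀ m n : ℤ, (m : K) * (bI 0 : K) + n * (bI 1 : K) = 0 → m = 0 ∧ n = 0 := by
    intro m n hmn
    have h3 := bI.linearIndependent
    have h4 : LinearIndependent ℤ ![bI 0, bI 1] := by
      convert h3
      ext i; fin_cases i <;> rfl
    rw [LinearIndependent.pair_iff] at h4
    apply h4
    apply Subtype.ext
    simpa [zsmul_eq_mul] using hmn
  set b' := Basis.localizationLocalization ℚ (nonZeroDivisors ℤ) K b with hb'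
  have hb'0 : b' 0 = 1 := by rw [hb', Basis.localizationLocalization_apply, ← hb0]
  have hb'1 : b' 1 = (D + θ) / 2 := by rw [hb', Basis.localizationLocalization_apply, ← hb1]
  have hrepr : ∀ x y : ℚ, b'.repr (x + y * θ) 0 = x - D * y ∧ b'.repr (x + y * θ) 1 = 2 * y := by
    intro x y
    have : (x : K) + y * θ = (x - D * y : ℚ) • b' 0 + (2 * y) • b' 1 := by
      rw [hb'0, hb'1, Rat.smul_def, Rat.smul_def]; push_cast; ring
    rw [this]
    simp
  have hdet : b'.det (Subtype.val ∘ bI) = 2 * (x₁ * y₂ - x₂ * y₁) := by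
    rw [Basis.det_apply, Matrix.det_fin_two]
    simp only [Basis.toMatrix_apply, Function.comp_apply]
    rw [h1, h2, (hrepr _ _).1, (hrepr _ _).1, (hrepr _ _).2, (hrepr _ _).2]
    ring
  have habs := FractionalIdeal.abs_det_basis_change b (I : FractionalIdeal (𝓞 K)⁰ K) bI
  rw [← hb', hdet] at habs
  set w : ℚ := 2 * (x₁ * y₂ - x₂ * y₁) with hw
  obtain ⟨s, t, hst⟩ := h.span (δ : K)
  have hN : |w| ^ 3 = |s ^ 2 - D * t ^ 2| := by
    rw [habs, ← map_pow, ← val_pow_eq_pow_val, hI, coe_toPrincipalIdeal,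
      FractionalIdeal.absNorm_span_singleton, hst, h.norm_eq]
  have hNδ : (δ : K) * σ δ = ((s ^ 2 - D * t ^ 2 : ℚ) : K) := by
    rw [hst]
    simp only [map_add, map_mul, map_ratCast, hσ]
    push_cast
    linear_combination -(t : K) ^ 2 * h.sq
  have hwθ : σ (bI 0 : K) * (bI 1 : K) - (bI 0 : K) * σ (bI 1 : K) = (w : K) * θ := by
    rw [h1, h2, hw]
    simp only [map_add, map_mul, map_ratCast, hσ]
    push_cast
    ring
  have h3 : w ^ 3 = s ^ 2 - D * t ^ 2 ∨ (-w) ^ 3 = s ^ 2 - D * t ^ 2 := by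
    rw [← abs_pow, abs_eq_abs] at hN
    rcases hN with hN | hN
    · exact Or.inl hN
    · right; rw [Odd.neg_pow (by decide), hN, neg_neg]
  rcases h3 with h3 | h3
  · exact ⟨_, _, w, hmem, hli, hwθ, by rw [hNδ, ← h3]; push_cast; rfl⟩
  · refine ⟨bI 1, bI 0, (-w : ℚ), fun z => ?_, fun m n hmn => ?_, ?_, ?_⟩
    · rw [hmem]
      constructor
      · rintro ⟨m, n, rfl⟩; exact ⟨n, m, by ring⟩
      · rintro ⟨m, n, rfl⟩; exact ⟨n, m, by ring⟩
    · rw [add_comm] at hmn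
      exact (hli _ _ hmn).symm
    · push_cast; linear_combination (-1 : K) * hwθ
    · rw [hNδ, ← h3]; push_cast; rfl

omit h in
lemma card_units_quotient (hfin : Module.finrank ℚ K = 2) (ρ : K →+* ℝ) :
    Nat.card ((𝓞 K)ˣ ⧸ (powMonoidHom 3 : (𝓞 K)ˣ →* (𝓞 K)ˣ).range) = 3 := by
  have hplace : 0 < InfinitePlace.nrRealPlaces K := by
    rw [InfinitePlace.nrRealPlaces, card_pos_iff]
    let φ : K →+* ℂ := (Complex.ofRealHom).comp ρ
    refine ⟨⟨InfinitePlace.mk φ, ?_⟩⟩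
    refine ⟨φ, ?_, rfl⟩
    rw [ComplexEmbedding.isReal_iff]
    ext z
    simp [φ]
  have hrank : Units.rank K = 1 := by
    have h1 := InfinitePlace.card_add_two_mul_card_eq_rank K
    have h2 := InfinitePlace.card_eq_nrRealPlaces_add_nrComplexPlaces K
    rw [Units.rank, h2]
    omega
  let i : Fin (Units.rank K) := ⟨0, by omega⟩
  have hi : ∀ j, j = i := by
    intro j; apply Fin.ext; have := j.2; omega
  set ε := Units.fundSystem K i with hε
  have hprod : ∀ e : Fin (Units.rank K) → ℤ, ∏ j, Units.fundSystem K j ^ e j = ε ^ e i := by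
    intro e
    exact prod_eq_single i (fun j hj => absurd (hi j) hj)
  have hex : ∀ x : (𝓞 K)ˣ, ∃ e : ℤ, ∃ ζ ∈ Units.torsion K, x = ζ * ε ^ e := by
    intro x
    obtain ⟨⟨ζ, e⟩, h1, -⟩ := Units.exist_unique_eq_mul_prod K x
    simp only [hprod] at h1
    exact ⟨e i, ζ, ζ.2, h1⟩
  have huniq : ∀ (e e' : ℤ) (ζ ζ' : (𝓞 K)ˣ), ζ ∈ Units.torsion K → ζ' ∈ Units.torsion K →
      ζ * ε ^ e = ζ' * ε ^ e' → e = e' := by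
    intro e e' ζ ζ' hζ hζ' heq
    obtain ⟨y, -, h2⟩ := Units.exist_unique_eq_mul_prod K (ζ * ε ^ e)
    have h3 := h2 (⟨ζ, hζ⟩, fun _ => e) (by simp only [hprod])
    have h4 := h2 (⟨ζ', hζ'⟩, fun _ => e') (by simp only [hprod]; exact heq)
    have h5 := h3.trans h4.symm
    simp only [Prod.mk.injEq] at h5
    exact congrFun h5.2 i
  choose e ζ hζ hx using hex
  let φ : (𝓞 K)ˣ →* Multiplicative ℤ := MonoidHom.mk' (fun u => Multiplicative.ofAdd (e u)) (by
    intro u v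
    rw [← ofAdd_add]
    congr 1
    apply huniq _ _ (ζ (u * v)) (ζ u * ζ v) (hζ _) (mul_mem (hζ _) (hζ _))
    rw [← hx, zpow_add, mul_mul_mul_comm, ← hx, ← hx])
  apply card_unit_cubes φ
  · intro z
    refine ⟨ε ^ (Multiplicative.toAdd z), ?_⟩
    change Multiplicative.ofAdd (e _) = z
    rw [← huniq (Multiplicative.toAdd z) (e (ε ^ (Multiplicative.toAdd z))) 1 (ζ _) (one_mem _)
      (hζ _) (by rw [← hx, one_mul])]
    rfl
  · intro u hu
    have h1 : e u = 0 := hu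
    have h2 : u ∈ Units.torsion K := by
      have h3 := hx u
      rw [h1, zpow_zero, mul_one] at h3
      rw [h3]; exact hζ u
    rw [Units.torsion, CommGroup.mem_torsion,
      isOfFinOrder_iff_pow_eq_one] at h2
    obtain ⟨n, hn, hun⟩ := h2
    have h3 : (ρ ((u : 𝓞 K) : K)) ^ n = 1 := by
      have := congrArg (fun v : (𝓞 K)ˣ => ρ ((v : 𝓞 K) : K)) hun
      simpa using this
    have h4 : ρ ((u : 𝓞 K) : K) ^ 2 = 1 := by
      have h5 : |ρ ((u : 𝓞 K) : K)| ^ n = 1 := by rw [← abs_pow, h3, abs_one]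
      have h6 := (pow_eq_one_iff_of_nonneg (abs_nonneg _) hn.ne').1 h5
      rw [← sq_abs, h6, one_pow]
    refine ⟨u, ?_⟩
    apply Units.ext
    apply RingOfIntegers.ext
    apply ρ.injective
    push_cast
    simp only [map_pow]
    linear_combination (ρ ((u : 𝓞 K) : K)) * h4

end IsQuad

end

section
open TForm FractionalIdeal

namespace TForm

/-- First coefficient of the cubic covariant. -/
def G0 (f : TForm) : ℤ := f.a ^ 2 * f.d - 3 * f.a * f.b * f.c + 2 * f.b ^ 3
/-- Second coefficient of the cubic covariant. -/
def G1 (f : TForm) : ℤ := f.a * f.b * f.d - 2 * f.a * f.c ^ 2 + f.b ^ 2 * f.c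
/-- Third coefficient of the cubic covariant. -/
def G2 (f : TForm) : ℤ := -(f.a * f.c * f.d - 2 * f.b ^ 2 * f.d + f.b * f.c ^ 2)
/-- Fourth coefficient of the cubic covariant. -/
def G3 (f : TForm) : ℤ := -(f.a * f.d ^ 2 - 3 * f.b * f.c * f.d + 2 * f.c ^ 3)

variable {K : Type*} [Field K]

/-- First coefficient of `(G + θ f) / 2`. -/
def g0 (f : TForm) (θ : K) : K := (f.G0 + f.a * θ) / 2
/-- Second coefficient of `(G + θ f) / 2`. -/
def g1 (f : TForm) (θ : K) : K := (f.G1 + f.b * θ) / 2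
/-- Third coefficient of `(G + θ f) / 2`. -/
def g2 (f : TForm) (θ : K) : K := (f.G2 + f.c * θ) / 2
/-- Fourth coefficient of `(G + θ f) / 2`. -/
def g3 (f : TForm) (θ : K) : K := (f.G3 + f.d * θ) / 2

section
variable [CharZero K] {f : TForm} {θ : K} (hθ : θ * θ = f.D)
include hθ

lemma g1_sq : f.g1 θ * f.g1 θ = f.g0 θ * f.g2 θ := by
  simp only [D, tdisc] at hθ
  simp only [g0, g1, g2, G0, G1, G2]
  push_cast at hθ ⊢
  linear_combination ((f.b : K) ^ 2 - f.a * f.c) / 4 * hθ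

lemma g0_mul_g3 : f.g0 θ * f.g3 θ = f.g1 θ * f.g2 θ := by
  simp only [D, tdisc] at hθ
  simp only [g0, g1, g2, g3, G0, G1, G2, G3]
  push_cast at hθ ⊢
  linear_combination ((f.a : K) * f.d - f.b * f.c) / 4 * hθ

lemma g0_mul_conj : f.g0 θ * f.g0 (-θ) = (f.hA : K) ^ 3 := by
  simp only [D, tdisc] at hθ
  simp only [g0, G0, hA]
  push_cast at hθ ⊢
  linear_combination -(f.a : K) ^ 2 / 4 * hθ

lemma g3_mul_conj : f.g3 θ * f.g3 (-θ) = (f.hC : K) ^ 3 := by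
  simp only [D, tdisc] at hθ
  simp only [g3, G3, hC]
  push_cast at hθ ⊢
  linear_combination -(f.d : K) ^ 2 / 4 * hθ

lemma sum_mul_conj : (f.g0 θ + 3 * f.g1 θ + 3 * f.g2 θ + f.g3 θ) *
    (f.g0 (-θ) + 3 * f.g1 (-θ) + 3 * f.g2 (-θ) + f.g3 (-θ)) =
      ((f.hA : K) + f.hB + f.hC) ^ 3 := by
  simp only [D, tdisc] at hθ
  simp only [g0, g1, g2, g3, G0, G1, G2, G3, hA, hB, hC]
  push_cast at hθ ⊢
  linear_combination -((f.a : K) + 3 * f.b + 3 * f.c + f.d) ^ 2 / 4 * hθ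

lemma theta_mul_g0 : θ * f.g0 θ = 2 * f.hA * f.g1 θ - f.hB * f.g0 θ := by
  simp only [D, tdisc] at hθ
  simp only [g0, g1, G0, G1, hA, hB]
  push_cast at hθ ⊢
  linear_combination (f.a : K) / 2 * hθ

lemma theta_mul_g1 : θ * f.g1 θ = f.hB * f.g1 θ - 2 * f.hC * f.g0 θ := by
  simp only [D, tdisc] at hθ
  simp only [g0, g1, G0, G1, hC, hB]
  push_cast at hθ ⊢
  linear_combination (f.b : K) / 2 * hθ

end

lemma G0_mul_b (f : TForm) : f.G0 * f.b - f.a * f.G1 = 2 * f.hA ^ 2 := by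
  simp only [G0, G1, hA]; ring

section act
variable (f : TForm) (p q r s : ℤ)

lemma G0_act : (f.act p q r s).G0 = (p * s - q * r) ^ 3 *
    (f.G0 * p ^ 3 + 3 * f.G1 * p ^ 2 * r + 3 * f.G2 * p * r ^ 2 + f.G3 * r ^ 3) := by
  simp only [G0, G1, G2, G3, act]; ring

lemma G1_act : (f.act p q r s).G1 = (p * s - q * r) ^ 3 *
    (f.G0 * p ^ 2 * q + f.G1 * (p ^ 2 * s + 2 * p * q * r) +
      f.G2 * (2 * p * r * s + q * r ^ 2) + f.G3 * r ^ 2 * s) := by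
  simp only [G0, G1, G2, G3, act]; ring

lemma G2_act : (f.act p q r s).G2 = (p * s - q * r) ^ 3 *
    (f.G0 * p * q ^ 2 + f.G1 * (2 * p * q * s + q ^ 2 * r) +
      f.G2 * (p * s ^ 2 + 2 * q * r * s) + f.G3 * r * s ^ 2) := by
  simp only [G0, G1, G2, G3, act]; ring

lemma G3_act : (f.act p q r s).G3 = (p * s - q * r) ^ 3 *
    (f.G0 * q ^ 3 + 3 * f.G1 * q ^ 2 * s + 3 * f.G2 * q * s ^ 2 + f.G3 * s ^ 3) := by
  simp only [G0, G1, G2, G3, act]; ring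

end act

open NumberField nonZeroDivisors in
/-- The form `f` arises from the ideal `I` with `I ^ 3 = (δ)` by choosing a basis. -/
def Rep {K : Type*} [Field K] [NumberField K] (f : TForm) (θ : K)
    (I : FractionalIdeal (𝓞 K)⁰ K) (δ : K) : Prop :=
  ∃ α β : K, (∀ z, z ∈ I ↔ ∃ m n : ℤ, z = m * α + n * β) ∧
    (∀ m n : ℤ, (m : K) * α + n * β = 0 → m = 0 ∧ n = 0) ∧
    δ * f.g0 θ = α ^ 3 ∧ δ * f.g1 θ = α ^ 2 * β ∧ δ * f.g2 θ = α * β ^ 2 ∧ δ * f.g3 θ = β ^ 3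

end TForm

namespace IsQuad

open NumberField nonZeroDivisors

variable {K : Type*} [Field K] [NumberField K] {D : ℤ} {θ : K} (h : IsQuad K D θ)

include h

lemma int_inj {m n m' n' : ℤ} (e : ((m : K) + n * θ) / 2 = (m' + n' * θ) / 2) :
    m = m' ∧ n = n' := by
  have := h.inj (x := m) (y := n) (x' := m') (y' := n') (by
    push_cast
    linear_combination 2 * e)
  exact_mod_cast this

omit h in
lemma _root_.TForm.Rep.act {f : TForm} {I : FractionalIdeal (𝓞 K)⁰ K} {δ : K}
    (hf : f.Rep θ I δ) {p q r s : ℤ} (hdet : p * s - q * r = 1) : (f.act p q r s).Rep θ I δ := by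
  obtain ⟨α, β, hI, hli, h0, h1, h2, h3⟩ := hf
  refine ⟨p * α + r * β, q * α + s * β, fun z => ?_, fun m n hmn => ?_, ?_, ?_, ?_, ?_⟩
  · rw [hI]
    have hd : (p : K) * s - q * r = 1 := by exact_mod_cast hdet
    constructor
    · rintro ⟨m, n, rfl⟩
      refine ⟨s * m - q * n, -r * m + p * n, ?_⟩
      push_cast
      linear_combination (-(m : K) * α - n * β) * hd
    · rintro ⟨m, n, rfl⟩
      refine ⟨p * m + q * n, r * m + s * n, ?_⟩
      push_cast
      ring
  · obtain ⟨e1, e2⟩ := hli (p * m + q * n) (r * m + s * n) (by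
      push_cast; linear_combination hmn)
    constructor
    · linear_combination s * e1 - q * e2 - m * hdet
    · linear_combination p * e2 - r * e1 - n * hdet
  · have : (f.act p q r s).g0 θ = f.g0 θ * p ^ 3 + 3 * f.g1 θ * p ^ 2 * r + 3 * f.g2 θ * p * r ^ 2
        + f.g3 θ * r ^ 3 := by
      simp only [g0, g1, g2, g3, G0_act, hdet]
      simp only [TForm.act]
      push_cast; ring
    rw [this]
    linear_combination (p : K) ^ 3 * h0 + 3 * p ^ 2 * r * h1 + 3 * p * r ^ 2 * h2 + r ^ 3 * h3
  · have : (f.act p q r s).g1 θ = f.g0 θ * p ^ 2 * q + f.g1 θ * (p ^ 2 * s + 2 * p * q * r) +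
        f.g2 θ * (2 * p * r * s + q * r ^ 2) + f.g3 θ * r ^ 2 * s := by
      simp only [g0, g1, g2, g3, G1_act, hdet]
      simp only [TForm.act]
      push_cast; ring
    rw [this]
    linear_combination (p : K) ^ 2 * q * h0 + (p ^ 2 * s + 2 * p * q * r) * h1 +
      (2 * p * r * s + q * r ^ 2) * h2 + r ^ 2 * s * h3
  · have : (f.act p q r s).g2 θ = f.g0 θ * p * q ^ 2 + f.g1 θ * (2 * p * q * s + q ^ 2 * r) +
        f.g2 θ * (p * s ^ 2 + 2 * q * r * s) + f.g3 θ * r * s ^ 2 := by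
      simp only [g0, g1, g2, g3, G2_act, hdet]
      simp only [TForm.act]
      push_cast; ring
    rw [this]
    linear_combination (p : K) * q ^ 2 * h0 + (2 * p * q * s + q ^ 2 * r) * h1 +
      (p * s ^ 2 + 2 * q * r * s) * h2 + r * s ^ 2 * h3
  · have : (f.act p q r s).g3 θ = f.g0 θ * q ^ 3 + 3 * f.g1 θ * q ^ 2 * s + 3 * f.g2 θ * q * s ^ 2
        + f.g3 θ * s ^ 3 := by
      simp only [g0, g1, g2, g3, G3_act, hdet]
      simp only [TForm.act]
      push_cast; ring
    rw [this]
    linear_combination (q : K) ^ 3 * h0 + 3 * q ^ 2 * s * h1 + 3 * q * s ^ 2 * h2 + s ^ 3 * h3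

lemma hA_ne {f : TForm} (hf : f.D = D) : f.hA ≠ 0 := by
  intro hA
  apply h.nonsq
  rw [← hf, f.D_eq, hA]
  exact ⟨f.hB, by ring⟩

omit h in
lemma rep_scale {f : TForm} {I : FractionalIdeal (𝓞 K)⁰ K} {δ k : K} (hk : k ≠ 0)
    (hf : f.Rep θ (spanSingleton (𝓞 K)⁰ k * I) (k ^ 3 * δ)) : f.Rep θ I δ := by
  obtain ⟨α, β, hI, hli, h0, h1, h2, h3⟩ := hf
  refine ⟨k⁻¹ * α, k⁻¹ * β, fun z => ?_, fun m n hmn => hli m n ?_, ?_, ?_, ?_, ?_⟩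
  · have : z ∈ I ↔ k * z ∈ spanSingleton (𝓞 K)⁰ k * I := by
      rw [mem_singleton_mul]
      constructor
      · intro hz; exact ⟨z, hz, rfl⟩
      · rintro ⟨y, hy, e⟩
        rwa [mul_left_cancel₀ hk e]
    rw [this, hI]
    constructor
    · rintro ⟨m, n, e⟩
      refine ⟨m, n, ?_⟩
      rw [← mul_right_inj' hk, e]
      field_simp
    · rintro ⟨m, n, rfl⟩
      refine ⟨m, n, ?_⟩
      field_simp
  · have : (m : K) * α + n * β = k * (m * (k⁻¹ * α) + n * (k⁻¹ * β)) := by field_simp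
    rw [this, hmn, mul_zero]
  all_goals
    have hk3 : k ^ 3 ≠ 0 := pow_ne_zero 3 hk
    rw [← mul_right_inj' hk3, ← mul_assoc]
    first
    | rw [h0]; field_simp
    | rw [h1]; field_simp
    | rw [h2]; field_simp
    | rw [h3]; field_simp

lemma rep_eqv {f f' : TForm} (hf' : f'.D = D)
    {I : FractionalIdeal (𝓞 K)⁰ K} {δ : K} (hδ : δ ≠ 0) (hr : f.Rep θ I δ) (hr' : f'.Rep θ I δ) :
    f.Eqv f' := by
  obtain ⟨α, β, hI, hli, h0, h1, h2, h3⟩ := hr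
  obtain ⟨α', β', hI', hli', h0', h1', h2', h3'⟩ := hr'
  obtain ⟨p, r, hα'⟩ := (hI α').1 ((hI' α').2 ⟨1, 0, by simp⟩)
  obtain ⟨q, s, hβ'⟩ := (hI β').1 ((hI' β').2 ⟨0, 1, by simp⟩)
  obtain ⟨p', r', hα⟩ := (hI' α).1 ((hI α).2 ⟨1, 0, by simp⟩)
  obtain ⟨q', s', hβ⟩ := (hI' β).1 ((hI β).2 ⟨0, 1, by simp⟩)
  have hdet : (p * s - q * r) * (p' * s' - q' * r') = 1 := by
    obtain ⟨e1, e2⟩ := hli (p * p' + q * r' - 1) (r * p' + s * r') (by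
      rw [hα', hβ'] at hα; push_cast; linear_combination -hα)
    obtain ⟨e3, e4⟩ := hli (p * q' + q * s') (r * q' + s * s' - 1) (by
      rw [hα', hβ'] at hβ; push_cast; linear_combination -hβ)
    linear_combination (r * q' + s * s') * e1 + e4 - (p * q' + q * s') * e2
  have k0 : f'.g0 θ = f.g0 θ * p ^ 3 + 3 * f.g1 θ * p ^ 2 * r + 3 * f.g2 θ * p * r ^ 2
        + f.g3 θ * r ^ 3 := by
    rw [← mul_right_inj' hδ, h0', hα']
    linear_combination -((p : K) ^ 3 * h0 + 3 * p ^ 2 * r * h1 + 3 * p * r ^ 2 * h2 + r ^ 3 * h3)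
  have k1 : f'.g1 θ = f.g0 θ * p ^ 2 * q + f.g1 θ * (p ^ 2 * s + 2 * p * q * r) +
        f.g2 θ * (2 * p * r * s + q * r ^ 2) + f.g3 θ * r ^ 2 * s := by
    rw [← mul_right_inj' hδ, h1', hα', hβ']
    linear_combination -((p : K) ^ 2 * q * h0 + (p ^ 2 * s + 2 * p * q * r) * h1 +
      (2 * p * r * s + q * r ^ 2) * h2 + r ^ 2 * s * h3)
  have k2 : f'.g2 θ = f.g0 θ * p * q ^ 2 + f.g1 θ * (2 * p * q * s + q ^ 2 * r) +
        f.g2 θ * (p * s ^ 2 + 2 * q * r * s) + f.g3 θ * r * s ^ 2 := by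
    rw [← mul_right_inj' hδ, h2', hα', hβ']
    linear_combination -((p : K) * q ^ 2 * h0 + (2 * p * q * s + q ^ 2 * r) * h1 +
      (p * s ^ 2 + 2 * q * r * s) * h2 + r * s ^ 2 * h3)
  have k3 : f'.g3 θ = f.g0 θ * q ^ 3 + 3 * f.g1 θ * q ^ 2 * s + 3 * f.g2 θ * q * s ^ 2
        + f.g3 θ * s ^ 3 := by
    rw [← mul_right_inj' hδ, h3', hβ']
    linear_combination -((q : K) ^ 3 * h0 + 3 * q ^ 2 * s * h1 + 3 * q * s ^ 2 * h2 + s ^ 3 * h3)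
  have l0 := h.int_inj (m := f'.G0) (n := f'.a) (m' := f.G0 * p ^ 3 + 3 * f.G1 * p ^ 2 * r +
    3 * f.G2 * p * r ^ 2 + f.G3 * r ^ 3) (n' := (f.act p q r s).a) (by
      simp only [g0, g1, g2, g3] at k0
      simp only [act]
      push_cast
      linear_combination k0)
  have l1 := h.int_inj (m := f'.G1) (n := f'.b) (m' := f.G0 * p ^ 2 * q + f.G1 * (p ^ 2 * s +
    2 * p * q * r) + f.G2 * (2 * p * r * s + q * r ^ 2) + f.G3 * r ^ 2 * s)
    (n' := (f.act p q r s).b) (by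
      simp only [g0, g1, g2, g3] at k1
      simp only [act]
      push_cast
      linear_combination k1)
  have l2 := h.int_inj (m := f'.G2) (n := f'.c) (m' := f.G0 * p * q ^ 2 + f.G1 * (2 * p * q * s +
    q ^ 2 * r) + f.G2 * (p * s ^ 2 + 2 * q * r * s) + f.G3 * r * s ^ 2)
    (n' := (f.act p q r s).c) (by
      simp only [g0, g1, g2, g3] at k2
      simp only [act]
      push_cast
      linear_combination k2)
  have l3 := h.int_inj (m := f'.G3) (n := f'.d) (m' := f.G0 * q ^ 3 + 3 * f.G1 * q ^ 2 * s +
    3 * f.G2 * q * s ^ 2 + f.G3 * s ^ 3) (n' := (f.act p q r s).d) (by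
      simp only [g0, g1, g2, g3] at k3
      simp only [act]
      push_cast
      linear_combination k3)
  have hff : f' = f.act p q r s := TForm.ext l0.2 l1.2 l2.2 l3.2
  have hu : IsUnit (p * s - q * r) := IsUnit.of_mul_eq_one _ hdet
  rcases Int.isUnit_iff.1 hu with hd | hd
  · exact ⟨p, q, r, s, hd, hff⟩
  · exfalso
    have m0 := f.G0_act p q r s
    have m1 := f.G1_act p q r s
    rw [← hff, ← l0.1, hd] at m0
    rw [← hff, ← l1.1, hd] at m1
    have z0 : f'.G0 = 0 := by linarith
    have z1 : f'.G1 = 0 := by linarith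
    have := f'.G0_mul_b
    rw [z0, z1] at this
    have : f'.hA ^ 2 = 0 := by linarith
    exact h.hA_ne hf' (pow_eq_zero_iff (by norm_num) |>.1 this)

omit h in
lemma rep_unique {f : TForm} {I I' : FractionalIdeal (𝓞 K)⁰ K} {δ δ' : K} (hδ : δ ≠ 0)
    (hδ' : δ' ≠ 0) (hr : f.Rep θ I δ) (hr' : f.Rep θ I' δ') :
    ∃ k : K, k ≠ 0 ∧ I' = spanSingleton (𝓞 K)⁰ k * I ∧ δ' = k ^ 3 * δ := by
  obtain ⟨α, β, hI, hli, h0, h1, h2, h3⟩ := hr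
  obtain ⟨α', β', hI', hli', h0', h1', h2', h3'⟩ := hr'
  have hα : α ≠ 0 := by
    intro e
    have := (hli 1 0 (by simp [e])).1
    norm_num at this
  have hα' : α' ≠ 0 := by
    intro e
    have := (hli' 1 0 (by simp [e])).1
    norm_num at this
  have hg : f.g0 θ ≠ 0 := by
    intro e; rw [e, mul_zero] at h0
    exact pow_ne_zero 3 hα h0.symm
  set k := α' / α with hk
  have hk0 : k ≠ 0 := div_ne_zero hα' hα
  have eα : α' = k * α := by rw [hk]; field_simp
  have eβ : β' = k * β := by
    have e1 : f.g1 θ * α = f.g0 θ * β := by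
      rw [← mul_right_inj' hδ]
      linear_combination α * h1 - β * h0
    have e2 : f.g1 θ * α' = f.g0 θ * β' := by
      rw [← mul_right_inj' hδ']
      linear_combination α' * h1' - β' * h0'
    rw [← mul_right_inj' hg, ← e2, eα]
    linear_combination k * e1
  refine ⟨k, hk0, ?_, ?_⟩
  · ext z
    rw [hI', mem_singleton_mul]
    constructor
    · rintro ⟨m, n, rfl⟩
      exact ⟨m * α + n * β, (hI _).2 ⟨m, n, rfl⟩, by rw [eα, eβ]; ring⟩
    · rintro ⟨y, hy, rfl⟩
      obtain ⟨m, n, rfl⟩ := (hI y).1 hy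
      exact ⟨m, n, by rw [eα, eβ]; ring⟩
  · apply mul_right_cancel₀ hg
    rw [h0', eα]
    linear_combination -k ^ 3 * h0

end IsQuad

end

section
open TForm Ideal FractionalIdeal Units

namespace IsQuad

open NumberField nonZeroDivisors

variable {K : Type*} [Field K] [NumberField K] {D : ℤ} {θ : K} (h : IsQuad K D θ)

include h

lemma exists_form_rep (hD : IsFundamentalDiscriminant D)
    {I : (FractionalIdeal (𝓞 K)⁰ K)ˣ} {δ : Kˣ} (hI : I ^ 3 = toPrincipalIdeal (𝓞 K) K δ) :
    ∃ f : TForm, f.D = D ∧ f.Rep θ (I : FractionalIdeal (𝓞 K)⁰ K) δ := by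
  obtain ⟨σ, hσ⟩ := h.exists_conj
  obtain ⟨α, β, w, hb, hli, hw, hw3⟩ := h.exists_ideal_basis hD hσ hI
  have hα : α ∈ (I : FractionalIdeal (𝓞 K)⁰ K) := (hb _).2 ⟨1, 0, by simp⟩
  have hβ : β ∈ (I : FractionalIdeal (𝓞 K)⁰ K) := (hb _).2 ⟨0, 1, by simp⟩
  have key : ∀ x y z : K, x ∈ (I : FractionalIdeal (𝓞 K)⁰ K) →
      y ∈ (I : FractionalIdeal (𝓞 K)⁰ K) → z ∈ (I : FractionalIdeal (𝓞 K)⁰ K) →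
      ∃ t n : ℤ, (δ : K) * ((t + n * θ) / 2) = x * y * z ∧
        σ δ * ((t - n * θ) / 2) = σ x * σ y * σ z := by
    intro x y z hx hy hz
    have h1 : x * y * z ∈ (I : FractionalIdeal (𝓞 K)⁰ K) ^ 3 := by
      rw [pow_succ, pow_two]
      exact mul_mem_mul (mul_mem_mul hx hy) hz
    rw [← val_pow_eq_pow_val, hI, coe_toPrincipalIdeal, mem_spanSingleton] at h1
    obtain ⟨u, hu⟩ := h1
    obtain ⟨m, n, hmn⟩ := (h.isIntegral_iff hD (u : K)).1 u.2
    have h2 : (δ : K) * (((2 * m + n * D : ℤ) + n * θ) / 2) = x * y * z := by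
      rw [← hu, Algebra.smul_def, show algebraMap (𝓞 K) K u = _ from hmn]
      push_cast
      ring
    have h3 := congrArg σ h2
    simp only [map_mul, map_div₀, map_add, map_intCast, hσ, map_ofNat] at h3
    exact ⟨2 * m + n * D, n, h2, by rw [← h3]; ring⟩
  obtain ⟨t0, a, a1, a2⟩ := key α α α hα hα hα
  obtain ⟨t1, b, b1, b2⟩ := key α α β hα hα hβ
  obtain ⟨t2, c, c1, c2⟩ := key α β β hα hβ hβ
  obtain ⟨t3, d, d1, d2⟩ := key β β β hβ hβ hβ
  have hθ0 : θ ≠ 0 := by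
    rintro rfl
    exact h.nonsq ⟨0, by simpa using h.sq.symm⟩
  have hδ : (δ : K) ≠ 0 := δ.ne_zero
  have hσδ : σ (δ : K) ≠ 0 := (map_ne_zero σ).2 hδ
  set p := σ (δ : K) with hp
  set q := (δ : K) with hq
  set α' := σ α
  set β' := σ β
  have hE : q * p * θ ≠ 0 := mul_ne_zero (mul_ne_zero hδ hσδ) hθ0
  set E := q * p * θ with hEdef
  have ea : (a : K) = (p * α ^ 3 - q * α' ^ 3) / E := by
    rw [eq_div_iff hE]; linear_combination p * a1 - q * a2
  have eb : (b : K) = (p * (α ^ 2 * β) - q * (α' ^ 2 * β')) / E := by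
    rw [eq_div_iff hE]; linear_combination p * b1 - q * b2
  have ec : (c : K) = (p * (α * β ^ 2) - q * (α' * β' ^ 2)) / E := by
    rw [eq_div_iff hE]; linear_combination p * c1 - q * c2
  have ed : (d : K) = (p * β ^ 3 - q * β' ^ 3) / E := by
    rw [eq_div_iff hE]; linear_combination p * d1 - q * d2
  have hw6 : (α' * β - α * β') ^ 3 = q * p * θ ^ 3 := by
    rw [hw, mul_pow, hw3]
  clear_value E p q

  refine ⟨⟨a, b, c, d⟩, Int.cast_injective (α := K) ?_, α, β, hb, hli, ?_, ?_, ?_, ?_⟩ <;>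
    simp only [TForm.D, tdisc, g0, G0, g1, G1, g2, G2, g3, G3] <;> push_cast <;>
    rw [ea, eb, ec, ed] <;> field_simp <;> subst hEdef
  · linear_combination p ^ 2 * q ^ 2 * ((α' * β - α * β') ^ 3 + q * p * θ ^ 3) * hw6 +
      p ^ 4 * q ^ 4 * θ ^ 4 * h.sq
  · linear_combination q ^ 2 * p * (p * α ^ 3 + q * α' ^ 3) * hw6
  · linear_combination q ^ 2 * p * (p * α ^ 2 * β + q * α' ^ 2 * β') * hw6
  · linear_combination q ^ 2 * p * (p * α * β ^ 2 + q * α' * β' ^ 2) * hw6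
  · linear_combination q ^ 2 * p * (p * β ^ 3 + q * β' ^ 3) * hw6

omit h in
/-- Fundamental discriminants are not of the form `n² Δ` with `Δ ≡ 0, 1 (mod 4)`. -/
lemma _root_.IsFundamentalDiscriminant.isUnit (hD : IsFundamentalDiscriminant D) {n Δ : ℤ}
    (e : D = n ^ 2 * Δ) (hΔ : Δ % 4 = 0 ∨ Δ % 4 = 1) : IsUnit n := by
  rcases hD.2 with ⟨hs, -⟩ | ⟨m, hm, hs, hm4⟩
  · exact hs n ⟨Δ, by rw [e]; ring⟩
  · rcases Int.even_or_odd' n with ⟨k, rfl | rfl⟩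
    · exfalso
      have e1 : m = k * k * Δ := by rw [hm] at e; linarith
      rw [Int.isUnit_mul_self (hs k ⟨Δ, e1⟩)] at e1
      omega
    · exact hs _ (IsCoprime.dvd_of_dvd_mul_left (y := 4) ⟨1, -(k * k + k), by ring⟩
        ⟨Δ, by rw [← hm, e]; ring⟩)

omit h in
lemma _root_.TForm.parity (f : TForm) : (2 : ℤ) ∣ f.G0 - f.a * f.D ∧ (2 : ℤ) ∣ f.G1 - f.b * f.D ∧
    (2 : ℤ) ∣ f.G2 - f.c * f.D ∧ (2 : ℤ) ∣ f.G3 - f.d * f.D ∧ (2 : ℤ) ∣ f.D - f.hB := by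
  obtain ⟨a, b, c, d⟩ := f
  refine ⟨?_, ?_, ?_, ?_, ?_⟩ <;>
  · refine (ZMod.intCast_zmod_eq_zero_iff_dvd _ 2).1 ?_
    simp only [G0, G1, G2, G3, D, tdisc, hB]
    push_cast
    generalize (a : ZMod 2) = a, (b : ZMod 2) = b, (c : ZMod 2) = c, (d : ZMod 2) = d
    revert a b c d
    decide

lemma exists_rep (hD : IsFundamentalDiscriminant D) {f : TForm} (hf : f.D = D) :
    ∃ (I : (FractionalIdeal (𝓞 K)⁰ K)ˣ) (δ : Kˣ), I ^ 3 = toPrincipalIdeal (𝓞 K) K δ ∧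
      f.Rep θ (I : FractionalIdeal (𝓞 K)⁰ K) δ := by
  have hθ : θ * θ = f.D := by rw [hf, h.sq]
  have hθ' : -θ * -θ = f.D := by rw [neg_mul_neg, hθ]
  have hint : ∀ m n : ℤ, (2 : ℤ) ∣ m - n * D → IsIntegral ℤ (((m : K) + n * θ) / 2) := by
    rintro m n ⟨k, hk⟩
    refine (h.isIntegral_iff hD _).2 ⟨k, n, ?_⟩
    rw [sub_eq_iff_eq_add.1 hk]; push_cast; ring
  have hint' : ∀ m n : ℤ, (2 : ℤ) ∣ m - n * D → IsIntegral ℤ (((m : K) + n * (-θ)) / 2) := by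
    rintro m n ⟨k, hk⟩
    simpa using hint m (-n) ⟨k + n * D, by linarith⟩
  obtain ⟨q0, q1, q2, q3, qB⟩ := f.parity
  rw [hf] at q0 q1 q2 q3 qB
  let γ0 : 𝓞 K := ⟨f.g0 θ, hint _ _ q0⟩
  let γ1 : 𝓞 K := ⟨f.g1 θ, hint _ _ q1⟩
  let γ2 : 𝓞 K := ⟨f.g2 θ, hint _ _ q2⟩
  let γ3 : 𝓞 K := ⟨f.g3 θ, hint _ _ q3⟩
  let γ0' : 𝓞 K := ⟨f.g0 (-θ), hint' _ _ q0⟩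
  let γ1' : 𝓞 K := ⟨f.g1 (-θ), hint' _ _ q1⟩
  let γ2' : 𝓞 K := ⟨f.g2 (-θ), hint' _ _ q2⟩
  let γ3' : 𝓞 K := ⟨f.g3 (-θ), hint' _ _ q3⟩
  have r1 : γ1 * γ1 = γ0 * γ2 := RingOfIntegers.ext (g1_sq hθ)
  have r2 : γ0 * γ3 = γ1 * γ2 := RingOfIntegers.ext (g0_mul_g3 hθ)
  have rA : γ0 * γ0' = (f.hA : 𝓞 K) ^ 3 :=
    RingOfIntegers.ext (by simp only [map_mul, map_pow, map_intCast]; exact g0_mul_conj hθ)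
  have rC : γ3 * γ3' = (f.hC : 𝓞 K) ^ 3 :=
    RingOfIntegers.ext (by simp only [map_mul, map_pow, map_intCast]; exact g3_mul_conj hθ)
  have rS : (γ0 + 3 * γ1 + 3 * γ2 + γ3) * (γ0' + 3 * γ1' + 3 * γ2' + γ3') =
      ((f.hA + f.hB + f.hC : ℤ) : 𝓞 K) ^ 3 :=
    RingOfIntegers.ext (by
      simp only [map_mul, map_add, map_pow, map_intCast, map_ofNat]
      push_cast
      exact sum_mul_conj hθ)
  have hA0 : f.hA ≠ 0 := h.hA_ne hf
  -- the coefficients generate the unit ideal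
  have hT : Ideal.span {γ0, γ1, γ2, γ3} = (⊤ : Ideal (𝓞 K)) := by
    set T := Ideal.span {γ0, γ1, γ2, γ3} with hT
    have m0 : γ0 ∈ T := subset_span (by simp)
    have m1 : γ1 ∈ T := subset_span (by simp)
    have m2 : γ2 ∈ T := subset_span (by simp)
    have m3 : γ3 ∈ T := subset_span (by simp)
    let J : Ideal ℤ := (T.comap (Int.castRingHom (𝓞 K))).radical
    have mem {n : ℤ} {x y : 𝓞 K} (hx : x ∈ T) (e : x * y = (n : 𝓞 K) ^ 3) : n ∈ J :=
      ⟨3, by rw [Ideal.mem_comap, map_pow, eq_intCast, ← e]; exact mul_mem_right _ _ hx⟩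
    have mA := mem m0 rA
    have mC := mem m3 rC
    have mS := mem (add_mem (add_mem (add_mem m0 (mul_mem_left _ _ m1)) (mul_mem_left _ _ m2)) m3) rS
    have mB : f.hB ∈ J := by convert sub_mem (sub_mem mS mA) mC using 1; ring
    have hgen := fun x => (Submodule.IsPrincipal.mem_iff_generator_dvd J (x := x))
    set g := Submodule.IsPrincipal.generator J
    obtain ⟨A', hA'⟩ := (hgen _).1 mA
    obtain ⟨B', hB'⟩ := (hgen _).1 mB
    obtain ⟨C', hC'⟩ := (hgen _).1 mC
    have hg : IsUnit g := by
      refine hD.isUnit (n := g) (Δ := B' * B' - 4 * A' * C') ?_ ?_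
      · rw [← hf, f.D_eq, hA', hB', hC']; ring
      · rcases Int.even_or_odd' B' with ⟨k, rfl | rfl⟩ <;> ring_nf <;> omega
    obtain ⟨n, hn⟩ := (hgen 1).2 hg.dvd
    exact (eq_top_iff_one _).2 (by simpa using hn)
  set J : Ideal (𝓞 K) := Ideal.span {γ0, γ1} with hJ
  have n0 : γ0 ∈ J := subset_span (by simp)
  have n1 : γ1 ∈ J := subset_span (by simp)
  have h3 {x y z w} (hx : x ∈ J) (hy : y ∈ J) (hz : z ∈ J) (e : w = x * y * z) : w ∈ J ^ 3 := by
    rw [e, pow_succ, pow_two]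
    exact mul_mem_mul (mul_mem_mul hx hy) hz
  have hcube : J ^ 3 = Ideal.span {γ0 ^ 2} := by
    apply le_antisymm
    · rw [hJ, pow_succ, pow_two, span_pair_mul_span_pair, span_mul_span', span_le]
      rintro _ ⟨x, hx, y, hy, rfl⟩
      simp only [Set.mem_insert_iff, Set.mem_singleton_iff] at hx hy
      rw [SetLike.mem_coe, mem_span_singleton]
      rcases hx with rfl | rfl | rfl | rfl <;> rcases hy with rfl | rfl <;>
      first
      | exact ⟨γ0, by ring1⟩
      | exact ⟨γ1, by ring1⟩
      | exact ⟨γ2, by linear_combination γ0 * r1⟩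
      | exact ⟨γ3, by linear_combination γ1 * r1 - γ0 * r2⟩
    · rw [← mul_one (Ideal.span {γ0 ^ 2}), Ideal.one_eq_top, ← hT,
        span_singleton_mul_le_iff]
      intro z hz
      refine (span_le.2 fun x hx => ?_ : Ideal.span {γ0, γ1, γ2, γ3} ≤ Submodule.comap
        (LinearMap.mulLeft (𝓞 K) (γ0 ^ 2)) (J ^ 3)) hz
      change γ0 ^ 2 * x ∈ J ^ 3
      rcases hx with rfl | rfl | rfl | rfl
      · exact h3 n0 n0 n0 (by ring)
      · exact h3 n0 n0 n1 (by ring)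
      · exact h3 n0 n1 n1 (by linear_combination -γ0 * r1)
      · exact h3 n1 n1 n1 (by linear_combination γ0 * r2 - γ1 * r1)
  have hγ0 : γ0 ≠ 0 := by
    intro e
    rw [e, zero_mul] at rA
    exact pow_ne_zero 3 (Int.cast_ne_zero.2 hA0) rA.symm
  have hJ0 : (J : FractionalIdeal (𝓞 K)⁰ K) ≠ 0 := by
    rw [Ne, coeIdeal_eq_zero]
    exact fun e => hγ0 (by rwa [e] at n0)
  have hg0 : (f.g0 θ) ≠ 0 := fun e => hγ0 (RingOfIntegers.ext e)
  refine ⟨mk0 _ hJ0, mk0 (f.g0 θ ^ 2) (pow_ne_zero 2 hg0), ?_, ?_⟩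
  · apply Units.ext
    rw [val_pow_eq_pow_val, coe_toPrincipalIdeal, val_mk0, val_mk0,
      ← coeIdeal_pow, hcube, coeIdeal_span_singleton, map_pow]
    rfl
  · refine ⟨f.g0 θ, f.g1 θ, fun z => ?_, fun m n hmn => ?_, ?_, ?_, ?_, ?_⟩
    · rw [val_mk0, mem_coeIdeal]
      have tg0 := theta_mul_g0 hθ
      have tg1 := theta_mul_g1 hθ
      constructor
      · rintro ⟨x, hx, rfl⟩
        obtain ⟨u, v, huv⟩ := mem_span_pair.1 hx
        obtain ⟨m, n, hmn⟩ := (h.isIntegral_iff hD (u : K)).1 u.2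
        obtain ⟨m', n', hmn'⟩ := (h.isIntegral_iff hD (v : K)).1 v.2
        have e : algebraMap (𝓞 K) K x = (u : K) * f.g0 θ + (v : K) * f.g1 θ := by
          rw [← huv]; simp only [map_add, map_mul]; rfl
        obtain ⟨k, hk⟩ := qB
        have hk' : (D : K) = f.hB + 2 * k := mod_cast sub_eq_iff_eq_add'.1 hk
        refine ⟨m + n * k - n' * f.hC, n * f.hA + m' + n' * (f.hB + k), ?_⟩
        rw [e, hmn, hmn', hk']
        push_cast
        linear_combination (n : K) / 2 * tg0 + (n' : K) / 2 * tg1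
      · rintro ⟨m, n, rfl⟩
        refine ⟨m * γ0 + n * γ1, add_mem (mul_mem_left _ _ n0) (mul_mem_left _ _ n1), ?_⟩
        simp only [map_add, map_mul, map_intCast]
        rfl
    · have e := h.int_inj (m := m * f.G0 + n * f.G1) (n := m * f.a + n * f.b) (m' := 0) (n' := 0)
        (by simp only [g0, g1] at hmn; push_cast; linear_combination hmn)
      have hG := f.G0_mul_b
      have hA2 : 2 * f.hA ^ 2 ≠ 0 := by positivity
      exact ⟨mul_left_cancel₀ hA2 (by linear_combination -m * hG + f.b * e.1 - f.G1 * e.2),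
        mul_left_cancel₀ hA2 (by linear_combination -n * hG - f.a * e.1 + f.G0 * e.2)⟩
    all_goals rw [val_mk0]
    · ring
    · linear_combination -f.g0 θ * g1_sq hθ
    · linear_combination -f.g1 θ * g1_sq hθ + f.g0 θ * g0_mul_g3 hθ

end IsQuad

end

section
open TForm FractionalIdeal IntermediateField Polynomial Subgroup

namespace IsQuad

open NumberField nonZeroDivisors

variable {K : Type*} [Field K] [NumberField K] {D : ℤ} {θ : K} (h : IsQuad K D θ)

lemma ker_toPrincipalIdeal : (toPrincipalIdeal (𝓞 K) K).ker =
    (Units.map (algebraMap (𝓞 K) K : 𝓞 K →* K)).range := by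
  have key : ∀ x : Kˣ, toPrincipalIdeal (𝓞 K) K x = 1 → ∃ a : 𝓞 K, (a : K) = x := by
    intro x hx
    have h1 := congrArg Units.val hx
    rw [coe_toPrincipalIdeal, Units.val_one] at h1
    have h2 := mem_spanSingleton_self (𝓞 K)⁰ (x : K)
    rw [h1] at h2
    exact (mem_one_iff _).1 h2
  ext x
  rw [MonoidHom.mem_ker, MonoidHom.mem_range]
  constructor
  · intro hx
    obtain ⟨a, ha⟩ := key x hx
    obtain ⟨b, hb⟩ := key x⁻¹ (by rw [map_inv, hx, inv_one])
    refine ⟨⟨a, b, ?_, ?_⟩, Units.ext ha⟩ <;>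
    · apply RingOfIntegers.ext
      simp [ha, hb]
  · rintro ⟨u, rfl⟩
    apply Units.ext
    rw [coe_toPrincipalIdeal, Units.val_one]
    change spanSingleton _ (algebraMap (𝓞 K) K (u : 𝓞 K)) = 1
    rw [← coeIdeal_span_singleton, Ideal.span_singleton_eq_top.2 u.isUnit,
      coeIdeal_top]

lemma card_ker_quotient
    (hU : Nat.card ((𝓞 K)ˣ ⧸ (powMonoidHom 3 : (𝓞 K)ˣ →* (𝓞 K)ˣ).range) = 3) :
    Nat.card ((toPrincipalIdeal (𝓞 K) K).ker ⧸ (powMonoidHom 3 :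
      (toPrincipalIdeal (𝓞 K) K).ker →* (toPrincipalIdeal (𝓞 K) K).ker).range) = 3 := by
  rw [ker_toPrincipalIdeal]
  have hinj : Function.Injective (Units.map (algebraMap (𝓞 K) K : 𝓞 K →* K)) :=
    Units.map_injective RingOfIntegers.coe_injective
  let e := MonoidHom.ofInjective hinj
  refine (Nat.card_congr (QuotientGroup.congr _ _ e ?_).toEquiv).symm.trans hU
  ext x
  rw [Subgroup.mem_map]
  constructor
  · rintro ⟨_, ⟨y, rfl⟩, rfl⟩
    exact ⟨e y, by simp⟩
  · rintro ⟨y, rfl⟩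
    exact ⟨_, ⟨e.symm y, rfl⟩, by simp⟩

include h

lemma card_orbits (hD : IsFundamentalDiscriminant D) (ρ : K →+* ℝ) :
    Nat.card {q : Quotient setoid // ∃ f : TForm, (⟦f⟧ : Quotient setoid) = q ∧ f.D = D} =
      3 * Nat.card {x : ClassGroup (𝓞 K) // x ^ 3 = 1} := by
  set p := toPrincipalIdeal (𝓞 K) K with hp
  have hpk : ∀ k : Kˣ, (p k : FractionalIdeal (𝓞 K)⁰ K) =
      spanSingleton (𝓞 K)⁰ (k : K) := fun k => coe_toPrincipalIdeal k
  have hcard := card_cubePairs_quotient p (card_ker_quotient (card_units_quotient h.finrank_eq ρ))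
  have hcl : Nat.card {x : ClassGroup (𝓞 K) // x ^ 3 = 1} =
      Nat.card {x : (FractionalIdeal (𝓞 K)⁰ K)ˣ ⧸ p.range // x ^ 3 = 1} := by
    let e : ClassGroup (𝓞 K) ≃* (FractionalIdeal (𝓞 K)⁰ K)ˣ ⧸ p.range := ClassGroup.equiv K
    refine Nat.card_congr (e.toEquiv.subtypeEquiv fun x => ?_)
    change x ^ 3 = 1 ↔ e x ^ 3 = 1
    rw [← map_pow, MulEquiv.map_eq_one_iff]
  rw [hcl, ← hcard]
  have hex : ∀ q : {q : Quotient setoid // ∃ f : TForm, (⟦f⟧ : Quotient setoid) = q ∧ f.D = D},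
      ∃ (f : TForm) (x : cubePairs p), (⟦f⟧ : Quotient setoid) = q.1 ∧ f.D = D ∧
        f.Rep θ (x.1.1 : FractionalIdeal (𝓞 K)⁰ K) x.1.2 := by
    rintro ⟨q, f, hq, hf⟩
    obtain ⟨I, δ, hI, hr⟩ := h.exists_rep hD hf
    exact ⟨f, ⟨(I, δ), hI⟩, hq, hf, hr⟩
  choose F X hFq hFD hrep using hex
  refine Nat.card_congr (Equiv.ofBijective (fun q => (X q : cubePairs p ⧸ trivPairs p)) ⟨?_, ?_⟩)
  · intro q q' hqq
    obtain ⟨k, hk⟩ := (mem_trivPairs p).1 (QuotientGroup.eq.1 hqq)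
    have e : X q' = X q * (((X q)⁻¹ * X q' : cubePairs p)) := by group
    have e1 := congrArg Subtype.val e
    rw [Subgroup.coe_mul, ← hk] at e1
    have hI : ((X q').1.1 : FractionalIdeal (𝓞 K)⁰ K) =
        spanSingleton (𝓞 K)⁰ (k : K) * (X q).1.1 := by
      rw [e1, Prod.fst_mul, Units.val_mul, mul_comm, hpk]
    have hδ : ((X q').1.2 : K) = (k : K) ^ 3 * (X q).1.2 := by
      rw [e1, Prod.snd_mul, Units.val_mul, mul_comm, Units.val_pow_eq_pow_val]
    have r' := hrep q'
    rw [hI, hδ] at r'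
    have r'' := rep_scale k.ne_zero r'
    have := h.rep_eqv (hFD q') (Units.ne_zero _) (hrep q) r''
    apply Subtype.ext
    rw [← hFq, ← hFq]
    exact Quotient.sound this
  · intro x
    obtain ⟨x, rfl⟩ := QuotientGroup.mk_surjective x
    obtain ⟨f, hf, hr⟩ := h.exists_form_rep hD x.2
    let q : {q : Quotient setoid // ∃ f : TForm, (⟦f⟧ : Quotient setoid) = q ∧ f.D = D} :=
      ⟨⟦f⟧, f, rfl, hf⟩
    refine ⟨q, ?_⟩
    obtain ⟨a, b, c, d, hdet, hact⟩ : (F q).Eqv f := Quotient.exact (hFq q)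
    have r1 := (hrep q).act hdet
    rw [← hact] at r1
    obtain ⟨k, hk, hI, hδ⟩ := rep_unique (Units.ne_zero _) (Units.ne_zero _) r1 hr
    refine QuotientGroup.eq.2 ((mem_trivPairs p).2 ⟨Units.mk0 k hk, ?_⟩)
    rw [Subgroup.coe_mul, Subgroup.coe_inv, eq_inv_mul_iff_mul_eq]
    refine Prod.ext (Units.ext ?_) (Units.ext ?_)
    · rw [Prod.fst_mul, Units.val_mul, hpk, Units.val_mk0, mul_comm]
      exact hI.symm
    · rw [Prod.snd_mul, Units.val_mul, Units.val_pow_eq_pow_val, Units.val_mk0, mul_comm]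
      exact hδ.symm

end IsQuad

lemma IsFundamentalDiscriminant.not_isSquare {D : ℤ} (hD : IsFundamentalDiscriminant D) :
    ¬ IsSquare D := by
  rintro ⟨s, hs⟩
  have hu := hD.isUnit (n := s) (Δ := 1) (by rw [hs]; ring) (by norm_num)
  apply hD.1
  rcases Int.isUnit_iff.1 hu with rfl | rfl <;> simpa using hs

/-- The orbits of forms of discriminant `D` correspond three to one to `Cl_3(D)`. -/
lemma card_orbits_eq {D : ℤ} (hD : IsFundamentalDiscriminant D) (hpos : 0 < D) :
    Nat.card {q : Quotient setoid // ∃ f : TForm, (⟦f⟧ : Quotient setoid) = q ∧ f.D = D} =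
      3 * h3 D := by
  set t : ℂ := (D : ℂ) ^ ((1 : ℂ) / 2) with ht
  have htsq : t * t = D := by
    have hD0 : (D : ℂ) ≠ 0 := by exact_mod_cast hpos.ne'
    rw [ht, ← Complex.cpow_add _ _ hD0]
    norm_num
  have hint : IsIntegral ℚ t := by
    refine ⟨X ^ 2 - C (D : ℚ), by monicity!, ?_⟩
    simp only [eval₂_sub, eval₂_pow, eval₂_X, eval₂_C]
    simp [pow_two, htsq]
  have htim : t.im = 0 := by
    have : t = (((D : ℝ) ^ ((1 : ℝ) / 2) : ℝ) : ℂ) := by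
      rw [Complex.ofReal_cpow (by exact_mod_cast hpos.le)]
      push_cast
      rfl
    rw [this, Complex.ofReal_im]
  have : FiniteDimensional ℚ (QuadField D) := adjoin.finiteDimensional hint
  have : NumberField (QuadField D) := { }
  let θ : QuadField D := ⟨t, mem_adjoin_simple_self ℚ t⟩
  have hspan : ∀ z : ℂ, z ∈ QuadField D → ∃ x y : ℚ, z = x + y * t := by
    intro z hz
    have hz' : z ∈ Algebra.adjoin ℚ {t} := by
      rw [← adjoin_simple_toSubalgebra_of_isAlgebraic hint.isAlgebraic]
      exact hz
    induction hz' using Algebra.adjoin_induction with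
    | mem x hx => exact ⟨0, 1, by simpa using hx⟩
    | algebraMap r => exact ⟨r, 0, by simp⟩
    | add x y hx hy h1 h2 =>
      obtain ⟨a, b, rfl⟩ := h1 (by
        change _ ∈ (adjoin ℚ {t}).toSubalgebra
        rwa [adjoin_simple_toSubalgebra_of_isAlgebraic hint.isAlgebraic])
      obtain ⟨c, d, rfl⟩ := h2 (by
        change _ ∈ (adjoin ℚ {t}).toSubalgebra
        rwa [adjoin_simple_toSubalgebra_of_isAlgebraic hint.isAlgebraic])
      exact ⟨a + c, b + d, by push_cast; ring⟩
    | mul x y hx hy h1 h2 =>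
      obtain ⟨a, b, rfl⟩ := h1 (by
        change _ ∈ (adjoin ℚ {t}).toSubalgebra
        rwa [adjoin_simple_toSubalgebra_of_isAlgebraic hint.isAlgebraic])
      obtain ⟨c, d, rfl⟩ := h2 (by
        change _ ∈ (adjoin ℚ {t}).toSubalgebra
        rwa [adjoin_simple_toSubalgebra_of_isAlgebraic hint.isAlgebraic])
      exact ⟨a * c + b * d * D, a * d + b * c, by
        push_cast; linear_combination (b : ℂ) * d * htsq⟩
  have hQ : IsQuad (QuadField D) D θ := by
    refine ⟨?_, ?_, hD.not_isSquare⟩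
    · apply Subtype.ext
      simpa using htsq
    · rintro ⟨z, hz⟩
      obtain ⟨x, y, e⟩ := hspan z hz
      exact ⟨x, y, Subtype.ext (by simpa using e)⟩
  have him : ∀ z : QuadField D, (z : ℂ).im = 0 := by
    rintro ⟨z, hz⟩
    obtain ⟨x, y, rfl⟩ := hspan z hz
    simp [htim]
  let ρ : QuadField D →+* ℝ :=
    { toFun := fun z => (z : ℂ).re
      map_one' := by simp
      map_zero' := by simp
      map_add' := by intro x y; simp
      map_mul' := by intro x y; simp [him] }
  exact hQ.card_orbits hD ρ

end

section
open TForm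

namespace TForm

/-- A reducible form is equivalent to one with vanishing leading coefficient. -/
lemma exists_eqv_a_eq_zero {f : TForm} (hf : ¬ f.Irred) : ∃ g : TForm, f.Eqv g ∧ g.a = 0 := by
  simp only [Irred, not_forall] at hf
  obtain ⟨x, y, he, hxy⟩ := hf
  have hg : Int.gcd x y ≠ 0 := by
    rw [Ne, Int.gcd_eq_zero_iff]; exact hxy
  obtain ⟨p, r, hcop, hx, hy⟩ : ∃ p r : ℤ, IsCoprime p r ∧ x = p * (Int.gcd x y : ℤ) ∧
      y = r * (Int.gcd x y : ℤ) := by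
    obtain ⟨p, r, h1, h2, h3⟩ := Int.exists_gcd_one (m := x) (n := y) (Nat.pos_of_ne_zero hg)
    exact ⟨p, r, Int.isCoprime_iff_gcd_eq_one.2 h1, h2, h3⟩
  obtain ⟨s, q, hsq⟩ := hcop
  refine ⟨f.act p (-q) r s, ⟨p, -q, r, s, by linarith, rfl⟩, ?_⟩
  have hg' : ((Int.gcd x y : ℕ) : ℤ) ^ 3 ≠ 0 := pow_ne_zero 3 (by exact_mod_cast hg)
  have h1 : f.eval x y = (Int.gcd x y : ℤ) ^ 3 * f.eval p r := by
    generalize ((Int.gcd x y : ℕ) : ℤ) = g at hx hy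
    rw [hx, hy]
    simp only [eval]; ring
  rw [h1] at he
  have h2 := (mul_eq_zero.1 he).resolve_left hg'
  simpa [eval, act] using h2

lemma eqv_of_not_irred {D : ℤ} (hD : IsFundamentalDiscriminant D) {f : TForm} (hf : f.D = D)
    (hr : ¬ f.Irred) : f.Eqv ⟨0, 1, D % 2, (D + 3 * (D % 2)) / 4⟩ := by
  obtain ⟨g, hfg, ha⟩ := exists_eqv_a_eq_zero hr
  have hgD : g.D = D := by rw [D_eqv hfg, hf]
  have e : D = g.b ^ 2 * (4 * (g.b * g.d) - 3 * (g.c * g.c)) := by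
    rw [← hgD, TForm.D, tdisc, ha]; ring
  have hb : IsUnit g.b := by
    refine hD.isUnit e ?_
    rcases Int.even_or_odd' g.c with ⟨k, hk | hk⟩
    · left
      have : g.c * g.c = 4 * (k * k) := by rw [hk]; ring
      omega
    · right
      have : g.c * g.c = 4 * (k * k + k) + 1 := by rw [hk]; ring
      omega
  obtain ⟨g', hfg', ha', hb', hD'⟩ : ∃ g' : TForm, f.Eqv g' ∧ g'.a = 0 ∧ g'.b = 1 ∧ g'.D = D := by
    rcases Int.isUnit_iff.1 hb with h1 | h1
    · exact ⟨g, hfg, ha, h1, hgD⟩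
    · have h2 : g.Eqv (g.act (-1) 0 0 (-1)) := ⟨_, _, _, _, by norm_num, rfl⟩
      refine ⟨_, hfg.trans h2, ?_, ?_, ?_⟩
      · rw [act_neg_one, ha]; rfl
      · rw [act_neg_one, h1]; rfl
      · rw [D_eqv h2, hgD]
  have e' : D = 4 * g'.d - 3 * (g'.c * g'.c) := by
    rw [← hD', TForm.D, tdisc, ha', hb']; ring
  have hpar : D % 2 = g'.c % 2 := by
    rcases Int.even_or_odd' g'.c with ⟨k, hk | hk⟩
    · have : g'.c * g'.c = 4 * (k * k) := by rw [hk]; ring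
      omega
    · have : g'.c * g'.c = 4 * (k * k + k) + 1 := by rw [hk]; ring
      omega
  obtain ⟨k, hk⟩ : ∃ k, D % 2 = g'.c + 2 * k := ⟨(D % 2 - g'.c) / 2, by omega⟩
  have h2 : g'.Eqv (g'.act 1 k 0 1) := ⟨_, _, _, _, by norm_num, rfl⟩
  have hD'' : (g'.act 1 k 0 1).D = D := by rw [D_eqv h2, hD']
  have : g'.act 1 k 0 1 = ⟨0, 1, D % 2, (D + 3 * (D % 2)) / 4⟩ := by
    have ea : (g'.act 1 k 0 1).a = 0 := by simp [act, ha']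
    have eb : (g'.act 1 k 0 1).b = 1 := by simp [act, ha', hb']
    have ec : (g'.act 1 k 0 1).c = D % 2 := by
      rw [hk]; simp only [act, ha', hb']; ring
    refine TForm.ext ea eb ec ?_
    rw [TForm.D, tdisc, ea, eb, ec] at hD''
    have hsq : (D % 2) ^ 2 = D % 2 := by
      rcases Int.emod_two_eq_zero_or_one D with h | h <;> rw [h] <;> rfl
    rw [hsq] at hD''
    change _ = (D + 3 * (D % 2)) / 4
    omega
  rw [← this]
  exact hfg'.trans h2

end TForm

lemma IsFundamentalDiscriminant.mod_four {D : ℤ} (hD : IsFundamentalDiscriminant D) :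
    D % 4 = 0 ∨ D % 4 = 1 := by
  rcases hD.2 with ⟨-, h⟩ | ⟨m, rfl, -⟩
  · exact Or.inr h
  · left; omega

/-- There are `3 #Cl_3(D) - 1` orbits of irreducible forms of discriminant `D`. -/
lemma ncard_irred_orbits {D : ℤ} (hD : IsFundamentalDiscriminant D) (hpos : 0 < D)
    (hfin : {q : Quotient setoid | ∃ f : TForm, (⟦f⟧ : Quotient setoid) = q ∧
      f.D = D ∧ f.Irred}.Finite) :
    {q : Quotient setoid | ∃ f : TForm, (⟦f⟧ : Quotient setoid) = q ∧
      f.D = D ∧ f.Irred}.ncard + 1 = 3 * h3 D := by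
  rw [← card_orbits_eq hD hpos, ← Set.coe_ofPred, Nat.card_coe_set_eq]
  set f0 : TForm := ⟨0, 1, D % 2, (D + 3 * (D % 2)) / 4⟩ with hf0
  have hred : ¬ f0.Irred := by
    intro h
    have := (h 1 0 (by simp [eval, hf0])).1
    norm_num at this
  have hD0 : f0.D = D := by
    rw [TForm.D, tdisc]
    have h4 := hD.mod_four
    have hsq : (D % 2) ^ 2 = D % 2 := by
      rcases Int.emod_two_eq_zero_or_one D with h | h <;> rw [h] <;> rfl
    simp only [hf0, hsq]
    omega
  have : {q : Quotient setoid | ∃ f : TForm, (⟦f⟧ : Quotient setoid) = q ∧ f.D = D} =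
      insert (⟦f0⟧ : Quotient setoid) {q : Quotient setoid | ∃ f : TForm,
        (⟦f⟧ : Quotient setoid) = q ∧ f.D = D ∧ f.Irred} := by
    ext q
    simp only [Set.mem_ofPred_eq, Set.mem_insert_iff]
    constructor
    · rintro ⟨f, rfl, hf⟩
      by_cases hi : f.Irred
      · exact Or.inr ⟨f, rfl, hf, hi⟩
      · exact Or.inl (Quotient.sound (eqv_of_not_irred hD hf hi))
    · rintro (rfl | ⟨f, rfl, hf, -⟩)
      · exact ⟨f0, rfl, hD0⟩
      · exact ⟨f, rfl, hf⟩
  rw [this, Set.ncard_insert_of_notMem _ hfin]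
  rintro ⟨f, hf, -, hi⟩
  exact hred (hi.eqv (Quotient.exact hf))

end

section
open Finset Real Polynomial

theorem card_divisors_le_rpow {ε : ℝ} (hε : 0 < ε) :
    ∃ C : ℝ, 1 ≤ C ∧ ∀ n : ℕ, n ≠ 0 → (n.divisors.card : ℝ) ≤ C * (n : ℝ) ^ ε := by
  have hl := log_pos one_lt_two
  set K := max 1 (1 / (ε * log 2)) with hK
  have hK1 : 1 ≤ K := le_max_left _ _
  set P := ⌈(2 : ℝ) ^ (1 / ε)⌉₊ with hP
  refine ⟨K ^ P, one_le_pow₀ hK1, fun n hn => ?_⟩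
  have h1 : (n : ℝ) ^ ε = ∏ p ∈ n.primeFactors, ((p : ℝ) ^ n.factorization p) ^ ε := by
    rw [finsetProd_rpow _ _ (fun _ _ => by positivity)]
    congr 1
    conv_lhs => rw [← Nat.prod_factorization_pow_eq_self hn]
    rw [Finsupp.prod]; push_cast; rfl
  rw [Nat.card_divisors hn, h1]
  push_cast
  calc ∏ p ∈ n.primeFactors, ((n.factorization p : ℝ) + 1)
      ≤ ∏ p ∈ n.primeFactors, (if p < P then K else 1) * ((p : ℝ) ^ n.factorization p) ^ ε := by
        refine prod_le_prod (fun _ _ => by positivity) fun p hp => ?_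
        set v := n.factorization p
        have hp2 : (2 : ℝ) ≤ p := by exact_mod_cast (Nat.prime_of_mem_primeFactors hp).two_le
        have h2 : ((p : ℝ) ^ v) ^ ε = ((p : ℝ) ^ ε) ^ v := by
          rw [← rpow_natCast, ← rpow_natCast, ← rpow_mul (by positivity),
            ← rpow_mul (by positivity), mul_comm]
        rw [h2]
        split_ifs with h
        · have h3 : 1 + v * (ε * log 2) ≤ ((p : ℝ) ^ ε) ^ v :=
            calc 1 + v * (ε * log 2) ≤ exp (v * (ε * log 2)) := by
                  rw [add_comm]; exact add_one_le_exp _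
              _ = ((2 : ℝ) ^ ε) ^ v := by
                  rw [rpow_def_of_pos two_pos, ← exp_nat_mul]; ring_nf
              _ ≤ _ := pow_le_pow_left₀ (by positivity) (rpow_le_rpow (by norm_num) hp2 hε.le) _
          have h4 : 1 ≤ K * (ε * log 2) := by
            rw [← div_le_iff₀ (by positivity)]; exact le_max_right _ _
          nlinarith [Nat.cast_nonneg (α := ℝ) v, mul_le_mul_of_nonneg_left h4 (Nat.cast_nonneg (α := ℝ) v)]
        · rw [one_mul]
          have h3 : (2 : ℝ) ≤ (p : ℝ) ^ ε := by
            have : (2 : ℝ) ^ (1 / ε) ≤ p := (Nat.le_ceil _).trans (by exact_mod_cast not_lt.1 h)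
            calc (2 : ℝ) = ((2 : ℝ) ^ (1 / ε)) ^ ε := by
                  rw [← rpow_mul (by norm_num), one_div_mul_cancel hε.ne', rpow_one]
              _ ≤ _ := rpow_le_rpow (by positivity) this hε.le
          refine le_trans ?_ (pow_le_pow_left₀ (by norm_num) h3 v)
          exact_mod_cast Nat.lt_two_pow_self
    _ = K ^ (n.primeFactors.filter (· < P)).card * ∏ p ∈ n.primeFactors, ((p : ℝ) ^ n.factorization p) ^ ε := by
        rw [prod_mul_distrib, prod_ite, prod_const, prod_const_one, mul_one]
    _ ≤ _ := by
        refine mul_le_mul_of_nonneg_right (pow_le_pow_right₀ hK1 ?_)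
          (prod_nonneg fun _ _ => by positivity)
        refine (card_le_card (t := range P) fun p hp => ?_).trans_eq (card_range P)
        exact mem_range.2 (mem_filter.1 hp).2

theorem card_divisors_le_of_le_pow {ε : ℝ} (hε : 0 < ε) :
    ∃ C : ℝ, 1 ≤ C ∧ ∀ X : ℝ, 1 ≤ X → ∀ n : ℕ, (n : ℝ) ≤ X ^ 10 → (n.divisors.card : ℝ) ≤ C * X ^ ε := by
  obtain ⟨C, hC, h⟩ := card_divisors_le_rpow (show 0 < ε / 10 by positivity)
  refine ⟨C, hC, fun X hX n hn => ?_⟩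
  rcases eq_or_ne n 0 with rfl | h0
  · simp; positivity
  refine (h n h0).trans (mul_le_mul_of_nonneg_left ?_ (by positivity))
  refine (rpow_le_rpow (by positivity) hn (by positivity)).trans_eq ?_
  rw [← rpow_natCast, ← rpow_mul (by positivity)]
  congr 1; push_cast; ring

namespace TForm

/-- The `r` modulo `N` that are allowed in `OvCond`. -/
noncomputable def rootSet (f : TForm) (N : ℕ) : Finset ℕ :=
  (range N).filter fun r : ℕ => (N : ℤ) ∣ (f.shift r).d ∧ IsCoprime (f.shift r).c (N : ℤ)

theorem mod_mem_rootSet {f : TForm} {N m r : ℕ} (hm : 0 < m) (hmN : m ∣ N) (h : r ∈ f.rootSet N) :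
    r % m ∈ f.rootSet m := by
  simp only [rootSet, mem_filter, mem_range] at h ⊢
  obtain ⟨-, h1, h2⟩ := h
  have hmN' : (m : ℤ) ∣ N := by exact_mod_cast hmN
  obtain ⟨k, hk⟩ : ∃ k : ℤ, (r : ℤ) = (r % m : ℕ) + m * k :=
    ⟨(r / m : ℕ), by exact_mod_cast (Nat.mod_add_div r m).symm⟩
  generalize ((r % m : ℕ) : ℤ) = s at hk ⊢
  refine ⟨Nat.mod_lt _ hm, ?_, ?_⟩
  · have := hmN'.trans h1
    rw [hk, shift_d] at this
    rw [shift_d]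
    refine (dvd_iff_dvd_of_dvd_sub ?_).1 this
    exact ⟨k * (3 * f.c + 3 * f.b * (2 * s + m * k) + f.a * (3 * s ^ 2 + 3 * s * m * k + (m * k) ^ 2)), by ring⟩
  · have := h2.of_isCoprime_of_dvd_right hmN'
    rw [hk, shift_c] at this
    rw [shift_c]
    have e : f.c + 2 * f.b * (s + m * k) + f.a * (s + m * k) ^ 2 =
      (f.c + 2 * f.b * s + f.a * s ^ 2) + m * (k * (2 * f.b + f.a * (2 * s + m * k))) := by ring
    rw [e] at this
    exact this.of_add_mul_left_left

theorem card_rootSet_mul_le (f : TForm) {m n : ℕ} (hm : 0 < m) (hn : 0 < n) (hmn : m.Coprime n) :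
    (f.rootSet (m * n)).card ≤ (f.rootSet m).card * (f.rootSet n).card := by
  rw [← card_product]
  refine card_le_card_of_injOn (fun r => (r % m, r % n)) (fun r hr => ?_) fun r hr s hs h => ?_
  · exact mem_product.2 ⟨mod_mem_rootSet hm (dvd_mul_right _ _) hr, mod_mem_rootSet hn (dvd_mul_left _ _) hr⟩
  · have h1 : r < m * n := mem_range.1 (mem_filter.1 hr).1
    have h2 : s < m * n := mem_range.1 (mem_filter.1 hs).1
    have h3 : r ≡ s [MOD m * n] := (Nat.modEq_and_modEq_iff_modEq_mul hmn).1
      ⟨congrArg Prod.fst h, congrArg Prod.snd h⟩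
    exact h3.eq_of_lt_of_lt h1 h2

theorem card_rootSet_prime_le (f : TForm) {p : ℕ} (hp : p.Prime) : (f.rootSet p).card ≤ 3 := by
  by_cases h3 : p = 3
  · subst h3; exact (card_filter_le _ _).trans (by simp)
  rcases (f.rootSet p).eq_empty_or_nonempty with h | ⟨r, hr⟩
  · simp [h]
  have := Fact.mk hp
  have key : ∀ r : ℕ, (p : ℤ) ∣ (f.shift r).d →
      (f.a : ZMod p) * (r : ZMod p) ^ 3 + 3 * f.b * (r : ZMod p) ^ 2 + 3 * f.c * (r : ZMod p) + f.d = 0 := by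
    intro r h
    rw [shift_d, ← ZMod.intCast_zmod_eq_zero_iff_dvd] at h
    push_cast at h
    linear_combination h
  set P : Cubic (ZMod p) := ⟨f.a, 3 * f.b, 3 * f.c, f.d⟩ with hP
  have hP0 : P.toPoly ≠ 0 := by
    intro h0
    have h1 := Cubic.toPoly_eq_zero_iff P |>.1 h0
    have h30 : (3 : ZMod p) ≠ 0 := by
      intro h
      have : ((3 : ℕ) : ZMod p) = 0 := by exact_mod_cast h
      rw [ZMod.natCast_eq_zero_iff, Nat.prime_dvd_prime_iff_eq hp Nat.prime_three] at this
      exact h3 this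
    have ha : (f.a : ZMod p) = 0 := congrArg Cubic.a h1
    have hb : (f.b : ZMod p) = 0 := (mul_eq_zero.1 (congrArg Cubic.b h1 : 3 * (f.b : ZMod p) = 0)).resolve_left h30
    have hc : (f.c : ZMod p) = 0 := (mul_eq_zero.1 (congrArg Cubic.c h1 : 3 * (f.c : ZMod p) = 0)).resolve_left h30
    have h4 := (mem_filter.1 hr).2.2
    have h5 : (p : ℤ) ∣ (f.shift r).c := by
      rw [shift_c, ← ZMod.intCast_zmod_eq_zero_iff_dvd]
      push_cast; rw [ha, hb, hc]; ring
    exact (Nat.prime_iff_prime_int.1 hp).not_isUnit (h4.isUnit_of_dvd' h5 dvd_rfl)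
  have h1 : (f.rootSet p).card ≤ P.toPoly.roots.toFinset.card := by
    refine card_le_card_of_injOn (fun r : ℕ => (r : ZMod p)) (fun r hr => ?_) fun r hr s hs h => ?_
    · simp only [mem_coe, Multiset.mem_toFinset]
      rw [mem_roots hP0, IsRoot.def]
      have := key r (mem_filter.1 hr).2.1
      simpa [Cubic.toPoly, hP] using this
    · have h1 : r < p := mem_range.1 (mem_filter.1 hr).1
      have h2 : s < p := mem_range.1 (mem_filter.1 hs).1
      exact ((ZMod.natCast_eq_natCast_iff _ _ _).1 h).eq_of_lt_of_lt h1 h2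
  refine h1.trans ((Multiset.toFinset_card_le _).trans ((card_roots' _).trans ?_))
  exact natDegree_cubic_le

theorem card_rootSet_le (f : TForm) {N : ℕ} (h : Squarefree N) : (f.rootSet N).card ≤ N.divisors.card ^ 2 := by
  induction N using Nat.recOnPosPrimePosCoprime with
  | prime_pow p k hp hk =>
    have : k = 1 := by
      by_contra hk1
      exact hp.not_isUnit (h p (by rw [← pow_two]; exact pow_dvd_pow p (by omega)))
    subst this
    have := f.card_rootSet_prime_le hp
    rw [pow_one, hp.divisors, card_pair hp.one_lt.ne]
    omega
  | zero => simp at h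
  | one => exact (card_filter_le _ _).trans (by simp)
  | coprime a b ha hb hab iha ihb =>
    refine (f.card_rootSet_mul_le (by omega) (by omega) hab).trans ?_
    rw [hab.card_divisors_mul, mul_pow]
    exact Nat.mul_le_mul (iha (h.squarefree_of_dvd (dvd_mul_right _ _))) (ihb (h.squarefree_of_dvd (dvd_mul_left _ _)))

theorem sum_card_ovCond_le (f : TForm) {n : ℕ} (h : Squarefree n) :
    ∑ e ∈ n.divisors, ((range (n / e)).filter fun r : ℕ => OvCond (n / e : ℕ) e f r).card ≤ n.divisors.card ^ 3 := by
  rw [pow_succ', ← smul_eq_mul]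
  refine sum_le_card_nsmul _ _ _ fun e he => ?_
  have h1 := Nat.div_dvd_of_dvd (Nat.dvd_of_mem_divisors he)
  refine le_trans (card_le_card fun r hr => ?_) ((f.card_rootSet_le (h.squarefree_of_dvd h1)).trans
    (Nat.pow_le_pow_left (card_le_card (Nat.divisors_subset_of_dvd h.ne_zero h1)) 2))
  simp only [mem_filter, rootSet] at hr ⊢
  exact ⟨hr.1, hr.2.2.1, hr.2.2.2.1⟩

end TForm

end

section
open Finset Real

theorem red_finite (Y : ℝ) : {f : TForm | f.Red false ∧ (f.D : ℝ) < Y}.Finite := by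
  refine (xSet_finite false Y (h := 1) (N := 1) (e := 1) (r := 0) (by simp) (by simp) (by simp)
    (by simp)).subset fun f hf => ⟨hf.1, hf.2, ?_, ?_⟩
  · simp [TForm.HDvd]
  · simp [TForm.OvCond, isCoprime_one_right]

/-- The reduced forms of discriminant less than `Y`. -/
noncomputable def redForms (Y : ℝ) : Finset TForm := (red_finite Y).toFinset

theorem mem_redForms {Y : ℝ} {f : TForm} : f ∈ redForms Y ↔ f.Red false ∧ (f.D : ℝ) < Y := by
  simp [redForms]

/-- The real number `B` with `a² B³ = S`. -/
noncomputable def cB (S : ℝ) (a : ℕ) : ℝ := (S / a ^ 2) ^ (1 / 3 : ℝ)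

/-- The bound for the third coefficient. -/
noncomputable def limC (S : ℝ) (a : ℕ) (_ : ℤ) : ℝ := 5 * a * cB S a ^ 2

/-- The bound for the last coefficient. -/
noncomputable def limD (S : ℝ) (a : ℕ) (b : ℤ) : ℝ :=
  100 * ((a : ℝ) ^ 3 * cB S a ^ 5 / ((a : ℝ) ^ 2 * cB S a ^ 2 + (b : ℝ) ^ 2))

/-- The possible pairs of first coefficients. -/
noncomputable def boxAB (S : ℝ) : Finset (ℕ × ℤ) :=
  Icc 1 ⌊√(2 * S)⌋₊ ×ˢ Icc (-(⌈√(2 * S)⌉₊ : ℤ)) ⌈√(2 * S)⌉₊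

/-- The integers of absolute value at most `L`. -/
noncomputable def seg (L : ℝ) : Finset ℤ := Icc (-(⌊L⌋₊ : ℤ)) ⌊L⌋₊

theorem mem_seg {L : ℝ} {z : ℤ} (h : |(z : ℝ)| ≤ L) : z ∈ seg L := by
  have h1 : z.natAbs ≤ ⌊L⌋₊ := Nat.le_floor (by rwa [Nat.cast_natAbs, Int.cast_abs])
  rw [seg, mem_Icc]; omega

theorem abs_le_of_mem_seg {L : ℝ} (hL : 0 ≤ L) {z : ℤ} (h : z ∈ seg L) : (z.natAbs : ℝ) ≤ L := by
  rw [seg, mem_Icc] at h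
  exact le_trans (by exact_mod_cast (by omega : z.natAbs ≤ ⌊L⌋₊)) (Nat.floor_le hL)

theorem card_seg_le {L : ℝ} (hL : 0 ≤ L) : ((seg L).card : ℝ) ≤ 2 * L + 1 := by
  rw [seg, Int.card_Icc]
  have : ((⌊L⌋₊ : ℤ) + 1 - -(⌊L⌋₊ : ℤ)).toNat = 2 * ⌊L⌋₊ + 1 := by omega
  rw [this]; push_cast
  linarith [Nat.floor_le hL]

theorem card_seg_dvd_le {L : ℝ} (hL : 0 ≤ L) {m δ : ℤ} (hm : 0 < m) :
    (((seg L).filter fun z => m ∣ z - δ).card : ℝ) ≤ 2 * L / m + 2 := by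
  have hm' : (1 : ℝ) ≤ m := by exact_mod_cast hm
  have h1 : (seg L).filter (fun z => m ∣ z - δ) =
      {x ∈ Ioc (-(⌊L⌋₊ : ℤ) - 1) ⌊L⌋₊ | x ≡ δ [ZMOD m]} := by
    ext z
    simp only [seg, mem_filter, mem_Icc, mem_Ioc]
    rw [Int.modEq_comm, Int.modEq_iff_dvd]
    refine and_congr_left fun _ => ⟨fun h => ?_, fun h => ?_⟩ <;> constructor <;> omega
  rw [h1]
  have h2 := Int.Ioc_filter_modEq_card (-(⌊L⌋₊ : ℤ) - 1) ⌊L⌋₊ hm δ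
  generalize card _ = k at h2 ⊢
  have h3 : ((k : ℤ) : ℚ) ≤ 2 * ⌊L⌋₊ / m + 2 := by
    rw [h2]
    push_cast
    refine max_le ?_ (by positivity)
    have h4 := Int.floor_le (((⌊L⌋₊ : ℚ) - δ) / m)
    have h5 := Int.lt_floor_add_one ((-(⌊L⌋₊ : ℚ) - 1 - δ) / m)
    have h6 : ((⌊L⌋₊ : ℚ) - δ) / m - (-(⌊L⌋₊ : ℚ) - 1 - δ) / m = 2 * ⌊L⌋₊ / m + 1 / m := by ring
    have h7 : (1 : ℚ) / m ≤ 1 := by rw [div_le_one (by exact_mod_cast hm)]; exact_mod_cast hm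
    linarith
  have h4 : (k : ℝ) ≤ 2 * ⌊L⌋₊ / m + 2 := by exact_mod_cast h3
  refine h4.trans ?_
  gcongr
  exact Nat.floor_le hL

section
variable {S : ℝ} (hS : 1 ≤ S)
include hS

theorem cB_pos {a : ℕ} (ha : 0 < a) : 0 < cB S a := by unfold cB; positivity

theorem cB_spec {a : ℕ} (ha : 0 < a) : (a : ℝ) ^ 2 * cB S a ^ 3 = S := by
  have : (0 : ℝ) < a := by exact_mod_cast ha
  rw [cB, ← rpow_natCast ((S / a ^ 2) ^ (1 / 3 : ℝ)), ← rpow_mul (by positivity)]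
  norm_num
  field_simp

theorem cB_ge {a : ℕ} (ha : a ∈ Icc 1 ⌊√(2 * S)⌋₊) : 1 / 2 ≤ cB S a := by
  obtain ⟨h1, h2⟩ := mem_Icc.1 ha
  have h3 := cB_spec hS h1
  have h4 := cB_pos hS h1
  have h5 : (a : ℝ) ≤ √(2 * S) := (Nat.le_floor_iff (by positivity)).1 h2
  have h6 : (a : ℝ) ^ 2 ≤ 2 * S := by
    rw [← sq_sqrt (show 0 ≤ 2 * S by linarith)]; gcongr
  by_contra! h
  have h7 : cB S a ^ 3 < (1 / 2) ^ 3 := by gcongr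
  nlinarith [sq_nonneg (a : ℝ)]

theorem limD_nonneg {a : ℕ} (ha : 0 < a) (b : ℤ) : 0 ≤ limD S a b := by
  have := cB_pos hS ha
  unfold limD; positivity

theorem mem_box {f : TForm} (hf : f ∈ redForms (4 / 27 * S ^ 2)) :
    (f.a.toNat : ℤ) = f.a ∧ 0 < f.D ∧ (f.a.toNat, f.b) ∈ boxAB S ∧ f.c ∈ seg (limC S f.a.toNat f.b) ∧
      f.d ∈ seg (limD S f.a.toNat f.b) := by
  obtain ⟨⟨h1, h2, h3⟩, h4⟩ := mem_redForms.1 hf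
  obtain ⟨fa, b, c, d⟩ := f
  lift fa to ℕ using h1.le with a
  have ha : 0 < a := by simpa using h1
  have haR : (0 : ℝ) < a := by exact_mod_cast ha
  have e := TForm.cast_D ⟨a, b, c, d⟩
  have h2' : (0 : ℝ) < (⟨a, b, c, d⟩ : TForm).D := by exact_mod_cast h2
  rw [e] at h2' h4
  have h7 : ((c : ℝ), (d : ℝ)) ∈ Om false a b (4 / 27 * ((a : ℝ) ^ 2 * cB S a ^ 3) ^ 2) := by
    rw [cB_spec hS ha]; exact ⟨by exact_mod_cast h3, by exact_mod_cast h2', by exact_mod_cast h4⟩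
  obtain ⟨k1, k2, -, k4, k5⟩ := om_bounds haR (cB_pos hS ha) h7
  have k3 := cB_spec hS ha
  refine ⟨by simp, h2, ?_, mem_seg (by simpa [limC] using k5), mem_seg (by simpa [limD] using k4)⟩
  rw [boxAB, mem_product, mem_Icc, mem_Icc]
  simp only [Int.toNat_natCast]
  have k6 : (4 / 5 : ℝ) ^ 3 ≤ cB S a ^ 3 := by gcongr
  refine ⟨⟨ha, Nat.le_floor (le_sqrt_of_sq_le ?_)⟩, ?_⟩
  · nlinarith [mul_le_mul_of_nonneg_left k6 (sq_nonneg (a : ℝ))]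
  · have : |(b : ℝ)| ≤ √(2 * S) := by
      refine le_sqrt_of_sq_le ?_
      rw [sq_abs]; linarith
    have h8 : (b.natAbs : ℝ) ≤ ⌈√(2 * S)⌉₊ := by
      rw [Nat.cast_natAbs, Int.cast_abs]; exact this.trans (Nat.le_ceil _)
    have : b.natAbs ≤ ⌈√(2 * S)⌉₊ := by exact_mod_cast h8
    omega

theorem card_b_le : ((Icc (-(⌈√(2 * S)⌉₊ : ℤ)) ⌈√(2 * S)⌉₊).card : ℝ) ≤ 6 * √S := by
  rw [Int.card_Icc]
  have : ((⌈√(2 * S)⌉₊ : ℤ) + 1 - -(⌈√(2 * S)⌉₊ : ℤ)).toNat = 2 * ⌈√(2 * S)⌉₊ + 1 := by omega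
  rw [this]; push_cast
  have h1 := Nat.ceil_lt_add_one (sqrt_nonneg (2 * S))
  have h2 : √(2 * S) ≤ 3 / 2 * √S := by
    rw [sqrt_mul (by norm_num)]
    gcongr
    rw [sqrt_le_left (by norm_num)]; norm_num
  have h3 := one_le_sqrt.2 hS
  linarith

theorem sum_sq_le : ∑ a ∈ Icc 1 ⌊√(2 * S)⌋₊, ((a : ℝ) * cB S a ^ 2) ^ 2 ≤ 4 * (S * √S) := by
  have hS0 : 0 < S := by linarith
  set K := ⌊√(2 * S)⌋₊
  have hK : (K : ℝ) ≤ √(2 * S) := Nat.floor_le (by positivity)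
  have e : ∀ a ∈ Icc 1 K, ((a : ℝ) * cB S a ^ 2) ^ 2 = S ^ (4 / 3 : ℝ) * (a : ℝ) ^ (-(2 / 3) : ℝ) := by
    intro a ha
    have ha0 : (0 : ℝ) < a := by exact_mod_cast (mem_Icc.1 ha).1
    rw [mul_pow, ← pow_mul, cB, ← rpow_natCast ((S / a ^ 2) ^ (1 / 3 : ℝ)), ← rpow_mul (by positivity),
      div_rpow hS0.le (by positivity), ← rpow_natCast (a : ℝ) 2, ← rpow_mul ha0.le,
      mul_div_assoc', mul_comm, mul_div_assoc, ← rpow_sub ha0]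
    norm_num
  rw [sum_congr rfl e, ← mul_sum]
  calc S ^ (4 / 3 : ℝ) * ∑ a ∈ Icc 1 K, (a : ℝ) ^ (-(2 / 3) : ℝ)
      ≤ S ^ (4 / 3 : ℝ) * (3 * (√(2 * S)) ^ (1 / 3 : ℝ)) := by
        gcongr
        exact (sum_rpow_neg_two_thirds K).trans (by gcongr)
    _ = 3 * 2 ^ (1 / 6 : ℝ) * (S ^ (4 / 3 : ℝ) * S ^ (1 / 6 : ℝ)) := by
        rw [sqrt_eq_rpow, ← rpow_mul (by positivity), mul_rpow (by norm_num) hS0.le]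
        norm_num; ring
    _ = 3 * 2 ^ (1 / 6 : ℝ) * (S * √S) := by
        rw [sqrt_eq_rpow, ← rpow_add hS0, ← rpow_one_add' hS0.le (by norm_num)]; norm_num
    _ ≤ _ := by
        gcongr
        have : (2 : ℝ) ^ (1 / 6 : ℝ) ≤ 4 / 3 := by
          refine (pow_le_pow_iff_left₀ (by positivity) (by norm_num) (n := 6) (by norm_num)).1 ?_
          rw [← rpow_natCast, ← rpow_mul (by norm_num)]; norm_num
        linarith

theorem sum_le : ∑ a ∈ Icc 1 ⌊√(2 * S)⌋₊, (a : ℝ) * cB S a ^ 2 ≤ 3 * S := by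
  have hs : 0 < √S := sqrt_pos.2 (by linarith)
  have hss : √S * √S = S := mul_self_sqrt (by linarith)
  have hK : (⌊√(2 * S)⌋₊ : ℝ) ≤ 3 / 2 * √S := by
    refine (Nat.floor_le (by positivity)).trans ?_
    rw [sqrt_mul (by norm_num)]
    gcongr
    rw [sqrt_le_left (by norm_num)]; norm_num
  have h1 : ∑ a ∈ Icc 1 ⌊√(2 * S)⌋₊, (2 * √S) * ((a : ℝ) * cB S a ^ 2) ≤
      ∑ a ∈ Icc 1 ⌊√(2 * S)⌋₊, (S + ((a : ℝ) * cB S a ^ 2) ^ 2) :=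
    sum_le_sum fun a _ => by nlinarith [sq_nonneg (√S - (a : ℝ) * cB S a ^ 2)]
  rw [← mul_sum, sum_add_distrib, sum_const, Nat.card_Icc, nsmul_eq_mul,
    Nat.add_sub_cancel] at h1
  have h2 := sum_sq_le hS
  have h3 : 2 * √S * ∑ a ∈ Icc 1 ⌊√(2 * S)⌋₊, (a : ℝ) * cB S a ^ 2 ≤ 2 * √S * (3 * S) := by
    nlinarith [mul_le_mul_of_nonneg_right hK (show 0 ≤ S by linarith)]
  exact le_of_mul_le_mul_left h3 (by positivity)

theorem sum_limD_le {a g : ℕ} (ha : a ∈ Icc 1 ⌊√(2 * S)⌋₊) (hg : g ∣ a) :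
    ∑ b ∈ (Icc (-(⌈√(2 * S)⌉₊ : ℤ)) ⌈√(2 * S)⌉₊).filter (fun b => (g : ℤ) ∣ b), limD S a b * g ≤
      600 * ((a : ℝ) * cB S a ^ 2) ^ 2 := by
  have ha1 := (mem_Icc.1 ha).1
  have hg0 : 0 < g := Nat.pos_of_dvd_of_pos hg ha1
  have haR : (0 : ℝ) < a := by exact_mod_cast ha1
  have hgR : (1 : ℝ) ≤ g := by exact_mod_cast hg0
  have hga : (g : ℝ) ≤ a := by exact_mod_cast Nat.le_of_dvd ha1 hg
  have hB := cB_ge hS ha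
  set B := cB S a with hBdef
  have hB0 : 0 < B := by linarith
  set M := ⌈√(2 * S)⌉₊
  have h1 := sum_inv_sq_le (P := a * B) (g := g) (by positivity) (by positivity) M
  have h2 : ∑ b ∈ (Icc (-(M : ℤ)) M).filter (fun b => (g : ℤ) ∣ b), limD S a b * g ≤
      ∑ b ∈ (Icc (-(M : ℤ)) M).image (fun z => (g : ℤ) * z), limD S a b * g := by
    refine sum_le_sum_of_subset_of_nonneg (fun b hb => ?_) fun b _ _ =>
      mul_nonneg (limD_nonneg hS ha1 b) (by positivity)
    obtain ⟨h3, z, rfl⟩ := mem_filter.1 hb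
    rw [mem_Icc] at h3
    refine mem_image.2 ⟨z, mem_Icc.2 ?_, rfl⟩
    have hg1 : (1 : ℤ) ≤ g := by exact_mod_cast hg0
    constructor <;> nlinarith
  have hgz : (g : ℤ) ≠ 0 := by exact_mod_cast hg0.ne'
  rw [sum_image fun x _ y _ h => mul_left_cancel₀ hgz h] at h2
  refine h2.trans ?_
  have e : ∀ z : ℤ, limD S a (g * z) * g = 100 * g * a ^ 3 * B ^ 5 * (1 / (((a : ℝ) * B) ^ 2 + ((g : ℝ) * z) ^ 2)) := by
    intro z; rw [limD, ← hBdef]; push_cast; ring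
  simp only [e]
  rw [← mul_sum]
  refine (mul_le_mul_of_nonneg_left h1 (by positivity)).trans ?_
  have e2 : 100 * g * a ^ 3 * B ^ 5 * (1 / ((a : ℝ) * B) ^ 2 + 4 / (g * ((a : ℝ) * B))) =
      100 * (a * B ^ 3 * g) + 400 * (a * B ^ 2) ^ 2 := by field_simp; ring
  rw [e2]
  have : (a : ℝ) * B ^ 3 * g ≤ 2 * (a * B ^ 2) ^ 2 := by
    calc (a : ℝ) * B ^ 3 * g ≤ a * B ^ 3 * (a * (2 * B)) := by gcongr; nlinarith
      _ = _ := by ring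
  linarith

/-- The number of triples of coefficients `a, b, c`. -/
theorem card_boxC_le : ∑ p ∈ boxAB S, ((seg (limC S p.1 p.2)).card : ℝ) ≤ 300 * (S * √S) := by
  have hs : 0 < √S := sqrt_pos.2 (by linarith)
  rw [boxAB, sum_product]
  refine (sum_le_sum (g := fun a : ℕ => 6 * √S * (14 * (a * cB S a ^ 2))) fun a ha => ?_).trans ?_
  · have hB := cB_ge hS ha
    have ha1 : (1 : ℝ) ≤ a := by exact_mod_cast (mem_Icc.1 ha).1
    have h1 : ∀ b : ℤ, ((seg (limC S a b)).card : ℝ) ≤ 14 * (a * cB S a ^ 2) := fun b => by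
      refine (card_seg_le (by unfold limC; positivity)).trans ?_
      unfold limC; nlinarith [mul_le_mul ha1 (mul_le_mul hB hB (by norm_num) (by linarith)) (by norm_num) (by linarith)]
    refine (sum_le_sum fun b _ => h1 b).trans ?_
    rw [sum_const, nsmul_eq_mul]
    gcongr
    exact card_b_le hS
  · rw [← mul_sum, ← mul_sum]
    nlinarith [mul_le_mul_of_nonneg_left (sum_le hS) hs.le]

/-- The number of triples of coefficients `a, b, d`. -/
theorem card_boxD_le : ∑ p ∈ boxAB S, ((seg (limD S p.1 p.2)).card : ℝ) ≤ 5000 * (S * √S) := by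
  have hs : 1 ≤ √S := one_le_sqrt.2 hS
  have hss : √S * √S = S := mul_self_sqrt (by linarith)
  rw [boxAB, sum_product]
  refine (sum_le_sum (g := fun a : ℕ => 1200 * (a * cB S a ^ 2) ^ 2 + 6 * √S) fun a ha => ?_).trans ?_
  · have h1 := sum_limD_le hS ha (one_dvd _)
    simp only [Nat.cast_one, isUnit_one, IsUnit.dvd, filter_true, mul_one] at h1
    refine (sum_le_sum fun b _ => card_seg_le (limD_nonneg hS (mem_Icc.1 ha).1 b)).trans ?_
    rw [sum_add_distrib, ← mul_sum, sum_const, nsmul_eq_mul, mul_one]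
    linarith [card_b_le hS]
  · rw [sum_add_distrib, ← mul_sum, sum_const, Nat.card_Icc, nsmul_eq_mul, Nat.add_sub_cancel]
    have hK : (⌊√(2 * S)⌋₊ : ℝ) ≤ 3 / 2 * √S := by
      refine (Nat.floor_le (by positivity)).trans ?_
      rw [sqrt_mul (by norm_num)]
      gcongr
      rw [sqrt_le_left (by norm_num)]; norm_num
    nlinarith [sum_sq_le hS, mul_le_mul_of_nonneg_right hK (show 0 ≤ √S by linarith)]

end

end

section
open scoped Pointwise
open Finset Real TForm

/-- The squarefree divisors of the Hessian of `f`, large ones only if `f` is irreducible. -/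
noncomputable def badH (f : TForm) (K : ℝ) : Finset ℕ :=
  f.D.natAbs.divisors.filter fun h : ℕ => Squarefree h ∧ f.HDvd h ∧ (K < h ∨ ¬ f.Irred)

theorem TForm.HDvd.dvd_D {h : ℤ} {f : TForm} (hf : f.HDvd h) : h ∣ f.D := by
  rw [D_eq, pow_two, mul_assoc]
  exact (hf.2.1.mul_left _).sub ((hf.1.mul_right _).mul_left _)

theorem TForm.exists_int_root {f : TForm} (hf : ¬ f.Irred) (ha : f.a ≠ 0) (hd : f.d ≠ 0) :
    ∃ x y : ℤ, x ∈ ({1, -1} : Finset ℤ) * (f.d.natAbs.divisors.image fun n : ℕ => (n : ℤ)) ∧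
      y ∈ f.a.natAbs.divisors.image (fun n : ℕ => (n : ℤ)) ∧
      f.c = -(f.a * x ^ 3 + 3 * f.b * x ^ 2 * y + f.d * y ^ 3) / (3 * x * y ^ 2) := by
  have key : ∃ x y : ℤ, IsCoprime x y ∧ 0 < y ∧ x ≠ 0 ∧ f.eval x y = 0 := by
    unfold Irred at hf
    push Not at hf
    obtain ⟨x, y, h, hxy⟩ := hf
    have hx : x ≠ 0 := by
      rintro rfl
      simp only [eval] at h
      have : f.d * y ^ 3 = 0 := by linear_combination h
      exact hxy rfl (by simpa [hd] using this)
    have hy : y ≠ 0 := by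
      rintro rfl
      simp only [eval] at h
      have : f.a * x ^ 3 = 0 := by linear_combination h
      exact hx (by simpa [ha] using this)
    obtain ⟨g, u, v, hg, huv, rfl, rfl⟩ := Int.exists_gcd_one' (m := x) (n := y) (Int.gcd_pos_of_ne_zero_left _ hx)
    have hg0 : (g : ℤ) ≠ 0 := by exact_mod_cast hg.ne'
    have h0 : f.eval u v = 0 := by
      have e : f.eval (u * g) (v * g) = (g : ℤ) ^ 3 * f.eval u v := by simp only [eval]; ring
      rw [e] at h
      exact (mul_eq_zero.1 h).resolve_left (pow_ne_zero 3 hg0)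
    have hc : IsCoprime u v := Int.isCoprime_iff_gcd_eq_one.2 huv
    rcases lt_or_gt_of_ne (left_ne_zero_of_mul hy) with hv | hv
    · refine ⟨-u, -v, hc.neg_neg, by omega, neg_ne_zero.2 (left_ne_zero_of_mul hx), ?_⟩
      have e : f.eval (-u) (-v) = - f.eval u v := by simp only [eval]; ring
      rw [e, h0, neg_zero]
    · exact ⟨u, v, hc, hv, left_ne_zero_of_mul hx, h0⟩
  obtain ⟨x, y, hc, hy, hx, h⟩ := key
  simp only [eval] at h
  have hya : y ∣ f.a := (hc.symm.pow_right (n := 3)).dvd_of_dvd_mul_right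
    ⟨-(3 * f.b * x ^ 2 + 3 * f.c * x * y + f.d * y ^ 2), by linear_combination h⟩
  have hxd : x ∣ f.d := (hc.pow_right (n := 3)).dvd_of_dvd_mul_right
    ⟨-(f.a * x ^ 2 + 3 * f.b * x * y + 3 * f.c * y ^ 2), by linear_combination h⟩
  refine ⟨x, y, ?_, ?_, ?_⟩
  · rw [Finset.mem_mul]
    refine ⟨x.sign, ?_, x.natAbs, mem_image_of_mem _ (Nat.mem_divisors.2 ⟨Int.natAbs_dvd_natAbs.2 hxd, by simpa using hd⟩),
      Int.sign_mul_natAbs x⟩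
    rcases lt_or_gt_of_ne hx with h | h
    · simp [Int.sign_eq_neg_one_of_neg h]
    · simp [Int.sign_eq_one_of_pos h]
  · refine mem_image.2 ⟨y.natAbs, Nat.mem_divisors.2 ⟨Int.natAbs_dvd_natAbs.2 hya, by simpa using ha⟩, ?_⟩
    exact Int.natAbs_of_nonneg hy.le
  · refine (Int.ediv_eq_of_eq_mul_left (by positivity) ?_).symm
    linear_combination -h

section
variable {S : ℝ} (hS : 1 ≤ S) {t : ℕ} (ht : ∀ n : ℕ, (n : ℝ) ≤ 100 * S ^ 2 → n.divisors.card ≤ t)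
include hS

theorem redForms_ext {f g : TForm} (hf : f ∈ redForms (4 / 27 * S ^ 2)) (hg : g ∈ redForms (4 / 27 * S ^ 2))
    (ha : f.a.toNat = g.a.toNat) (hb : f.b = g.b) (hc : f.c = g.c) (hd : f.d = g.d) : f = g :=
  TForm.ext (by rw [← (mem_box hS hf).1, ← (mem_box hS hg).1, ha]) hb hc hd

include ht

theorem card_reducible_le : ((redForms (4 / 27 * S ^ 2)).filter (fun f => ¬ f.Irred ∨ f.hA = 0)).card ≤
    ((300 + 5000 + 2 * t ^ 2 * 5000 : ℝ)) * (S * √S) := by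
  set F := redForms (4 / 27 * S ^ 2) with hF
  have hsub : F.filter (fun f => ¬ f.Irred ∨ f.hA = 0) ⊆ F.filter (fun f => f.d = 0) ∪
      (F.filter (fun f => f.hA = 0) ∪ F.filter (fun f => f.d ≠ 0 ∧ ¬ f.Irred)) := by
    intro f hf
    simp only [mem_union, mem_filter] at hf ⊢
    tauto
  have h1 : ((F.filter (fun f => f.d = 0)).card : ℝ) ≤ 300 * (S * √S) := by
    refine le_trans ?_ (card_boxC_le hS)
    rw [← Nat.cast_sum, ← card_sigma, Nat.cast_le]
    refine card_le_card_of_injOn (fun f => ⟨(f.a.toNat, f.b), f.c⟩) (fun f hf => ?_) fun f hf g hg h => ?_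
    · obtain ⟨-, -, k1, k2, -⟩ := mem_box hS (mem_filter.1 hf).1
      exact mem_sigma.2 ⟨k1, k2⟩
    · simp only [Sigma.mk.injEq, Prod.mk.injEq, heq_eq_eq] at h
      have hf' := mem_filter.1 hf
      have hg' := mem_filter.1 hg
      exact redForms_ext hS hf'.1 hg'.1 h.1.1 h.1.2 h.2 (by rw [hf'.2, hg'.2])
  have hD : ∀ f ∈ F, (⟨(f.a.toNat, f.b), f.d⟩ : (_ : ℕ × ℤ) × ℤ) ∈ (boxAB S).sigma fun p => seg (limD S p.1 p.2) :=
    fun f hf => mem_sigma.2 ⟨(mem_box hS hf).2.2.1, (mem_box hS hf).2.2.2.2⟩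
  have hbD := card_boxD_le hS
  rw [← Nat.cast_sum, ← card_sigma] at hbD
  have h2 : ((F.filter (fun f => f.hA = 0)).card : ℝ) ≤ 5000 * (S * √S) := by
    refine le_trans ?_ hbD
    rw [Nat.cast_le]
    refine card_le_card_of_injOn (fun f => ⟨(f.a.toNat, f.b), f.d⟩) (fun f hf => hD f (mem_filter.1 hf).1)
      fun f hf g hg h => ?_
    simp only [Sigma.mk.injEq, Prod.mk.injEq, heq_eq_eq] at h
    have hf' := mem_filter.1 hf
    have hg' := mem_filter.1 hg
    refine redForms_ext hS hf'.1 hg'.1 h.1.1 h.1.2 ?_ h.2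
    have e1 := hf'.2
    have e2 := hg'.2
    have e3 : f.a = g.a := by rw [← (mem_box hS hf'.1).1, ← (mem_box hS hg'.1).1, h.1.1]
    have e4 : 0 < f.a := (mem_redForms.1 hf'.1).1.1
    simp only [hA] at e1 e2
    rw [h.1.2, e3] at e1
    rw [e3] at e4
    exact mul_left_cancel₀ e4.ne' (by linarith)
  have h3 : ((F.filter (fun f => f.d ≠ 0 ∧ ¬ f.Irred)).card : ℝ) ≤ 2 * t ^ 2 * (5000 * (S * √S)) := by
    refine le_trans ?_ (mul_le_mul_of_nonneg_left hbD (by positivity))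
    rw [show (2 * (t : ℝ) ^ 2) = (2 * t ^ 2 : ℕ) by push_cast; ring, ← Nat.cast_mul, Nat.cast_le]
    refine card_le_mul_card_image_of_maps_to (f := fun f : TForm => (⟨(f.a.toNat, f.b), f.d⟩ : (_ : ℕ × ℤ) × ℤ))
      (fun f hf => hD f (mem_filter.1 hf).1) _ fun ⟨⟨a, b⟩, d⟩ hp => ?_
    obtain ⟨hp1, hp2⟩ := mem_sigma.1 hp
    have ha := mem_product.1 hp1 |>.1
    have ha1 : (1 : ℝ) ≤ a := by exact_mod_cast (mem_Icc.1 ha).1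
    have hB := cB_ge hS ha
    have hBs := cB_spec hS (mem_Icc.1 ha).1
    have hta : a.divisors.card ≤ t := ht _ <| by
      have h5 : (a : ℝ) ≤ √(2 * S) := (Nat.le_floor_iff (by positivity)).1 (mem_Icc.1 ha).2
      nlinarith [sq_sqrt (show 0 ≤ 2 * S by linarith), sqrt_nonneg (2 * S)]
    have htd : d.natAbs.divisors.card ≤ t := ht _ <| by
      refine (abs_le_of_mem_seg (limD_nonneg hS (mem_Icc.1 ha).1 b) hp2).trans ?_
      rw [limD]
      have : (a : ℝ) ^ 3 * cB S a ^ 5 / ((a : ℝ) ^ 2 * cB S a ^ 2 + (b : ℝ) ^ 2) ≤ a * cB S a ^ 3 := by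
        rw [div_le_iff₀ (by positivity)]
        nlinarith [show 0 ≤ (a : ℝ) * cB S a ^ 3 * (b : ℝ) ^ 2 by positivity]
      nlinarith [show 0 < cB S a ^ 3 by positivity, mul_le_mul_of_nonneg_right ha1 (show 0 ≤ a * cB S a ^ 3 by positivity)]
    let φ : ℤ × ℤ → ℤ := fun q => -((a : ℤ) * q.1 ^ 3 + 3 * b * q.1 ^ 2 * q.2 + d * q.2 ^ 3) / (3 * q.1 * q.2 ^ 2)
    calc _ ≤ (((({1, -1} : Finset ℤ) * (d.natAbs.divisors.image fun n : ℕ => (n : ℤ))) ×ˢ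
          (a.divisors.image fun n : ℕ => (n : ℤ))).image φ).card := by
          refine card_le_card_of_injOn (fun f => f.c) (fun f hf => ?_) fun f hf g hg h => ?_
          · simp only [coe_filter, mem_filter, Set.mem_ofPred_eq, Sigma.mk.injEq, Prod.mk.injEq, heq_eq_eq] at hf
            obtain ⟨⟨hf1, hf2, hf3⟩, ⟨hf4, hf5⟩, hf6⟩ := hf
            obtain ⟨x, y, hx, hy, hc⟩ := f.exists_int_root hf3 (mem_redForms.1 hf1).1.1.ne' hf2
            have e := (mem_box hS hf1).1
            rw [hf4] at e
            rw [← e] at hy hc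
            rw [hf6] at hx hc
            rw [hf5] at hc
            exact mem_coe.2 (mem_image.2 ⟨(x, y), mem_product.2 ⟨hx, by simpa using hy⟩, hc.symm⟩)
          · simp only [coe_filter, mem_filter, Set.mem_ofPred_eq, Sigma.mk.injEq, Prod.mk.injEq, heq_eq_eq] at hf hg
            exact redForms_ext hS hf.1.1 hg.1.1 (by rw [hf.2.1.1, hg.2.1.1]) (by rw [hf.2.1.2, hg.2.1.2]) h (by rw [hf.2.2, hg.2.2])
      _ ≤ (2 * t) * t := by
          refine card_image_le.trans ?_
          rw [card_product]
          refine Nat.mul_le_mul (card_mul_le.trans (Nat.mul_le_mul card_le_two ?_)) ?_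
          · exact card_image_le.trans htd
          · exact card_image_le.trans hta
      _ = 2 * t ^ 2 := by ring
  have h4 : ((F.filter (fun f => ¬ f.Irred ∨ f.hA = 0)).card : ℝ) ≤ (F.filter (fun f => f.d = 0)).card +
      ((F.filter (fun f => f.hA = 0)).card + (F.filter (fun f => f.d ≠ 0 ∧ ¬ f.Irred)).card) := by
    exact_mod_cast (card_le_card hsub).trans ((card_union_le _ _).trans
      (Nat.add_le_add_left (card_union_le _ _) _))
  linarith

theorem sum_badH_irred_le {K L : ℝ} (hK : 0 < K) (hL : ∑ a ∈ Icc 1 ⌊√(2 * S)⌋₊, (1 : ℝ) / a ≤ L) :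
    ((∑ f ∈ (redForms (4 / 27 * S ^ 2)).filter (fun f => f.Irred ∧ f.hA ≠ 0), (badH f K).card : ℕ) : ℝ) ≤
      t ^ 2 * (16800 * (S ^ 2 * L / K) + 504 * (S * √S)) := by
  have hS0 : 0 < S := by linarith
  let U := (boxAB S).sigma fun p => seg (limC S p.1 p.2)
  let V := U.sigma fun u => (u.1.2 ^ 2 - u.1.1 * u.2 : ℤ).natAbs.divisors.filter fun h : ℕ => Squarefree h ∧ K < h
  let W := V.sigma fun v => (seg (limD S v.1.1.1 v.1.1.2)).filter fun d =>
    HDvd (v.2 : ℤ) ⟨v.1.1.1, v.1.1.2, v.1.2, d⟩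
  have h1 : ∑ f ∈ (redForms (4 / 27 * S ^ 2)).filter (fun f => f.Irred ∧ f.hA ≠ 0), (badH f K).card ≤ W.card := by
    rw [← card_sigma]
    refine card_le_card_of_injOn (fun x => ⟨⟨⟨(x.1.a.toNat, x.1.b), x.1.c⟩, x.2⟩, x.1.d⟩) (fun x hx => ?_)
      fun x hx y hy h => ?_
    · obtain ⟨f, h⟩ := x
      simp only [coe_sigma, Set.mem_sigma_iff, coe_filter, badH, Set.mem_ofPred_eq] at hx
      obtain ⟨⟨hf, hi, hA⟩, -, hsq, hd, hKh⟩ := hx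
      obtain ⟨e, -, k1, k2, k3⟩ := mem_box hS hf
      simp only [mem_coe, W, V, U, mem_sigma, mem_filter, Nat.mem_divisors, e]
      refine ⟨⟨⟨k1, k2⟩, ⟨Int.natCast_dvd.1 hd.1, Int.natAbs_ne_zero.2 hA⟩, hsq, ?_⟩, k3, hd⟩
      tauto
    · obtain ⟨f, m⟩ := x
      obtain ⟨g, n⟩ := y
      have hf := (mem_filter.1 (mem_sigma.1 hx).1).1
      have hg := (mem_filter.1 (mem_sigma.1 hy).1).1
      simp only [Sigma.mk.injEq, Prod.mk.injEq, heq_eq_eq] at h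
      obtain ⟨⟨⟨⟨h1, h2⟩, h3⟩, h4⟩, h5⟩ := h
      obtain rfl : f = g := redForms_ext hS hf hg h1 h2 h3 h5
      subst h4; rfl
  refine (Nat.cast_le.2 h1).trans ?_
  have h2 : (W.card : ℝ) ≤ ∑ p ∈ boxAB S, ∑ c ∈ seg (limC S p.1 p.2), (t : ℝ) *
      ∑ g ∈ p.1.divisors.filter (fun g : ℕ => (g : ℤ) ∣ p.2), (2 * (limD S p.1 p.2 * g) / K + 2) := by
    rw [card_sigma, Nat.cast_sum, sum_sigma, sum_sigma]
    refine sum_le_sum fun ⟨a, b⟩ hp => sum_le_sum fun c hc => ?_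
    obtain ⟨ha, hb⟩ := mem_product.1 hp
    dsimp only at ha hb hc ⊢
    have ha0 := (mem_Icc.1 ha).1
    have hD := limD_nonneg hS ha0 b
    have hB := cB_ge hS ha
    have hBs := cB_spec hS ha0
    refine (sum_le_card_nsmul _ _ (∑ g ∈ a.divisors.filter (fun g : ℕ => (g : ℤ) ∣ b),
      (2 * (limD S a b * g) / K + 2)) fun h hh => ?_).trans ?_
    · obtain ⟨hh0, hsq, hKh⟩ := mem_filter.1 hh
      have hhR : (0 : ℝ) < h := hK.trans hKh
      obtain ⟨g, h', hg, hh', e, hga, hgb, -⟩ := hDvd_class (a : ℤ) hsq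
      obtain ⟨g0, h0', hg0, hh0', e0, hga0, hgb0, hall⟩ := hDvd_class (a : ℤ) hsq
      lift g0 to ℕ using hg0.le
      by_cases hne : ((seg (limD S a b)).filter fun d => HDvd (h : ℤ) ⟨a, b, c, d⟩).Nonempty
      · obtain ⟨d, hd⟩ := hne
        have hgb' := hgb0 b c d (mem_filter.1 hd).2
        obtain ⟨γ, δ, hγ⟩ := hall b hgb'
        refine le_trans ?_ (single_le_sum (f := fun g : ℕ => 2 * (limD S a b * g) / K + 2)
          (fun i _ => by positivity) (mem_filter.2 ⟨Nat.mem_divisors.2 ⟨by exact_mod_cast hga0, by omega⟩, hgb'⟩))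
        refine (Nat.cast_le.2 (card_le_card (monotone_filter_right _ fun d _ h => ((hγ c d).1 h).2))).trans
          ((card_seg_dvd_le hD hh0').trans ?_)
        have eR : (h : ℝ) = g0 * h0' := by exact_mod_cast e0
        have hh0R : (0 : ℝ) < h0' := by exact_mod_cast hh0'
        rw [add_le_add_iff_right, div_le_div_iff₀ hh0R hK]
        nlinarith [mul_le_mul_of_nonneg_left hKh.le hD]
      · rw [not_nonempty_iff_eq_empty.1 hne, card_empty, Nat.cast_zero]
        positivity
    · rw [nsmul_eq_mul]
      refine mul_le_mul_of_nonneg_right (Nat.cast_le.2 ((card_filter_le _ _).trans (ht _ ?_))) (by positivity)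
      have hb' : |(b : ℝ)| ≤ 2 * √(2 * S) := by
        have k1 : |b| ≤ (⌈√(2 * S)⌉₊ : ℤ) := abs_le.2 (mem_Icc.1 hb)
        have k2 : |(b : ℝ)| ≤ (⌈√(2 * S)⌉₊ : ℝ) := by exact_mod_cast k1
        have k3 : 1 ≤ √(2 * S) := one_le_sqrt.2 (by linarith)
        linarith [Nat.ceil_lt_add_one (sqrt_nonneg (2 * S))]
      have hc' := abs_le_of_mem_seg (by rw [limC]; positivity) hc
      rw [Nat.cast_natAbs, Int.cast_abs] at hc' ⊢
      rw [limC] at hc'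
      have k4 : (b : ℝ) ^ 2 ≤ 8 * S := by
        rw [← sq_abs]
        nlinarith [sq_sqrt (show 0 ≤ 2 * S by linarith), abs_nonneg (b : ℝ)]
      have k5 : (a : ℝ) * |(c : ℝ)| ≤ 10 * S := by
        have k6 : (a : ℝ) ^ 2 * cB S a ^ 2 ≤ 2 * S := by
          nlinarith [show 0 ≤ (a : ℝ) ^ 2 * cB S a ^ 2 by positivity]
        nlinarith [mul_le_mul_of_nonneg_left hc' (Nat.cast_nonneg (α := ℝ) a)]
      push_cast
      refine (abs_sub _ _).trans ?_
      rw [abs_mul, abs_of_nonneg (sq_nonneg (b : ℝ)), Nat.abs_cast]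
      nlinarith
  refine h2.trans ?_
  have h3 : ∀ a ∈ Icc 1 ⌊√(2 * S)⌋₊, ∑ b ∈ Icc (-(⌈√(2 * S)⌉₊ : ℤ)) ⌈√(2 * S)⌉₊,
      ∑ c ∈ seg (limC S a b), (t : ℝ) * ∑ g ∈ a.divisors.filter (fun g : ℕ => (g : ℤ) ∣ b), (2 * (limD S a b * g) / K + 2)
      ≤ t ^ 2 * (16800 * S ^ 2 / K * (1 / a) + 168 * √S * (a * cB S a ^ 2)) := by
    intro a ha
    have ha0 := (mem_Icc.1 ha).1
    have ha1 : (1 : ℝ) ≤ a := by exact_mod_cast ha0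
    have hB := cB_ge hS ha
    have hBs := cB_spec hS ha0
    have hC : ((seg (limC S a 0)).card : ℝ) ≤ 14 * (a * cB S a ^ 2) := by
      refine (card_seg_le (by rw [limC]; positivity)).trans ?_
      rw [limC]
      nlinarith [show 1 / 4 ≤ cB S a ^ 2 by nlinarith]
    have hta : (a.divisors.card : ℝ) ≤ t := Nat.cast_le.2 <| ht _ <| by
      have h5 : (a : ℝ) ≤ √(2 * S) := (Nat.le_floor_iff (by positivity)).1 (mem_Icc.1 ha).2
      nlinarith [sq_sqrt (show 0 ≤ 2 * S by linarith), sqrt_nonneg (2 * S)]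
    have hg : ∑ b ∈ Icc (-(⌈√(2 * S)⌉₊ : ℤ)) ⌈√(2 * S)⌉₊, ∑ g ∈ a.divisors.filter (fun g : ℕ => (g : ℤ) ∣ b),
        (2 * (limD S a b * g) / K + 2) ≤ t * (1200 * ((a : ℝ) * cB S a ^ 2) ^ 2 / K + 12 * √S) := by
      simp only [sum_filter]
      rw [sum_comm]
      refine (sum_le_card_nsmul _ _ (1200 * ((a : ℝ) * cB S a ^ 2) ^ 2 / K + 12 * √S) fun g hg => ?_).trans ?_
      · rw [← sum_filter, sum_add_distrib, ← sum_div, ← mul_sum, sum_const, nsmul_eq_mul]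
        have k1 := sum_limD_le hS ha (Nat.dvd_of_mem_divisors hg)
        have k2 := (Nat.cast_le (α := ℝ).2 (card_filter_le (Icc (-(⌈√(2 * S)⌉₊ : ℤ)) ⌈√(2 * S)⌉₊)
          (fun b => (g : ℤ) ∣ b))).trans (card_b_le hS)
        refine add_le_add ?_ (by linarith)
        rw [div_le_div_iff_of_pos_right hK]
        linarith
      · rw [nsmul_eq_mul]
        exact mul_le_mul_of_nonneg_right hta (by positivity)
    simp only [sum_const, nsmul_eq_mul]
    change ∑ b ∈ _, ((seg (limC S a 0)).card : ℝ) * _ ≤ _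
    rw [← mul_sum, ← mul_sum]
    calc
      _ ≤ 14 * (a * cB S a ^ 2) * (t * (t * (1200 * ((a : ℝ) * cB S a ^ 2) ^ 2 / K + 12 * √S))) := by
        gcongr
        exact mul_nonneg (by positivity) (sum_nonneg fun b _ => sum_nonneg fun g _ => by
          have := limD_nonneg hS ha0 b
          positivity)
      _ = _ := by
        have e : S ^ 2 = a * (a * cB S a ^ 2) ^ 3 := by nth_rw 1 [← hBs]; ring
        rw [e]
        field_simp
        ring
  rw [boxAB, sum_product]
  refine (sum_le_sum h3).trans ?_
  rw [← mul_sum, sum_add_distrib, ← mul_sum, ← mul_sum]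
  refine mul_le_mul_of_nonneg_left (add_le_add ?_ ?_) (by positivity)
  · calc _ ≤ 16800 * S ^ 2 / K * L := by gcongr
      _ = _ := by ring
  · nlinarith [sum_le hS, sqrt_nonneg S]

theorem sum_badH_le {K L : ℝ} (hK : 0 < K) (hL : ∑ a ∈ Icc 1 ⌊√(2 * S)⌋₊, (1 : ℝ) / a ≤ L) :
    ((∑ f ∈ redForms (4 / 27 * S ^ 2), (badH f K).card : ℕ) : ℝ) ≤ 16800 * t ^ 3 * (S * √S + S ^ 2 * L / K) := by
  have h1 := sum_badH_irred_le hS ht hK hL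
  have h2 := card_reducible_le hS ht
  have ht1 : (1 : ℝ) ≤ t := by
    have := ht 1 (by push_cast; nlinarith)
    rw [Nat.divisors_one, card_singleton] at this
    exact_mod_cast this
  have h3 : ∑ f ∈ (redForms (4 / 27 * S ^ 2)).filter (fun f => ¬ (f.Irred ∧ f.hA ≠ 0)), (badH f K).card ≤
      ((redForms (4 / 27 * S ^ 2)).filter (fun f => ¬ f.Irred ∨ f.hA = 0)).card * t := by
    rw [← smul_eq_mul (α := ℕ), filter_congr fun (f : TForm) _ => (by tauto : ¬ (f.Irred ∧ f.hA ≠ 0) ↔ ¬ f.Irred ∨ f.hA = 0)]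
    refine sum_le_card_nsmul _ _ _ fun f hf => (card_filter_le _ _).trans (ht _ ?_)
    obtain ⟨h4, h5⟩ := mem_redForms.1 (mem_filter.1 hf).1
    have h6 : (0 : ℝ) < f.D := by exact_mod_cast h4.2.1
    rw [Nat.cast_natAbs, Int.cast_abs, abs_of_pos h6]
    nlinarith
  rw [← sum_filter_add_sum_filter_not _ fun f : TForm => f.Irred ∧ f.hA ≠ 0, Nat.cast_add]
  have h4 : (_ : ℝ) ≤ _ := Nat.cast_le.2 h3
  rw [Nat.cast_mul] at h4
  have hs : 0 ≤ S * √S := by positivity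
  have hL0 : 0 ≤ S ^ 2 * L / K := by
    have : 0 ≤ L := le_trans (sum_nonneg fun a _ => by positivity) hL
    positivity
  have e1 : (t : ℝ) ≤ t ^ 3 := le_self_pow₀ ht1 (by norm_num)
  have e2 : (t : ℝ) ^ 2 ≤ t ^ 3 := pow_le_pow_right₀ ht1 (by norm_num)
  nlinarith [mul_le_mul_of_nonneg_right h2 (Nat.cast_nonneg (α := ℝ) t), mul_le_mul_of_nonneg_right e1 hs,
    mul_le_mul_of_nonneg_right e2 hs, mul_le_mul_of_nonneg_right e2 hL0]

end

end

section
open Finset ArithmeticFunction TForm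

/-- Fundamental discriminants together with `1`. -/
def FundOrOne (D : ℤ) : Prop := IsFundamentalDiscriminant D ∨ D = 1

namespace TForm

theorem DDvd.mul_of_isCoprime {g u v D : ℤ} (hg : g ≠ 0) (hv : v ≠ 0) (huv : IsCoprime u v)
    (h1 : DDvd (g * u) D) (h2 : DDvd (g * v) D) : DDvd (g * u * v) D := by
  obtain ⟨d1, e1, m1⟩ := h1
  obtain ⟨d2, e2, m2⟩ := h2
  have e3 : u ^ 2 * d1 = v ^ 2 * d2 := mul_left_cancel₀ (pow_ne_zero 2 hg) (by linear_combination e2 - e1)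
  obtain ⟨d, rfl⟩ : v ^ 2 ∣ d1 := (huv.symm.pow (m := 2) (n := 2)).dvd_of_dvd_mul_left ⟨d2, e3⟩
  obtain rfl : u ^ 2 * d = d2 := mul_left_cancel₀ (pow_ne_zero 2 hv) (by linear_combination e3)
  refine ⟨d, by linear_combination e1, ?_⟩
  rcases Int.even_or_odd' v with ⟨k, rfl | rfl⟩
  · rcases Int.even_or_odd' u with ⟨l, rfl | rfl⟩
    · exact absurd (huv.isUnit_of_dvd' (x := 2) ⟨_, rfl⟩ ⟨_, rfl⟩) (by norm_num [Int.isUnit_iff])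
    · have : (2 * l + 1) ^ 2 * d = d + 4 * ((l ^ 2 + l) * d) := by ring
      omega
  · have : (2 * k + 1) ^ 2 * d = d + 4 * ((k ^ 2 + k) * d) := by ring
    omega

theorem DDvd.of_dvd {q m D : ℤ} (h : DDvd m D) (hq : q ∣ m) : DDvd q D := by
  obtain ⟨k, rfl⟩ := hq
  obtain ⟨d, e, hd⟩ := h
  refine ⟨k ^ 2 * d, by rw [e]; ring, ?_⟩
  rcases Int.even_or_odd' k with ⟨l, rfl | rfl⟩
  · left; rw [show (2 * l) ^ 2 * d = 4 * (l ^ 2 * d) by ring]; omega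
  · rw [show (2 * l + 1) ^ 2 * d = d + 4 * ((l ^ 2 + l) * d) by ring]; omega

theorem DDvd.sq_le {q : ℕ} {D : ℤ} (hD : 0 < D) (h : DDvd q D) : 0 < q ∧ (q : ℤ) ^ 2 ≤ D := by
  obtain ⟨d, e, -⟩ := h
  refine ⟨Nat.pos_of_ne_zero ?_, Int.le_of_dvd hD ⟨d, e⟩⟩
  rintro rfl
  simp [e] at hD

theorem exists_dDvd_iff {D : ℤ} (hD : 0 < D) (h1 : DDvd 1 D) : ∃ m : ℕ, 0 < m ∧ ∀ q : ℕ, DDvd q D ↔ q ∣ m := by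
  have hle : ∀ q : ℕ, DDvd q D → q ∈ Icc 1 D.natAbs := fun q hq => by
    obtain ⟨h2, h3⟩ := DDvd.sq_le hD hq
    rw [mem_Icc]
    have : (1 : ℤ) ≤ q := by exact_mod_cast h2
    exact ⟨h2, by zify; rw [abs_of_pos hD]; nlinarith⟩
  obtain ⟨m, hm, hmax⟩ := exists_max_image ((Icc 1 D.natAbs).filter fun q : ℕ => DDvd q D) id
    ⟨1, mem_filter.2 ⟨hle 1 (by simpa using h1), by simpa using h1⟩⟩
  obtain ⟨hm1, hm2⟩ := mem_filter.1 hm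
  have hm0 := (mem_Icc.1 hm1).1
  refine ⟨m, hm0, fun q => ⟨fun hq => ?_, fun hq => hm2.of_dvd (Int.natCast_dvd_natCast.2 hq)⟩⟩
  obtain ⟨g, u, v, hg, huv, rfl, rfl⟩ := Nat.exists_coprime' (m := q) (n := m) (Nat.gcd_pos_of_pos_right _ hm0)
  have hv : 0 < v := Nat.pos_of_ne_zero (by rintro rfl; simp at hm0)
  have hg' : (g : ℤ) ≠ 0 := by exact_mod_cast hg.ne'
  have hl : DDvd (u * (v * g) : ℕ) D := by
    have := DDvd.mul_of_isCoprime (u := u) (v := v) (D := D) hg' (by exact_mod_cast hv.ne')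
      (Nat.isCoprime_iff_coprime.2 huv) (by simpa [mul_comm] using hq) (by simpa [mul_comm] using hm2)
    rw [show ((u * (v * g) : ℕ) : ℤ) = g * u * v by push_cast; ring]
    exact this
  have h2 := hmax _ (mem_filter.2 ⟨hle _ hl, hl⟩)
  have hu : u ≤ 1 := by
    by_contra hu
    have : 2 * (v * g) ≤ u * (v * g) := Nat.mul_le_mul_right _ (by omega)
    have h3 : 0 < v * g := by positivity
    simp only [id] at h2
    omega
  exact Nat.mul_dvd_mul_right ((Nat.dvd_one.2 (by
    have := (DDvd.sq_le hD hq).1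
    have := Nat.pos_of_mul_pos_right this
    omega)).trans (one_dvd _)) g

theorem fundOrOne_iff {D : ℤ} (hD : 0 < D) : FundOrOne D ↔ DDvd 1 D ∧ ∀ q : ℕ, DDvd q D → q = 1 := by
  constructor
  · rintro (h | rfl)
    · refine ⟨⟨D, by ring, ?_⟩, fun q ⟨d, e, hd⟩ => ?_⟩
      · have := h.mod_four; omega
      · simpa [Int.isUnit_iff] using h.isUnit e hd
    · refine ⟨⟨1, by norm_num⟩, fun q hq => ?_⟩
      have := DDvd.sq_le one_pos hq
      nlinarith
  · rintro ⟨⟨d, e, hd⟩, h⟩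
    obtain rfl : D = d := by linarith
    by_cases h1 : D = 1
    · exact .inr h1
    refine .inl ⟨h1, ?_⟩
    have key : ∀ x d : ℤ, D = x ^ 2 * d → (d % 4 = 0 ∨ d % 4 = 1) → IsUnit x := fun x d e hd => by
      rw [Int.isUnit_iff_natAbs_eq]
      exact h _ ⟨d, by rw [e, Int.natCast_natAbs, sq_abs], hd⟩
    rcases hd with hd | hd
    · refine .inr ⟨D / 4, by omega, fun x ⟨k, hk⟩ => key x (4 * k) ?_ (by omega), ?_⟩
      · linear_combination 4 * hk + (by omega : D = 4 * (D / 4))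
      · by_contra h4
        have := key 2 (D / 4) (by omega) (by omega)
        norm_num [Int.isUnit_iff] at this
    · refine .inl ⟨fun x ⟨k, hk⟩ => key x k (by rw [hk]; ring) ?_, hd⟩
      rcases Int.even_or_odd' x with ⟨l, rfl | rfl⟩
      · rw [show 2 * l * (2 * l) * k = 4 * (l ^ 2 * k) by ring] at hk; omega
      · rw [show (2 * l + 1) * (2 * l + 1) * k = k + 4 * ((l ^ 2 + l) * k) by ring] at hk; omega

theorem sum_moebius_dDvd {D : ℤ} (hD : 0 < D) {N : ℕ} (hN : D < (N + 1) ^ 2) :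
    ∑ q ∈ Icc 1 N, (if DDvd q D then moebius q else 0) = if FundOrOne D then 1 else 0 := by
  rw [fundOrOne_iff hD, ← sum_filter]
  by_cases h1 : DDvd 1 D
  · obtain ⟨m, hm, h⟩ := exists_dDvd_iff hD h1
    have e : (Icc 1 N).filter (fun q : ℕ => DDvd q D) = m.divisors := by
      ext q
      rw [mem_filter, Nat.mem_divisors, ← h, mem_Icc]
      refine ⟨fun hq => ⟨hq.2, hm.ne'⟩, fun hq => ⟨?_, hq.1⟩⟩
      obtain ⟨h2, h3⟩ := DDvd.sq_le hD hq.1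
      refine ⟨h2, Nat.lt_succ_iff.1 (lt_of_pow_lt_pow_left₀ 2 (by omega) ?_)⟩
      zify
      exact h3.trans_lt hN
    rw [e, ← coe_mul_zeta_apply, moebius_mul_coe_zeta, one_apply]
    congr 1
    simp only [h, h1, true_and, eq_iff_iff]
    exact ⟨fun hm q hq => Nat.dvd_one.1 (hm ▸ hq), fun h => h m dvd_rfl⟩
  · rw [if_neg (fun h => h1 h.1), filter_eq_empty_iff.2, sum_empty]
    exact fun q _ hq => h1 (hq.of_dvd (one_dvd _))

theorem sum_mem_oSet {X : ℝ} {f : TForm} (hf : f.Irred) (hD : 0 < f.D) (hX : (f.D : ℝ) < X) {q : ℕ} (hq : Squarefree q) :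
    ∑ h ∈ q.divisors, (if (⟦f⟧ : Quotient setoid) ∈ OSet X (q / h : ℕ) h then 1 else 0) =
      if DDvd q f.D then 1 else 0 := by
  set G : ℕ := Int.gcd f.hA (Int.gcd f.hB f.hC) with hG
  have hGd : ∀ k : ℤ, f.HDvd k ↔ k ∣ G := fun k => by
    rw [hG, Int.dvd_coe_gcd_iff, Int.dvd_coe_gcd_iff]; rfl
  have hmem : ∀ h ∈ q.divisors, (⟦f⟧ : Quotient setoid) ∈ OSet X (q / h : ℕ) h ↔ DDvd q f.D ∧ h = q.gcd G := by
    intro h hh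
    obtain ⟨n, rfl⟩ := Nat.dvd_of_mem_divisors hh
    have hh0 := Nat.pos_of_mem_divisors hh
    rw [Nat.mul_div_cancel_left _ hh0]
    have hcop := Nat.coprime_of_squarefree_mul hq
    have e : (⟦f⟧ : Quotient setoid) ∈ OSet X n h ↔ DDvd n f.D ∧ n.Coprime G ∧ h ∣ G := by
      have k1 : ∀ g : ℕ, (∀ p : ℤ, Prime p → p ∣ n → ¬ p ∣ (g : ℤ)) ↔ n.Coprime g := fun g => by
        rw [← Nat.isCoprime_iff_coprime]
        refine ⟨fun hp => isCoprime_of_prime_dvd (fun h0 => hq.ne_zero (by simp [Nat.cast_eq_zero.1 h0.1])) fun p h1 h2 h3 => hp p h1 h2 h3,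
          fun hc p h1 h2 h3 => h1.not_isUnit (hc.isUnit_of_dvd' h2 h3)⟩
      rw [← k1, ← Int.natCast_dvd_natCast (m := h), ← hGd]
      simp only [← hGd]
      refine ⟨fun ⟨g, h1, h2, h3, h4, h5, h6, h7⟩ => ?_, fun ⟨h5, h6, h7⟩ => ⟨f, rfl, hf, hD, hX, h5, h6, h7⟩⟩
      have hgf : g.Eqv f := Quotient.exact h1
      exact ⟨by rwa [D_eqv hgf], fun p k2 k3 k4 => h6 p k2 k3 (k4.eqv (setoid.symm hgf)), h7.eqv hgf⟩
    rw [e]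
    constructor
    · rintro ⟨h1, h2, h3⟩
      refine ⟨?_, by rw [Nat.Coprime.gcd_mul_right_cancel _ h2, Nat.gcd_eq_left h3]⟩
      have h4 : DDvd (1 * h) f.D := by
        obtain ⟨⟨a, ha⟩, ⟨b, hb⟩, c, hc⟩ := (hGd h).2 (Int.natCast_dvd_natCast.2 h3)
        refine ⟨b ^ 2 - 4 * (a * c), by rw [D_eq, ha, hb, hc]; ring, ?_⟩
        rcases Int.even_or_odd' b with ⟨l, rfl | rfl⟩
        · left; rw [show (2 * l) ^ 2 - 4 * (a * c) = 4 * (l ^ 2 - a * c) by ring]; omega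
        · right; rw [show (2 * l + 1) ^ 2 - 4 * (a * c) = 4 * (l ^ 2 + l - a * c) + 1 by ring]; omega
      have := DDvd.mul_of_isCoprime (v := n) one_ne_zero (by have := right_ne_zero_of_mul hq.ne_zero; exact_mod_cast this)
        (Nat.isCoprime_iff_coprime.2 hcop) h4 (by rwa [one_mul])
      rwa [one_mul, ← Nat.cast_mul] at this
    · rintro ⟨h1, h2⟩
      have h3 : h ∣ G := h2 ▸ Nat.gcd_dvd_right _ _
      refine ⟨h1.of_dvd (by simp), ?_, h3⟩
      have h4 : h * n.gcd G ∣ h := by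
        conv_rhs => rw [h2]
        exact Nat.dvd_gcd (Nat.mul_dvd_mul_left _ (Nat.gcd_dvd_left _ _))
          ((hcop.coprime_dvd_right (Nat.gcd_dvd_left _ _)).mul_dvd_of_dvd_of_dvd h3 (Nat.gcd_dvd_right _ _))
      exact Nat.dvd_one.1 (Nat.dvd_of_mul_dvd_mul_left hh0 (by rwa [mul_one]))
  rw [sum_congr rfl fun h hh => if_congr (hmem h hh) rfl rfl]
  by_cases h1 : DDvd q f.D
  · simp only [h1, true_and, if_true, sum_ite_eq', Nat.mem_divisors, hq.ne_zero, Nat.gcd_dvd_left, ne_eq,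
      not_false_eq_true, and_self]
  · simp [h1]

end TForm

end

section
open Finset ArithmeticFunction TForm Quotient

namespace TForm

/-- The discriminant of an orbit. -/
def orbitDisc : Quotient TForm.setoid → ℤ := Quotient.lift TForm.D fun _ _ h => (D_eqv h).symm

theorem mem_oSet_one {X : ℝ} {f : TForm} :
    (⟦f⟧ : Quotient setoid) ∈ OSet X (1 : ℕ) (1 : ℕ) ↔ f.Irred ∧ 0 < f.D ∧ (f.D : ℝ) < X := by
  constructor
  · rintro ⟨g, h1, h2, h3, h4, -⟩
    have h : g.Eqv f := exact h1
    rw [D_eqv h]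
    exact ⟨h2.eqv h, h3, h4⟩
  · rintro ⟨h1, h2, h3⟩
    refine ⟨f, rfl, h1, h2, h3, ⟨f.D, by simp, f.D_mod⟩, fun p hp h => absurd (isUnit_of_dvd_one (by simpa using h)) hp.not_isUnit, ?_⟩
    simp [HDvd]

theorem sum_oSet_fundOrOne (X : ℝ) {Ω : Finset (Quotient setoid)} (hΩ : (Ω : Set _) = OSet X (1 : ℕ) (1 : ℕ)) :
    ((Ω.filter fun o => FundOrOne (orbitDisc o)).card : ℤ) = ∑ q ∈ Icc 1 ⌊√X⌋₊,
      moebius q * ∑ h ∈ q.divisors, ((OSet X (q / h : ℕ) h).ncard : ℤ) := by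
  have hmem : ∀ f : TForm, ⟦f⟧ ∈ Ω ↔ f.Irred ∧ 0 < f.D ∧ (f.D : ℝ) < X := fun f => by
    rw [← mem_oSet_one, ← hΩ, mem_coe]
  have h1 : ∀ o ∈ Ω, (if FundOrOne (orbitDisc o) then (1 : ℤ) else 0) =
      ∑ q ∈ Icc 1 ⌊√X⌋₊, (if DDvd q (orbitDisc o) then moebius q else 0) := by
    refine fun o => Quotient.inductionOn o fun f hf => (sum_moebius_dDvd (D := f.D) ((hmem f).1 hf).2.1 ?_).symm
    have h2 := ((hmem f).1 hf).2.2
    have h3 : X < (⌊√X⌋₊ + 1 : ℝ) ^ 2 := (Real.sqrt_lt' (by positivity)).1 (Nat.lt_floor_add_one _)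
    exact_mod_cast h2.trans h3
  rw [card_filter, Nat.cast_sum]
  simp only [Nat.cast_ite, Nat.cast_one, Nat.cast_zero]
  rw [sum_congr rfl h1, sum_comm]
  refine sum_congr rfl fun q _ => ?_
  by_cases hq : Squarefree q
  · rw [sum_congr rfl (g := fun o => moebius q * ∑ h ∈ q.divisors, (if o ∈ OSet X (q / h : ℕ) h then 1 else 0)),
      ← mul_sum, sum_comm]
    · congr 1
      refine sum_congr rfl fun h hh => ?_
      rw [sum_boole, ← Set.ncard_coe_finset]
      congr 2
      ext o
      simp only [coe_filter, Set.mem_ofPred_eq, and_iff_right_iff_imp]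
      rintro ⟨g, rfl, h1, h2, h3, -⟩
      exact (hmem g).2 ⟨h1, h2, h3⟩
    · refine fun o => Quotient.inductionOn o fun f hf => ?_
      obtain ⟨k1, k2, k3⟩ := (hmem f).1 hf
      have := congrArg (Nat.cast : ℕ → ℤ) (sum_mem_oSet k1 k2 k3 hq)
      simp only [Nat.cast_sum, Nat.cast_ite, Nat.cast_one, Nat.cast_zero] at this
      rw [this, mul_ite, mul_one, mul_zero]
      rfl
  · simp [moebius_eq_zero_of_not_squarefree hq]

theorem card_dDvd_le {X : ℝ} (hX : 0 < X) {q : ℕ} (hq : 0 < q) :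
    |(((Ioo 0 ⌈X⌉).filter fun D => DDvd q D).card : ℝ) - X / (2 * q ^ 2)| ≤ 2 := by
  set M := ⌈X / q ^ 2⌉₊ with hM
  have hqR : (0 : ℝ) < (q : ℝ) ^ 2 := by positivity
  have h1 : (Ioo 0 ⌈X⌉).filter (fun D => DDvd q D) =
      (((range M).filter fun k => k % 4 = 0 ∨ k % 4 = 1).erase 0).image fun k : ℕ => (q : ℤ) ^ 2 * k := by
    ext D
    simp only [mem_filter, mem_Ioo, mem_image, mem_erase, mem_range, hM,
      Nat.lt_ceil, Int.lt_ceil, lt_div_iff₀ hqR]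
    constructor
    · rintro ⟨⟨h1, h2⟩, d, rfl, hd⟩
      have hd0 : 0 < d := pos_of_mul_pos_right h1 (by positivity)
      lift d to ℕ using hd0.le
      exact ⟨d, ⟨by omega, by push_cast at h2; linarith, by omega⟩, rfl⟩
    · rintro ⟨k, ⟨h1, h2, h3⟩, rfl⟩
      have : 0 < k := Nat.pos_of_ne_zero h1
      exact ⟨⟨by positivity, by push_cast; linarith⟩, k, rfl, by omega⟩
  have h2 : ∀ M : ℕ, ((range M).filter fun k => k % 4 = 0 ∨ k % 4 = 1).card = (M + 3) / 4 + (M + 2) / 4 := by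
    intro M
    induction M with
    | zero => rfl
    | succ n ih =>
      rw [range_add_one, filter_insert]
      split_ifs
      · rw [card_insert_of_notMem (by simp), ih]; omega
      · rw [ih]; omega
  have hM0 : 0 < M := Nat.ceil_pos.2 (by positivity)
  rw [h1, card_image_of_injective _ fun a b h => by
    simpa using mul_left_cancel₀ (by positivity : (q : ℤ) ^ 2 ≠ 0) h, card_erase_of_mem (by simp [hM0]), h2]
  have h3 := Nat.le_ceil (X / q ^ 2)
  have h4 := Nat.ceil_lt_add_one (show 0 ≤ X / q ^ 2 by positivity)
  rw [← hM] at h3 h4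
  have h5 : 2 * M ≤ 4 * ((M + 3) / 4 + (M + 2) / 4 - 1) + 6 := by omega
  have h6 : 4 * ((M + 3) / 4 + (M + 2) / 4 - 1) ≤ 2 * M + 1 := by omega
  generalize (M + 3) / 4 + (M + 2) / 4 - 1 = c at *
  have h7 : (2 * M : ℝ) ≤ 4 * c + 6 := by exact_mod_cast h5
  have h8 : (4 * c : ℝ) ≤ 2 * M + 1 := by exact_mod_cast h6
  have h9 : X / (2 * q ^ 2) = X / q ^ 2 / 2 := by field_simp
  rw [h9, abs_le]
  constructor <;> linarith

theorem three_mul_cl3sum : ∃ C : ℝ, ∀ X : ℝ, 1 < X → 3 * cl3sum (fun D => 0 < (D : ℝ) ∧ (D : ℝ) < X) + C =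
    ∑ q ∈ Icc 1 ⌊√X⌋₊, (moebius q : ℝ) * (∑ h ∈ q.divisors, ((OSet X (q / h : ℕ) h).ncard : ℝ) +
      ((Ioo 0 ⌈X⌉).filter fun D => DDvd q D).card) := by
  let J : ℤ → ℕ := fun D => {o : Quotient setoid | ∃ f : TForm, ⟦f⟧ = o ∧ f.D = D ∧ f.Irred}.ncard
  refine ⟨J 1 + 1, fun X hX => ?_⟩
  have hfin := oSet_finite X (n := 1) (h := 1) squarefree_one squarefree_one (Nat.coprime_one_left 1)
  set Ω := hfin.toFinset with hΩ
  have hJ : ∀ D ∈ Ioo 0 ⌈X⌉, {o : Quotient setoid | ∃ f : TForm, ⟦f⟧ = o ∧ f.D = D ∧ f.Irred} =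
      ((Ω.filter fun o => orbitDisc o = D : Finset _) : Set (Quotient setoid)) := by
    intro D hD
    obtain ⟨h1, h2⟩ := mem_Ioo.1 hD
    ext o
    refine Quotient.inductionOn o fun f => ?_
    rw [Finset.mem_coe, Finset.mem_filter, hΩ, Set.Finite.mem_toFinset, mem_oSet_one]
    change _ ↔ _ ∧ f.D = D
    constructor
    · rintro ⟨g, h3, rfl, h4⟩
      have h : g.Eqv f := exact h3
      exact ⟨⟨h4.eqv h, by rwa [D_eqv h], by rw [D_eqv h]; exact Int.lt_ceil.1 h2⟩, D_eqv h⟩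
    · rintro ⟨⟨h3, -, -⟩, h4⟩
      exact ⟨f, rfl, h4, h3⟩
  have h1 : 3 * cl3sum (fun D => 0 < (D : ℝ) ∧ (D : ℝ) < X) =
      ∑ D ∈ Ioo 0 ⌈X⌉, if IsFundamentalDiscriminant D then (J D + 1 : ℝ) else 0 := by
    rw [cl3sum, tsum_eq_sum (s := Ioo 0 ⌈X⌉), mul_sum]
    · refine sum_congr rfl fun D hD => ?_
      obtain ⟨h1, h2⟩ := mem_Ioo.1 hD
      by_cases h : IsFundamentalDiscriminant D
      · rw [if_pos ⟨h, by exact_mod_cast h1, Int.lt_ceil.1 h2⟩, if_pos h]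
        have := ncard_irred_orbits h h1 (by rw [hJ D hD]; exact finite_toSet _)
        exact_mod_cast this.symm
      · rw [if_neg (fun h' => h h'.1), if_neg h, mul_zero]
    · refine fun D hD => if_neg fun h => hD (mem_Ioo.2 ⟨by exact_mod_cast h.2.1, Int.lt_ceil.2 h.2.2⟩)
  have h2 : 3 * cl3sum (fun D => 0 < (D : ℝ) ∧ (D : ℝ) < X) + (J 1 + 1) =
      ∑ D ∈ Ioo 0 ⌈X⌉, if FundOrOne D then (J D + 1 : ℝ) else 0 := by
    have h1X : (1 : ℤ) ∈ Ioo 0 ⌈X⌉ := mem_Ioo.2 ⟨one_pos, Int.lt_ceil.2 (by simpa using hX)⟩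
    rw [h1, ← add_sum_erase _ _ h1X, ← add_sum_erase _ _ h1X, if_neg (fun h => h.1 rfl), if_pos (.inr rfl), zero_add,
      add_comm]
    congr 1
    refine sum_congr rfl fun D hD => if_congr ?_ rfl rfl
    rw [FundOrOne, or_iff_left (ne_of_mem_erase hD)]
  have h3 : ∑ D ∈ Ioo 0 ⌈X⌉, (if FundOrOne D then (J D : ℝ) else 0) = (Ω.filter fun o => FundOrOne (orbitDisc o)).card := by
    rw [← sum_filter, card_eq_sum_card_fiberwise (f := orbitDisc) (t := (Ioo 0 ⌈X⌉).filter FundOrOne), Nat.cast_sum]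
    · refine sum_congr rfl fun D hD => ?_
      obtain ⟨h3, h4⟩ := mem_filter.1 hD
      simp only [J]
      rw [hJ D h3, Set.ncard_coe_finset, filter_filter]
      congr 2
      ext o
      simp only [mem_filter, and_congr_right_iff]
      exact fun _ => ⟨fun h => ⟨h ▸ h4, h⟩, And.right⟩
    · intro o ho
      obtain ⟨h3, h4⟩ := mem_filter.1 (mem_coe.1 ho)
      refine mem_coe.2 (mem_filter.2 ⟨?_, h4⟩)
      rw [hΩ, Set.Finite.mem_toFinset] at h3
      revert h3
      refine Quotient.inductionOn o fun f h3 => ?_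
      obtain ⟨-, k1, k2⟩ := mem_oSet_one.1 h3
      exact Finset.mem_Ioo.2 ⟨k1, Int.lt_ceil.2 k2⟩
  have h4 : ∑ D ∈ Ioo 0 ⌈X⌉, (if FundOrOne D then (1 : ℝ) else 0) = ∑ q ∈ Icc 1 ⌊√X⌋₊,
      (moebius q : ℝ) * ((Ioo 0 ⌈X⌉).filter fun D => DDvd q D).card := by
    have h5 : ∀ D ∈ Ioo 0 ⌈X⌉, (if FundOrOne D then (1 : ℝ) else 0) =
        ∑ q ∈ Icc 1 ⌊√X⌋₊, (if DDvd q D then (moebius q : ℝ) else 0) := by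
      intro D hD
      obtain ⟨k1, k2⟩ := mem_Ioo.1 hD
      have h3 : X < (⌊√X⌋₊ + 1 : ℝ) ^ 2 := (Real.sqrt_lt' (by positivity)).1 (Nat.lt_floor_add_one _)
      exact_mod_cast (sum_moebius_dDvd k1 (by exact_mod_cast (Int.lt_ceil.1 k2).trans h3)).symm
    rw [sum_congr rfl h5, sum_comm]
    refine sum_congr rfl fun q _ => ?_
    rw [← sum_filter, sum_const, nsmul_eq_mul, mul_comm]
  have h5 := sum_oSet_fundOrOne X (Ω := Ω) (by simp [hΩ])
  rw [h2, ← sum_congr rfl fun D _ => (by split_ifs <;> simp : (if FundOrOne D then (J D : ℝ) else 0) + (if FundOrOne D then 1 else 0) =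
    if FundOrOne D then (J D + 1 : ℝ) else 0), sum_add_distrib, h3, h4]
  simp only [mul_add, sum_add_distrib]
  congr 1
  exact_mod_cast h5

end TForm

end

section
open Finset

/-- The main term in the count of orbits. -/
noncomputable def mainT (S : ℝ) (n h : ℕ) : ℝ :=
  ∑ e ∈ n.divisors, phiD (n / e) * phiD e / h ^ 2 * (Real.pi ^ 2 / 27 * S ^ 2 / e +
    4 / 9 * kappa * (riemannZeta (1 / 3)).re * S ^ (5 / 3 : ℝ) * (e : ℝ) ^ (-(1 / 3) : ℝ))

/-- The number of reduced overring data that are reducible or have large content of the Hessian. -/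
noncomputable def badCount (S K : ℝ) (n h : ℕ) : ℕ :=
  ∑ e ∈ n.divisors, ∑ r ∈ range (n / e), ((redForms (4 / 27 * S ^ 2)).filter fun f =>
    f.OvCond (n / e : ℕ) e r ∧ f.HDvd h ∧ (K < h ∨ ¬ f.Irred)).card

theorem badCount_le (S K : ℝ) {n : ℕ} (h : ℕ) (hn : Squarefree n) : badCount S K n h ≤
    n.divisors.card ^ 3 * ((redForms (4 / 27 * S ^ 2)).filter fun f => f.HDvd h ∧ (K < h ∨ ¬ f.Irred)).card := by
  have h1 : badCount S K n h = ∑ f ∈ (redForms (4 / 27 * S ^ 2)).filter fun f => f.HDvd h ∧ (K < h ∨ ¬ f.Irred),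
      ∑ e ∈ n.divisors, ((range (n / e)).filter fun r : ℕ => f.OvCond (n / e : ℕ) e r).card := by
    rw [sum_comm]
    refine sum_congr rfl fun e _ => ?_
    simp only [card_filter]
    rw [sum_comm]
    rw [sum_filter]
    refine sum_congr rfl fun f _ => ?_
    split_ifs with hf <;> simp [hf]
  rw [h1]
  exact (sum_le_card_nsmul _ _ _ fun (f : TForm) _ => f.sum_card_ovCond_le hn).trans_eq (mul_comm _ _)

theorem sum_badCount_le (S K : ℝ) {n : ℕ} (hn : Squarefree n) {H : Finset ℕ} (hH : ∀ h ∈ H, Squarefree h) :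
    ∑ h ∈ H, badCount S K n h ≤ n.divisors.card ^ 3 * ∑ f ∈ redForms (4 / 27 * S ^ 2), (badH f K).card := by
  refine (sum_le_sum fun h _ => badCount_le S K h hn).trans ?_
  rw [← mul_sum]
  refine Nat.mul_le_mul_left _ ?_
  simp only [card_filter]
  rw [sum_comm]
  refine sum_le_sum fun f hf => ?_
  rw [← card_filter]
  refine card_le_card fun h hh => ?_
  simp only [mem_filter] at hh
  simp only [badH, mem_filter, Nat.mem_divisors]
  have hD := (mem_redForms.1 hf).1.2.1
  exact ⟨⟨by simpa using Int.natAbs_dvd_natAbs.2 hh.2.1.dvd_D, by omega⟩, hH h hh.1, hh.2⟩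

section
variable {X S : ℝ} {n h : ℕ} (hXS : 4 / 27 * S ^ 2 = X / n ^ 2) (hn : Squarefree n) (hh : Squarefree h) (hnh : h.Coprime n)
include hXS hn hh hnh

theorem ncard_oSet_le_badCount {K : ℝ} (hK : K < h) : (OSet X n h).ncard ≤ badCount S K n h := by
  refine (ncard_oSet_le X hn hh hnh).trans (sum_le_sum fun e _ => sum_le_sum fun r _ => ?_)
  rw [← Set.ncard_coe_finset]
  refine Set.ncard_le_ncard (fun f hf => ?_) (finite_toSet _)
  rw [mem_coe, mem_filter, mem_redForms, hXS]
  exact ⟨⟨hf.1.1, hf.1.2.1⟩, hf.1.2.2.2, hf.1.2.2.1, Or.inl hK⟩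

theorem abs_ncard_oSet_sub_le (hS : 1 ≤ S) (K : ℝ) : |((OSet X n h).ncard : ℝ) - mainT S n h| ≤
    n.divisors.card ^ 3 * (1000000 * (S * √S) * (n : ℝ) ^ (5 / 6 : ℝ) / h + 480 * n * S) + badCount S K n h := by
  have key : ∀ st, |((∑ e ∈ n.divisors, ∑ r ∈ range (n / e), (XSet st (4 / 27 * S ^ 2) h (n / e : ℕ) e r).ncard : ℕ) : ℝ) -
      mainT S n h| ≤ n.divisors.card ^ 3 * (1000000 * (S * √S) * (n : ℝ) ^ (5 / 6 : ℝ) / h + 480 * n * S) := by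
    intro st
    rw [mainT, Nat.cast_sum, ← sum_sub_distrib]
    refine (abs_sum_le_sum_abs _ _).trans ((sum_le_card_nsmul _ _ (n.divisors.card ^ 2 * (1000000 * (S * √S) * (n : ℝ) ^ (5 / 6 : ℝ) / h + 480 * n * S)) fun e he => ?_).trans_eq (by rw [nsmul_eq_mul]; ring))
    have h1 : e * (n / e) = n := Nat.mul_div_cancel' (Nat.dvd_of_mem_divisors he)
    have h2 := (count_reduced st hS (N := n / e) (e := e) (by rwa [h1]) hh (by rwa [h1])).2
    rw [h1, ← Nat.cast_sum] at h2
    refine h2.trans (mul_le_mul_of_nonneg_right ?_ (by positivity))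
    rw [pow_two]
    gcongr ?_ * ?_ 
    · exact_mod_cast card_le_card (Nat.divisors_subset_of_dvd hn.ne_zero (Nat.div_dvd_of_dvd (Nat.dvd_of_mem_divisors he)))
    · exact_mod_cast card_le_card (Nat.divisors_subset_of_dvd hn.ne_zero (Nat.dvd_of_mem_divisors he))
  have hfin : ∀ st, ∀ e ∈ n.divisors, ∀ r ∈ range (n / e), (XSet st (4 / 27 * S ^ 2) h (n / e : ℕ) e r).Finite := by
    intro st e he r hr
    have h1 : e * (n / e) = n := Nat.mul_div_cancel' (Nat.dvd_of_mem_divisors he)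
    exact xSet_finite st _ (by rwa [h1]) hh (by rwa [h1]) (mem_range.1 hr)
  have up : (OSet X n h).ncard ≤ ∑ e ∈ n.divisors, ∑ r ∈ range (n / e), (XSet false (4 / 27 * S ^ 2) h (n / e : ℕ) e r).ncard := by
    refine (ncard_oSet_le X hn hh hnh).trans (sum_le_sum fun e he => sum_le_sum fun r hr => ?_)
    rw [← hXS]
    exact Set.ncard_le_ncard (fun f hf => hf.1) (hfin _ e he r hr)
  have low : ∑ e ∈ n.divisors, ∑ r ∈ range (n / e), (XSet true (4 / 27 * S ^ 2) h (n / e : ℕ) e r).ncard ≤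
      (OSet X n h).ncard + badCount S K n h := by
    refine le_trans ?_ (Nat.add_le_add_right (le_ncard_oSet X hn hh hnh) _)
    simp only [badCount, ← sum_add_distrib]
    refine sum_le_sum fun e he => sum_le_sum fun r hr => ?_
    rw [← hXS, ← Set.ncard_coe_finset]
    refine le_trans (Set.ncard_le_ncard (fun f hf => ?_) (Set.Finite.union ((hfin true e he r hr).subset fun f hf => hf.1) (finite_toSet _)))
      (Set.ncard_union_le _ _)
    by_cases hi : f.Irred
    · exact Or.inl ⟨hf, hi⟩
    · right
      rw [mem_coe, mem_filter, mem_redForms]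
      exact ⟨⟨hf.1.toFalse, hf.2.1⟩, hf.2.2.2, hf.2.2.1, Or.inr hi⟩
  have up' : (_ : ℝ) ≤ _ := Nat.cast_le.2 up
  have low' : (_ : ℝ) ≤ _ := Nat.cast_le.2 low
  have k1 := abs_le.1 (key true)
  have k2 := abs_le.1 (key false)
  rw [Nat.cast_add] at low'
  have := Nat.cast_nonneg (α := ℝ) (badCount S K n h)
  rw [abs_le]
  constructor <;> linarith

end

end

section
open Finset Real ArithmeticFunction

/-- The size parameter of the reduced forms with discriminant below `X / n²`. -/
noncomputable def sX (X : ℝ) (n : ℕ) : ℝ := √(27 / 4 * X) / n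

theorem sX_sq {X : ℝ} (hX : 0 ≤ X) (n : ℕ) : sX X n ^ 2 = 27 / 4 * X / n ^ 2 := by
  rw [sX, div_pow, sq_sqrt (by positivity)]

theorem sX_mul {X : ℝ} (hX : 0 ≤ X) {n : ℕ} (hn : 0 < n) : n * sX X n ≤ 3 * √X := by
  rw [sX, mul_div_cancel₀ _ (by positivity), sqrt_mul (by norm_num)]
  gcongr
  rw [sqrt_le_left (by norm_num)]
  norm_num

theorem one_le_sX {X : ℝ} (hX : 1 ≤ X) {n : ℕ} (hn : n ∈ Icc 1 ⌊√X⌋₊) : 1 ≤ sX X n := by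
  obtain ⟨h1, h2⟩ := mem_Icc.1 hn
  have h3 : (0 : ℝ) < n := by exact_mod_cast h1
  rw [sX, le_div_iff₀ h3, one_mul]
  exact ((Nat.le_floor_iff (by positivity)).1 h2).trans (sqrt_le_sqrt (by linarith))

theorem sX_mul_sqrt_le {X : ℝ} (hX : 0 ≤ X) {n : ℕ} (hn : 0 < n) :
    sX X n * √(sX X n) ≤ 6 * X ^ (3 / 4 : ℝ) * (n : ℝ) ^ (-(3 / 2) : ℝ) := by
  have hn' : (0 : ℝ) < n := by exact_mod_cast hn
  have h1 : sX X n ≤ 3 * X ^ (1 / 2 : ℝ) * (n : ℝ) ^ (-1 : ℝ) := by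
    rw [rpow_neg_one, ← sqrt_eq_rpow, ← div_eq_mul_inv, le_div_iff₀ hn', mul_comm]
    exact sX_mul hX hn
  have h2 : √(sX X n) ≤ 2 * X ^ (1 / 4 : ℝ) * (n : ℝ) ^ (-(1 / 2) : ℝ) := by
    rw [sqrt_le_left (by positivity), mul_pow, mul_pow, ← rpow_natCast (X ^ _), ← rpow_natCast ((n : ℝ) ^ _),
      ← rpow_mul hX, ← rpow_mul hn'.le]
    norm_num at h1 ⊢
    refine h1.trans ?_
    gcongr
    norm_num
  have h3 : X ^ (3 / 4 : ℝ) = X ^ (1 / 2 : ℝ) * X ^ (1 / 4 : ℝ) := by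
    rw [← rpow_add_of_nonneg hX (by norm_num) (by norm_num)]; norm_num
  have h4 : (n : ℝ) ^ (-(3 / 2) : ℝ) = (n : ℝ) ^ (-1 : ℝ) * (n : ℝ) ^ (-(1 / 2) : ℝ) := by
    rw [← rpow_add hn']; norm_num
  rw [h3, h4]
  have h0 : 0 ≤ sX X n := by unfold sX; positivity
  calc _ ≤ (3 * X ^ (1 / 2 : ℝ) * (n : ℝ) ^ (-1 : ℝ)) * (2 * X ^ (1 / 4 : ℝ) * (n : ℝ) ^ (-(1 / 2) : ℝ)) := by gcongr
    _ = _ := by ring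

theorem sum_divisors_le_sum_sum {g : ℕ → ℕ → ℕ} (R : ℕ) :
    ∑ q ∈ (Icc 1 R).filter Squarefree, ∑ h ∈ q.divisors, g (q / h) h ≤
      ∑ n ∈ (Icc 1 R).filter Squarefree, ∑ h ∈ (Icc 1 R).filter Squarefree, g n h := by
  set T := (Icc 1 R).filter Squarefree with hT
  have hmem : ∀ q ∈ T, ∀ d, d ∣ q → d ∈ T := by
    intro q hq d hd
    simp only [hT, mem_filter, mem_Icc] at hq ⊢
    exact ⟨⟨Nat.pos_of_dvd_of_pos hd hq.1.1, (Nat.le_of_dvd hq.1.1 hd).trans hq.1.2⟩, hq.2.squarefree_of_dvd hd⟩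
  rw [sum_comm' (t' := T) (s' := fun h => T.filter fun q => h ∣ q)]
  · rw [sum_comm (s := T) (t := T)]
    refine sum_le_sum fun h _ => ?_
    rw [← sum_image (s := T.filter fun q => h ∣ q) (g := fun q => q / h) (f := fun n => g n h)]
    · refine sum_le_sum_of_subset fun n hn => ?_
      obtain ⟨q, hq, rfl⟩ := mem_image.1 hn
      rw [mem_filter] at hq
      exact hmem q hq.1 _ (Nat.div_dvd_of_dvd hq.2)
    · intro q hq q' hq' he
      rw [mem_coe, mem_filter] at hq hq'
      exact (Nat.div_left_inj hq.2 hq'.2).1 he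
  · intro q h
    simp only [mem_filter, Nat.mem_divisors]
    refine ⟨fun ⟨h1, h2⟩ => ⟨⟨h1, h2.1⟩, hmem q h1 h h2.1⟩, fun ⟨⟨h1, h2⟩, h3⟩ => ⟨h1, h2, ?_⟩⟩
    simp only [hT, mem_filter, mem_Icc] at h1
    omega

section
variable {X : ℝ} (hX : 1 ≤ X) {t : ℕ} (ht : ∀ m : ℕ, (m : ℝ) ≤ 675 * X → m.divisors.card ≤ t)
  (hL : ∀ N : ℕ, (N : ℝ) ≤ 3 * X → ∑ a ∈ Icc 1 N, (1 : ℝ) / a ≤ t) {Q : ℝ} (hQ : 0 < Q)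
include hX ht hL hQ

theorem sum_badCount_total : ((∑ q ∈ (Icc 1 ⌊√X⌋₊).filter Squarefree, ∑ h ∈ q.divisors,
    badCount (sX X (q / h)) (Q / (q / h : ℕ)) (q / h) h : ℕ) : ℝ) ≤
      16800 * t ^ 7 * (6 * X ^ (3 / 4 : ℝ) + 7 * X * t / Q) := by
  have h0 := sum_divisors_le_sum_sum (g := fun n h => badCount (sX X n) (Q / n) n h) ⌊√X⌋₊
  refine (Nat.cast_le.2 h0).trans ?_
  have hXX : √X ≤ X := by rw [sqrt_le_left (by linarith)]; nlinarith
  have h1 : ∀ n ∈ (Icc 1 ⌊√X⌋₊).filter Squarefree,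
      ((∑ h ∈ (Icc 1 ⌊√X⌋₊).filter Squarefree, badCount (sX X n) (Q / n) n h : ℕ) : ℝ) ≤
      16800 * t ^ 6 * (6 * X ^ (3 / 4 : ℝ) + 7 * X * t / Q) * (1 / n) := by
    intro n hn
    rw [mem_filter] at hn
    have hn1 := (mem_Icc.1 hn.1).1
    have hn2 : (n : ℝ) ≤ √X := (Nat.le_floor_iff (by positivity)).1 (mem_Icc.1 hn.1).2
    have hn3 : (1 : ℝ) ≤ n := by exact_mod_cast hn1
    have hs2 := sX_sq (zero_le_one.trans hX) n
    have hs1 := one_le_sX hX hn.1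
    have hs3 : sX X n ^ 2 ≤ 27 / 4 * X := by
      rw [hs2]; exact div_le_self (by linarith) (by nlinarith)
    have h2 := sum_badCount_le (sX X n) (Q / n) hn.2 (H := (Icc 1 ⌊√X⌋₊).filter Squarefree) fun h hh => (mem_filter.1 hh).2
    have h3 := sum_badH_le hs1 (t := t) (fun m hm => ht m (hm.trans (by linarith))) (K := Q / n) (by positivity)
      (hL ⌊√(2 * sX X n)⌋₊ ((Nat.floor_le (by positivity)).trans (by rw [sqrt_le_left (by linarith)]; nlinarith)))
    have h4 : (n.divisors.card : ℝ) ^ 3 ≤ t ^ 3 := by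
      have : n.divisors.card ≤ t := ht n (by linarith)
      gcongr
    calc _ ≤ ((n.divisors.card ^ 3 * ∑ f ∈ redForms (4 / 27 * sX X n ^ 2), (badH f (Q / n)).card : ℕ) : ℝ) := Nat.cast_le.2 h2
      _ ≤ t ^ 3 * (16800 * t ^ 3 * (sX X n * √(sX X n) + sX X n ^ 2 * t / (Q / n))) := by
        rw [Nat.cast_mul, Nat.cast_pow]; gcongr
      _ ≤ t ^ 3 * (16800 * t ^ 3 * (6 * X ^ (3 / 4 : ℝ) * (1 / n) + 7 * X * t / Q * (1 / n))) := by
        refine mul_le_mul_of_nonneg_left (mul_le_mul_of_nonneg_left (add_le_add ?_ ?_) (by positivity)) (by positivity)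
        · refine (sX_mul_sqrt_le (by linarith) hn1).trans ?_
          rw [one_div, ← rpow_neg_one]
          gcongr
          norm_num
        · rw [hs2, div_div_eq_mul_div, div_mul_div_comm, div_le_div_iff₀ (by positivity) (by positivity)]
          have e : 27 / 4 * X / n ^ 2 * t * n * (Q * n) = 27 / 4 * (X * t * Q) := by field_simp
          have : 0 ≤ X * t * Q := by positivity
          rw [e]; linarith
      _ = _ := by ring
  rw [Nat.cast_sum]
  refine (sum_le_sum h1).trans ?_
  rw [← mul_sum]
  have h2 : ∑ n ∈ (Icc 1 ⌊√X⌋₊).filter Squarefree, (1 : ℝ) / n ≤ t :=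
    (sum_le_sum_of_subset_of_nonneg (filter_subset _ _) fun _ _ _ => by positivity).trans
      (hL _ ((Nat.floor_le (by positivity)).trans (by linarith)))
  calc _ ≤ 16800 * t ^ 6 * (6 * X ^ (3 / 4 : ℝ) + 7 * X * t / Q) * t := by gcongr
    _ = _ := by ring

theorem abs_sum_ncard_oSet_sub_le (hQX : Q ≤ √X) :
    |∑ q ∈ Icc 1 ⌊√X⌋₊, (moebius q : ℝ) * ∑ h ∈ q.divisors, ((OSet X (q / h : ℕ) h).ncard : ℝ) -
      ∑ q ∈ Icc 1 ⌊Q⌋₊, (moebius q : ℝ) * ∑ h ∈ q.divisors, mainT (sX X (q / h)) (q / h) h| ≤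
    16800 * t ^ 7 * (6 * X ^ (3 / 4 : ℝ) + 7 * X * t / Q) +
      t ^ 4 * (18000000 * X ^ (3 / 4 : ℝ) * Q ^ (1 / 3 : ℝ) + 1440 * √X * Q) := by
  have hX0 : 0 ≤ X := by linarith
  have hXX : √X ≤ X := by rw [sqrt_le_left (by linarith)]; nlinarith
  set B : ℕ → ℕ := fun q => ∑ h ∈ q.divisors, badCount (sX X (q / h)) (Q / (q / h : ℕ)) (q / h) h with hB
  have hmu : ∀ q : ℕ, |(moebius q : ℝ)| ≤ 1 := by
    intro q; exact_mod_cast abs_moebius_le_one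
  have hdiv : ∀ q ∈ Icc 1 ⌊√X⌋₊, Squarefree q → ∀ h ∈ q.divisors, q / h ∈ Icc 1 ⌊√X⌋₊ ∧ (q / h) * h = q ∧
      Squarefree (q / h) ∧ Squarefree h ∧ h.Coprime (q / h) ∧ 4 / 27 * sX X (q / h) ^ 2 = X / (q / h : ℕ) ^ 2 := by
    intro q hq hsq h hh
    have h1 := Nat.dvd_of_mem_divisors hh
    have h2 := Nat.div_mul_cancel h1
    have h3 := Nat.div_dvd_of_dvd h1
    rw [mem_Icc] at hq ⊢
    refine ⟨⟨Nat.pos_of_dvd_of_pos h3 hq.1, (Nat.le_of_dvd hq.1 h3).trans hq.2⟩, h2, hsq.squarefree_of_dvd h3,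
      hsq.squarefree_of_dvd h1, ?_, by rw [sX_sq hX0]; ring⟩
    rw [← h2] at hsq
    exact (Nat.coprime_of_squarefree_mul hsq).symm
  have hE : ∀ q ∈ Icc 1 ⌊Q⌋₊, |(moebius q : ℝ) * ∑ h ∈ q.divisors, ((OSet X (q / h : ℕ) h).ncard : ℝ) -
      (moebius q : ℝ) * ∑ h ∈ q.divisors, mainT (sX X (q / h)) (q / h) h| ≤
      t ^ 4 * (6000000 * X ^ (3 / 4 : ℝ) * (q : ℝ) ^ (-(2 / 3) : ℝ) + 1440 * √X) + if Squarefree q then B q else 0 := by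
    intro q hq
    rw [← mul_sub, abs_mul, ← sum_sub_distrib]
    by_cases hsq : Squarefree q
    swap
    · rw [moebius_eq_zero_of_not_squarefree hsq, if_neg hsq]
      simp only [Int.cast_zero, abs_zero, zero_mul]
      positivity
    rw [if_pos hsq]
    refine (mul_le_of_le_one_left (abs_nonneg _) (hmu q)).trans ((abs_sum_le_sum_abs _ _).trans ?_)
    have hq1 : q ∈ Icc 1 ⌊√X⌋₊ := Icc_subset_Icc_right (Nat.floor_le_floor hQX) hq
    have hqX : (q : ℝ) ≤ X := ((Nat.le_floor_iff (by positivity)).1 (mem_Icc.1 hq1).2).trans hXX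
    have hterm : ∀ h ∈ q.divisors, |((OSet X (q / h : ℕ) h).ncard : ℝ) - mainT (sX X (q / h)) (q / h) h| ≤
        t ^ 3 * (6000000 * X ^ (3 / 4 : ℝ) * (q : ℝ) ^ (-(2 / 3) : ℝ) + 1440 * √X) +
          badCount (sX X (q / h)) (Q / (q / h : ℕ)) (q / h) h := by
      intro h hh
      obtain ⟨h1, h2, h3, h4, h5, h6⟩ := hdiv q hq1 hsq h hh
      refine (abs_ncard_oSet_sub_le h6 h3 h4 h5 (one_le_sX hX h1) (Q / (q / h : ℕ))).trans (add_le_add_left ?_ _)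
      set n := q / h
      have hn0 : 0 < n := (mem_Icc.1 h1).1
      have hh0 : 0 < h := Nat.pos_of_mem_divisors hh
      have hn1 : (0 : ℝ) < n := by exact_mod_cast hn0
      have hh1 : (1 : ℝ) ≤ h := by exact_mod_cast hh0
      have h7 : (q : ℝ) = n * h := by rw [← h2]; push_cast; ring
      have h8 : n.divisors.card ≤ t := ht n (by nlinarith)
      have h9 := sX_mul_sqrt_le hX0 hn0
      have h10 : (n : ℝ) ^ (-(3 / 2) : ℝ) * (n : ℝ) ^ (5 / 6 : ℝ) / h ≤ (q : ℝ) ^ (-(2 / 3) : ℝ) := by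
        rw [h7, mul_rpow hn1.le (by linarith), ← rpow_add hn1, div_eq_mul_inv, ← rpow_neg_one (h : ℝ)]
        norm_num
        gcongr
        norm_num
      have h11 : 480 * n * sX X n ≤ 1440 * √X := by linarith [sX_mul hX0 hn0]
      have h12 : 0 ≤ sX X n := by unfold sX; positivity
      calc _ ≤ (t : ℝ) ^ 3 * (1000000 * (6 * X ^ (3 / 4 : ℝ) * (n : ℝ) ^ (-(3 / 2) : ℝ)) * (n : ℝ) ^ (5 / 6 : ℝ) / h + 1440 * √X) := by
            gcongr
        _ = (t : ℝ) ^ 3 * (6000000 * X ^ (3 / 4 : ℝ) * ((n : ℝ) ^ (-(3 / 2) : ℝ) * (n : ℝ) ^ (5 / 6 : ℝ) / h) + 1440 * √X) := by ring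
        _ ≤ _ := by gcongr
    refine (sum_le_sum hterm).trans ?_
    rw [sum_add_distrib, sum_const, nsmul_eq_mul, ← Nat.cast_sum]
    refine add_le_add_left ?_ _
    have : q.divisors.card ≤ t := ht q (by nlinarith)
    calc _ ≤ (t : ℝ) * (t ^ 3 * (6000000 * X ^ (3 / 4 : ℝ) * (q : ℝ) ^ (-(2 / 3) : ℝ) + 1440 * √X)) := by gcongr
      _ = _ := by ring
  have hT : ∀ q ∈ Icc 1 ⌊√X⌋₊ \ Icc 1 ⌊Q⌋₊, |(moebius q : ℝ) * ∑ h ∈ q.divisors, ((OSet X (q / h : ℕ) h).ncard : ℝ)| ≤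
      if Squarefree q then (B q : ℝ) else 0 := by
    intro q hq
    rw [Finset.mem_sdiff] at hq
    have hqQ : Q < q := by
      have h1 := (mem_Icc.1 hq.1).1
      simp only [mem_Icc, not_and] at hq
      exact Nat.lt_of_floor_lt (not_le.1 (hq.2 h1))
    rw [abs_mul]
    by_cases hsq : Squarefree q
    swap
    · rw [moebius_eq_zero_of_not_squarefree hsq, if_neg hsq]; simp
    rw [if_pos hsq]
    refine (mul_le_of_le_one_left (abs_nonneg _) (hmu q)).trans ?_
    rw [abs_of_nonneg (by positivity), hB, Nat.cast_sum]
    refine sum_le_sum fun h hh => Nat.cast_le.2 ?_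
    obtain ⟨h1, h2, h3, h4, h5, h6⟩ := hdiv q hq.1 hsq h hh
    refine ncard_oSet_le_badCount h6 h3 h4 h5 ?_
    have hn1 : (0 : ℝ) < (q / h : ℕ) := by exact_mod_cast (mem_Icc.1 h1).1
    rw [div_lt_iff₀ hn1]
    calc Q < q := hqQ
      _ = _ := by rw [mul_comm]; exact_mod_cast h2.symm
  have hsub : Icc 1 ⌊Q⌋₊ ⊆ Icc 1 ⌊√X⌋₊ := Icc_subset_Icc_right (Nat.floor_le_floor hQX)
  rw [← sum_sdiff hsub, add_sub_assoc, ← sum_sub_distrib]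
  have hBt := sum_badCount_total hX ht hL hQ
  rw [sum_filter, ← sum_sdiff hsub] at hBt
  have k1 := (abs_sum_le_sum_abs _ _).trans (sum_le_sum hT)
  have k2 := (abs_sum_le_sum_abs _ _).trans (sum_le_sum hE)
  rw [sum_add_distrib, ← mul_sum, sum_add_distrib, ← mul_sum, sum_const, Nat.card_Icc,
    nsmul_eq_mul, Nat.add_sub_cancel] at k2
  refine (abs_add_le _ _).trans ((add_le_add k1 k2).trans ?_)
  have k3 := Nat.floor_le hQ.le
  have k4 : ∑ q ∈ Icc 1 ⌊Q⌋₊, (q : ℝ) ^ (-(2 / 3) : ℝ) ≤ 3 * Q ^ (1 / 3 : ℝ) :=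
    (sum_rpow_neg_two_thirds _).trans (by gcongr)
  have k5 : (t : ℝ) ^ 4 * (6000000 * X ^ (3 / 4 : ℝ) * ∑ q ∈ Icc 1 ⌊Q⌋₊, (q : ℝ) ^ (-(2 / 3) : ℝ) + ⌊Q⌋₊ * (1440 * √X)) ≤
      t ^ 4 * (6000000 * X ^ (3 / 4 : ℝ) * (3 * Q ^ (1 / 3 : ℝ)) + Q * (1440 * √X)) := by gcongr
  push_cast at hBt
  simp only [hB]
  push_cast
  linarith

end

end

section
open Real ArithmeticFunction

theorem tendsto_sum_ncard_oSet : Tendsto (fun X : ℝ =>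
    (∑ q ∈ Finset.Icc 1 ⌊√X⌋₊, (moebius q : ℝ) * ∑ h ∈ q.divisors, ((OSet X (q / h : ℕ) h).ncard : ℝ) -
      ∑ q ∈ Finset.Icc 1 ⌊X ^ (1 / 5 : ℝ)⌋₊, (moebius q : ℝ) * ∑ h ∈ q.divisors, mainT (sX X (q / h)) (q / h) h) /
      X ^ (5 / 6 : ℝ)) atTop (𝓝 0) := by
  obtain ⟨C, hC1, hC⟩ := card_divisors_le_of_le_pow (ε := 1 / 2000) (by norm_num)
  have hu := (tendsto_rpow_atTop (show (0 : ℝ) < 1 / 2000 by norm_num)).eventually_ge_atTop (C + 6002)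
  have hlim : Tendsto (fun X : ℝ => 20000000 * X ^ (-(1 / 120) : ℝ)) atTop (𝓝 0) := by
    simpa using (tendsto_rpow_neg_atTop (show (0 : ℝ) < 1 / 120 by norm_num)).const_mul 20000000
  refine squeeze_zero_norm' ?_ hlim
  filter_upwards [hu, eventually_ge_atTop 3] with X hu hX
  have hX1 : 1 ≤ X := by linarith
  have hX0 : 0 < X := by linarith
  set u := X ^ (1 / 2000 : ℝ) with hu'
  set t := ⌊u ^ 2⌋₊ with ht'
  have ht1 : u ^ 2 - 1 ≤ t := (Nat.sub_one_lt_floor _).le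
  have ht2 : (t : ℝ) ≤ X ^ (1 / 1000 : ℝ) := by
    refine (Nat.floor_le (by positivity)).trans_eq ?_
    rw [hu', ← rpow_mul_natCast hX0.le]; norm_num
  have hτ : ∀ m : ℕ, (m : ℝ) ≤ 675 * X → m.divisors.card ≤ t := by
    intro m hm
    have h9 : (3 : ℝ) ^ 9 ≤ X ^ 9 := pow_le_pow_left₀ (by norm_num) hX 9
    have h1 := hC X hX1 m (hm.trans (by nlinarith))
    have : (m.divisors.card : ℝ) ≤ t := by nlinarith
    exact_mod_cast this
  have hL : ∀ N : ℕ, (N : ℝ) ≤ 3 * X → ∑ a ∈ Finset.Icc 1 N, (1 : ℝ) / a ≤ t := by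
    intro N hN
    have h1 := harmonic_le_one_add_log N
    rw [harmonic_eq_sum_Icc] at h1
    push_cast at h1
    simp only [one_div]
    refine h1.trans ?_
    have h2 : Real.log N ≤ Real.log (3 * X) := by
      rcases Nat.eq_zero_or_pos N with h | h
      · subst h; simpa using Real.log_nonneg (by linarith)
      · exact log_le_log (by exact_mod_cast h) hN
    have h3 := log_le_rpow_div (x := 3 * X) (by positivity) (show (0 : ℝ) < 1 / 2000 by norm_num)
    rw [mul_rpow (by norm_num) hX0.le, ← hu'] at h3
    have h4 : (3 : ℝ) ^ (1 / 2000 : ℝ) ≤ 3 := by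
      conv_rhs => rw [← rpow_one 3]
      exact rpow_le_rpow_of_exponent_le (by norm_num) (by norm_num)
    have h5 : (3 : ℝ) ^ (1 / 2000 : ℝ) * u / (1 / 2000) ≤ 6000 * u := by
      rw [div_le_iff₀ (by norm_num)]; nlinarith
    nlinarith
  have hQX : X ^ (1 / 5 : ℝ) ≤ √X := by
    rw [Real.sqrt_eq_rpow]; exact Real.rpow_le_rpow_of_exponent_le hX1 (by norm_num)
  have key := abs_sum_ncard_oSet_sub_le hX1 hτ hL (Q := X ^ (1 / 5 : ℝ)) (by positivity) hQX
  rw [norm_eq_abs, abs_div, abs_of_pos (rpow_pos_of_pos hX0 _), div_le_iff₀ (by positivity), mul_assoc,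
    ← rpow_add hX0]
  refine key.trans ?_
  have hp : ∀ k : ℕ, (t : ℝ) ^ k ≤ X ^ (k / 1000 : ℝ) := by
    intro k
    refine (pow_le_pow_left₀ (by positivity) ht2 k).trans_eq ?_
    rw [← rpow_mul_natCast hX0.le]; congr 1; ring
  have m1 : (t : ℝ) ^ 7 * X ^ (3 / 4 : ℝ) ≤ X ^ (-(1 / 120) + 5 / 6 : ℝ) := by
    refine (mul_le_mul_of_nonneg_right (hp 7) (by positivity)).trans ?_
    rw [← rpow_add hX0]
    exact rpow_le_rpow_of_exponent_le hX1 (by norm_num)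
  have m2 : (t : ℝ) ^ 8 * X / X ^ (1 / 5 : ℝ) ≤ X ^ (-(1 / 120) + 5 / 6 : ℝ) := by
    rw [div_le_iff₀ (by positivity)]
    refine (mul_le_mul_of_nonneg_right (hp 8) (by positivity)).trans ?_
    rw [← rpow_add hX0, ← rpow_add_one hX0.ne']
    exact rpow_le_rpow_of_exponent_le hX1 (by norm_num)
  have m3 : (t : ℝ) ^ 4 * X ^ (3 / 4 : ℝ) * (X ^ (1 / 5 : ℝ)) ^ (1 / 3 : ℝ) ≤ X ^ (-(1 / 120) + 5 / 6 : ℝ) := by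
    refine (mul_le_mul_of_nonneg_right (mul_le_mul_of_nonneg_right (hp 4) (by positivity)) (by positivity)).trans ?_
    rw [← rpow_mul hX0.le, ← rpow_add hX0, ← rpow_add hX0]
    exact rpow_le_rpow_of_exponent_le hX1 (by norm_num)
  have m4 : (t : ℝ) ^ 4 * √X * X ^ (1 / 5 : ℝ) ≤ X ^ (-(1 / 120) + 5 / 6 : ℝ) := by
    refine (mul_le_mul_of_nonneg_right (mul_le_mul_of_nonneg_right (hp 4) (by positivity)) (by positivity)).trans ?_
    rw [sqrt_eq_rpow, ← rpow_add hX0, ← rpow_add hX0]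
    exact rpow_le_rpow_of_exponent_le hX1 (by norm_num)
  calc _ = 100800 * ((t : ℝ) ^ 7 * X ^ (3 / 4 : ℝ)) + 117600 * ((t : ℝ) ^ 8 * X / X ^ (1 / 5 : ℝ)) +
        18000000 * ((t : ℝ) ^ 4 * X ^ (3 / 4 : ℝ) * (X ^ (1 / 5 : ℝ)) ^ (1 / 3 : ℝ)) +
        1440 * ((t : ℝ) ^ 4 * √X * X ^ (1 / 5 : ℝ)) := by ring
    _ ≤ _ := by
      have := (rpow_pos_of_pos hX0 (-(1 / 120) + 5 / 6)).le
      linarith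

end

section
open ArithmeticFunction (moebius)
open Finset Real ArithmeticFunction

/-- The arithmetic function `n ↦ n ^ (-c)`. -/
noncomputable def powF (c : ℝ) : ArithmeticFunction ℝ := ⟨fun n => if n = 0 then 0 else (n : ℝ) ^ (-c), if_pos rfl⟩

/-- The arithmetic function `phiD`. -/
noncomputable def phiF : ArithmeticFunction ℝ := ⟨phiD, by simp [phiD]⟩

/-- The convolution of `phiD n / n ^ c`, `phiD n / n ^ d` and `1 / n ^ 2`. -/
noncomputable def convF (c d : ℝ) : ArithmeticFunction ℝ := phiF.pmul (powF c) * phiF.pmul (powF d) * powF 2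

theorem powF_apply (c : ℝ) {n : ℕ} (hn : n ≠ 0) : powF c n = (n : ℝ) ^ (-c) := if_neg hn

theorem powF_isMultiplicative (c : ℝ) : (powF c).IsMultiplicative := by
  rw [IsMultiplicative.iff_ne_zero]
  refine ⟨by rw [powF_apply _ one_ne_zero]; simp, fun {m n} hm hn _ => ?_⟩
  rw [powF_apply _ hm, powF_apply _ hn, powF_apply _ (mul_ne_zero hm hn), Nat.cast_mul,
    mul_rpow (by positivity) (by positivity)]

theorem phiF_isMultiplicative : phiF.IsMultiplicative := by
  have h : phiF = ((moebius : ArithmeticFunction ℝ).pmul (powF 1)) * (zeta : ArithmeticFunction ℝ) := by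
    ext n
    rw [coe_mul_zeta_apply]
    change ∑ k ∈ n.divisors, (moebius k : ℝ) / k = _
    refine sum_congr rfl fun k hk => ?_
    rw [pmul_apply, powF_apply _ (Nat.pos_of_mem_divisors hk).ne', rpow_neg_one]
    rfl
  rw [h]
  exact (isMultiplicative_moebius.intCast.pmul (powF_isMultiplicative 1)).mul
    isMultiplicative_zeta.natCast

theorem convF_isMultiplicative (c d : ℝ) : (convF c d).IsMultiplicative :=
  ((phiF_isMultiplicative.pmul (powF_isMultiplicative c)).mul (phiF_isMultiplicative.pmul (powF_isMultiplicative d))).mul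
    (powF_isMultiplicative 2)

theorem phiD_one : phiD 1 = 1 := by simp [phiD]

theorem phiD_prime {p : ℕ} (hp : p.Prime) : phiD p = 1 - 1 / p := by
  rw [phiD, hp.sum_divisors, moebius_apply_prime hp]
  push_cast
  rw [moebius_apply_one]
  push_cast
  ring

theorem convF_apply (c d : ℝ) (q : ℕ) : convF c d q = ∑ h ∈ q.divisors, ∑ e ∈ (q / h).divisors,
    phiD (q / h / e) * phiD e / h ^ 2 * ((q / h / e : ℕ) : ℝ) ^ (-c) * (e : ℝ) ^ (-d) := by
  rw [convF, mul_apply, Nat.sum_divisorsAntidiagonal' fun x y => (phiF.pmul (powF c) * phiF.pmul (powF d)) x * powF 2 y]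
  refine sum_congr rfl fun h hh => ?_
  rw [mul_apply, Nat.sum_divisorsAntidiagonal' fun x y => phiF.pmul (powF c) x * phiF.pmul (powF d) y, sum_mul]
  refine sum_congr rfl fun e he => ?_
  have h1 : (q / h / e) ≠ 0 := by
    have := Nat.div_dvd_of_dvd (Nat.dvd_of_mem_divisors he)
    exact fun h0 => (Nat.ne_zero_of_mem_divisors he) (by rw [h0] at this; exact zero_dvd_iff.1 this)
  rw [pmul_apply, pmul_apply, powF_apply _ h1,
    powF_apply _ (Nat.pos_of_mem_divisors he).ne', powF_apply _ (Nat.pos_of_mem_divisors hh).ne', rpow_neg (x := (h : ℝ)) (by positivity)]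
  norm_num [phiF]
  ring

theorem convF_prime (c d : ℝ) {p : ℕ} (hp : p.Prime) :
    convF c d p = (1 - 1 / p) * ((p : ℝ) ^ (-c) + (p : ℝ) ^ (-d)) + 1 / p ^ 2 := by
  rw [convF_apply, hp.sum_divisors, Nat.div_self hp.pos, Nat.div_one, hp.sum_divisors]
  simp only [Nat.divisors_one, sum_singleton, Nat.div_self hp.pos, Nat.div_one, phiD_one, phiD_prime hp]
  norm_num
  ring

theorem abs_convF_le {c d κ ε : ℝ} (hc : κ ≤ c) (hd : κ ≤ d) (hk : κ ≤ 2) (hε : 0 < ε) :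
    ∃ C : ℝ, ∀ q : ℕ, q ≠ 0 → |convF c d q| ≤ C * (q : ℝ) ^ (ε - κ) := by
  obtain ⟨C, hC1, hC⟩ := card_divisors_le_rpow (ε := ε / 4) (by positivity)
  refine ⟨C ^ 4, fun q hq => ?_⟩
  have hq0 : (0 : ℝ) < q := by positivity
  have hle : ∀ d, d ∣ q → (d.divisors.card : ℝ) ≤ q.divisors.card := fun d hd =>
    Nat.cast_le.2 (card_le_card (Nat.divisors_subset_of_dvd hq hd))
  set T : ℝ := (q.divisors.card : ℝ) with hT
  have h2 : |convF c d q| ≤ T ^ 4 * (q : ℝ) ^ (-κ) := by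
    rw [convF_apply]
    have h3 : ∀ h ∈ q.divisors, |∑ e ∈ (q / h).divisors, phiD (q / h / e) * phiD e / h ^ 2 * ((q / h / e : ℕ) : ℝ) ^ (-c) * (e : ℝ) ^ (-d)| ≤
        T ^ 3 * (q : ℝ) ^ (-κ) := by
      intro h hh
      have hhq := Nat.dvd_of_mem_divisors hh
      have hn := Nat.div_dvd_of_dvd hhq
      have h4 : ∀ e ∈ (q / h).divisors, |phiD (q / h / e) * phiD e / h ^ 2 * ((q / h / e : ℕ) : ℝ) ^ (-c) * (e : ℝ) ^ (-d)| ≤ T ^ 2 * (q : ℝ) ^ (-κ) := by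
        intro e he
        have hen := Nat.dvd_of_mem_divisors he
        have hN := Nat.div_dvd_of_dvd hen
        have e1 : q / h / e * e * h = q := by rw [Nat.div_mul_cancel hen, Nat.div_mul_cancel hhq]
        have e2 : (q : ℝ) = (q / h / e : ℕ) * e * h := by exact_mod_cast e1.symm
        have b1 := (abs_phiD_le (q / h / e)).trans (hle _ (hN.trans hn))
        have b2 := (abs_phiD_le e).trans (hle _ (hen.trans hn))
        have i1 : (1 : ℝ) ≤ (q / h / e : ℕ) := by
          exact_mod_cast Nat.pos_of_dvd_of_pos (hN.trans hn) (Nat.pos_of_ne_zero hq)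
        have i2 : (1 : ℝ) ≤ e := by exact_mod_cast Nat.pos_of_mem_divisors he
        have i3 : (1 : ℝ) ≤ h := by exact_mod_cast Nat.pos_of_mem_divisors hh
        rw [e2]
        generalize ((q / h / e : ℕ) : ℝ) = N at i1 ⊢
        have e3 : (1 : ℝ) / h ^ 2 = (h : ℝ) ^ (-2 : ℝ) := by
          rw [rpow_neg (by linarith)]; norm_num
        rw [mul_rpow (by positivity) (by positivity), mul_rpow (by positivity) (by positivity), div_eq_mul_one_div, e3,
          abs_mul, abs_mul, abs_mul, abs_mul, abs_of_nonneg (a := N ^ (-c)) (by positivity),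
          abs_of_nonneg (a := (e : ℝ) ^ (-d)) (by positivity), abs_of_nonneg (a := (h : ℝ) ^ (-2 : ℝ)) (by positivity)]
        calc _ ≤ T * T * (h : ℝ) ^ (-κ) * N ^ (-κ) * (e : ℝ) ^ (-κ) := by gcongr
          _ = _ := by ring
      refine (abs_sum_le_sum_abs _ _).trans ((sum_le_card_nsmul _ _ _ h4).trans ?_)
      rw [nsmul_eq_mul]
      calc _ ≤ T * (T ^ 2 * (q : ℝ) ^ (-κ)) := by gcongr; exact hle _ hn
        _ = _ := by ring
    refine (abs_sum_le_sum_abs _ _).trans ((sum_le_card_nsmul _ _ _ h3).trans_eq ?_)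
    rw [nsmul_eq_mul]; ring
  refine h2.trans ?_
  calc _ ≤ (C * (q : ℝ) ^ (ε / 4)) ^ 4 * (q : ℝ) ^ (-κ) := by gcongr; exact hC q hq
    _ = C ^ 4 * (((q : ℝ) ^ (ε / 4)) ^ 4 * (q : ℝ) ^ (-κ)) := by ring
    _ = _ := by
      rw [← rpow_mul_natCast hq0.le, ← rpow_add hq0]; congr 2; push_cast; ring

theorem abs_moebius_mul_le (q : ℕ) (x : ℝ) : |(moebius q : ℝ) * x| ≤ |x| := by
  rw [abs_mul]
  refine mul_le_of_le_one_left (abs_nonneg _) ?_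
  exact_mod_cast abs_moebius_le_one

theorem summable_moebius_convF {c d κ a : ℝ} (hc : κ ≤ c) (hd : κ ≤ d) (hk : κ ≤ 2) (ha : a + 1 < κ) :
    Summable fun q : ℕ => |(moebius q : ℝ) * convF c d q| * (q : ℝ) ^ a := by
  obtain ⟨C, hC⟩ := abs_convF_le (ε := (κ - a - 1) / 2) hc hd hk (by linarith)
  refine Summable.of_nonneg_of_le (fun q => by positivity) (fun q => ?_)
    ((summable_nat_rpow (p := (κ - a - 1) / 2 - κ + a)).2 (by linarith) |>.mul_left C)
  rcases eq_or_ne q 0 with rfl | hq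
  · simp only [ArithmeticFunction.map_zero, Int.cast_zero, zero_mul, abs_zero, Nat.cast_zero]
    rw [Real.zero_rpow (by linarith), mul_zero]
  · refine (mul_le_mul_of_nonneg_right ((abs_moebius_mul_le _ _).trans (hC q hq)) (by positivity)).trans_eq ?_
    rw [mul_assoc, ← rpow_add (by positivity)]

theorem hasProd_moebius_mul {f : ArithmeticFunction ℝ} (hf : f.IsMultiplicative) (hs : Summable fun q : ℕ => |(moebius q : ℝ) * f q|) :
    HasProd (fun p : Nat.Primes => 1 - f p) (∑' q, (moebius q : ℝ) * f q) := by
  have h := EulerProduct.eulerProduct_hasProd (f := fun q : ℕ => (moebius q : ℝ) * f q) (by simp [hf.map_one])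
    (fun {m n} hmn => by
      rw [isMultiplicative_moebius.map_mul_of_coprime hmn, hf.map_mul_of_coprime hmn]; push_cast; ring) hs (by simp)
  have e : (fun p : Nat.Primes => ∑' k, (moebius ((p : ℕ) ^ k) : ℝ) * f ((p : ℕ) ^ k)) = fun p : Nat.Primes => 1 - f p := by
    funext p
    rw [tsum_eq_sum (s := range 2)]
    · rw [sum_range_succ, sum_range_one, pow_zero, pow_one, moebius_apply_prime p.2]
      simp [hf.map_one, sub_eq_add_neg]
    · intro k hk
      rw [mem_range, not_lt] at hk
      rw [moebius_apply_prime_pow p.2 (by omega), if_neg (by omega)]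
      simp
  rw [e] at h
  exact h

end

section
open ArithmeticFunction (moebius)
open Finset Real

theorem sum_mainT {X : ℝ} (hX : 0 ≤ X) (q : ℕ) : ∑ h ∈ q.divisors, mainT (sX X (q / h)) (q / h) h =
    π ^ 2 / 4 * X * convF 2 3 q +
      4 / 9 * kappa * (riemannZeta (1 / 3)).re * (27 / 4) ^ (5 / 6 : ℝ) * X ^ (5 / 6 : ℝ) * convF (5 / 3) 2 q := by
  rw [convF_apply, convF_apply, mul_sum, mul_sum, ← sum_add_distrib]
  refine sum_congr rfl fun h hh => ?_
  rw [mainT, mul_sum, mul_sum, ← sum_add_distrib]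
  refine sum_congr rfl fun e he => ?_
  have hen := Nat.dvd_of_mem_divisors he
  have hn : 0 < q / h := Nat.pos_of_ne_zero (Nat.ne_zero_of_mem_divisors he)
  have hN : 0 < q / h / e := Nat.div_pos (Nat.le_of_dvd hn hen) (Nat.pos_of_mem_divisors he)
  have he0 : (0 : ℝ) < e := by exact_mod_cast Nat.pos_of_mem_divisors he
  have hN0 : (0 : ℝ) < (q / h / e : ℕ) := by exact_mod_cast hN
  have e1 : ((q / h : ℕ) : ℝ) = (q / h / e : ℕ) * e := by exact_mod_cast (Nat.div_mul_cancel hen).symm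
  have e2 : sX X (q / h) ^ (5 / 3 : ℝ) = (27 / 4) ^ (5 / 6 : ℝ) * X ^ (5 / 6 : ℝ) * ((q / h / e : ℕ) : ℝ) ^ (-(5 / 3) : ℝ) * (e : ℝ) ^ (-(5 / 3) : ℝ) := by
    rw [sX, div_rpow (by positivity) (by positivity), sqrt_eq_rpow, ← rpow_mul (by positivity),
      mul_rpow (by norm_num) hX, e1, mul_rpow hN0.le he0.le, rpow_neg hN0.le, rpow_neg he0.le]
    norm_num
    ring
  have e3 : (e : ℝ) ^ (-2 : ℝ) = (e : ℝ) ^ (-(5 / 3) : ℝ) * (e : ℝ) ^ (-(1 / 3) : ℝ) := by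
    rw [← rpow_add he0]; norm_num
  have e4 : ((q / h / e : ℕ) : ℝ) ^ (-2 : ℝ) = 1 / ((q / h / e : ℕ) : ℝ) ^ 2 := by
    rw [rpow_neg hN0.le]; norm_num
  have e5 : (e : ℝ) ^ (-3 : ℝ) = 1 / (e : ℝ) ^ 3 := by
    rw [rpow_neg he0.le]; norm_num
  rw [sX_sq hX, e2, e3, e4, e5, e1]
  have : π ^ 2 / 27 * (27 / 4 * X / (((q / h / e : ℕ) : ℝ) * e) ^ 2) / e =
      π ^ 2 / 4 * X * (1 / ((q / h / e : ℕ) : ℝ) ^ 2 * (1 / (e : ℝ) ^ 3)) := by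
    field_simp
  rw [this]
  ring

/-- `∑ μ(q) / q ^ 2`. -/
noncomputable def moebiusTwo : ℝ := ∑' q, (moebius q : ℝ) * powF 2 q

theorem summable_moebius_powF {a : ℝ} (ha : a < 1) : Summable fun q : ℕ => |(moebius q : ℝ) * powF 2 q| * (q : ℝ) ^ a := by
  refine Summable.of_nonneg_of_le (fun q => by positivity) (fun q => ?_) ((summable_nat_rpow (p := -2 + a)).2 (by linarith))
  rcases eq_or_ne q 0 with rfl | hq
  · simp only [ArithmeticFunction.map_zero, Int.cast_zero, zero_mul, abs_zero, Nat.cast_zero]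
    positivity
  · refine (mul_le_mul_of_nonneg_right (abs_moebius_mul_le _ _) (by positivity)).trans_eq ?_
    rw [powF_apply _ hq, abs_of_nonneg (by positivity), ← rpow_add (by positivity)]

theorem powF_two (p : Nat.Primes) : powF 2 p = 1 / (p : ℝ) ^ 2 := by
  rw [powF_apply _ p.2.ne_zero, rpow_neg (by positivity)]; norm_num

theorem hasProd_moebiusTwo : HasProd (fun p : Nat.Primes => 1 - 1 / (p : ℝ) ^ 2) moebiusTwo := by
  have h := hasProd_moebius_mul (powF_isMultiplicative 2) (by simpa using summable_moebius_powF (a := 0) (by norm_num))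
  simp only [powF_two] at h
  exact h

theorem moebiusTwo_eq : moebiusTwo = 6 / π ^ 2 := by
  let f : ℕ →*₀ ℝ :=
    { toFun := fun n => 1 / (n : ℝ) ^ 2
      map_zero' := by simp
      map_one' := by simp
      map_mul' := fun m n => by push_cast; rw [mul_pow, one_div_mul_one_div] }
  have h := EulerProduct.eulerProduct_completely_multiplicative_hasProd (f := f)
    (by simp [f])
  have h1 : HasProd (fun p : Nat.Primes => (1 - 1 / (p : ℝ) ^ 2)⁻¹) (π ^ 2 / 6) := by
    rw [← hasSum_zeta_two.tsum_eq]; exact h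
  have h2 := hasProd_moebiusTwo.mul h1
  have h3 : (fun p : Nat.Primes => (1 - 1 / (p : ℝ) ^ 2) * (1 - 1 / (p : ℝ) ^ 2)⁻¹) = fun _ => 1 := by
    funext p
    have hp : (2 : ℝ) ≤ p := by exact_mod_cast p.2.two_le
    have h4 : 1 / (p : ℝ) ^ 2 < 1 := by rw [div_lt_one (by positivity)]; nlinarith
    exact mul_inv_cancel₀ (by linarith)
  rw [h3] at h2
  have h5 := h2.unique hasProd_one
  field_simp at h5 ⊢
  linarith

theorem tsum_convF_one : ∑' q, (moebius q : ℝ) * convF 2 3 q = (6 / π ^ 2) ^ 2 := by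
  have h := hasProd_moebius_mul (convF_isMultiplicative 2 3)
    (by simpa using summable_moebius_convF (a := 0) (κ := 2) le_rfl (by norm_num) le_rfl (by norm_num))
  have h2 := hasProd_moebiusTwo.mul hasProd_moebiusTwo
  have e : (fun p : Nat.Primes => 1 - convF 2 3 p) = fun p : Nat.Primes => (1 - 1 / (p : ℝ) ^ 2) * (1 - 1 / (p : ℝ) ^ 2) := by
    funext p
    have hp : (0 : ℝ) < p := by exact_mod_cast p.2.pos
    rw [convF_prime _ _ p.2, rpow_neg hp.le, rpow_neg hp.le]
    norm_num
    field_simp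
    ring
  rw [e] at h
  rw [h.unique h2, moebiusTwo_eq]
  ring

theorem tsum_convF_two : ∑' q, (moebius q : ℝ) * convF (5 / 3) 2 q = 6 / Real.pi ^ 2 * primeProd := by
  have h := hasProd_moebius_mul (convF_isMultiplicative (5 / 3) 2)
    (by simpa using summable_moebius_convF (a := 0) (κ := 5 / 3) le_rfl (by norm_num) (by norm_num) (by norm_num))
  have hm : Multipliable fun p : Nat.Primes => 1 - ((p : ℝ) ^ ((1 : ℝ) / 3) + 1) / ((p : ℝ) * ((p : ℝ) + 1)) := by
    simp only [sub_eq_add_neg]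
    refine Real.multipliable_one_add_of_summable (Summable.neg ?_)
    refine Summable.of_nonneg_of_le (fun p => by positivity) (fun p => ?_)
      (((Nat.Primes.summable_rpow (r := -(5 / 3))).2 (by norm_num)).mul_left 2)
    have hp : (1 : ℝ) ≤ p := by exact_mod_cast p.2.one_lt.le
    have h1 : 1 ≤ (p : ℝ) ^ ((1 : ℝ) / 3) := one_le_rpow hp (by norm_num)
    have h2 : (p : ℝ) ^ (-(5 / 3) : ℝ) = (p : ℝ) ^ ((1 : ℝ) / 3) / p ^ 2 := by
      rw [← rpow_natCast, ← rpow_sub (by positivity)]; norm_num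
    rw [h2, ← mul_div_assoc]
    gcongr <;> nlinarith
  have h2 := hasProd_moebiusTwo.mul hm.hasProd
  have e : (fun p : Nat.Primes => 1 - convF (5 / 3) 2 p) = fun p : Nat.Primes => (1 - 1 / (p : ℝ) ^ 2) *
      (1 - ((p : ℝ) ^ ((1 : ℝ) / 3) + 1) / ((p : ℝ) * ((p : ℝ) + 1))) := by
    funext p
    have hp : (0 : ℝ) < p := by exact_mod_cast p.2.pos
    have h2 : (p : ℝ) ^ (-(5 / 3) : ℝ) = (p : ℝ) ^ ((1 : ℝ) / 3) / p ^ 2 := by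
      rw [← rpow_natCast, ← rpow_sub hp]; norm_num
    rw [convF_prime _ _ p.2, h2, rpow_neg hp.le]
    norm_num
    field_simp
    ring
  rw [e] at h
  rw [h.unique h2, moebiusTwo_eq, primeProd]

theorem tendsto_tail {f : ℕ → ℝ} (h0 : f 0 = 0) {a b : ℝ} (ha : 0 ≤ a) (hb : 0 < b) (hf : Summable fun q => |f q| * (q : ℝ) ^ a) :
    Tendsto (fun X : ℝ => X ^ (a * b) * (∑ q ∈ Icc 1 ⌊X ^ b⌋₊, f q - ∑' q, f q)) atTop (𝓝 0) := by
  have hs : Summable fun q => |f q| := by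
    refine Summable.of_nonneg_of_le (fun q => abs_nonneg _) (fun q => ?_) hf
    rcases eq_or_ne q 0 with rfl | hq
    · rw [h0, abs_zero, zero_mul]
    · refine le_mul_of_one_le_right (abs_nonneg _) (one_le_rpow ?_ ha)
      exact_mod_cast Nat.pos_of_ne_zero hq
  have hK : Tendsto (fun X : ℝ => ⌊X ^ b⌋₊ + 1) atTop atTop :=
    (tendsto_add_atTop_nat 1).comp (tendsto_nat_floor_atTop.comp (tendsto_rpow_atTop hb))
  refine squeeze_zero_norm' ?_ ((tendsto_sum_nat_add fun q => |f q| * (q : ℝ) ^ a).comp hK)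
  filter_upwards [eventually_gt_atTop 0] with X hX
  set K := ⌊X ^ b⌋₊ with hKd
  have h1 := hs.of_abs.sum_add_tsum_nat_add (K + 1)
  have h2 : ∑ q ∈ range (K + 1), f q = ∑ q ∈ Icc 1 K, f q := by
    refine (sum_subset (fun q hq => ?_) fun q hq hq' => ?_).symm
    · simp only [mem_Icc, mem_range] at hq ⊢; omega
    · simp only [mem_Icc, mem_range] at hq hq'
      rw [show q = 0 by omega, h0]
  rw [h2] at h1
  rw [← h1, sub_add_cancel_left, norm_eq_abs, abs_mul, abs_neg, abs_of_pos (by positivity)]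
  have hs1 := (summable_nat_add_iff (K + 1)).2 hs
  have h3 : |∑' i, f (i + (K + 1))| ≤ ∑' i, |f (i + (K + 1))| := by
    simpa using norm_tsum_le_tsum_norm (f := fun i => f (i + (K + 1))) (by simpa using hs1)
  refine (mul_le_mul_of_nonneg_left h3 (by positivity)).trans ?_
  rw [← tsum_mul_left]
  refine (hs1.mul_left _).tsum_le_tsum (fun i => ?_) ((summable_nat_add_iff (f := fun q => |f q| * (q : ℝ) ^ a) (K + 1)).2 hf)
  rw [mul_comm, mul_comm a b, rpow_mul hX.le]
  gcongr
  refine (Nat.lt_floor_add_one _).le.trans ?_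
  push_cast
  linarith [Nat.cast_nonneg (α := ℝ) i]

theorem const_eq : 4 / 9 * kappa * (27 / 4 : ℝ) ^ (5 / 6 : ℝ) * (6 / π ^ 2) / 3 = 8 / (5 * Gamma (2 / 3) ^ 3) := by
  have g1 := Gamma_mul_Gamma_add_half (1 / 6)
  have g2 := Gamma_mul_Gamma_one_sub (1 / 3)
  have e1 : (1 / 6 + 1 / 2 : ℝ) = 2 / 3 := by norm_num
  have e2 : (2 * (1 / 6) : ℝ) = 1 / 3 := by norm_num
  have e3 : (1 - 1 / 3 : ℝ) = 2 / 3 := by norm_num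
  rw [e1, e2, e3] at g1
  rw [e3, mul_one_div, sin_pi_div_three] at g2
  have hG : 0 < Gamma (2 / 3) := Gamma_pos_of_pos (by norm_num)
  have h3 : √3 ^ 2 = 3 := sq_sqrt (by norm_num)
  have hpi := sq_sqrt pi_pos.le
  have h27 : (27 / 4 : ℝ) ^ (5 / 6 : ℝ) * (2 : ℝ) ^ (2 / 3 : ℝ) = 9 * √3 / 2 := by
    have a1 : (27 : ℝ) = 3 ^ (3 : ℝ) := by norm_num
    have a2 : (4 : ℝ) = 2 ^ (2 : ℝ) := by norm_num
    rw [div_rpow (by norm_num) (by norm_num), a1, a2, ← rpow_mul (by norm_num), ← rpow_mul (by norm_num),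
      div_mul_eq_mul_div, mul_div_assoc, ← rpow_sub (by norm_num), sqrt_eq_rpow]
    rw [show (3 * (5 / 6) : ℝ) = 2 + 1 / 2 by norm_num, rpow_add (by norm_num)]
    norm_num [rpow_neg_one]
    ring
  rw [kappa]
  have g3 : Gamma (1 / 6) = 2 ^ (2 / 3 : ℝ) * √π * (2 * π / √3) / Gamma (2 / 3) ^ 2 := by
    have : Gamma (1 / 3) * Gamma (2 / 3) = 2 * π / √3 := by rw [g2]; field_simp
    rw [eq_div_iff (by positivity), pow_two, ← mul_assoc, g1, ← this]
    norm_num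
    ring
  rw [g3]
  field_simp
  have e4 : √π ^ 2 * (27 / 4 : ℝ) ^ (5 / 6 : ℝ) * (2 : ℝ) ^ (2 / 3 : ℝ) = π * (9 * √3 / 2) := by
    rw [hpi, mul_assoc, h27]
  nlinarith [e4]

end

section
open ArithmeticFunction (moebius)
open Finset

theorem tendsto_sum_card_dDvd : Tendsto (fun X : ℝ => (∑ q ∈ Icc 1 ⌊√X⌋₊, (moebius q : ℝ) *
    ((Ioo 0 ⌈X⌉).filter fun D => TForm.DDvd q D).card - X / 2 * ∑ q ∈ Icc 1 ⌊√X⌋₊, (moebius q : ℝ) * powF 2 q) /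
      X ^ (5 / 6 : ℝ)) atTop (𝓝 0) := by
  have hlim : Tendsto (fun X : ℝ => 2 * X ^ (-(1 / 3) : ℝ)) atTop (𝓝 0) := by
    simpa using (tendsto_rpow_neg_atTop (show (0 : ℝ) < 1 / 3 by norm_num)).const_mul 2
  refine squeeze_zero_norm' ?_ hlim
  filter_upwards [eventually_gt_atTop 0] with X hX
  rw [Real.norm_eq_abs, abs_div, abs_of_pos (Real.rpow_pos_of_pos hX _), div_le_iff₀ (by positivity), mul_assoc,
    ← Real.rpow_add hX, mul_sum, ← sum_sub_distrib]
  refine (abs_sum_le_sum_abs _ _).trans ((sum_le_card_nsmul _ _ 2 fun q hq => ?_).trans ?_)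
  · have hq0 : 0 < q := (mem_Icc.1 hq).1
    rw [mul_left_comm, ← mul_sub]
    refine (abs_moebius_mul_le _ _).trans (le_of_eq_of_le ?_ (TForm.card_dDvd_le hX hq0))
    rw [powF_apply _ hq0.ne', Real.rpow_neg (by positivity)]
    norm_num
    congr 1
    field_simp
  · rw [Nat.card_Icc, Nat.add_sub_cancel, nsmul_eq_mul, mul_comm]
    refine mul_le_mul_of_nonneg_left ((Nat.floor_le (by positivity)).trans_eq ?_) (by norm_num)
    rw [Real.sqrt_eq_rpow]; norm_num

end

/-- The Davenport-Heilbronn theorem for 3-torsion in class groups of real quadratic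
fields, with secondary term: `∑_{0 < D < X} #Cl_3(D) = (4/π²) X +
(8 ζ(1/3)/(5 Γ(2/3)³)) ∏_p (1 - (p^{1/3}+1)/(p(p+1))) X^{5/6} + o(X^{5/6})`. -/
theorem secondary_term_cl3_positive_disc :
    Tendsto (fun X : ℝ =>
      (cl3sum (fun D => 0 < (D : ℝ) ∧ (D : ℝ) < X)
        - 4 / Real.pi ^ 2 * X
        - (8 * (riemannZeta (1/3)).re / (5 * Real.Gamma (2/3) ^ 3))
            * primeProd * X ^ ((5 : ℝ)/6))
      / X ^ ((5 : ℝ)/6)) atTop (𝓝 0) := by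
  obtain ⟨C, hC⟩ := TForm.three_mul_cl3sum
  have t1 := tendsto_tail (f := fun q => (ArithmeticFunction.moebius q : ℝ) * convF 2 3 q) (by simp) (a := 5 / 6) (b := 1 / 5)
    (by norm_num) (by norm_num) (summable_moebius_convF (κ := 2) le_rfl (by norm_num) le_rfl (by norm_num))
  have t2 := tendsto_tail (f := fun q => (ArithmeticFunction.moebius q : ℝ) * convF (5 / 3) 2 q) (by simp) (a := 0) (b := 1 / 5)
    le_rfl (by norm_num) (summable_moebius_convF (κ := 5 / 3) le_rfl (by norm_num) (by norm_num) (by norm_num))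
  have t3 := tendsto_tail (f := fun q => (ArithmeticFunction.moebius q : ℝ) * powF 2 q) (by simp) (a := 1 / 3) (b := 1 / 2)
    (by norm_num) (by norm_num) (summable_moebius_powF (by norm_num))
  have t5 : Tendsto (fun X : ℝ => C * X ^ (-(5 / 6) : ℝ)) atTop (𝓝 0) := by
    simpa using (tendsto_rpow_neg_atTop (show (0 : ℝ) < 5 / 6 by norm_num)).const_mul C
  rw [tsum_convF_one] at t1
  rw [tsum_convF_two] at t2
  change Tendsto (fun X : ℝ => _ * (_ - moebiusTwo)) _ _ at t3
  rw [moebiusTwo_eq] at t3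
  set K := 4 / 9 * kappa * (riemannZeta (1 / 3)).re * (27 / 4) ^ (5 / 6 : ℝ) with hK
  have hlim := ((((tendsto_sum_ncard_oSet.add (t1.const_mul (Real.pi ^ 2 / 4))).add (t2.const_mul K)).add
    (t3.const_mul (1 / 2))).add (tendsto_sum_card_dDvd.sub t5)).const_mul (1 / 3)
  simp only [mul_zero, add_zero, sub_zero] at hlim
  refine hlim.congr' ?_
  filter_upwards [eventually_gt_atTop 1] with X hX
  have hX0 : 0 < X := by linarith
  have h := hC X hX
  simp only [mul_add, Finset.sum_add_distrib] at h
  have e1 : ∑ q ∈ Finset.Icc 1 ⌊X ^ (1 / 5 : ℝ)⌋₊, (ArithmeticFunction.moebius q : ℝ) * ∑ h ∈ q.divisors, mainT (sX X (q / h)) (q / h) h =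
      Real.pi ^ 2 / 4 * X * ∑ q ∈ Finset.Icc 1 ⌊X ^ (1 / 5 : ℝ)⌋₊, (ArithmeticFunction.moebius q : ℝ) * convF 2 3 q +
      K * X ^ (5 / 6 : ℝ) * ∑ q ∈ Finset.Icc 1 ⌊X ^ (1 / 5 : ℝ)⌋₊, (ArithmeticFunction.moebius q : ℝ) * convF (5 / 3) 2 q := by
    rw [Finset.mul_sum, Finset.mul_sum, ← Finset.sum_add_distrib]
    refine Finset.sum_congr rfl fun q _ => ?_
    rw [sum_mainT hX0.le]
    ring
  have hc : K * (6 / Real.pi ^ 2) = 3 * (8 * (riemannZeta (1 / 3)).re / (5 * Real.Gamma (2 / 3) ^ 3)) := by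
    have := const_eq
    rw [hK]
    linear_combination 3 * (riemannZeta (1 / 3)).re * this
  have e2 : X ^ (-(5 / 6) : ℝ) = 1 / X ^ (5 / 6 : ℝ) := by rw [Real.rpow_neg hX0.le, one_div]
  have e3 : X = X ^ (1 / 6 : ℝ) * X ^ (5 / 6 : ℝ) := by rw [← Real.rpow_add hX0]; norm_num
  have e4 : X ^ (5 / 6 * (1 / 5) : ℝ) = X ^ (1 / 6 : ℝ) := by norm_num
  have e5 : X ^ (1 / 3 * (1 / 2) : ℝ) = X ^ (1 / 6 : ℝ) := by norm_num
  have hpos : 0 < X ^ (5 / 6 : ℝ) := by positivity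
  have hpi : Real.pi ^ 2 / 4 * (6 / Real.pi ^ 2) ^ 2 = 9 / Real.pi ^ 2 := by field_simp; norm_num
  rw [e1, e2, e4, e5, zero_mul, Real.rpow_zero, one_mul, ← Real.sqrt_eq_rpow X, eq_div_iff hpos.ne']
  have hv (Y : ℝ) : Y / X ^ (5 / 6 : ℝ) * X ^ (5 / 6 : ℝ) = Y := div_mul_cancel₀ Y hpos.ne'
  set a := ∑ q ∈ Finset.Icc 1 ⌊X ^ (1 / 5 : ℝ)⌋₊, (ArithmeticFunction.moebius q : ℝ) * convF 2 3 q
  set m := ∑ q ∈ Finset.Icc 1 ⌊√X⌋₊, (ArithmeticFunction.moebius q : ℝ) * powF 2 q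
  simp only [add_mul, mul_add, sub_mul, mul_assoc, hv]
  linear_combination -(1 / 3) * h + (4 / Real.pi ^ 2 - Real.pi ^ 2 / 12 * a - m / 6) * e3 -
    X ^ (1 / 6 : ℝ) * X ^ (5 / 6 : ℝ) / 3 * hpi - primeProd * X ^ (5 / 6 : ℝ) / 3 * hc
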